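/- There is a universal constant c > 0 such that for all integers 1 ≤ r < R < R', the random walk loop soup 𝓛_{R'} in B_{R'} with intensity 1 satisfies: the probability that there exists a loop γ in 𝓛_{R'} that crosses A_{r,R} and does not disconnect B_r from ∂B_R is at most c·(r/R)^{1/2}. -/

import Mathlib

open MeasureTheory Set
open scoped ENNReal NNReal

noncomputable section

namespace RWLSPaper

open scoped Classical

/-- Vertices of the square lattice `ℤ²`. -/
abbrev Lat : Type := ℤ × ℤ

/-- The plane `ℝ²`, with the Euclidean metric. -/
abbrev Plane : Type := EuclideanSpace ℝ (Fin 2)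

/-- Embedding of the lattice into the plane. -/
def emb (z : Lat) : Plane := (WithLp.equiv 2 (Fin 2 → ℝ)).symm ![(z.1 : ℝ), (z.2 : ℝ)]

/-- Lattice adjacency: Euclidean distance one. -/
def Adj (a b : Lat) : Prop := (a.1 - b.1) ^ 2 + (a.2 - b.2) ^ 2 = 1

/-- ℓ∞ norm on the lattice. -/
def linf (a : Lat) : ℤ := max |a.1| |a.2|

/-- The box `B_R(z) = {w : |w - z|_∞ ≤ R}`. -/
def box (z : Lat) (R : ℤ) : Set Lat := {w | linf (w - z) ≤ R}

/-- Inner vertex boundary of a set of vertices. -/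
def bdry (A : Set Lat) : Set Lat := {z | z ∈ A ∧ ∃ w, w ∉ A ∧ linf (z - w) = 1}

/-- A set of vertices, embedded in the plane. -/
def embS (A : Set Lat) : Set Plane := emb '' A

/-- The boundary of the box `B_R(z)`, embedded in the plane. -/
def bdryE (z : Lat) (R : ℤ) : Set Plane := embS (bdry (box z R))

/-- The solid box `z + [-R,R]²` in the plane. -/
def boxP (z : Lat) (R : ℤ) : Set Plane :=
  {p | |p 0 - (z.1 : ℝ)| ≤ (R : ℝ) ∧ |p 1 - (z.2 : ℝ)| ≤ (R : ℝ)}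

/-- Trace of a list of vertices: the vertices, together with the segments joining
consecutive ones. -/
def traceL (l : List Lat) : Set Plane :=
  (⋃ z ∈ l, {emb z}) ∪ ⋃ p ∈ l.zip l.tail, segment ℝ (emb p.1) (emb p.2)

/-- Nearest-neighbour paths: nonempty lists of successively adjacent vertices. -/
def IsPath (l : List Lat) : Prop := l ≠ [] ∧ l.Chain' Adj

/-- Number of steps of a path. -/
def steps (l : List Lat) : ℕ := l.length - 1

/-- Paths from `z` to `w` with at least one step. -/
def PathsBetween (z w : Lat) : Set (List Lat) :=
  {l | IsPath l ∧ l.head? = some z ∧ l.getLast? = some w ∧ 2 ≤ l.length}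

/-- Total mass of a set of paths under the measure giving weight `4^{-|η|}` to each
path `η`. -/
def pathMass (M : Set (List Lat)) : ℝ≥0∞ :=
  ∑' l : M, (4 : ℝ≥0∞)⁻¹ ^ steps l.1

/-- `A` disconnects `B` from `C` in the plane: every continuous path joining a point
of `B` to a point of `C` meets `A`. -/
def Disconnects (A B C : Set Plane) : Prop :=
  ∀ γ : ℝ → Plane, ContinuousOn γ (Icc 0 1) → γ 0 ∈ B → γ 1 ∈ C →
    ∃ t ∈ Icc (0 : ℝ) 1, γ t ∈ A

/-- The set `M^{z,w}_{r,R}` of paths from `z` to `w` which intersect `∂B_R` and do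
not disconnect `B_r` from `∂B_R`. -/
def MSet (z w : Lat) (r R : ℤ) : Set (List Lat) :=
  {l | l ∈ PathsBetween z w ∧ (traceL l ∩ bdryE 0 R).Nonempty ∧
    ¬ Disconnects (traceL l) (embS (box 0 r)) (bdryE 0 R)}

/-- Nearest-neighbour walks from `u` to `v` staying in `D`. -/
def WalksIn (D : Set Lat) (u v : Lat) : Set (List Lat) :=
  {l | IsPath l ∧ l.head? = some u ∧ l.getLast? = some v ∧ ∀ x ∈ l, x ∈ D}

/-- The Green's function of simple random walk killed upon exiting `D`, through the
path-sum formula `G_D(u,v) = Σ_{η : u → v, η ⊆ D} 4^{-|η|}`. -/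
def green (D : Set Lat) (u v : Lat) : ℝ≥0∞ :=
  ∑' l : WalksIn D u v, (4 : ℝ≥0∞)⁻¹ ^ steps l.1

/-! ### Loops -/

/-- A rooted loop, encoded by its cyclic word: a nonempty list of vertices which,
cyclically, are successively adjacent. -/
structure RootedLoop where
  word : List Lat
  ne : word ≠ []
  adj : (word ++ word.take 1).Chain' Adj

/-- Rerooting (cyclic relabeling) relation on rooted loops. -/
def loopRot (l l' : RootedLoop) : Prop := ∃ k, l'.word = l.word.rotate k

/-- Unrooted loops: rooted loops modulo rerooting. -/
def ULoop : Type := Quot loopRot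

/-- A representative of an unrooted loop. -/
def ULoop.out (γ : ULoop) : RootedLoop := Quot.out γ

/-- Number of steps of a loop. -/
def ULoop.steps (γ : ULoop) : ℕ := γ.out.word.length

/-- Vertices visited by a loop. -/
def ULoop.verts (γ : ULoop) : Set Lat := {x | x ∈ γ.out.word}

/-- The trace of a loop in the plane. -/
def ULoop.trace (γ : ULoop) : Set Plane := traceL (γ.out.word ++ γ.out.word.take 1)

/-- The multiplicity `J(γ)`: the largest `j` such that `γ` is the concatenation of
`j` copies of a single loop. -/
def ULoop.mult (γ : ULoop) : ℕ :=
  sSup {j : ℕ | ∃ u : List Lat, u ≠ [] ∧ γ.out.word = (List.replicate j u).flatten}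

/-- The unrooted loop measure: `ν(γ) = 4^{-|γ|} / J(γ)`. -/
def loopWeight (γ : ULoop) : ℝ≥0 := (4 : ℝ≥0)⁻¹ ^ γ.steps / (γ.mult : ℝ≥0)

/-- Total `ν`-mass of a set of loops. -/
def nuMass (S : Set ULoop) : ℝ≥0∞ := ∑' γ : S, (loopWeight γ.1 : ℝ≥0∞)

/-- `ν(γ)` if `γ` is contained in `D`, and `0` otherwise. -/
def nuD (D : Set Lat) (γ : ULoop) : ℝ≥0 := if ULoop.verts γ ⊆ D then loopWeight γ else 0

/-! ### The random walk loop soup -/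

/-- Loop configurations: multiplicity functions on unrooted loops. -/
abbrev Config : Type := ULoop → ℕ

/-- The set of loops appearing in a configuration. -/
def Config.loops (ω : Config) : Set ULoop := {γ | ω γ ≠ 0}

/-- The Poisson probability mass function with mean `r`. -/
def poissonProb (r : ℝ≥0) (k : ℕ) : ℝ≥0∞ :=
  ENNReal.ofReal (Real.exp (-(r : ℝ)) * (r : ℝ) ^ k / k.factorial)

/-- `P` is the law of the random walk loop soup in `D` with intensity `α`: a Poisson
point process with intensity `α·ν` restricted to loops contained in `D`; equivalently,
the multiplicities of the various loops are independent, the multiplicity of a loop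
`γ ⊆ D` being Poisson-distributed with mean `α ν(γ)`. -/
def IsLoopSoup (D : Set Lat) (α : ℝ) (P : Measure Config) : Prop :=
  IsProbabilityMeasure P ∧
  ∀ (s : Finset ULoop) (m : ULoop → ℕ),
    P {ω | ∀ γ ∈ s, ω γ = m γ} = ∏ γ ∈ s, poissonProb (α.toNNReal * nuD D γ) (m γ)

/-- Decreasing events of the loop soup. -/
def DecreasingEvent (E : Set Config) : Prop :=
  ∀ ω ω' : Config, (∀ γ, ω' γ ≤ ω γ) → ω ∈ E → ω' ∈ E

/-! ### Clusters -/

/-- Two loops are adjacent when they intersect. -/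
def Touches (γ γ' : ULoop) : Prop := (ULoop.verts γ ∩ ULoop.verts γ').Nonempty

/-- Connection of loops within a family `L` of loops: transitive closure of adjacency. -/
def linkedL (L : Set ULoop) : ULoop → ULoop → Prop :=
  Relation.ReflTransGen (fun a b => a ∈ L ∧ b ∈ L ∧ Touches a b)

/-- The cluster of `γ` in `L`, as a set of loops. -/
def clusterClass (L : Set ULoop) (γ : ULoop) : Set ULoop := {γ' | γ' ∈ L ∧ linkedL L γ γ'}

/-- The subset of the plane covered by a family of loops. -/
def classTrace (K : Set ULoop) : Set Plane := ⋃ γ ∈ K, ULoop.trace γ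

/-- The clusters of a loop configuration, regarded as subsets of the plane. -/
def clusters (L : Set ULoop) : Set (Set Plane) :=
  {C | ∃ γ ∈ L, C = classTrace (clusterClass L γ)}

/-- `Λ(A, L)`: the union of `A` with all the clusters of `L` meeting `A`. -/
def LamL (A : Set Plane) (L : Set ULoop) : Set Plane :=
  A ∪ ⋃ C ∈ {C | C ∈ clusters L ∧ (C ∩ A).Nonempty}, C

/-- Connection within an arbitrary family of subsets of the plane (two members being
adjacent when they intersect). -/
def linkedS (F : Set (Set Plane)) : Set Plane → Set Plane → Prop :=
  Relation.ReflTransGen (fun a b => a ∈ F ∧ b ∈ F ∧ (a ∩ b).Nonempty)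

/-- Clusters of a family of subsets of the plane. -/
def clustersS (F : Set (Set Plane)) : Set (Set Plane) :=
  {C | ∃ S ∈ F, C = ⋃ S' ∈ {S' | S' ∈ F ∧ linkedS F S S'}, S'}

/-- `Λ(A, F)` for a family `F` of subsets of the plane. -/
def LamS (A : Set Plane) (F : Set (Set Plane)) : Set Plane :=
  A ∪ ⋃ C ∈ {C | C ∈ clustersS F ∧ (C ∩ A).Nonempty}, C

/-- The traces of a family of loops. -/
def traces (L : Set ULoop) : Set (Set Plane) := ULoop.trace '' L

/-! ### Filling, frontier, outermost clusters, crossings -/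

/-- The filling of a set: the complement of the union of all unbounded connected
subsets of the complement of its closure. -/
def Fill (A : Set Plane) : Set Plane :=
  {x | ∀ C : Set Plane, C ⊆ (closure A)ᶜ → IsConnected C → x ∈ C → Bornology.IsBounded C}

/-- The frontier of a loop: the topological boundary of the filling of its trace. -/
def loopFrontier (γ : ULoop) : Set Plane := frontier (Fill (ULoop.trace γ))

/-- The frontiers of the loops of a family. -/
def frontiers (L : Set ULoop) : Set (Set Plane) := loopFrontier '' L

/-- An outermost cluster of `L`. -/
def Outermost (L : Set ULoop) (C : Set Plane) : Prop :=
  C ∈ clusters L ∧ ∀ C' ∈ clusters L, C' ≠ C → ¬ Fill C ⊆ Fill C'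

/-- `S` crosses the annulus `A_{r,R}(z)`: it meets both `∂B_r(z)` and `∂B_R(z)`. -/
def CrossesAnn (S : Set Plane) (z : Lat) (r R : ℤ) : Prop :=
  (S ∩ bdryE z r).Nonempty ∧ (S ∩ bdryE z R).Nonempty

/-! ### Arm events -/

/-- The four-arm event: at least two distinct outermost clusters cross `A_{l,d}(z)`. -/
def fourArm (z : Lat) (l d : ℤ) (L : Set ULoop) : Prop :=
  ∃ C1 C2 : Set Plane, Outermost L C1 ∧ Outermost L C2 ∧ C1 ≠ C2 ∧
    CrossesAnn C1 z l d ∧ CrossesAnn C2 z l d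

/-- The four-arm event, as a set of configurations. -/
def A4 (z : Lat) (l d : ℤ) : Set Config := {ω | fourArm z l d ω.loops}

/-- The truncated four-arm event `→𝒜(z;l,d)`. -/
def A4trunc (z : Lat) (l d : ℤ) : Set Config :=
  {ω | fourArm z l d ω.loops ∧ LamL (embS (box z l)) ω.loops ⊆ boxP z (2 * d)}

/-- The truncated inward four-arm event `←𝒜(z;l,d)`. -/
def A4in (z : Lat) (l d : ℤ) : Set Config :=
  {ω | fourArm z l d ω.loops ∧
    LamL (embS (bdry (box z d))) ω.loops ∩ embS (box z (l / 2)) = ∅}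

/-- Lattice points in the open upper half-plane `ℍ`. -/
def upperLat : Set Lat := {w | 0 < w.2}

/-- The upper part of the boundary of `B_R`, embedded in the plane. -/
def bdryEP (R : ℤ) : Set Plane := embS (bdry (box 0 R) ∩ upperLat)

/-- `S` crosses the half-annulus `A^+_{r,R}`. -/
def CrossesAnnP (S : Set Plane) (r R : ℤ) : Prop :=
  (S ∩ bdryEP r).Nonempty ∧ (S ∩ bdryEP R).Nonempty

/-- The interior two-arm event: some outermost cluster has a frontier crossing `A_{l,d}`. -/
def A2 (l d : ℤ) : Set Config :=
  {ω | ∃ C, Outermost ω.loops C ∧ CrossesAnn (frontier (Fill C)) 0 l d}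

/-- The boundary two-arm event. -/
def A2P (l d : ℤ) : Set Config :=
  {ω | ∃ C, Outermost ω.loops C ∧ CrossesAnnP (frontier (Fill C)) l d}

/-- The boundary four-arm event. -/
def A4P (l d : ℤ) : Set Config :=
  {ω | ∃ C1 C2, Outermost ω.loops C1 ∧ Outermost ω.loops C2 ∧ C1 ≠ C2 ∧
    CrossesAnnP C1 l d ∧ CrossesAnnP C2 l d}

/-- Outward truncation condition: `Λ(B_l, ·) ⊆ B_{2d}`. -/
def TruncOut (l d : ℤ) (ω : Config) : Prop :=
  LamL (embS (box 0 l)) ω.loops ⊆ boxP 0 (2 * d)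

/-- Inward truncation condition: `Λ(∂B_d, ·) ∩ B_{⌊l/2⌋} = ∅`. -/
def TruncIn (l d : ℤ) (ω : Config) : Prop :=
  LamL (embS (bdry (box 0 d))) ω.loops ∩ embS (box 0 (l / 2)) = ∅

/-! ### Random walks and qualities -/

/-- `μ` is the law of the simple random walk on `ℤ²` started at `z`, as a measure on
`ℕ → ℤ²`. -/
def IsSRW (z : Lat) (μ : Measure (ℕ → Lat)) : Prop :=
  IsProbabilityMeasure μ ∧
  ∀ (n : ℕ) (f : ℕ → Lat), f 0 = z → (∀ i < n, Adj (f i) (f (i + 1))) →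
    μ {w | ∀ i ≤ n, w i = f i} = (4 : ℝ≥0∞)⁻¹ ^ n

/-- First hitting time of a set of vertices by a walk. -/
def hitTime (w : ℕ → Lat) (A : Set Lat) : ℕ := sInf {i | w i ∈ A}

/-- Position of a walk at its first hitting of `A`. -/
def hitPt (w : ℕ → Lat) (A : Set Lat) : Lat := w (hitTime w A)

/-- Trace of a walk, stopped at its first hitting of `A`. -/
def stoppedTrace (w : ℕ → Lat) (A : Set Lat) : Set Plane :=
  traceL ((List.range (hitTime w A + 1)).map w)

/-- The walk stays in `D` up to its first hitting of `A`. -/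
def StaysIn (w : ℕ → Lat) (D A : Set Lat) : Prop := ∀ i ≤ hitTime w A, w i ∈ D

/-- `μ` is the law of the simple random walk started at `z`, conditioned to stay in
`D` until it first hits `A`. -/
def IsCondSRW (z : Lat) (D A : Set Lat) (μ : Measure (ℕ → Lat)) : Prop :=
  ∃ ν : Measure (ℕ → Lat), IsSRW z ν ∧
    μ = (ν {w | StaysIn w D A})⁻¹ • ν.restrict {w | StaysIn w D A}

/-- Lattice ball of real radius (ℓ∞ distance). -/
def ballV (c : Lat) (ρ : ℝ) : Set Lat := {w | ((linf (w - c) : ℤ) : ℝ) ≤ ρ}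

/-- Union of the stopped traces of a packet of walks. -/
def packTrace {j : ℕ} (ws : Fin j → ℕ → Lat) (A : Set Lat) : Set Plane :=
  ⋃ i, stoppedTrace (ws i) A

/-- Union of the balls of radius `ρ` around the hitting points of a packet of walks. -/
def packBalls {j : ℕ} (ws : Fin j → ℕ → Lat) (A : Set Lat) (ρ : ℝ) : Set Plane :=
  ⋃ i, embS (ballV (hitPt (ws i) A) ρ)

/-- The frontiers of the loops of `ω` not contained in `B_r`. -/
def outerFrontiers (r : ℤ) (ω : Config) : Set (Set Plane) :=
  frontiers {γ | γ ∈ ω.loops ∧ ¬ ULoop.verts γ ⊆ box 0 r}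

/-- The frontiers of the loops of `ω` meeting `B_R`. -/
def meetFrontiers (R : ℤ) (ω : Config) : Set (Set Plane) :=
  frontiers {γ | γ ∈ ω.loops ∧ (ULoop.verts γ ∩ box 0 R).Nonempty}

/-- Quality at scale `s` for two packets of walks inside a loop soup, with initial
configuration `(Lr, V1, V2)` at scale `r`. -/
def qualityJK (Lr : Set ULoop) (V1 V2 : Set Lat) (r : ℤ) {j k : ℕ}
    (w1 : Fin j → ℕ → Lat) (w2 : Fin k → ℕ → Lat) (ω : Config) (s : ℤ) : ℝ :=
  sSup {δ : ℝ | 0 ≤ δ ∧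
    LamS (embS V1 ∪ packTrace w1 (bdry (box 0 s)) ∪ packBalls w1 (bdry (box 0 s)) (δ * (s : ℝ)))
        (traces Lr ∪ outerFrontiers r ω) ∩
      (embS V2 ∪ packTrace w2 (bdry (box 0 s)) ∪
        packBalls w2 (bdry (box 0 s)) (δ * (s : ℝ))) = ∅}

/-- Quality at scale `s` for a single pair of walks. -/
def qualityPair (Lr : Set ULoop) (V1 V2 : Set Lat) (r : ℤ)
    (w1 w2 : ℕ → Lat) (ω : Config) (s : ℤ) : ℝ :=
  qualityJK Lr V1 V2 r (fun _ : Fin 1 => w1) (fun _ : Fin 1 => w2) ω s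

/-- Reversed quality at scale `s`, for two packets walking inward from `∂B_R`. -/
def qualityRev (L : Set ULoop) (V1 V2 : Set Lat) (R : ℤ) {j k : ℕ}
    (w1 : Fin j → ℕ → Lat) (w2 : Fin k → ℕ → Lat) (ω : Config) (s : ℤ) : ℝ :=
  sSup {δ : ℝ | 0 ≤ δ ∧
    LamS (embS V1 ∪ packTrace w1 (bdry (box 0 s)) ∪ packBalls w1 (bdry (box 0 s)) (δ * (s : ℝ)))
        (traces L ∪ meetFrontiers R ω) ∩
      (embS V2 ∪ packTrace w2 (bdry (box 0 s)) ∪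
        packBalls w2 (bdry (box 0 s)) (δ * (s : ℝ))) = ∅}

/-- Quality at scale `s` for one packet of walks, with non-disconnection of `U`. -/
def qualityDisc (Lr : Set ULoop) (U : Set Lat) (r : ℤ) {j : ℕ}
    (ws : Fin j → ℕ → Lat) (ω : Config) (s : ℤ) : ℝ :=
  sSup {δ : ℝ | 0 ≤ δ ∧
    embS U ∩ Fill (LamS
      (packTrace ws (bdry (box 0 s)) ∪ packBalls ws (bdry (box 0 s)) (δ * (s : ℝ)))
      (traces Lr ∪ outerFrontiers r ω)) = ∅}

/-! ### Crossing loops and bad clusters -/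

/-- Crossing loops: loops contained in `D` which cross `A_{d,k}` without
disconnecting `B_d` from `∂B_k`. -/
def crossingLoops (D : Set Lat) (d k : ℤ) : Set ULoop :=
  {γ | ULoop.verts γ ⊆ D ∧ CrossesAnn (ULoop.trace γ) 0 d k ∧
    ¬ Disconnects (ULoop.trace γ) (embS (box 0 d)) (bdryE 0 k)}

/-- `K` is a bad cluster of `L` for the annulus `A_{l,d}`, relative to the set `CL` of
crossing loops: an outermost cluster crossing `A_{l,d}` which no longer crosses it
once its crossing loops are removed. -/
def IsBad (CL : Set ULoop) (l d : ℤ) (L : Set ULoop) (K : Set ULoop) : Prop :=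
  (∃ γ ∈ L, K = clusterClass L γ) ∧
  Outermost L (classTrace K) ∧ CrossesAnn (classTrace K) 0 l d ∧
  ¬ CrossesAnn (classTrace (K \ CL)) 0 l d

/-- `E_1`: the four-arm event holds, with exactly one bad cluster. -/
def E1 (CL : Set ULoop) (l d : ℤ) : Set Config :=
  {ω | fourArm 0 l d ω.loops ∧ ∃! K : Set ULoop, IsBad CL l d ω.loops K}

/-- `E_2`: the four-arm event holds, with at least two bad clusters. -/
def E2 (CL : Set ULoop) (l d : ℤ) : Set Config :=
  {ω | fourArm 0 l d ω.loops ∧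
    ∃ K K' : Set ULoop, K ≠ K' ∧ IsBad CL l d ω.loops K ∧ IsBad CL l d ω.loops K'}

/-- Number of crossing loops of a configuration, counted with multiplicity. -/
def crossingCount (CL : Set ULoop) (ω : Config) : ℝ≥0∞ := ∑' γ : CL, (ω γ.1 : ℝ≥0∞)

/-! ### Arcs of the square -/

/-- The square curve `{‖p‖_∞ = n}`: the closed polygonal curve through `∂B_n`. -/
def sqCurve (n : ℤ) : Set Plane := {p | max |p 0| |p 1| = (n : ℝ)}

/-- `J` is one of the two arcs of the closed curve `∂B_n` with endpoints `x` and `y`. -/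
def IsArc (n : ℤ) (x y : Lat) (J : Set Plane) : Prop :=
  IsClosed J ∧ IsConnected J ∧ J ⊆ sqCurve n ∧ emb x ∈ J ∧ emb y ∈ J ∧
  IsConnected ((sqCurve n \ J) ∪ {emb x, emb y})

/-! ### Part B: abstract twisted networks -/

/-- A finite network with symmetric weights, a unitary connection and a strict
supersolution. -/
structure Net (V : Type) where
  U : Finset V
  p : V → V → ℝ
  t : V → V → ℂ
  psi : V → ℝ
  p_nonneg : ∀ x y, 0 ≤ p x y
  p_symm : ∀ x y, p x y = p y x
  p_self : ∀ x, p x x = 0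
  t_norm : ∀ x y, ‖t x y‖ = 1
  t_symm : ∀ x y, t y x = (starRingEnd ℂ) (t x y)
  psi_pos : ∀ x ∈ U, 0 < psi x
  super : ∀ x ∈ U, ∑ y ∈ U, p x y * psi y < psi x

namespace Net

variable {V : Type} (N : Net V)

/-- Twisted weights. -/
def P (x y : V) : ℂ := (N.p x y : ℂ) * N.t x y

lemma P_norm (x y : V) : ‖N.P x y‖ = N.p x y := by
  simp [P, N.t_norm, abs_of_nonneg (N.p_nonneg x y)]

lemma P_symm (x y : V) : N.P y x = (starRingEnd ℂ) (N.P x y) := by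
  simp [P, N.t_symm x y, N.p_symm x y]

lemma P_self (x : V) : N.P x x = 0 := by simp [P, N.p_self]

lemma super_sub {D : Finset V} (hD : D ⊆ N.U) {x : V} (hx : x ∈ N.U) :
    ∑ y ∈ D, N.p x y * N.psi y < N.psi x := by
  refine lt_of_le_of_lt ?_ (N.super x hx)
  exact Finset.sum_le_sum_of_subset_of_nonneg hD
    (fun y hy _ => mul_nonneg (N.p_nonneg _ _) (N.psi_pos y hy).le)

/-- Maximum principle. -/
lemma mp {D : Finset V} (hD : D ⊆ N.U) (w : V → ℝ)
    (hw : ∀ x ∈ D, w x ≤ ∑ y ∈ D, N.p x y * w y) : ∀ x ∈ D, w x ≤ 0 := by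
  intro x0 hx0
  obtain ⟨x, hx, hmax⟩ := D.exists_max_image (fun x => w x / N.psi x) ⟨x0, hx0⟩
  have hpx := N.psi_pos x (hD hx)
  have key : w x / N.psi x ≤ 0 := by
    by_contra hM
    push Not at hM
    set M := w x / N.psi x with hMdef
    have h1 : w x = M * N.psi x := by rw [hMdef]; field_simp
    have h2 : ∑ y ∈ D, N.p x y * w y ≤ ∑ y ∈ D, N.p x y * (M * N.psi y) := by
      refine Finset.sum_le_sum fun y hy => mul_le_mul_of_nonneg_left ?_ (N.p_nonneg _ _)
      have := hmax y hy
      rwa [div_le_iff₀ (N.psi_pos y (hD hy))] at this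
    have h3 : ∑ y ∈ D, N.p x y * (M * N.psi y) = M * ∑ y ∈ D, N.p x y * N.psi y := by
      rw [Finset.mul_sum]; refine Finset.sum_congr rfl fun y _ => by ring
    have h4 := N.super_sub hD (hD hx)
    have h5 := hw x hx
    have h6 : M * ∑ y ∈ D, N.p x y * N.psi y < M * N.psi x := by gcongr
    linarith
  have h := hmax x0 hx0
  have hp0 := N.psi_pos x0 (hD hx0)
  have : w x0 / N.psi x0 ≤ 0 := h.trans key
  by_contra hc
  push Not at hc
  have := div_pos hc hp0
  linarith

/-- Comparison. -/
lemma comp {D : Finset V} (hD : D ⊆ N.U) (u phi b : V → ℝ)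
    (hu : ∀ x ∈ D, u x ≤ b x + ∑ y ∈ D, N.p x y * u y)
    (hphi : ∀ x ∈ D, b x + ∑ y ∈ D, N.p x y * phi y ≤ phi x) : ∀ x ∈ D, u x ≤ phi x := by
  intro x hx
  have := N.mp hD (fun x => u x - phi x) (fun x hx => by
    have h1 := hu x hx
    have h2 := hphi x hx
    have : ∑ y ∈ D, N.p x y * (u y - phi y)
      = ∑ y ∈ D, N.p x y * u y - ∑ y ∈ D, N.p x y * phi y := by
      rw [← Finset.sum_sub_distrib]; refine Finset.sum_congr rfl fun y _ => by ring
    rw [this]; linarith) x hx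
  linarith

/-- `u` solves the twisted Poisson problem in `D`. -/
def IsSol (D : Finset V) (b u : V → ℂ) : Prop :=
  (∀ x ∈ D, u x = b x + ∑ y ∈ D, N.P x y * u y) ∧ ∀ x ∉ D, u x = 0

lemma sol_unique {D : Finset V} (hD : D ⊆ N.U) {b u v : V → ℂ}
    (hu : N.IsSol D b u) (hv : N.IsSol D b v) : u = v := by
  have h0 : ∀ x ∈ D, ‖u x - v x‖ ≤ 0 := by
    refine N.mp hD (fun x => ‖u x - v x‖) fun x hx => ?_
    have : u x - v x = ∑ y ∈ D, N.P x y * (u y - v y) := by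
      rw [hu.1 x hx, hv.1 x hx]
      simp [mul_sub, Finset.sum_sub_distrib]
    rw [this]
    refine (norm_sum_le _ _).trans (le_of_eq ?_)
    exact Finset.sum_congr rfl fun y _ => by rw [norm_mul, P_norm]
  funext x
  by_cases hx : x ∈ D
  · have := h0 x hx
    have := norm_le_zero_iff.1 this
    exact sub_eq_zero.1 this
  · rw [hu.2 x hx, hv.2 x hx]

lemma exists_sol {D : Finset V} (hD : D ⊆ N.U) (b : V → ℂ) : ∃ u, N.IsSol D b u := by
  let ext : (D → ℂ) → V → ℂ := fun f x => if h : x ∈ D then f ⟨x, h⟩ else 0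
  let L : (D → ℂ) →ₗ[ℂ] (D → ℂ) :=
    { toFun := fun f x => f x - ∑ y : D, N.P x y * f y
      map_add' := by
        intro f g; funext x
        simp only [Pi.add_apply, mul_add, Finset.sum_add_distrib]; ring
      map_smul' := by
        intro c f; funext x
        simp only [Pi.smul_apply, smul_eq_mul, RingHom.id_apply, mul_sub, Finset.mul_sum]
        congr 1
        refine Finset.sum_congr rfl fun y _ => by ring }
  have hext : ∀ f : D → ℂ, ∀ x : V, ∑ y ∈ D, N.P x y * ext f y = ∑ y : D, N.P x y * f y := by
    intro f x
    rw [← Finset.sum_coe_sort D]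
    refine Finset.sum_congr rfl fun y _ => ?_
    simp [ext]
  have hinj : Function.Injective L := by
    rw [← LinearMap.ker_eq_bot, LinearMap.ker_eq_bot']
    intro f hf
    have h1 : N.IsSol D 0 (ext f) := by
      refine ⟨fun x hx => ?_, fun x hx => by simp [ext, hx]⟩
      rw [hext]
      have := congrFun hf ⟨x, hx⟩
      simp only [L, LinearMap.coe_mk, AddHom.coe_mk, Pi.zero_apply] at this
      simp only [ext, hx, dite_true, Pi.zero_apply, zero_add]
      exact sub_eq_zero.1 this
    have h2 : N.IsSol D 0 (0 : V → ℂ) := ⟨fun x _ => by simp, fun x _ => rfl⟩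
    have h3 := N.sol_unique hD h1 h2
    funext x
    have := congrFun h3 x.1
    simpa [ext] using this
  obtain ⟨f, hf⟩ := (LinearMap.injective_iff_surjective.1 hinj) (fun x => b x.1)
  refine ⟨ext f, fun x hx => ?_, fun x hx => by simp [ext, hx]⟩
  rw [hext]
  have := congrFun hf ⟨x, hx⟩
  simp only [L, LinearMap.coe_mk, AddHom.coe_mk] at this
  simp only [ext, hx, dite_true]
  rw [← this]; ring

/-- The solution. -/
def sol (D : Finset V) (b : V → ℂ) : V → ℂ :=
  if h : ∃ u, N.IsSol D b u then h.choose else 0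

lemma sol_spec {D : Finset V} (hD : D ⊆ N.U) (b : V → ℂ) : N.IsSol D b (N.sol D b) := by
  have h := N.exists_sol hD b
  rw [sol, dif_pos h]; exact h.choose_spec

lemma sol_eq {D : Finset V} (hD : D ⊆ N.U) {b u : V → ℂ} (hu : N.IsSol D b u) :
    N.sol D b = u := N.sol_unique hD (N.sol_spec hD b) hu

lemma sol_pairing {D : Finset V} (hD : D ⊆ N.U) (b c : V → ℂ) :
    ∑ x ∈ D, b x * (starRingEnd ℂ) (N.sol D c x) =
      ∑ x ∈ D, N.sol D b x * (starRingEnd ℂ) (c x) := by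
  obtain ⟨hu, -⟩ := N.sol_spec hD b
  obtain ⟨hv, -⟩ := N.sol_spec hD c
  set u := N.sol D b
  set v := N.sol D c
  have h1 : ∑ x ∈ D, b x * (starRingEnd ℂ) (v x) =
      ∑ x ∈ D, u x * (starRingEnd ℂ) (v x)
        - ∑ x ∈ D, ∑ y ∈ D, N.P x y * u y * (starRingEnd ℂ) (v x) := by
    rw [← Finset.sum_sub_distrib]
    refine Finset.sum_congr rfl fun x hx => ?_
    rw [← Finset.sum_mul]
    have := hu x hx
    rw [show b x = u x - ∑ y ∈ D, N.P x y * u y by rw [eq_sub_iff_add_eq, ← this]]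
    ring
  have h2 : ∑ x ∈ D, u x * (starRingEnd ℂ) (c x) =
      ∑ x ∈ D, u x * (starRingEnd ℂ) (v x)
        - ∑ x ∈ D, ∑ y ∈ D, u x * (starRingEnd ℂ) (N.P x y * v y) := by
    rw [← Finset.sum_sub_distrib]
    refine Finset.sum_congr rfl fun x hx => ?_
    rw [← Finset.mul_sum, ← map_sum]
    have := hv x hx
    rw [show c x = v x - ∑ y ∈ D, N.P x y * v y by rw [eq_sub_iff_add_eq, ← this]]
    rw [map_sub]; ring
  rw [h1, h2, Finset.sum_comm]
  congr 1
  refine Finset.sum_congr rfl fun y _ => Finset.sum_congr rfl fun x _ => ?_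
  rw [map_mul, ← N.P_symm]; ring

/-- Hitting kernel. -/
def K (D : Finset V) (z w : V) : ℂ := N.sol D (fun x => N.P x w) z

/-- Return mass. -/
def ccC (D : Finset V) (z : V) : ℂ := ∑ y ∈ D, N.P z y * N.K D y z

/-- Real part of the return mass. -/
def cc (D : Finset V) (z : V) : ℝ := (N.ccC D z).re

lemma K_off {D : Finset V} (hD : D ⊆ N.U) {z : V} (hz : z ∉ D) (w : V) : N.K D z w = 0 :=
  (N.sol_spec hD _).2 z hz

lemma K_bound {D : Finset V} (hD : D ⊆ N.U) {w : V} (hw : w ∈ N.U) (hwD : w ∉ D) (z : V)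
    (hz : z ∈ D) : ‖N.K D z w‖ ≤ N.psi z / N.psi w := by
  have hpw := N.psi_pos w hw
  refine N.comp hD (fun z => ‖N.K D z w‖) (fun z => N.psi z / N.psi w) (fun z => N.p z w)
    ?_ ?_ z hz
  · intro x hx
    have := (N.sol_spec hD (fun x => N.P x w)).1 x hx
    change N.K D x w = N.P x w + ∑ y ∈ D, N.P x y * N.K D y w at this
    change ‖N.K D x w‖ ≤ _
    rw [this]
    refine (norm_add_le _ _).trans ?_
    rw [P_norm]
    gcongr
    refine (norm_sum_le _ _).trans (le_of_eq ?_)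
    exact Finset.sum_congr rfl fun y _ => by rw [norm_mul, P_norm]
  · intro x hx
    have h1 := N.super_sub (D := insert w D) (by
      intro a ha; rcases Finset.mem_insert.1 ha with rfl | h
      · exact hw
      · exact hD h) (hD hx)
    rw [Finset.sum_insert hwD] at h1
    have h2 : N.p x w + ∑ y ∈ D, N.p x y * (N.psi y / N.psi w) =
      (N.p x w * N.psi w + ∑ y ∈ D, N.p x y * N.psi y) / N.psi w := by
      rw [add_div, Finset.sum_div]
      congr 1
      · field_simp
      · exact Finset.sum_congr rfl fun y _ => by ring
    rw [h2]
    exact (div_le_div_iff_of_pos_right hpw).2 h1.le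

lemma ccC_real {D : Finset V} (hD : D ⊆ N.U) (z : V) : N.ccC D z = (N.cc D z : ℂ) := by
  have h := N.sol_pairing hD (fun x => N.P x z) (fun x => N.P x z)
  have : (starRingEnd ℂ) (N.ccC D z) = N.ccC D z := by
    rw [ccC, map_sum]
    calc _ = ∑ x ∈ D, N.P x z * (starRingEnd ℂ) (N.K D x z) := by
          refine Finset.sum_congr rfl fun x _ => ?_
          rw [map_mul, ← N.P_symm]
      _ = ∑ x ∈ D, N.K D x z * (starRingEnd ℂ) (N.P x z) := h
      _ = _ := Finset.sum_congr rfl fun x _ => by rw [← N.P_symm, mul_comm]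
  exact (Complex.conj_eq_iff_re.1 this).symm

lemma cc_le {D : Finset V} (hD : D ⊆ N.U) {z : V} (hz : z ∈ N.U) (hzD : z ∉ D) :
    N.cc D z ≤ (∑ y ∈ D, N.p z y * N.psi y) / N.psi z := by
  refine (Complex.re_le_norm _).trans ?_
  refine (norm_sum_le _ _).trans ?_
  rw [Finset.sum_div]
  refine Finset.sum_le_sum fun y hy => ?_
  rw [norm_mul, P_norm, mul_div_assoc]
  exact mul_le_mul_of_nonneg_left (N.K_bound hD hz hzD y hy) (N.p_nonneg _ _)

lemma cc_lt_one {D : Finset V} (hD : D ⊆ N.U) {z : V} (hz : z ∈ N.U) (hzD : z ∉ D) :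
    N.cc D z < 1 := by
  refine lt_of_le_of_lt (N.cc_le hD hz hzD) ?_
  rw [div_lt_one (N.psi_pos z hz)]
  exact N.super_sub hD hz

lemma K_split {D : Finset V} (hD : D ⊆ N.U) {z : V} (hz : z ∈ D) (w : V) (x : V)
    (hx : x ∈ D.erase z) :
    N.K D x w = N.K (D.erase z) x w + N.K D z w * N.K (D.erase z) x z := by
  have hD1 : D.erase z ⊆ N.U := (Finset.erase_subset _ _).trans hD
  have hs := (N.sol_spec hD (fun x => N.P x w)).1
  have h1 := (N.sol_spec hD1 (fun x => N.P x w)).1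
  have h2 := (N.sol_spec hD1 (fun x => N.P x z)).1
  have e1 : N.IsSol (D.erase z) (fun x => N.P x w + N.K D z w * N.P x z)
      (fun x => if x ∈ D.erase z then N.K D x w else 0) := by
    refine ⟨fun x hx => ?_, fun x hx => by simp [hx]⟩
    have := hs x (Finset.mem_of_mem_erase hx)
    rw [← Finset.add_sum_erase _ _ hz] at this
    have hsum : ∑ y ∈ D.erase z, N.P x y * (if y ∈ D.erase z then N.K D y w else 0) =
        ∑ y ∈ D.erase z, N.P x y * N.K D y w :=
      Finset.sum_congr rfl fun y hy => by rw [if_pos hy]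
    change (if x ∈ D.erase z then N.K D x w else 0) = (N.P x w + N.K D z w * N.P x z) +
      ∑ y ∈ D.erase z, N.P x y * (if y ∈ D.erase z then N.K D y w else 0)
    rw [if_pos hx, hsum]
    change N.K D x w = N.P x w + (N.P x z * N.K D z w + ∑ y ∈ D.erase z, N.P x y * N.K D y w)
      at this
    rw [this]; ring
  have e2 : N.IsSol (D.erase z) (fun x => N.P x w + N.K D z w * N.P x z)
      (fun x => N.K (D.erase z) x w + N.K D z w * N.K (D.erase z) x z) := by
    refine ⟨fun x hx => ?_, fun x hx => by simp [N.K_off hD1 hx]⟩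
    have a1 := h1 x hx
    have a2 := h2 x hx
    change N.K _ x w = _ + ∑ y ∈ _, N.P x y * N.K _ y w at a1
    change N.K _ x z = _ + ∑ y ∈ _, N.P x y * N.K _ y z at a2
    simp only [mul_add, Finset.sum_add_distrib]
    have : ∑ y ∈ D.erase z, N.P x y * (N.K D z w * N.K (D.erase z) y z)
       = N.K D z w * ∑ y ∈ D.erase z, N.P x y * N.K (D.erase z) y z := by
      rw [Finset.mul_sum]; exact Finset.sum_congr rfl fun y _ => by ring
    rw [this]
    rw [a1, a2]; ring
  have := congrFun (N.sol_unique hD1 e1 e2) x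
  change (if x ∈ D.erase z then N.K D x w else 0) = _ at this
  rwa [if_pos hx] at this

lemma K_rec {D : Finset V} (hD : D ⊆ N.U) {z : V} (hz : z ∈ D) (w : V) :
    N.K D z w = ((1 - N.cc (D.erase z) z)⁻¹ : ℝ) *
      (N.P z w + ∑ y ∈ D.erase z, N.P z y * N.K (D.erase z) y w) := by
  have hD1 : D.erase z ⊆ N.U := (Finset.erase_subset _ _).trans hD
  have hc := N.cc_lt_one hD1 (hD hz) (Finset.notMem_erase _ _)
  have hs := (N.sol_spec hD (fun x => N.P x w)).1 z hz
  rw [← Finset.add_sum_erase _ _ hz, N.P_self, zero_mul, zero_add] at hs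
  change N.K D z w = _ + ∑ y ∈ _, N.P z y * N.K _ y w at hs
  have e : ∑ y ∈ D.erase z, N.P z y * N.K D y w =
      ∑ y ∈ D.erase z, N.P z y * N.K (D.erase z) y w + N.K D z w * N.cc (D.erase z) z := by
    rw [← N.ccC_real hD1, ccC, Finset.mul_sum, ← Finset.sum_add_distrib]
    refine Finset.sum_congr rfl fun y hy => ?_
    rw [N.K_split hD hz w y hy]; ring
  rw [e] at hs
  have hne : ((1 - N.cc (D.erase z) z : ℝ) : ℂ) ≠ 0 := by
    norm_cast; linarith
  push_cast at hne ⊢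
  rw [eq_inv_mul_iff_mul_eq₀ hne]
  linear_combination hs

/-- Real part of the rotated hitting kernel. -/
def J (D : Finset V) (z w : V) (th : ℂ) : ℝ := (th * N.K D z w).re

lemma J_rec {D : Finset V} (hD : D ⊆ N.U) {z : V} (hz : z ∈ D) (w : V) (th : ℂ) :
    N.J D z w th = (1 - N.cc (D.erase z) z)⁻¹ *
      (N.p z w * (th * N.t z w).re +
        ∑ y ∈ D.erase z, N.p z y * N.J (D.erase z) y w (th * N.t z y)) := by
  rw [J, N.K_rec hD hz]
  rw [show ∀ (a : ℝ) (b : ℂ), th * ((a : ℂ) * b) = (a : ℂ) * (th * b) from fun a b => by ring]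
  rw [Complex.re_ofReal_mul, mul_add, Complex.add_re, Finset.mul_sum, Complex.re_sum]
  congr 2
  · rw [P, ← Complex.re_ofReal_mul]; congr 1; ring
  · refine Finset.sum_congr rfl fun y _ => ?_
    rw [P, J, ← Complex.re_ofReal_mul]; congr 1; ring

lemma cc_eq (D : Finset V) (z : V) :
    N.cc D z = ∑ y ∈ D, N.p z y * N.J D y z (N.t z y) := by
  rw [cc, ccC, Complex.re_sum]
  refine Finset.sum_congr rfl fun y _ => ?_
  rw [P, J, ← Complex.re_ofReal_mul]; congr 1; ring

lemma J_off {D : Finset V} (hD : D ⊆ N.U) {z : V} (hz : z ∉ D) (w : V) (th : ℂ) :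
    N.J D z w th = 0 := by simp [J, N.K_off hD hz]

/-- Phase of the stack `l` (top at the head), from its entry `w` up to the top. -/
def ph : List V → V → ℂ
  | [], _ => 1
  | _ :: [], _ => 1
  | z :: z' :: r, w => if z = w then 1 else ph (z' :: r) w * N.t z' z

lemma ph_self (z : V) (l : List V) : N.ph (z :: l) z = 1 := by
  cases l <;> simp [ph]

lemma ph_cons (y z : V) (l : List V) (w : V) (h : y ≠ w) :
    N.ph (y :: z :: l) w = N.ph (z :: l) w * N.t z y := by
  simp [ph, h]

/-- Admissible stacks. -/
def Stack (l : List V) : Prop := l.Nodup ∧ l.IsChain (fun a b => 0 < N.p a b) ∧ ∀ x ∈ l, x ∈ N.U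

lemma Stack.push {l : List V} {y z : V} (h : N.Stack (z :: l)) (hy : y ∉ z :: l) (hyU : y ∈ N.U)
    (hp : 0 < N.p z y) : N.Stack (y :: z :: l) := by
  refine ⟨List.nodup_cons.2 ⟨hy, h.1⟩, List.isChain_cons_cons.2 ⟨by rwa [N.p_symm], h.2.1⟩, ?_⟩
  intro x hx
  rcases List.mem_cons.1 hx with rfl | hx
  · exact hyU
  · exact h.2.2 x hx

/-- All simple cycles have phases of nonnegative real part. -/
def Cyc : Prop := ∀ (z : V) (l : List V), N.Stack (z :: l) → ∀ w ∈ l, 0 < N.p z w →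
  0 ≤ (N.ph (z :: l) w * N.t z w).re

lemma J_pos_mono (hcyc : N.Cyc) : ∀ (D : Finset V), D ⊆ N.U → ∀ (z : V) (l : List V), z ∈ D →
    N.Stack (z :: l) → (∀ x ∈ l, x ∉ D) → ∀ w ∈ l,
      0 ≤ N.J D z w (N.ph (z :: l) w) ∧
      ∀ D' ⊆ D, N.J D' z w (N.ph (z :: l) w) ≤ N.J D z w (N.ph (z :: l) w) := by
  intro D
  induction D using Finset.strongInduction with
  | H D ih =>
  intro hDU z l hz hst hdis w hw
  have hD1 : D.erase z ⊆ N.U := (Finset.erase_subset _ _).trans hDU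
  have ih1 := ih (D.erase z) (Finset.erase_ssubset hz) hD1
  -- push facts
  have hpush : ∀ y ∈ D.erase z, 0 < N.p z y → N.Stack (y :: z :: l) ∧ (∀ x ∈ z :: l, x ∉ D.erase z) := by
    intro y hy hp
    refine ⟨Stack.push N hst ?_ (hD1 hy) hp, ?_⟩
    · intro hmem
      rcases List.mem_cons.1 hmem with rfl | h
      · exact Finset.notMem_erase _ _ hy
      · exact hdis y h (Finset.mem_of_mem_erase hy)
    · intro x hx
      rcases List.mem_cons.1 hx with rfl | h
      · exact Finset.notMem_erase _ _
      · exact fun h' => hdis x h (Finset.mem_of_mem_erase h')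
  have hyw : ∀ y ∈ D.erase z, y ≠ w := fun y hy e => by
    subst e; exact hdis _ hw (Finset.mem_of_mem_erase hy)
  have hterm : ∀ y ∈ D.erase z, ∀ D' ⊆ D.erase z,
      0 ≤ N.p z y * N.J (D.erase z) y w (N.ph (z :: l) w * N.t z y) ∧
      N.p z y * N.J D' y w (N.ph (z :: l) w * N.t z y) ≤
        N.p z y * N.J (D.erase z) y w (N.ph (z :: l) w * N.t z y) := by
    intro y hy D' hD'
    rcases (N.p_nonneg z y).eq_or_lt with h0 | h0
    · simp [← h0]
    obtain ⟨h1, h2⟩ := hpush y hy h0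
    have := ih1 y (z :: l) hy h1 h2 w (List.mem_cons_of_mem _ hw)
    rw [N.ph_cons y z l w (hyw y hy)] at this
    exact ⟨mul_nonneg h0.le this.1, mul_le_mul_of_nonneg_left (this.2 D' hD') h0.le⟩
  have htermc : ∀ y ∈ D.erase z, ∀ D' ⊆ D.erase z,
      0 ≤ N.p z y * N.J (D.erase z) y z (N.t z y) ∧
      N.p z y * N.J D' y z (N.t z y) ≤ N.p z y * N.J (D.erase z) y z (N.t z y) := by
    intro y hy D' hD'
    rcases (N.p_nonneg z y).eq_or_lt with h0 | h0
    · simp [← h0]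
    obtain ⟨h1, h2⟩ := hpush y hy h0
    have := ih1 y (z :: l) hy h1 h2 z List.mem_cons_self
    rw [N.ph_cons y z l z (Finset.ne_of_mem_erase hy), N.ph_self, one_mul] at this
    exact ⟨mul_nonneg h0.le this.1, mul_le_mul_of_nonneg_left (this.2 D' hD') h0.le⟩
  have hdir : 0 ≤ N.p z w * (N.ph (z :: l) w * N.t z w).re := by
    rcases (N.p_nonneg z w).eq_or_lt with h0 | h0
    · simp [← h0]
    · exact mul_nonneg h0.le (hcyc z l hst w hw h0)
  have hc1 := N.cc_lt_one hD1 (hDU hz) (Finset.notMem_erase _ _)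
  constructor
  · rw [N.J_rec hDU hz]
    refine mul_nonneg (inv_nonneg.2 (by linarith)) (add_nonneg hdir ?_)
    exact Finset.sum_nonneg fun y hy => (hterm y hy _ le_rfl).1
  · intro D' hD'
    have hD'U := hD'.trans hDU
    by_cases hz' : z ∈ D'
    swap
    · rw [N.J_off hD'U hz', N.J_rec hDU hz]
      refine mul_nonneg (inv_nonneg.2 (by linarith)) (add_nonneg hdir ?_)
      exact Finset.sum_nonneg fun y hy => (hterm y hy _ le_rfl).1
    have hE : D'.erase z ⊆ D.erase z := Finset.erase_subset_erase _ hD'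
    have hccle : N.cc (D'.erase z) z ≤ N.cc (D.erase z) z := by
      rw [N.cc_eq, N.cc_eq]
      refine (Finset.sum_le_sum fun y hy => (htermc y (hE hy) _ hE).2).trans ?_
      exact Finset.sum_le_sum_of_subset_of_nonneg hE fun y hy _ => (htermc y hy _ le_rfl).1
    rw [N.J_rec hDU hz, N.J_rec hD'U hz']
    have hsum : ∑ y ∈ D'.erase z, N.p z y * N.J (D'.erase z) y w (N.ph (z :: l) w * N.t z y) ≤
        ∑ y ∈ D.erase z, N.p z y * N.J (D.erase z) y w (N.ph (z :: l) w * N.t z y) := by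
      refine (Finset.sum_le_sum fun y hy => (hterm y (hE hy) _ hE).2).trans ?_
      exact Finset.sum_le_sum_of_subset_of_nonneg hE fun y hy _ => (hterm y hy _ le_rfl).1
    have hinv : (1 - N.cc (D'.erase z) z)⁻¹ ≤ (1 - N.cc (D.erase z) z)⁻¹ := by
      apply inv_anti₀ <;> linarith
    have hnn : 0 ≤ N.p z w * (N.ph (z :: l) w * N.t z w).re +
        ∑ y ∈ D.erase z, N.p z y * N.J (D.erase z) y w (N.ph (z :: l) w * N.t z y) :=
      add_nonneg hdir (Finset.sum_nonneg fun y hy => (hterm y hy _ le_rfl).1)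
    calc _ ≤ (1 - N.cc (D'.erase z) z)⁻¹ * (N.p z w * (N.ph (z :: l) w * N.t z w).re +
        ∑ y ∈ D.erase z, N.p z y * N.J (D.erase z) y w (N.ph (z :: l) w * N.t z y)) := by
          refine mul_le_mul_of_nonneg_left (by linarith) (inv_nonneg.2 (by linarith))
      _ ≤ _ := mul_le_mul_of_nonneg_right hinv hnn

end Net

namespace Net

variable {V : Type} (N : Net V)

/-- The part of a stack from the entry `w` down. -/
def dropTo (w : V) : List V → List V
  | [] => []
  | z :: l => if z = w then z :: l else dropTo w l

lemma dropTo_suffix (w : V) (l : List V) : dropTo w l <:+ l := by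
  induction l with
  | nil => simp [dropTo]
  | cons z l ih =>
    by_cases h : z = w
    · simp [dropTo, h]
    · simp only [dropTo, h, if_false]; exact ih.trans (List.suffix_cons _ _)

lemma dropTo_of_mem {w : V} {l : List V} (h : w ∈ l) : ∃ r, dropTo w l = w :: r := by
  induction l with
  | nil => simp at h
  | cons z l ih =>
    by_cases hz : z = w
    · exact ⟨l, by simp [dropTo, hz]⟩
    · obtain ⟨r, hr⟩ := ih (by simpa [Ne.symm hz] using h)
      exact ⟨r, by simp [dropTo, hz, hr]⟩

/-- Truncated sums of weights of walks read through the loop-erasing stack. -/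
def F (x : V) (S : Finset V) : ℕ → List V → Bool → ℝ
  | 0, l, f => if l = [x] ∧ f = true then 1 else 0
  | _ + 1, [], _ => 0
  | k + 1, z :: r, f => (if z :: r = [x] ∧ f = true then 1 else 0) +
      ∑ y ∈ N.U, N.p z y *
        (if y ∈ z :: r then
          (if N.ph (z :: r) y * N.t z y = 1 then F x S k (dropTo y (z :: r)) f else 0)
        else F x S k (y :: z :: r) (f || decide (y ∈ S)))

lemma F_nonneg (x : V) (S : Finset V) (k : ℕ) : ∀ l f, 0 ≤ N.F x S k l f := by
  induction k with
  | zero => intro l f; rw [F]; split_ifs <;> norm_num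
  | succ k ih =>
    intro l f
    cases l with
    | nil => simp [F]
    | cons z r =>
      rw [F]
      refine add_nonneg (by split_ifs <;> norm_num) (Finset.sum_nonneg fun y _ => ?_)
      refine mul_nonneg (N.p_nonneg _ _) ?_
      split_ifs
      · exact ih _ _
      · exact le_rfl
      · exact ih _ _

lemma F_mono (x : V) (S : Finset V) (k : ℕ) : ∀ l f, N.F x S k l f ≤ N.F x S (k + 1) l f := by
  induction k with
  | zero =>
    intro l f
    cases l with
    | nil => simp [F]
    | cons z r =>
      rw [F, F]
      refine le_add_of_nonneg_right (Finset.sum_nonneg fun y _ => ?_)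
      refine mul_nonneg (N.p_nonneg _ _) ?_
      split_ifs
      · exact N.F_nonneg _ _ _ _ _
      · exact le_rfl
      · exact N.F_nonneg _ _ _ _ _
  | succ k ih =>
    intro l f
    cases l with
    | nil => simp [F]
    | cons z r =>
      rw [F, F]
      gcongr with y _
      · exact N.p_nonneg _ _
      · split_ifs
        · exact ih _ _
        · exact le_rfl
        · exact ih _ _

/-- Complement in `U` of the stack entries. -/
def off (l : List V) : Finset V := N.U.filter (fun x => x ∉ l)

lemma off_sub (l : List V) : N.off l ⊆ N.U := Finset.filter_subset _ _

lemma off_cons (z : V) (l : List V) : N.off (z :: l) = (N.off l).erase z := by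
  ext a; simp [off]; tauto

lemma mem_off {l : List V} {x : V} : x ∈ N.off l ↔ x ∈ N.U ∧ x ∉ l := by simp [off]

lemma sum_U_split (z : V) (r : List V) (hst : N.Stack (z :: r)) (f : V → ℝ)
    (hz : f z = 0) :
    ∑ y ∈ N.U, f y = ∑ y ∈ N.off (z :: r), f y + ∑ y ∈ r.toFinset, f y := by
  rw [← Finset.sum_filter_add_sum_filter_not N.U (fun x => x ∉ z :: r)]
  congr 1
  have : N.U.filter (fun x => ¬ x ∉ z :: r) = insert z r.toFinset := by
    ext a
    simp only [Finset.mem_filter, not_not, Finset.mem_insert, List.mem_toFinset, List.mem_cons]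
    constructor
    · exact fun h => h.2
    · exact fun h => ⟨hst.2.2 a (List.mem_cons.2 h), h⟩
  rw [this]
  by_cases hzr : z ∈ r.toFinset
  · rw [Finset.insert_eq_of_mem hzr]
  · rw [Finset.sum_insert hzr, hz, zero_add]

/-- coefficient of the jump to the entry `w` -/
def aco (D : Finset V) (z : V) (r : List V) (w : V) : ℝ :=
  N.p z w * (N.ph (z :: r) w * N.t z w).re +
    ∑ y ∈ D, N.p z y * N.J D y w (N.ph (z :: r) w * N.t z y)

lemma pop_le (hcyc : N.Cyc) {z : V} {r : List V} (hst : N.Stack (z :: r)) {w : V} (hw : w ∈ r)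
    (A : ℝ) (hA : 0 ≤ A) :
    N.p z w * (if N.ph (z :: r) w * N.t z w = 1 then A else 0) ≤
      N.p z w * (N.ph (z :: r) w * N.t z w).re * A := by
  rcases (N.p_nonneg z w).eq_or_lt with h0 | h0
  · simp [← h0]
  rw [mul_assoc]
  refine mul_le_mul_of_nonneg_left ?_ h0.le
  split_ifs with h
  · simp [h]
  · exact mul_nonneg (hcyc z r hst w hw h0) hA

lemma dropTo_cons_of_mem {z : V} {r : List V} (hst : N.Stack (z :: r)) {w : V} (hw : w ∈ r) :
    dropTo w (z :: r) = dropTo w r := by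
  have : z ≠ w := fun e => by
    subst e; exact (List.nodup_cons.1 hst.1).1 hw
  simp [dropTo, this]

lemma step_yes (hcyc : N.Cyc) (x : V) (S : Finset V) (k : ℕ) (z : V) (r : List V)
    (hst : N.Stack (z :: r))
    (ih : ∀ y, N.Stack (y :: z :: r) → N.F x S k (y :: z :: r) true ≤
      ∑ w ∈ (z :: r).toFinset, N.J (N.off (z :: r)) y w (N.ph (y :: z :: r) w) *
        N.F x S k (dropTo w (z :: r)) true) :
    N.F x S (k + 1) (z :: r) true ≤ (if z :: r = [x] then 1 else 0) +
      N.cc (N.off (z :: r)) z * N.F x S k (z :: r) true +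
      ∑ w ∈ r.toFinset, N.aco (N.off (z :: r)) z r w * N.F x S k (dropTo w r) true := by
  rw [F]
  simp only [and_true, Bool.true_or]
  rw [add_assoc]
  gcongr
  rw [N.sum_U_split z r hst _ (by simp [N.p_self])]
  have hzr : z ∉ r.toFinset := by simpa using (List.nodup_cons.1 hst.1).1
  have h1 : ∀ y ∈ N.off (z :: r), N.p z y * (if y ∈ z :: r then
          (if N.ph (z :: r) y * N.t z y = 1 then N.F x S k (dropTo y (z :: r)) true else 0)
        else N.F x S k (y :: z :: r) true) ≤
      N.p z y * N.J (N.off (z :: r)) y z (N.t z y) * N.F x S k (z :: r) true +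
      ∑ w ∈ r.toFinset, N.p z y * N.J (N.off (z :: r)) y w (N.ph (z :: r) w * N.t z y) *
        N.F x S k (dropTo w r) true := by
    intro y hy
    obtain ⟨hyU, hyn⟩ := N.mem_off.1 hy
    rw [if_neg hyn]
    rcases (N.p_nonneg z y).eq_or_lt with h0 | h0
    · simp [← h0]
    have := ih y (Stack.push N hst hyn hyU h0)
    rw [List.toFinset_cons, Finset.sum_insert hzr] at this
    have hyz : y ≠ z := fun e => hyn (by simp [e])
    rw [N.ph_cons y z r z hyz, N.ph_self, one_mul] at this
    have e1 : dropTo z (z :: r) = z :: r := by simp [dropTo]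
    rw [e1] at this
    have e2 : ∑ w ∈ r.toFinset, N.J (N.off (z :: r)) y w (N.ph (y :: z :: r) w) *
        N.F x S k (dropTo w (z :: r)) true =
        ∑ w ∈ r.toFinset, N.J (N.off (z :: r)) y w (N.ph (z :: r) w * N.t z y) *
        N.F x S k (dropTo w r) true := by
      refine Finset.sum_congr rfl fun w hw => ?_
      have hw' : w ∈ r := by simpa using hw
      rw [N.ph_cons y z r w (fun e => hyn (by simp [e, hw'])), N.dropTo_cons_of_mem hst hw']
    rw [e2] at this
    refine (mul_le_mul_of_nonneg_left this h0.le).trans (le_of_eq ?_)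
    rw [mul_add, Finset.mul_sum, mul_assoc]
    congr 1
    exact Finset.sum_congr rfl fun w _ => by ring
  have h2 : ∀ w ∈ r.toFinset, N.p z w * (if w ∈ z :: r then
          (if N.ph (z :: r) w * N.t z w = 1 then N.F x S k (dropTo w (z :: r)) true else 0)
        else N.F x S k (w :: z :: r) true) ≤
      N.p z w * (N.ph (z :: r) w * N.t z w).re * N.F x S k (dropTo w r) true := by
    intro w hw
    have hw' : w ∈ r := by simpa using hw
    rw [if_pos (List.mem_cons_of_mem _ hw'), N.dropTo_cons_of_mem hst hw']
    exact N.pop_le hcyc hst hw' _ (N.F_nonneg _ _ _ _ _)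
  refine (add_le_add (Finset.sum_le_sum h1) (Finset.sum_le_sum h2)).trans (le_of_eq ?_)
  rw [Finset.sum_add_distrib, ← Finset.sum_mul, ← N.cc_eq, add_assoc, Finset.sum_comm,
    ← Finset.sum_add_distrib]
  congr 1
  refine Finset.sum_congr rfl fun w _ => ?_
  rw [aco, add_mul, ← Finset.sum_mul]; ring

lemma aco_J {D : Finset V} {z : V} {r : List V} (hst : N.Stack (z :: r)) (w : V)
    (hD : D ⊆ N.U) (hz : z ∈ D) :
    (1 - N.cc (D.erase z) z)⁻¹ * N.aco (D.erase z) z r w = N.J D z w (N.ph (z :: r) w) := by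
  rw [N.J_rec hD hz, aco]

/-- For a nonempty remaining stack. -/
lemma claim_yes (hcyc : N.Cyc) (x : V) (S : Finset V) (k : ℕ) : ∀ (z : V) (r : List V),
    r ≠ [] → N.Stack (z :: r) → N.F x S k (z :: r) true ≤
      ∑ w ∈ r.toFinset, N.J (N.off r) z w (N.ph (z :: r) w) * N.F x S k (dropTo w r) true := by
  induction k with
  | zero =>
    intro z r hr hst
    have hzD : z ∈ N.off r := N.mem_off.2 ⟨hst.2.2 z (by simp), (List.nodup_cons.1 hst.1).1⟩
    have : N.F x S 0 (z :: r) true = 0 := by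
      rw [F, if_neg]; simp [hr]
    rw [this]
    refine Finset.sum_nonneg fun w hw => mul_nonneg ?_ (N.F_nonneg _ _ _ _ _)
    exact (N.J_pos_mono hcyc _ (N.off_sub r) z r hzD hst (fun a ha h => (N.mem_off.1 h).2 ha) w
      (by simpa using hw)).1
  | succ k ih =>
    intro z r hr hst
    have hzU := hst.2.2 z (by simp)
    have hzr := (List.nodup_cons.1 hst.1).1
    have hzD : z ∈ N.off r := N.mem_off.2 ⟨hzU, hzr⟩
    have h := N.step_yes hcyc x S k z r hst (fun y hy => ih y (z :: r) (by simp) hy)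
    rw [if_neg (by simp [hr]), zero_add] at h
    have hc := N.cc_lt_one (N.off_sub (z :: r)) hzU (fun h => (N.mem_off.1 h).2 (by simp))
    have hc0 : 0 ≤ N.cc (N.off (z :: r)) z := by
      rw [N.cc_eq]
      refine Finset.sum_nonneg fun y hy => ?_
      rcases (N.p_nonneg z y).eq_or_lt with h0 | h0
      · simp [← h0]
      obtain ⟨hyU, hyn⟩ := N.mem_off.1 hy
      have := (N.J_pos_mono hcyc _ (N.off_sub (z :: r)) y (z :: r) hy
        (Stack.push N hst hyn hyU h0) (fun a ha h => (N.mem_off.1 h).2 ha) z (by simp)).1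
      rw [N.ph_cons y z r z (fun e => hyn (by simp [e])), N.ph_self, one_mul] at this
      exact mul_nonneg h0.le this
    have hm := N.F_mono x S k (z :: r) true
    have h' : (1 - N.cc (N.off (z :: r)) z) * N.F x S (k + 1) (z :: r) true ≤
        ∑ w ∈ r.toFinset, N.aco (N.off (z :: r)) z r w * N.F x S k (dropTo w r) true := by
      nlinarith
    have hpos : 0 < 1 - N.cc (N.off (z :: r)) z := by linarith
    rw [← le_inv_mul_iff₀ hpos] at h'
    refine h'.trans ?_
    rw [Finset.mul_sum]
    refine Finset.sum_le_sum fun w hw => ?_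
    rw [← mul_assoc, N.off_cons, N.aco_J hst w (N.off_sub r) hzD]
    refine mul_le_mul_of_nonneg_left (N.F_mono _ _ _ _ _) ?_
    exact (N.J_pos_mono hcyc _ (N.off_sub r) z r hzD hst (fun a ha h => (N.mem_off.1 h).2 ha) w
      (by simpa using hw)).1

lemma bottom_yes (hcyc : N.Cyc) (S : Finset V) (x : V) (hx : x ∈ N.U) (k : ℕ) :
    N.F x S k [x] true ≤ (1 - N.cc (N.off [x]) x)⁻¹ := by
  have hst : N.Stack [x] := ⟨by simp, by simp, by simpa using hx⟩
  have h := N.step_yes hcyc x S k x [] hst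
    (fun y hy => N.claim_yes hcyc x S k y [x] (by simp) hy)
  simp only [if_true, List.toFinset_nil, Finset.sum_empty, add_zero] at h
  have hc := N.cc_lt_one (N.off_sub [x]) hx (fun h => (N.mem_off.1 h).2 (by simp))
  have hm := N.F_mono x S k [x] true
  have hpos : 0 < 1 - N.cc (N.off [x]) x := by linarith
  rw [← one_div, le_div_iff₀ hpos]
  nlinarith

end Net

namespace Net

variable {V : Type} (N : Net V)

lemma sum_sdiff_J (D S : Finset V) (hD : D ⊆ N.U) (z w : V) (th : V → ℂ) :
    ∑ y ∈ D, N.p z y * N.J (D \ S) y w (th y) = ∑ y ∈ D \ S, N.p z y * N.J (D \ S) y w (th y) := by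
  symm
  refine Finset.sum_subset Finset.sdiff_subset fun y _ hy => ?_
  rw [N.J_off (Finset.sdiff_subset.trans hD) hy, mul_zero]

lemma step_no (hcyc : N.Cyc) (x : V) (S : Finset V) (k : ℕ) (z : V) (r : List V)
    (hst : N.Stack (z :: r)) (hS : ∀ a ∈ z :: r, a ∉ S)
    (ih : ∀ y, N.Stack (y :: z :: r) → (∀ a ∈ y :: z :: r, a ∉ S) →
      N.F x S k (y :: z :: r) false ≤
      ∑ w ∈ (z :: r).toFinset, (N.J (N.off (z :: r) \ S) y w (N.ph (y :: z :: r) w) *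
        N.F x S k (dropTo w (z :: r)) false +
        (N.J (N.off (z :: r)) y w (N.ph (y :: z :: r) w) -
          N.J (N.off (z :: r) \ S) y w (N.ph (y :: z :: r) w)) *
        N.F x S k (dropTo w (z :: r)) true)) :
    N.F x S (k + 1) (z :: r) false ≤
      (N.cc (N.off (z :: r) \ S) z * N.F x S k (z :: r) false +
        (N.cc (N.off (z :: r)) z - N.cc (N.off (z :: r) \ S) z) * N.F x S k (z :: r) true) +
      ∑ w ∈ r.toFinset, (N.aco (N.off (z :: r) \ S) z r w * N.F x S k (dropTo w r) false +
        (N.aco (N.off (z :: r)) z r w - N.aco (N.off (z :: r) \ S) z r w) *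
          N.F x S k (dropTo w r) true) := by
  rw [F]
  simp only [and_false, Bool.false_or, if_false, zero_add, Bool.false_eq_true]
  rw [N.sum_U_split z r hst _ (by simp [N.p_self])]
  have hzr : z ∉ r.toFinset := by simpa using (List.nodup_cons.1 hst.1).1
  set D := N.off (z :: r) with hDdef
  have hDU : D ⊆ N.U := N.off_sub _
  have h1 : ∀ y ∈ D, N.p z y * (if y ∈ z :: r then
          (if N.ph (z :: r) y * N.t z y = 1 then N.F x S k (dropTo y (z :: r)) false else 0)
        else N.F x S k (y :: z :: r) (decide (y ∈ S))) ≤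
      (N.p z y * N.J (D \ S) y z (N.t z y) * N.F x S k (z :: r) false +
      (N.p z y * N.J D y z (N.t z y) - N.p z y * N.J (D \ S) y z (N.t z y)) *
        N.F x S k (z :: r) true) +
      ∑ w ∈ r.toFinset, (N.p z y * N.J (D \ S) y w (N.ph (z :: r) w * N.t z y) *
        N.F x S k (dropTo w r) false +
        (N.p z y * N.J D y w (N.ph (z :: r) w * N.t z y) -
          N.p z y * N.J (D \ S) y w (N.ph (z :: r) w * N.t z y)) *
        N.F x S k (dropTo w r) true) := by
    intro y hy
    obtain ⟨hyU, hyn⟩ := N.mem_off.1 hy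
    rw [if_neg hyn]
    rcases (N.p_nonneg z y).eq_or_lt with h0 | h0
    · simp [← h0]
    have hpst := Stack.push N hst hyn hyU h0
    have this : N.F x S k (y :: z :: r) (decide (y ∈ S)) ≤
      ∑ w ∈ (z :: r).toFinset, (N.J (D \ S) y w (N.ph (y :: z :: r) w) *
        N.F x S k (dropTo w (z :: r)) false +
        (N.J D y w (N.ph (y :: z :: r) w) -
          N.J (D \ S) y w (N.ph (y :: z :: r) w)) *
        N.F x S k (dropTo w (z :: r)) true) := by
      by_cases hyS : y ∈ S
      · simp only [hyS, decide_true]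
        refine (N.claim_yes hcyc x S k y (z :: r) (by simp) hpst).trans (le_of_eq ?_)
        refine Finset.sum_congr rfl fun w _ => ?_
        rw [N.J_off (Finset.sdiff_subset.trans hDU) (by simp [hyS])]; ring
      · simp only [hyS, decide_false]
        refine ih y hpst ?_
        intro a ha
        rcases List.mem_cons.1 ha with rfl | ha
        · exact hyS
        · exact hS a ha
    rw [List.toFinset_cons, Finset.sum_insert hzr] at this
    have hyz : y ≠ z := fun e => hyn (by simp [e])
    rw [N.ph_cons y z r z hyz, N.ph_self, one_mul] at this
    have e1 : dropTo z (z :: r) = z :: r := by simp [dropTo]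
    rw [e1] at this
    refine (mul_le_mul_of_nonneg_left this h0.le).trans (le_of_eq ?_)
    rw [mul_add, Finset.mul_sum]
    congr 1
    · ring
    · refine Finset.sum_congr rfl fun w hw => ?_
      have hw' : w ∈ r := by simpa using hw
      rw [N.ph_cons y z r w (fun e => hyn (by simp [e, hw'])), N.dropTo_cons_of_mem hst hw']
      ring
  have h2 : ∀ w ∈ r.toFinset, N.p z w * (if w ∈ z :: r then
          (if N.ph (z :: r) w * N.t z w = 1 then N.F x S k (dropTo w (z :: r)) false else 0)
        else N.F x S k (w :: z :: r) (decide (w ∈ S))) ≤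
      N.p z w * (N.ph (z :: r) w * N.t z w).re * N.F x S k (dropTo w r) false := by
    intro w hw
    have hw' : w ∈ r := by simpa using hw
    rw [if_pos (List.mem_cons_of_mem _ hw'), N.dropTo_cons_of_mem hst hw']
    exact N.pop_le hcyc hst hw' _ (N.F_nonneg _ _ _ _ _)
  refine (add_le_add (Finset.sum_le_sum h1) (Finset.sum_le_sum h2)).trans (le_of_eq ?_)
  rw [Finset.sum_add_distrib, Finset.sum_add_distrib, ← Finset.sum_mul, ← Finset.sum_mul,
    Finset.sum_sub_distrib, N.sum_sdiff_J D S hDU, ← N.cc_eq, ← N.cc_eq, add_assoc,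
    Finset.sum_comm, ← Finset.sum_add_distrib]
  congr 1
  refine Finset.sum_congr rfl fun w _ => ?_
  rw [Finset.sum_add_distrib, ← Finset.sum_mul, ← Finset.sum_mul, Finset.sum_sub_distrib,
    N.sum_sdiff_J D S hDU, aco, aco]; ring

lemma cc_mono (hcyc : N.Cyc) (z : V) (r : List V) (hst : N.Stack (z :: r)) (D' : Finset V)
    (hD' : D' ⊆ N.off (z :: r)) :
    N.cc D' z ≤ N.cc (N.off (z :: r)) z := by
  have hterm : ∀ y ∈ N.off (z :: r), ∀ E ⊆ N.off (z :: r),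
      0 ≤ N.p z y * N.J (N.off (z :: r)) y z (N.t z y) ∧
      N.p z y * N.J E y z (N.t z y) ≤ N.p z y * N.J (N.off (z :: r)) y z (N.t z y) := by
    intro y hy E hE
    rcases (N.p_nonneg z y).eq_or_lt with h0 | h0
    · simp [← h0]
    obtain ⟨hyU, hyn⟩ := N.mem_off.1 hy
    have := (N.J_pos_mono hcyc _ (N.off_sub (z :: r)) y (z :: r) hy
      (Stack.push N hst hyn hyU h0) (fun a ha h => (N.mem_off.1 h).2 ha) z (by simp))
    rw [N.ph_cons y z r z (fun e => hyn (by simp [e])), N.ph_self, one_mul] at this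
    exact ⟨mul_nonneg h0.le this.1, mul_le_mul_of_nonneg_left (this.2 E hE) h0.le⟩
  rw [N.cc_eq, N.cc_eq]
  refine (Finset.sum_le_sum fun y hy => (hterm y (hD' hy) _ hD').2).trans ?_
  exact Finset.sum_le_sum_of_subset_of_nonneg hD' fun y hy _ => (hterm y hy _ le_rfl).1

lemma cc_nonneg (hcyc : N.Cyc) (z : V) (r : List V) (hst : N.Stack (z :: r)) (D' : Finset V)
    (hD' : D' ⊆ N.off (z :: r)) : 0 ≤ N.cc D' z := by
  rw [N.cc_eq]
  refine Finset.sum_nonneg fun y hy => ?_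
  rcases (N.p_nonneg z y).eq_or_lt with h0 | h0
  · simp [← h0]
  obtain ⟨hyU, hyn⟩ := N.mem_off.1 (hD' hy)
  have := (N.J_pos_mono hcyc D' (hD'.trans (N.off_sub _)) y (z :: r) hy
    (Stack.push N hst hyn hyU h0) (fun a ha h => (N.mem_off.1 (hD' h)).2 ha) z (by simp)).1
  rw [N.ph_cons y z r z (fun e => hyn (by simp [e])), N.ph_self, one_mul] at this
  exact mul_nonneg h0.le this

lemma step_yes' (hcyc : N.Cyc) (x : V) (S : Finset V) (k : ℕ) (z : V) (r : List V) (hr : r ≠ [])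
    (hst : N.Stack (z :: r)) :
    (1 - N.cc (N.off (z :: r)) z) * N.F x S k (z :: r) true ≤
      ∑ w ∈ r.toFinset, N.aco (N.off (z :: r)) z r w * N.F x S k (dropTo w r) true := by
  have hm := N.F_mono x S k (z :: r) true
  have h := N.step_yes hcyc x S k z r hst
    (fun y hy => N.claim_yes hcyc x S k y (z :: r) (by simp) hy)
  rw [if_neg (by simp [hr]), zero_add] at h
  nlinarith

lemma off_sdiff_cons (z : V) (l : List V) (S : Finset V) :
    N.off (z :: l) \ S = (N.off l \ S).erase z := by
  ext a; simp [off]; tauto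

/-- For a nonempty remaining stack, flag not raised yet. -/
lemma claim_no (hcyc : N.Cyc) (x : V) (S : Finset V) (k : ℕ) : ∀ (z : V) (r : List V),
    r ≠ [] → N.Stack (z :: r) → (∀ a ∈ z :: r, a ∉ S) → N.F x S k (z :: r) false ≤
      ∑ w ∈ r.toFinset, (N.J (N.off r \ S) z w (N.ph (z :: r) w) * N.F x S k (dropTo w r) false +
        (N.J (N.off r) z w (N.ph (z :: r) w) - N.J (N.off r \ S) z w (N.ph (z :: r) w)) *
          N.F x S k (dropTo w r) true) := by
  induction k with
  | zero =>
    intro z r hr hst hS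
    have hzD : z ∈ N.off r := N.mem_off.2 ⟨hst.2.2 z (by simp), (List.nodup_cons.1 hst.1).1⟩
    have : N.F x S 0 (z :: r) false = 0 := by
      rw [F, if_neg]; simp
    rw [this]
    have hzD' : z ∈ N.off r \ S := Finset.mem_sdiff.2 ⟨hzD, hS z (by simp)⟩
    refine Finset.sum_nonneg fun w hw => add_nonneg (mul_nonneg ?_ (N.F_nonneg _ _ _ _ _))
      (mul_nonneg (sub_nonneg.2 ?_) (N.F_nonneg _ _ _ _ _))
    · exact (N.J_pos_mono hcyc _ (Finset.sdiff_subset.trans (N.off_sub r)) z r hzD' hst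
        (fun a ha h => (N.mem_off.1 (Finset.mem_sdiff.1 h).1).2 ha) w (by simpa using hw)).1
    · exact (N.J_pos_mono hcyc _ (N.off_sub r) z r hzD hst
        (fun a ha h => (N.mem_off.1 h).2 ha) w (by simpa using hw)).2 _ Finset.sdiff_subset
  | succ k ih =>
    intro z r hr hst hS
    have hzU := hst.2.2 z (by simp)
    have hzr := (List.nodup_cons.1 hst.1).1
    have hzD : z ∈ N.off r := N.mem_off.2 ⟨hzU, hzr⟩
    have hzD' : z ∈ N.off r \ S := Finset.mem_sdiff.2 ⟨hzD, hS z (by simp)⟩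
    have h := N.step_no hcyc x S k z r hst hS (fun y hy hyS => ih y (z :: r) (by simp) hy hyS)
    have hyes := N.step_yes' hcyc x S k z r hr hst
    have hc := N.cc_lt_one (N.off_sub (z :: r)) hzU (fun h => (N.mem_off.1 h).2 (by simp))
    have hc0 := N.cc_nonneg hcyc z r hst _ (Finset.sdiff_subset (s := N.off (z :: r)) (t := S))
    have hcm := N.cc_mono hcyc z r hst _ (Finset.sdiff_subset (s := N.off (z :: r)) (t := S))
    have hm := N.F_mono x S k (z :: r) false
    set c := N.cc (N.off (z :: r)) z with hcdef
    set c' := N.cc (N.off (z :: r) \ S) z with hcdef'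
    have hpos : 0 < 1 - c := by linarith
    have hpos' : 0 < 1 - c' := by linarith
    rw [Finset.sum_add_distrib] at h ⊢
    set A1 := ∑ w ∈ r.toFinset, N.aco (N.off (z :: r)) z r w * N.F x S k (dropTo w r) true
    have hy2 : N.F x S k (z :: r) true ≤ (1 - c)⁻¹ * A1 := by
      rwa [le_inv_mul_iff₀ hpos]
    have h3 : (1 - c') * N.F x S (k + 1) (z :: r) false ≤ (c - c') * ((1 - c)⁻¹ * A1) +
      (∑ w ∈ r.toFinset, N.aco (N.off (z :: r) \ S) z r w * N.F x S k (dropTo w r) false +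
        ∑ w ∈ r.toFinset, (N.aco (N.off (z :: r)) z r w - N.aco (N.off (z :: r) \ S) z r w) *
          N.F x S k (dropTo w r) true) := by
      have := mul_le_mul_of_nonneg_left hy2 (sub_nonneg.2 hcm)
      have := mul_le_mul_of_nonneg_left hm hc0
      linarith
    rw [← le_inv_mul_iff₀ hpos'] at h3
    refine h3.trans ?_
    have e : (1 - c')⁻¹ * ((c - c') * ((1 - c)⁻¹ * A1) +
      (∑ w ∈ r.toFinset, N.aco (N.off (z :: r) \ S) z r w * N.F x S k (dropTo w r) false +
        ∑ w ∈ r.toFinset, (N.aco (N.off (z :: r)) z r w - N.aco (N.off (z :: r) \ S) z r w) *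
          N.F x S k (dropTo w r) true)) =
      ∑ w ∈ r.toFinset, ((1 - c')⁻¹ * N.aco (N.off (z :: r) \ S) z r w) *
          N.F x S k (dropTo w r) false +
        ∑ w ∈ r.toFinset, ((1 - c)⁻¹ * N.aco (N.off (z :: r)) z r w -
            (1 - c')⁻¹ * N.aco (N.off (z :: r) \ S) z r w) *
          N.F x S k (dropTo w r) true := by
      have e1 : (1 - c')⁻¹ * ((c - c') * (1 - c)⁻¹) = (1 - c)⁻¹ - (1 - c')⁻¹ := by
        field_simp; ring
      have e2 : (1 - c')⁻¹ * ((c - c') * ((1 - c)⁻¹ * A1)) = ((1 - c)⁻¹ - (1 - c')⁻¹) * A1 := by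
        rw [← e1]; ring
      rw [mul_add, e2, mul_add, Finset.mul_sum, Finset.mul_sum, Finset.mul_sum]
      rw [add_left_comm, ← Finset.sum_add_distrib]
      congr 1
      · exact Finset.sum_congr rfl fun w _ => by ring
      · exact Finset.sum_congr rfl fun w _ => by ring
    rw [e]
    refine add_le_add (Finset.sum_le_sum fun w hw => ?_) (Finset.sum_le_sum fun w hw => ?_)
    · rw [hcdef', N.off_sdiff_cons, N.aco_J hst w (Finset.sdiff_subset.trans (N.off_sub r)) hzD']
      refine mul_le_mul_of_nonneg_left (N.F_mono _ _ _ _ _) ?_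
      exact (N.J_pos_mono hcyc _ (Finset.sdiff_subset.trans (N.off_sub r)) z r hzD' hst
        (fun a ha h => (N.mem_off.1 (Finset.mem_sdiff.1 h).1).2 ha) w (by simpa using hw)).1
    · rw [hcdef', N.off_sdiff_cons, N.aco_J hst w (Finset.sdiff_subset.trans (N.off_sub r)) hzD',
        hcdef, N.off_cons, N.aco_J hst w (N.off_sub r) hzD]
      refine mul_le_mul_of_nonneg_left (N.F_mono _ _ _ _ _) (sub_nonneg.2 ?_)
      exact (N.J_pos_mono hcyc _ (N.off_sub r) z r hzD hst
        (fun a ha h => (N.mem_off.1 h).2 ha) w (by simpa using hw)).2 _ Finset.sdiff_subset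

lemma bottom_no (hcyc : N.Cyc) (S : Finset V) (x : V) (hx : x ∈ N.U) (hxS : x ∉ S) (k : ℕ) :
    N.F x S k [x] false ≤ (1 - N.cc (N.off [x]) x)⁻¹ - (1 - N.cc (N.off [x] \ S) x)⁻¹ := by
  have hst : N.Stack [x] := ⟨by simp, by simp, by simpa using hx⟩
  have hS : ∀ a ∈ [x], a ∉ S := by simpa using hxS
  have h := N.step_no hcyc x S k x [] hst hS
    (fun y hy hyS => N.claim_no hcyc x S k y [x] (by simp) hy hyS)
  simp only [List.toFinset_nil, Finset.sum_empty, add_zero] at h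
  have hc := N.cc_lt_one (N.off_sub [x]) hx (fun h => (N.mem_off.1 h).2 (by simp))
  have hm := N.F_mono x S k [x] false
  have hy := N.bottom_yes hcyc S x hx k
  have hc0 := N.cc_nonneg hcyc x [] hst _ (Finset.sdiff_subset (s := N.off [x]) (t := S))
  have hcm := N.cc_mono hcyc x [] hst _ (Finset.sdiff_subset (s := N.off [x]) (t := S))
  set c := N.cc (N.off [x]) x with hcdef
  set c' := N.cc (N.off [x] \ S) x with hcdef'
  have hpos : 0 < 1 - c := by linarith
  have hpos' : 0 < 1 - c' := by linarith
  have e1 : (1 - c)⁻¹ - (1 - c')⁻¹ = (1 - c')⁻¹ * ((c - c') * (1 - c)⁻¹) := by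
    field_simp; ring
  rw [e1, le_inv_mul_iff₀ hpos']
  have := mul_le_mul_of_nonneg_left hy (sub_nonneg.2 hcm)
  have := mul_le_mul_of_nonneg_left hm hc0
  linarith

/-- Weight of the walk from `z` through the list `l`. -/
def wt : V → List V → ℝ
  | _, [] => 1
  | z, y :: l => N.p z y * wt y l

lemma wt_nonneg (l : List V) : ∀ z, 0 ≤ N.wt z l := by
  induction l with
  | nil => intro z; simp [wt]
  | cons y l ih => intro z; rw [wt]; exact mul_nonneg (N.p_nonneg _ _) (ih y)

/-- Popgood continuations. -/
def PG (x : V) (S : Finset V) : List V → List V → Bool → Prop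
  | [], l, f => l = [x] ∧ f = true
  | _ :: _, [], _ => False
  | y :: c, z :: r, f => y ∈ N.U ∧
      if y ∈ z :: r then N.ph (z :: r) y * N.t z y = 1 ∧ PG x S c (dropTo y (z :: r)) f
      else PG x S c (y :: z :: r) (f || decide (y ∈ S))

lemma sum_PG_le (x : V) (S : Finset V) (k : ℕ) : ∀ (z : V) (r : List V) (f : Bool)
    (A : Finset (List V)), (∀ c ∈ A, c.length ≤ k ∧ N.PG x S c (z :: r) f) →
    ∑ c ∈ A, N.wt z c ≤ N.F x S k (z :: r) f := by
  induction k with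
  | zero =>
    intro z r f A hA
    have hsub : A ⊆ {[]} := fun c hc => by
      have := (hA c hc).1; simpa using this
    rcases Finset.subset_singleton_iff.1 hsub with rfl | rfl
    · simpa using N.F_nonneg x S 0 (z :: r) f
    · have := (hA [] (by simp)).2
      simp only [PG] at this
      rw [F, if_pos this]; simp [wt]
  | succ k ih =>
    intro z r f A hA
    rw [F]
    have hsplit : ∑ c ∈ A, N.wt z c = (∑ c ∈ A.filter (fun c => c = []), N.wt z c) +
        ∑ c ∈ A.filter (fun c => ¬ c = []), N.wt z c :=
      (Finset.sum_filter_add_sum_filter_not A _ _).symm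
    rw [hsplit]
    refine add_le_add ?_ ?_
    · by_cases hn : [] ∈ A
      · have hf : A.filter (fun c => c = []) = {[]} := by
          ext c; simp; rintro rfl; exact hn
        have := (hA [] hn).2
        simp only [PG] at this
        rw [hf, if_pos this]; simp [wt]
      · have hf : A.filter (fun c => c = []) = ∅ := by
          ext c; simp; rintro h rfl; exact hn h
        rw [hf, Finset.sum_empty]; split_ifs <;> norm_num
    · let B : V → Finset (List V) := fun y => (A.filter (fun c => c.head? = some y)).image List.tail
      have hB : ∀ y c, c ∈ B y ↔ y :: c ∈ A := by
        intro y c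
        simp only [B, Finset.mem_image, Finset.mem_filter]
        constructor
        · rintro ⟨d, ⟨hd, hh⟩, rfl⟩
          cases d with
          | nil => simp at hh
          | cons a d => simp at hh; subst hh; simpa using hd
        · intro h; exact ⟨y :: c, ⟨h, by simp⟩, by simp⟩
      have hU : ∀ y c, y :: c ∈ A → y ∈ N.U := by
        intro y c h
        have := (hA _ h).2
        simp only [PG] at this
        exact this.1
      have e : ∑ c ∈ A.filter (fun c => ¬ c = []), N.wt z c =
          ∑ y ∈ N.U, N.p z y * ∑ c ∈ B y, N.wt y c := by
        have : A.filter (fun c => ¬ c = []) =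
            (N.U.sigma B).image (fun q => q.1 :: q.2) := by
          ext c
          simp only [Finset.mem_filter, Finset.mem_image, Finset.mem_sigma, hB]
          constructor
          · rintro ⟨h1, h2⟩
            cases c with
            | nil => simp at h2
            | cons a c => exact ⟨⟨a, c⟩, ⟨hU a c h1, h1⟩, rfl⟩
          · rintro ⟨q, ⟨_, h⟩, rfl⟩
            exact ⟨h, by simp⟩
        rw [this, Finset.sum_image, Finset.sum_sigma]
        · refine Finset.sum_congr rfl fun y _ => ?_
          rw [Finset.mul_sum]; rfl
        · rintro ⟨a, c⟩ _ ⟨a', c'⟩ _ h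
          simp at h; simp [h]
      rw [e]
      refine Finset.sum_le_sum fun y hy => mul_le_mul_of_nonneg_left ?_ (N.p_nonneg _ _)
      have hBk : ∀ c ∈ B y, c.length ≤ k := fun c hc => by
        have := (hA _ ((hB y c).1 hc)).1
        simp at this; omega
      have hBP := fun c (hc : c ∈ B y) => (hA _ ((hB y c).1 hc)).2
      simp only [PG] at hBP
      by_cases hmem : y ∈ z :: r
      · rw [if_pos hmem]
        simp only [hmem, if_true] at hBP
        by_cases hph : N.ph (z :: r) y * N.t z y = 1
        · rw [if_pos hph]
          obtain ⟨r', hr'⟩ := dropTo_of_mem hmem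
          rw [hr'] at hBP ⊢
          exact ih y r' f (B y) fun c hc => ⟨hBk c hc, (hBP c hc).2.2⟩
        · rw [if_neg hph]
          have : B y = ∅ := by
            rw [Finset.eq_empty_iff_forall_notMem]
            intro c hc; exact hph (hBP c hc).2.1
          rw [this, Finset.sum_empty]
      · rw [if_neg hmem]
        simp only [hmem, if_false] at hBP
        exact ih y (z :: r) _ (B y) fun c hc => ⟨hBk c hc, (hBP c hc).2⟩

lemma ph_pot (h : V → ℂ) : ∀ (l : List V), l.Nodup → (l.IsChain (fun a b => h b * N.t b a = h a)) →
    ∀ z r, l = z :: r → ∀ w ∈ l, h w * N.ph l w = h z := by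
  intro l
  induction l with
  | nil => intro _ _ z r h; simp at h
  | cons a l ih =>
    intro hnd hch z r he w hw
    obtain ⟨rfl, rfl⟩ := List.cons.inj he
    by_cases haw : a = w
    · subst haw; rw [N.ph_self, mul_one]
    · cases l with
      | nil => simp at hw; exact absurd hw.symm haw
      | cons b l =>
        rw [N.ph_cons a b l w haw]
        have hw' : w ∈ b :: l := by
          rcases List.mem_cons.1 hw with h | h
          · exact absurd h.symm haw
          · exact h
        have := ih (List.nodup_cons.1 hnd).2 (List.isChain_cons_cons.1 hch).2 b l rfl w hw'
        rw [← mul_assoc, this]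
        exact (List.isChain_cons_cons.1 hch).1

/-- Walks along which the connection is a gradient are popgood. -/
lemma PG_of_pot (x : V) (S : Finset V) (h : V → ℂ) (h0 : ∀ v, h v ≠ 0) :
    ∀ (c : List V) (z : V) (r : List V) (f : Bool), (z :: r).Nodup →
      (z :: r).IsChain (fun a b => h b * N.t b a = h a) → (z :: r).getLast? = some x →
      (z :: c).IsChain (fun a b => h a * N.t a b = h b) →
      (∀ y ∈ c, y ∈ N.U) → (z :: c).getLast? = some x →
      (f = true ∨ ∃ y ∈ c, y ∈ S) → (∀ y ∈ z :: r, y ∈ S → f = true) →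
      N.PG x S c (z :: r) f := by
  intro c
  induction c with
  | nil =>
    intro z r f hnd _ hl _ _ hlc hf _
    simp at hlc hf
    subst hlc
    refine ⟨?_, hf⟩
    cases r with
    | nil => rfl
    | cons b r =>
      exfalso
      rw [List.getLast?_cons_cons] at hl
      exact (List.nodup_cons.1 hnd).1 (List.mem_of_getLast? hl)
  | cons y c ih =>
    intro z r f hnd hch hl hcc hU hlc hf hfS
    have hzy := (List.isChain_cons_cons.1 hcc).1
    have hcc' := (List.isChain_cons_cons.1 hcc).2
    rw [PG]
    refine ⟨hU y (by simp), ?_⟩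
    have hU' : ∀ a ∈ c, a ∈ N.U := fun a ha => hU a (by simp [ha])
    rw [List.getLast?_cons_cons] at hlc
    by_cases hy : y ∈ z :: r
    · rw [if_pos hy]
      constructor
      · have h1 := N.ph_pot h (z :: r) hnd hch z r rfl y hy
        have : h y * (N.ph (z :: r) y * N.t z y) = h y * 1 := by
          rw [← mul_assoc, h1, hzy, mul_one]
        exact mul_left_cancel₀ (h0 y) this
      · obtain ⟨r', hr'⟩ := dropTo_of_mem hy
        have hsuf := dropTo_suffix y (z :: r)
        rw [hr'] at hsuf ⊢
        refine ih y r' f (hnd.sublist hsuf.sublist) ?_ ?_ hcc' hU' hlc ?_ ?_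
        · exact hch.suffix hsuf
        · obtain ⟨q, hq⟩ := hsuf
          rw [← hq, List.getLast?_append_of_ne_nil] at hl
          · exact hl
          · simp
        · rcases hf with hf | ⟨a, ha, haS⟩
          · exact Or.inl hf
          · rcases List.mem_cons.1 ha with rfl | ha
            · exact Or.inl (hfS a hy haS)
            · exact Or.inr ⟨a, ha, haS⟩
        · exact fun a ha haS => hfS a (hsuf.subset ha) haS
    · rw [if_neg hy]
      refine ih y (z :: r) _ (List.nodup_cons.2 ⟨hy, hnd⟩)
        (List.isChain_cons_cons.2 ⟨hzy, hch⟩) (by rw [List.getLast?_cons_cons]; exact hl)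
        hcc' hU' hlc ?_ ?_
      · rcases hf with hf | ⟨a, ha, haS⟩
        · simp [hf]
        · rcases List.mem_cons.1 ha with rfl | ha
          · simp [haS]
          · exact Or.inr ⟨a, ha, haS⟩
      · intro a ha haS
        rcases List.mem_cons.1 ha with rfl | ha
        · simp [haS]
        · simp [hfS a ha haS]

/-- Key estimate. -/
theorem key (hcyc : N.Cyc) (x : V) (S : Finset V) (hx : x ∈ N.U) (hxS : x ∉ S)
    (A : Finset (List V))
    (hA : ∀ c ∈ A, (∃ h : V → ℂ, (∀ v, h v ≠ 0) ∧ (x :: c).IsChain (fun a b => h a * N.t a b = h b)) ∧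
      (∀ y ∈ c, y ∈ N.U) ∧ (x :: c).getLast? = some x ∧ ∃ y ∈ c, y ∈ S) :
    ∑ c ∈ A, N.wt x c ≤ (1 - N.cc (N.off [x]) x)⁻¹ - (1 - N.cc (N.off [x] \ S) x)⁻¹ := by
  refine le_trans ?_ (N.bottom_no hcyc S x hx hxS (A.sup List.length))
  refine N.sum_PG_le x S _ x [] false A fun c hc => ⟨Finset.le_sup (f := List.length) hc, ?_⟩
  obtain ⟨⟨h, h0, hch⟩, hU, hl, hS⟩ := hA c hc
  exact N.PG_of_pot x S h h0 c x [] false (by simp) (by simp) (by simp) hch hU hl (Or.inr hS)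
    (by simpa using hxS)

/-- Key estimate for a single target, in terms of a kernel. -/
theorem key_single (hcyc : N.Cyc) (x s : V) (hx : x ∈ N.U) (hs : s ∈ N.U) (hxs : x ≠ s)
    (hp : N.p x s = 0)
    (hcx : ∑ y ∈ N.U, N.p x y * N.psi y ≤ N.psi x / 2)
    (hcs : ∑ y ∈ N.U, N.p s y * N.psi y ≤ N.psi s / 2)
    (A : Finset (List V))
    (hA : ∀ c ∈ A, (∃ h : V → ℂ, (∀ v, h v ≠ 0) ∧ (x :: c).IsChain (fun a b => h a * N.t a b = h b)) ∧
      (∀ y ∈ c, y ∈ N.U) ∧ (x :: c).getLast? = some x ∧ s ∈ c) :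
    ∑ c ∈ A, N.wt x c ≤ 8 * ‖∑ y ∈ N.off [x, s], N.P x y * N.K (N.off [x, s]) y s‖ ^ 2 := by
  have h1 := N.key hcyc x {s} hx (by simpa using hxs) A (fun c hc => by
    obtain ⟨a, b, d, e⟩ := hA c hc
    exact ⟨a, b, d, s, e, by simp⟩)
  refine h1.trans ?_
  set D := N.off [x, s] with hD
  have hDU : D ⊆ N.U := N.off_sub _
  have hxD : x ∉ D := fun h => (N.mem_off.1 h).2 (by simp)
  have hsD : s ∉ D := fun h => (N.mem_off.1 h).2 (by simp)
  set E := N.off [x] with hE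
  have hEU : E ⊆ N.U := N.off_sub _
  have hsE : s ∈ E := N.mem_off.2 ⟨hs, by simpa using hxs.symm⟩
  have hxE : x ∉ E := fun h => (N.mem_off.1 h).2 (by simp)
  have e1 : E \ {s} = D := by
    ext a; simp [hE, hD, off]; tauto
  have e2 : E.erase s = D := by
    ext a; simp [hE, hD, off]; tauto
  rw [e1]
  have half : ∀ (G : Finset V) (v : V), G ⊆ N.U → v ∈ N.U → v ∉ G →
      ∑ y ∈ N.U, N.p v y * N.psi y ≤ N.psi v / 2 → N.cc G v ≤ 1 / 2 := by
    intro G v hG hv hvG hh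
    refine (N.cc_le hG hv hvG).trans ?_
    rw [div_le_iff₀ (N.psi_pos v hv)]
    have : ∑ y ∈ G, N.p v y * N.psi y ≤ ∑ y ∈ N.U, N.p v y * N.psi y :=
      Finset.sum_le_sum_of_subset_of_nonneg hG
        (fun y hy _ => mul_nonneg (N.p_nonneg _ _) (N.psi_pos y hy).le)
    linarith
  have hc1 := half E x hEU hx hxE hcx
  have hc2 := half D x hDU hx hxD hcx
  have hc3 := half D s hDU hs hsD hcs
  set b := ∑ y ∈ D, N.P x y * N.K D y s with hb
  -- the difference of the return masses
  have hPxs : N.P x s = 0 := by simp [P, hp]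
  have hPsx : N.P s x = 0 := by simp [P, N.p_symm s x, hp]
  have hdiff : N.ccC E x = N.ccC D x + N.K E s x * b := by
    rw [ccC, ← Finset.add_sum_erase _ _ hsE, hPxs, zero_mul, zero_add, e2, ccC, hb, Finset.mul_sum,
      ← Finset.sum_add_distrib]
    refine Finset.sum_congr rfl fun y hy => ?_
    have := N.K_split hEU hsE x y (by rw [e2]; exact hy)
    rw [this, e2]; ring
  have hK : N.K E s x = ((1 - N.cc D s)⁻¹ : ℝ) * (starRingEnd ℂ) b := by
    rw [N.K_rec hEU hsE, e2, hPsx, zero_add]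
    congr 1
    have := N.sol_pairing hDU (fun y => N.P y s) (fun y => N.P y x)
    change ∑ y ∈ D, N.P y s * (starRingEnd ℂ) (N.K D y x) =
      ∑ y ∈ D, N.K D y s * (starRingEnd ℂ) (N.P y x) at this
    have t1 : ∑ y ∈ D, N.K D y s * (starRingEnd ℂ) (N.P y x) = b := by
      rw [hb]; refine Finset.sum_congr rfl fun y _ => ?_
      rw [← N.P_symm, mul_comm]
    rw [t1] at this
    rw [← this, map_sum]
    refine Finset.sum_congr rfl fun y _ => ?_
    rw [map_mul, ← N.P_symm, Complex.conj_conj]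
  have hreal : N.cc E x = N.cc D x + (1 - N.cc D s)⁻¹ * ‖b‖ ^ 2 := by
    have := congrArg Complex.re hdiff
    rw [Complex.add_re, hK, mul_assoc, Complex.re_ofReal_mul, mul_comm _ b, Complex.mul_conj] at this
    rw [Complex.ofReal_re, Complex.normSq_eq_norm_sq] at this
    exact this
  have hg : (1 - N.cc D s)⁻¹ ≤ 2 := by
    rw [show (2 : ℝ) = (1 / 2)⁻¹ by norm_num]
    apply inv_anti₀ <;> linarith
  have p1 : 0 < 1 - N.cc E x := by linarith
  have p2 : 0 < 1 - N.cc D x := by linarith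
  have e3 : (1 - N.cc E x)⁻¹ - (1 - N.cc D x)⁻¹ =
      (1 - N.cc E x)⁻¹ * ((1 - N.cc D x)⁻¹ * (N.cc E x - N.cc D x)) := by
    field_simp; ring
  have g1 : (1 - N.cc E x)⁻¹ ≤ 2 := by
    rw [show (2 : ℝ) = (1 / 2)⁻¹ by norm_num]
    apply inv_anti₀ <;> linarith
  have g2 : (1 - N.cc D x)⁻¹ ≤ 2 := by
    rw [show (2 : ℝ) = (1 / 2)⁻¹ by norm_num]
    apply inv_anti₀ <;> linarith
  have hd : N.cc E x - N.cc D x = (1 - N.cc D s)⁻¹ * ‖b‖ ^ 2 := by rw [hreal]; ring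
  have p3 : 0 ≤ (1 - N.cc D s)⁻¹ := inv_nonneg.2 (by linarith)
  rw [e3, hd]
  calc _ ≤ 2 * (2 * (2 * ‖b‖ ^ 2)) := by gcongr
    _ = _ := by ring

end Net

/-! ### Part C: planar topology on the lattice -/

lemma adj_iff (u v : Lat) : Adj u v ↔ v = (u.1 + 1, u.2) ∨ v = (u.1, u.2 + 1) ∨
    v = (u.1 - 1, u.2) ∨ v = (u.1, u.2 - 1) := by
  obtain ⟨a, b⟩ := u
  obtain ⟨c, d⟩ := v
  simp only [Adj, Prod.mk.injEq]
  constructor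
  · intro h
    have h1 : (a - c) ^ 2 ≤ 1 := by nlinarith [sq_nonneg (b - d)]
    have h2 : (b - d) ^ 2 ≤ 1 := by nlinarith [sq_nonneg (a - c)]
    have h3 : -1 ≤ a - c ∧ a - c ≤ 1 := by constructor <;> nlinarith
    have h4 : -1 ≤ b - d ∧ b - d ≤ 1 := by constructor <;> nlinarith
    obtain ⟨e, he⟩ : ∃ e, e = a - c := ⟨_, rfl⟩
    obtain ⟨f, hf⟩ : ∃ f, f = b - d := ⟨_, rfl⟩
    rw [← he, ← hf] at h
    rw [← he] at h3
    rw [← hf] at h4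
    obtain ⟨h31, h32⟩ := h3
    obtain ⟨h41, h42⟩ := h4
    interval_cases e <;> interval_cases f <;> simp at h <;> omega
  · rintro (⟨h1, h2⟩ | ⟨h1, h2⟩ | ⟨h1, h2⟩ | ⟨h1, h2⟩) <;> subst h1 <;> subst h2 <;> ring_nf

lemma adj_symm {u v : Lat} (h : Adj u v) : Adj v u := by
  unfold Adj at *; nlinarith

lemma adj_ne {u v : Lat} (h : Adj u v) : u ≠ v := by
  rintro rfl; simp [Adj] at h

/-- Signed crossing by the step `(u,v)` of the zipper going right from the face `f`. -/
def cr (f u v : Lat) : ℤ :=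
  if u.1 = v.1 ∧ f.1 < u.1 then (if f.2 < v.2 then 1 else 0) - (if f.2 < u.2 then 1 else 0) else 0

lemma cr_symm (f u v : Lat) : cr f v u = - cr f u v := by
  unfold cr
  by_cases h : u.1 = v.1 ∧ f.1 < u.1
  · have h' : v.1 = u.1 ∧ f.1 < v.1 := ⟨h.1.symm, h.1 ▸ h.2⟩
    rw [if_pos h, if_pos h']; ring
  · have h' : ¬ (v.1 = u.1 ∧ f.1 < v.1) := fun k => h ⟨k.1.symm, k.1 ▸ k.2⟩
    rw [if_neg h, if_neg h']; ring

/-- Indicator of a step. -/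
def ind (a b u v : Lat) : ℤ := (if u = a ∧ v = b then 1 else 0) - (if u = b ∧ v = a then 1 else 0)

lemma cr_right (i j : ℤ) (u v : Lat) (h : Adj u v) :
    cr (i - 1, j) u v - cr (i, j) u v = ind (i, j) (i, j + 1) u v := by
  obtain ⟨a, b⟩ := u
  rcases (adj_iff _ _).1 h with rfl | rfl | rfl | rfl <;>
  · simp only [cr, ind, Prod.mk.injEq]
    grind

/-- Potential for a vertical move of the face. -/
def vpot (i j : ℤ) (v : Lat) : ℤ := if i < v.1 ∧ v.2 = j then 1 else 0

lemma cr_up (i j : ℤ) (u v : Lat) (h : Adj u v) :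
    cr (i, j) u v - cr (i, j - 1) u v =
      ind (i, j) (i + 1, j) u v - (vpot i j v - vpot i j u) := by
  obtain ⟨a, b⟩ := u
  rcases (adj_iff _ _).1 h with rfl | rfl | rfl | rfl <;>
  · simp only [cr, ind, vpot, Prod.mk.injEq]
    grind

/-! #### Simple cycles -/

/-- Left face of a step. -/
def leftF (u v : Lat) : Lat :=
  if v = (u.1 + 1, u.2) then u else if v = (u.1, u.2 + 1) then (u.1 - 1, u.2)
  else if v = (u.1 - 1, u.2) then (u.1 - 1, u.2 - 1) else (u.1, u.2 - 1)

/-- A periodic simple lattice cycle. -/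
structure SCyc where
  c : ℕ → Lat
  n : ℕ
  hn : 3 ≤ n
  inj : ∀ a b, c a = c b ↔ a ≡ b [MOD n]
  adj : ∀ k, Adj (c k) (c (k + 1))

namespace SCyc

variable (s : SCyc)

/-- Winding around the face `f`. -/
def W (f : Lat) : ℤ := ∑ k ∈ Finset.range s.n, cr f (s.c k) (s.c (k + 1))

/-- Net flow. -/
def fl (a b : Lat) : ℤ := ∑ k ∈ Finset.range s.n, ind a b (s.c k) (s.c (k + 1))

lemma per (k : ℕ) : s.c (k + s.n) = s.c k := (s.inj _ _).2 (by simp [Nat.ModEq])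

lemma fl_symm (a b : Lat) : s.fl b a = - s.fl a b := by
  rw [fl, fl, ← Finset.sum_neg_distrib]
  refine Finset.sum_congr rfl fun k _ => ?_
  unfold ind; ring

lemma W_right (i j : ℤ) : s.W (i - 1, j) - s.W (i, j) = s.fl (i, j) (i, j + 1) := by
  rw [W, W, fl, ← Finset.sum_sub_distrib]
  exact Finset.sum_congr rfl fun k _ => cr_right i j _ _ (s.adj k)

lemma W_up (i j : ℤ) : s.W (i, j) - s.W (i, j - 1) = s.fl (i, j) (i + 1, j) := by
  rw [W, W, fl, ← Finset.sum_sub_distrib]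
  have : ∑ k ∈ Finset.range s.n, (vpot i j (s.c (k + 1)) - vpot i j (s.c k)) = 0 := by
    rw [Finset.sum_range_sub (fun k => vpot i j (s.c k))]
    have := s.per 0
    rw [zero_add] at this
    rw [this]; ring
  rw [← sub_zero (∑ k ∈ Finset.range s.n, ind _ _ _ _), ← this, ← Finset.sum_sub_distrib]
  exact Finset.sum_congr rfl fun k _ => cr_up i j _ _ (s.adj k)

lemma fl_vertex (k : ℕ) (z : Lat) :
    s.fl (s.c (k + 1)) z = (if s.c (k + 2) = z then 1 else 0) - (if s.c k = z then 1 else 0) := by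
  have hn : 0 < s.n := by have := s.hn; omega
  rw [fl]
  unfold ind
  rw [Finset.sum_sub_distrib]
  congr 1
  · rw [Finset.sum_eq_single ((k + 1) % s.n)]
    · have h1 : s.c ((k + 1) % s.n) = s.c (k + 1) := (s.inj _ _).2 (Nat.mod_modEq _ _)
      have h2 : s.c ((k + 1) % s.n + 1) = s.c (k + 2) :=
        (s.inj _ _).2 ((Nat.mod_modEq (k + 1) s.n).add_right 1)
      rw [h1, h2]; simp
    · intro m hm hne
      rw [if_neg]
      rintro ⟨h, -⟩
      have := (s.inj _ _).1 h
      rw [Nat.ModEq, Nat.mod_eq_of_lt (Finset.mem_range.1 hm)] at this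
      exact hne this
    · intro h; exact absurd (Finset.mem_range.2 (Nat.mod_lt _ hn)) h
  · rw [Finset.sum_eq_single (k % s.n)]
    · have h1 : s.c (k % s.n) = s.c k := (s.inj _ _).2 (Nat.mod_modEq _ _)
      have h2 : s.c (k % s.n + 1) = s.c (k + 1) :=
        (s.inj _ _).2 ((Nat.mod_modEq k s.n).add_right 1)
      rw [h1, h2]; simp
    · intro m hm hne
      rw [if_neg]
      rintro ⟨-, h⟩
      have := Nat.ModEq.add_right_cancel' 1 ((s.inj _ _).1 h)
      rw [Nat.ModEq, Nat.mod_eq_of_lt (Finset.mem_range.1 hm)] at this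
      exact hne this
    · intro h; exact absurd (Finset.mem_range.2 (Nat.mod_lt _ hn)) h

lemma ne2 (k : ℕ) : s.c k ≠ s.c (k + 2) := by
  intro h
  have := (s.inj _ _).1 h
  have h2 := s.hn
  have h3 : s.n ∣ (k + 2) - k := (Nat.modEq_iff_dvd' (by omega)).1 this
  have := Nat.le_of_dvd (by omega) h3
  omega

lemma left_const (k : ℕ) :
    s.W (leftF (s.c k) (s.c (k + 1))) = s.W (leftF (s.c (k + 1)) (s.c (k + 2))) := by
  have hne := s.ne2 k
  have hu := (adj_iff _ _).1 (adj_symm (s.adj k))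
  have hw := (adj_iff _ _).1 (s.adj (k + 1))
  have hv := s.fl_vertex k
  set u := s.c k
  set v := s.c (k + 1)
  set w := s.c (k + 2)
  clear_value u v w
  obtain ⟨x, y⟩ := v
  have r1 := s.W_right x y
  have r2 := s.W_up x y
  have r3 := s.W_right x (y - 1)
  have r4 := s.W_up (x - 1) y
  have n1 := hv (x, y + 1)
  have n2 := hv (x + 1, y)
  have n3 := hv (x, y - 1)
  have n4 := hv (x - 1, y)
  rw [s.fl_symm, sub_add_cancel] at r3
  rw [s.fl_symm, sub_add_cancel] at r4
  rw [n1] at r1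
  rw [n2] at r2
  rw [n3] at r3
  rw [n4] at r4
  rcases hu with rfl | rfl | rfl | rfl <;> rcases hw with rfl | rfl | rfl | rfl <;>
    first
    | (exfalso; exact hne rfl)
    | (simp only [leftF, Prod.mk.injEq] at *
       norm_num at r1 r2 r3 r4 ⊢
       done)
    | (simp only [leftF, Prod.mk.injEq] at *
       norm_num at r1 r2 r3 r4 ⊢
       first | omega | (split_ifs <;> omega))

lemma left_all (k : ℕ) : s.W (leftF (s.c k) (s.c (k + 1))) = s.W (leftF (s.c 0) (s.c 1)) := by
  induction k with
  | zero => rfl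
  | succ k ih => rw [← s.left_const k, ih]

lemma W_far : ∃ M : ℤ, ∀ i, M ≤ i → s.W (i, 0) = 0 := by
  refine ⟨∑ k ∈ Finset.range s.n, |(s.c k).1|, fun i hi => ?_⟩
  refine Finset.sum_eq_zero fun k hk => ?_
  unfold cr
  rw [if_neg]
  rintro ⟨-, h⟩
  have h1 := Finset.single_le_sum (f := fun k => |(s.c k).1|) (fun i _ => abs_nonneg _) hk
  have h2 := le_abs_self (s.c k).1
  simp only at h h1
  omega

lemma fl_val (x y : Lat) : s.fl x y = 0 ∨ (∃ k, s.c k = x ∧ s.c (k + 1) = y ∧ s.fl x y = 1) ∨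
    (∃ k, s.c k = y ∧ s.c (k + 1) = x ∧ s.fl x y = -1) := by
  by_cases h : s.fl x y = 0
  · exact Or.inl h
  right
  obtain ⟨k, hk, hne⟩ := Finset.exists_ne_zero_of_sum_ne_zero h
  have hk' : (s.c k = x ∧ s.c (k + 1) = y) ∨ (s.c k = y ∧ s.c (k + 1) = x) := by
    by_contra hc
    push Not at hc
    apply hne
    unfold ind
    rw [if_neg (fun h => hc.1 h.1 h.2), if_neg (fun h => hc.2 h.1 h.2)]; rfl
  rcases hk' with ⟨h1, h2⟩ | ⟨h1, h2⟩
  · left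
    refine ⟨k, h1, h2, ?_⟩
    have := s.fl_vertex k x
    rw [h2, h1, if_pos rfl, if_neg, s.fl_symm] at this
    · omega
    · intro h3; exact s.ne2 k (h1.trans h3.symm)
  · right
    refine ⟨k, h1, h2, ?_⟩
    have := s.fl_vertex k y
    rw [h2, h1, if_pos rfl, if_neg] at this
    · omega
    · intro h3; exact s.ne2 k (h1.trans h3.symm)

/-- A simple cycle winds at most once around the origin face. -/
lemma W_le_one : |s.W (0, 0)| ≤ 1 := by
  obtain ⟨M, hM⟩ := s.W_far
  set a := s.W (leftF (s.c 0) (s.c 1)) with ha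
  have key : ∀ m : ℕ, ∀ i : ℤ, M ≤ i + m →
      s.W (i, 0) = 0 ∨ ((s.W (i, 0) = a ∨ s.W (i, 0) = a - 1) ∧ (a = 0 ∨ a = 1)) := by
    intro m
    induction m with
    | zero => intro i hi; left; exact hM i (by simpa using hi)
    | succ m ih =>
      intro i hi
      have ih' := ih (i + 1) (by push_cast at hi; linarith)
      have hr := s.W_right (i + 1) 0
      rw [add_sub_cancel_right] at hr
      rcases s.fl_val (i + 1, 0) (i + 1, 0 + 1) with h | ⟨k, h1, h2, h⟩ | ⟨k, h1, h2, h⟩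
      · have : s.W (i, 0) = s.W (i + 1, 0) := by omega
        rw [this]; exact ih'
      · have hl := s.left_all k
        rw [← ha, h1, h2] at hl
        have : leftF (i + 1, 0) (i + 1, 0 + 1) = (i, 0) := by simp [leftF]
        rw [this] at hl
        omega
      · have hl := s.left_all k
        rw [← ha, h1, h2] at hl
        have : leftF (i + 1, 0 + 1) (i + 1, 0) = (i + 1, 0) := by simp [leftF]
        rw [this] at hl
        omega
  have := key (M.toNat) 0 (by have := Int.self_le_toNat M; omega)
  rw [abs_le]
  omega

end SCyc

/-- Sum of crossings along a list. -/
def crL (f : Lat) : List Lat → ℤ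
  | [] => 0
  | [_] => 0
  | a :: b :: l => cr f a b + crL f (b :: l)

lemma crL_append (f : Lat) (l m : List Lat) (a : Lat) :
    crL f (l ++ a :: m) = crL f (l ++ [a]) + crL f (a :: m) := by
  induction l with
  | nil => simp [crL]
  | cons b l ih =>
    cases l with
    | nil => simp [crL]
    | cons c l =>
      simp only [List.cons_append, crL] at ih ⊢
      rw [ih]; ring

lemma crL_eq_sum (f : Lat) (c : ℕ → Lat) (n : ℕ) :
    crL f ((List.range (n + 1)).map c) = ∑ k ∈ Finset.range n, cr f (c k) (c (k + 1)) := by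
  induction n generalizing c with
  | zero => rfl
  | succ n ih =>
    rw [Finset.sum_range_succ', List.range_succ_eq_map, List.map_cons, List.map_map,
      List.range_succ_eq_map, List.map_cons, List.map_map, crL]
    have := ih (c ∘ Nat.succ)
    rw [List.range_succ_eq_map, List.map_cons, List.map_map] at this
    rw [this]
    simp [add_comm]

/-- A simple closed lattice list winds at most once around the origin face. -/
lemma crL_simple (z : Lat) (l : List Lat) (hnd : (z :: l).Nodup)
    (hch : (z :: l ++ [z]).IsChain Adj) (hlen : 2 ≤ l.length) :
    |crL (0, 0) (z :: l ++ [z])| ≤ 1 := by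
  set n := l.length + 1 with hn
  have hln : (z :: l).length = n := by simp [hn]
  have hmod : ∀ k, k % n < (z :: l).length := fun k => by
    rw [hln]; exact Nat.mod_lt _ (by omega)
  let c : ℕ → Lat := fun k => (z :: l)[k % n]'(hmod k)
  have hmap : (List.range (n + 1)).map c = z :: l ++ [z] := by
    apply List.ext_getElem
    · simp [hn]
    · intro i h1 h2
      simp only [List.length_map, List.length_range] at h1
      rw [List.getElem_map, List.getElem_range]
      by_cases hi : i < n
      · rw [List.getElem_append_left (by rw [hln]; exact hi)]
        simp only [c, Nat.mod_eq_of_lt hi]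
      · have : i = n := by omega
        subst this
        rw [List.getElem_append_right (by rw [hln])]
        simp [c]
  let s : SCyc :=
    { c := c
      n := n
      hn := by omega
      inj := by
        intro a b
        simp only [c]
        rw [hnd.getElem_inj_iff]
        rfl
      adj := by
        intro k
        have hk : k % n < n := Nat.mod_lt _ (by omega)
        have h := hch
        rw [← hmap, List.isChain_iff_getElem] at h
        have := h (k % n) (by simp; omega)
        simp only [List.getElem_map, List.getElem_range] at this
        simpa [c, Nat.mod_mod, Nat.add_mod] using this }
  have := s.W_le_one
  rw [← hmap, crL_eq_sum]
  exact this

/-! ### Faces, dual chains, potentials -/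

/-- The edge `a b` separates the faces `f` and `g`. -/
def Dual (f g a b : Lat) : Prop :=
  (f = (a.1 - 1, a.2) ∧ g = a ∧ b = (a.1, a.2 + 1)) ∨
  (g = (a.1 - 1, a.2) ∧ f = a ∧ b = (a.1, a.2 + 1)) ∨
  (f = (a.1, a.2 - 1) ∧ g = a ∧ b = (a.1 + 1, a.2)) ∨
  (g = (a.1, a.2 - 1) ∧ f = a ∧ b = (a.1 + 1, a.2))

/-- Dual step avoiding the edges `E`. -/
def FStep (E : Lat → Lat → Prop) (f g : Lat) : Prop :=
  ∃ a b, Dual f g a b ∧ ¬ E a b ∧ ¬ E b a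

lemma Dual.symm {f g a b : Lat} (h : Dual f g a b) : Dual g f a b := by
  unfold Dual at *; tauto

lemma FStep.symm {E : Lat → Lat → Prop} {f g : Lat} (h : FStep E f g) : FStep E g f := by
  obtain ⟨a, b, h1, h2⟩ := h
  exact ⟨a, b, h1.symm, h2⟩

/-- The face `f` lies in the box of radius `s`. -/
def inF (s : ℤ) (f : Lat) : Prop := -s ≤ f.1 ∧ f.1 + 1 ≤ s ∧ -s ≤ f.2 ∧ f.2 + 1 ≤ s

/-- Non-disconnection, discrete version. -/
def NN (s R : ℤ) (E : Lat → Lat → Prop) : Prop :=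
  ∃ f g, inF s f ∧ ¬ inF R g ∧ Relation.ReflTransGen (FStep E) f g

/-- `Φ` is a potential on `E` for the difference of zippers. -/
def Pot (E : Lat → Lat → Prop) (F : Lat → Lat → ℤ) : Prop :=
  ∃ Φ : Lat → ℤ, ∀ u v, Adj u v → E u v → F u v = Φ v - Φ u

lemma Pot.add {E F G} (h1 : Pot E F) (h2 : Pot E G) : Pot E (fun u v => F u v + G u v) := by
  obtain ⟨Φ, hΦ⟩ := h1
  obtain ⟨Ψ, hΨ⟩ := h2
  exact ⟨fun v => Φ v + Ψ v, fun u v h h' => by beta_reduce; rw [hΦ u v h h', hΨ u v h h']; ring⟩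

lemma Pot.neg {E F} (h1 : Pot E F) : Pot E (fun u v => - F u v) := by
  obtain ⟨Φ, hΦ⟩ := h1
  exact ⟨fun v => - Φ v, fun u v h h' => by beta_reduce; rw [hΦ u v h h']; ring⟩

lemma ind_zero {E : Lat → Lat → Prop} {a b u v : Lat} (h1 : ¬ E a b) (h2 : ¬ E b a)
    (h : E u v) : ind a b u v = 0 := by
  unfold ind
  rw [if_neg, if_neg]; · rfl
  · rintro ⟨rfl, rfl⟩; exact h2 h
  · rintro ⟨rfl, rfl⟩; exact h1 h

lemma pot_step {E : Lat → Lat → Prop} {f g : Lat} (h : FStep E f g) :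
    Pot E (fun u v => cr f u v - cr g u v) := by
  obtain ⟨⟨i, j⟩, b, hd, h1, h2⟩ := h
  rcases hd with ⟨rfl, rfl, rfl⟩ | ⟨rfl, rfl, rfl⟩ | ⟨rfl, rfl, rfl⟩ | ⟨rfl, rfl, rfl⟩
  · refine ⟨fun _ => 0, fun u v ha he => ?_⟩
    have := cr_right i j u v ha
    rw [ind_zero h1 h2 he] at this
    simp only at *
    linarith
  · refine ⟨fun _ => 0, fun u v ha he => ?_⟩
    have := cr_right i j u v ha
    rw [ind_zero h1 h2 he] at this
    simp only at *
    linarith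
  · refine ⟨fun v => vpot i j v, fun u v ha he => ?_⟩
    have := cr_up i j u v ha
    rw [ind_zero h1 h2 he] at this
    simp only at *
    linarith
  · refine ⟨fun v => - vpot i j v, fun u v ha he => ?_⟩
    have := cr_up i j u v ha
    rw [ind_zero h1 h2 he] at this
    simp only at *
    linarith

lemma pot_chain {E : Lat → Lat → Prop} {f g : Lat} (h : Relation.ReflTransGen (FStep E) f g) :
    Pot E (fun u v => cr f u v - cr g u v) := by
  induction h with
  | refl => exact ⟨fun _ => 0, fun u v _ _ => by simp⟩
  | tail _ h ih =>
    obtain ⟨Φ, hΦ⟩ := ih.add (pot_step h)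
    exact ⟨Φ, fun u v ha he => by rw [← hΦ u v ha he]; ring⟩

lemma linf_le {R : ℤ} {u : Lat} : linf u ≤ R ↔ (-R ≤ u.1 ∧ u.1 ≤ R) ∧ (-R ≤ u.2 ∧ u.2 ≤ R) := by
  rw [linf, max_le_iff, abs_le, abs_le]

lemma pot_out {E : Lat → Lat → Prop} {R : ℤ} {g : Lat} (hg : ¬ inF R g)
    (hE : ∀ u v, E u v → linf u ≤ R ∧ linf v ≤ R) : Pot E (fun u v => cr g u v) := by
  refine ⟨fun v => if g.1 < -R then (if g.2 < v.2 then 1 else 0) else 0, fun u v ha he => ?_⟩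
  obtain ⟨h1, h2⟩ := hE u v he
  rw [linf_le] at h1 h2
  unfold inF at hg
  obtain ⟨i, j⟩ := g
  obtain ⟨a, b⟩ := u
  simp only at hg h1
  rcases (adj_iff _ _).1 ha with rfl | rfl | rfl | rfl <;>
  · simp only [cr] at *
    grind

lemma in_conn {E : Lat → Lat → Prop} {s : ℤ} (hs : 1 ≤ s) {f : Lat} (hf : inF s f)
    (hE : ∀ u v, E u v → s ≤ linf u ∧ s ≤ linf v) :
    Relation.ReflTransGen (FStep E) f (0, 0) := by
  have hst : ∀ a b : Lat, linf a < s ∨ linf b < s → ¬ E a b ∧ ¬ E b a := by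
    intro a b h
    constructor <;> intro he <;> have := hE _ _ he <;> omega
  have hlt : ∀ a : Lat, linf a < s ↔ (-s < a.1 ∧ a.1 < s) ∧ (-s < a.2 ∧ a.2 < s) := by
    intro a; rw [linf, max_lt_iff, abs_lt, abs_lt]
  have hR : ∀ i j, inF s (i - 1, j) → inF s (i, j) → FStep E (i - 1, j) (i, j) := by
    intro i j h1 h2
    refine ⟨(i, j), (i, j + 1), Or.inl ⟨rfl, rfl, rfl⟩, hst _ _ ?_⟩
    rw [hlt, hlt]; unfold inF at *; simp only at *; omega
  have hU : ∀ i j, inF s (i, j - 1) → inF s (i, j) → FStep E (i, j - 1) (i, j) := by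
    intro i j h1 h2
    refine ⟨(i, j), (i + 1, j), Or.inr (Or.inr (Or.inl ⟨rfl, rfl, rfl⟩)), hst _ _ ?_⟩
    rw [hlt, hlt]; unfold inF at *; simp only at *; omega
  have key : ∀ n : ℕ, ∀ i j : ℤ, inF s (i, j) → i.natAbs + j.natAbs = n →
      Relation.ReflTransGen (FStep E) (i, j) (0, 0) := by
    intro n
    induction n with
    | zero =>
      intro i j _ h
      have : i = 0 := by omega
      have : j = 0 := by omega
      subst_vars; exact Relation.ReflTransGen.refl
    | succ n ih =>
      intro i j hin h
      rcases lt_trichotomy i 0 with hi | hi | hi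
      · have h' : inF s (i + 1, j) := by unfold inF at *; simp only at *; omega
        refine Relation.ReflTransGen.head ?_ (ih (i + 1) j h' (by omega))
        have := hR (i + 1) j (by simpa using hin) h'
        simpa using this
      · rcases lt_trichotomy j 0 with hj | hj | hj
        · have h' : inF s (i, j + 1) := by unfold inF at *; simp only at *; omega
          refine Relation.ReflTransGen.head ?_ (ih i (j + 1) h' (by omega))
          have := hU i (j + 1) (by simpa using hin) h'
          simpa using this
        · omega
        · have h' : inF s (i, j - 1) := by unfold inF at *; simp only at *; omega
          exact Relation.ReflTransGen.head (hU i j h' hin).symm (ih i (j - 1) h' (by omega))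
      · have h' : inF s (i - 1, j) := by unfold inF at *; simp only at *; omega
        exact Relation.ReflTransGen.head (hR i j h' hin).symm (ih (i - 1) j h' (by omega))
  exact key _ f.1 f.2 hf rfl

/-- A non-disconnecting family of edges carries a potential for the zipper. -/
lemma NN.pot {E : Lat → Lat → Prop} {s R : ℤ} (hs : 1 ≤ s) (h : NN s R E)
    (hE : ∀ u v, E u v → (s ≤ linf u ∧ linf u ≤ R) ∧ (s ≤ linf v ∧ linf v ≤ R)) :
    Pot E (fun u v => cr (0, 0) u v) := by
  obtain ⟨f, g, hf, hg, hc⟩ := h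
  obtain ⟨Φ, hΦ⟩ := ((pot_chain (in_conn hs hf
    (fun u v h => ⟨(hE u v h).1.1, (hE u v h).2.1⟩))).neg.add (pot_chain hc)).add
      (pot_out hg (fun u v h => ⟨(hE u v h).1.2, (hE u v h).2.2⟩))
  exact ⟨Φ, fun u v ha he => by rw [← hΦ u v ha he]; ring⟩

lemma NN.mono {E E' : Lat → Lat → Prop} {s R s' R' : ℤ} (h : NN s R E) (hE : ∀ u v, E' u v → E u v)
    (hs : s ≤ s') (hR : R' ≤ R) : NN s' R' E' := by
  obtain ⟨f, g, hf, hg, hc⟩ := h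
  refine ⟨f, g, ?_, ?_, Relation.ReflTransGen.mono ?_ _ _ hc⟩
  · unfold inF at *; omega
  · intro h; apply hg; unfold inF at *; omega
  · rintro a b ⟨x, y, h1, h2, h3⟩
    exact ⟨x, y, h1, fun h => h2 (hE _ _ h), fun h => h3 (hE _ _ h)⟩

/-- Dual steps crossing a ring edge go in or out of the corresponding box. -/
lemma dual_ring {s : ℤ} {f g a b : Lat} (h : Dual f g a b) (ha : linf a = s) (hb : linf b = s) :
    (inF s f ∧ ¬ inF s g) ∨ (¬ inF s f ∧ inF s g) := by
  have h1 := (linf_le (u := a)).1 ha.le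
  have h2 := (linf_le (u := b)).1 hb.le
  have h3 := mt (linf_le (R := s - 1) (u := a)).2 (by omega)
  have h4 := mt (linf_le (R := s - 1) (u := b)).2 (by omega)
  unfold inF
  obtain ⟨x, y⟩ := a
  rcases h with ⟨rfl, rfl, rfl⟩ | ⟨rfl, rfl, rfl⟩ | ⟨rfl, rfl, rfl⟩ | ⟨rfl, rfl, rfl⟩ <;>
    simp only at * <;> omega

lemma dual_near {s : ℤ} {f g a b : Lat} (h : Dual f g a b) (hf : inF s f) : inF (s + 1) g := by
  unfold inF at *
  obtain ⟨x, y⟩ := a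
  rcases h with ⟨rfl, rfl, rfl⟩ | ⟨rfl, rfl, rfl⟩ | ⟨rfl, rfl, rfl⟩ | ⟨rfl, rfl, rfl⟩ <;>
    simp only at * <;> omega

/-- Extraction of a crossing segment: the chain only crosses one edge of each ring. -/
lemma NN.seg {E : Lat → Lat → Prop} {s R : ℤ} (hsR : s < R) (h : NN s R E) :
    ∃ a b a' b' : Lat, ∀ Q : Lat → Lat → Prop,
      (∀ u v, Q u v → (linf u = s ∧ linf v = s ∧ (u, v) ≠ (a, b) ∧ (u, v) ≠ (b, a)) ∨
        (linf u = R ∧ linf v = R ∧ (u, v) ≠ (a', b') ∧ (u, v) ≠ (b', a'))) →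
      NN s R (fun u v => E u v ∨ Q u v) := by
  obtain ⟨f, g, hf, hg, hc⟩ := h
  -- last exit
  have step1 : ∃ f0 f1 a b, inF s f0 ∧ ¬ inF s f1 ∧ Dual f0 f1 a b ∧ (¬ E a b ∧ ¬ E b a) ∧
      Relation.ReflTransGen (fun f g => FStep E f g ∧ ¬ inF s f ∧ ¬ inF s g) f1 g := by
    have hgs : ¬ inF s g := fun h => hg (by unfold inF at *; omega)
    have : inF s f → ∃ f0 f1 a b, inF s f0 ∧ ¬ inF s f1 ∧ Dual f0 f1 a b ∧ (¬ E a b ∧ ¬ E b a) ∧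
      Relation.ReflTransGen (fun f g => FStep E f g ∧ ¬ inF s f ∧ ¬ inF s g) f1 g := by
      have gen : (∃ f0 f1 a b, inF s f0 ∧ ¬ inF s f1 ∧ Dual f0 f1 a b ∧ (¬ E a b ∧ ¬ E b a) ∧
        Relation.ReflTransGen (fun f g => FStep E f g ∧ ¬ inF s f ∧ ¬ inF s g) f1 g) ∨
        (¬ inF s f ∧ Relation.ReflTransGen (fun f g => FStep E f g ∧ ¬ inF s f ∧ ¬ inF s g) f g) := by
        clear hf
        induction hc using Relation.ReflTransGen.head_induction_on with
        | refl => exact Or.inr ⟨hgs, Relation.ReflTransGen.refl⟩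
        | head h1 _ ih =>
          rename_i p q _
          rcases ih with ih | ⟨ih1, ih2⟩
          · exact Or.inl ih
          · by_cases hp : inF s p
            · obtain ⟨a, b, h1, h2⟩ := h1
              exact Or.inl ⟨p, q, a, b, hp, ih1, h1, h2, ih2⟩
            · exact Or.inr ⟨hp, ih2.head ⟨h1, hp, ih1⟩⟩
      intro hf
      rcases gen with h | h
      · exact h
      · exact absurd hf h.1
    exact this hf
  obtain ⟨f0, f1, a, b, h0, h1, hd, he, hc1⟩ := step1
  have hf1 : inF R f1 := by
    have := dual_near hd h0
    unfold inF at *; omega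
  have step2 : ∃ fm fn a' b', ¬ inF R fn ∧ Dual fm fn a' b' ∧ (¬ E a' b' ∧ ¬ E b' a') ∧
      ¬ inF s fm ∧ ¬ inF s fn ∧ Relation.ReflTransGen
        (fun f g => FStep E f g ∧ (¬ inF s f ∧ ¬ inF s g) ∧ (inF R f ∧ inF R g)) f1 fm := by
    have gen : (∃ fm fn a' b', ¬ inF R fn ∧ Dual fm fn a' b' ∧ (¬ E a' b' ∧ ¬ E b' a') ∧
      ¬ inF s fm ∧ ¬ inF s fn ∧ Relation.ReflTransGen
        (fun f g => FStep E f g ∧ (¬ inF s f ∧ ¬ inF s g) ∧ (inF R f ∧ inF R g)) f1 fm) ∨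
        (inF R g ∧ Relation.ReflTransGen
        (fun f g => FStep E f g ∧ (¬ inF s f ∧ ¬ inF s g) ∧ (inF R f ∧ inF R g)) f1 g) := by
      clear hg hc
      induction hc1 with
      | refl => exact Or.inr ⟨hf1, Relation.ReflTransGen.refl⟩
      | tail _ h2 ih =>
        rename_i p q _
        rcases ih with ih | ⟨ih1, ih2⟩
        · exact Or.inl ih
        · by_cases hq : inF R q
          · exact Or.inr ⟨hq, ih2.tail ⟨h2.1, h2.2, ih1, hq⟩⟩
          · obtain ⟨⟨a', b', h3, h4⟩, h5⟩ := h2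
            exact Or.inl ⟨p, q, a', b', hq, h3, h4, h5.1, h5.2, ih2⟩
    rcases gen with h | h
    · exact h
    · exact absurd h.1 hg
  obtain ⟨fm, fn, a', b', h2, hd', he', hms, hns, hc2⟩ := step2
  refine ⟨a, b, a', b', fun Q hQ => ⟨f0, fn, h0, h2, ?_⟩⟩
  have hfmR : inF R fm ∨ fm = fm := Or.inr rfl
  have hfm : inF R fm := by
    cases hc2 with
    | refl => exact hf1
    | tail _ h => exact h.2.2.2
  have s1 : FStep (fun u v => E u v ∨ Q u v) f0 f1 := by
    refine ⟨a, b, hd, ?_, ?_⟩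
    · rintro (h | h)
      · exact he.1 h
      · rcases hQ _ _ h with h | h
        · exact h.2.2.1 rfl
        · rcases dual_ring hd h.1 h.2.1 with k | k
          · exact k.2 hf1
          · apply k.1; unfold inF at *; omega
    · rintro (h | h)
      · exact he.2 h
      · rcases hQ _ _ h with h | h
        · exact h.2.2.2 rfl
        · rcases dual_ring hd h.2.1 h.1 with k | k
          · exact k.2 hf1
          · apply k.1; unfold inF at *; omega
  have s3 : FStep (fun u v => E u v ∨ Q u v) fm fn := by
    refine ⟨a', b', hd', ?_, ?_⟩
    · rintro (h | h)
      · exact he'.1 h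
      · rcases hQ _ _ h with h | h
        · rcases dual_ring hd' h.1 h.2.1 with k | k
          · exact hms k.1
          · exact hns k.2
        · exact h.2.2.1 rfl
    · rintro (h | h)
      · exact he'.2 h
      · rcases hQ _ _ h with h | h
        · rcases dual_ring hd' h.2.1 h.1 with k | k
          · exact hms k.1
          · exact hns k.2
        · exact h.2.2.2 rfl
  have s2 : Relation.ReflTransGen (FStep (fun u v => E u v ∨ Q u v)) f1 fm := by
    refine Relation.ReflTransGen.mono ?_ _ _ hc2
    rintro p q ⟨⟨x, y, h3, h4⟩, h5, h6⟩
    refine ⟨x, y, h3, ?_, ?_⟩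
    · rintro (h | h)
      · exact h4.1 h
      · rcases hQ _ _ h with h | h
        · rcases dual_ring h3 h.1 h.2.1 with k | k
          · exact h5.1 k.1
          · exact h5.2 k.2
        · rcases dual_ring h3 h.1 h.2.1 with k | k
          · exact k.2 h6.2
          · exact k.1 h6.1
    · rintro (h | h)
      · exact h4.2 h
      · rcases hQ _ _ h with h | h
        · rcases dual_ring h3 h.2.1 h.1 with k | k
          · exact h5.1 k.1
          · exact h5.2 k.2
        · rcases dual_ring h3 h.2.1 h.1 with k | k
          · exact k.2 h6.2
          · exact k.1 h6.1
  exact (s2.head s1).tail s3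

/-! #### Rings -/

/-- Parametrisation of the ring of radius `s`. -/
def ringPt (s : ℤ) (k : ℤ) : Lat :=
  if k < 2 * s then (s, -s + k) else if k < 4 * s then (s - (k - 2 * s), s)
  else if k < 6 * s then (-s, s - (k - 4 * s)) else (-s + (k - 6 * s), -s)

lemma linf_eq {s : ℤ} {u : Lat} : linf u = s ↔
    ((-s ≤ u.1 ∧ u.1 ≤ s) ∧ (-s ≤ u.2 ∧ u.2 ≤ s)) ∧ (u.1 = s ∨ u.1 = -s ∨ u.2 = s ∨ u.2 = -s) := by
  constructor
  · intro h
    have h1 := (linf_le (u := u)).1 h.le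
    have h3 := mt (linf_le (R := s - 1) (u := u)).2 (by omega)
    omega
  · intro h
    have h1 := (linf_le (R := s) (u := u)).2 h.1
    have h3 := mt (linf_le (R := s - 1) (u := u)).1 (by omega)
    omega

/-- The list of the vertices of the ring. -/
def ringL (s : ℤ) : List Lat := (List.range (8 * s).toNat).map (fun k : ℕ => ringPt s (k : ℤ))

lemma ring_spec {s : ℤ} (hs : 1 ≤ s) : (ringL s).Nodup ∧
    (ringL s ++ (ringL s).take 1).IsChain Adj ∧ ∀ z, z ∈ ringL s ↔ linf z = s := by
  refine ⟨?_, ?_, ?_⟩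
  · unfold ringL
    rw [List.nodup_map_iff_inj_on (List.nodup_range)]
    intro x hx y hy h
    rw [List.mem_range] at hx hy
    simp only [ringPt] at h
    split_ifs at h <;> simp only [Prod.mk.injEq] at h <;> omega
  · have h8 : (8 * s).toNat = (8 * s - 1).toNat + 1 := by omega
    have htake : (ringL s).take 1 = [ringPt s 0] := by
      unfold ringL
      rw [h8, List.range_succ_eq_map]; simp
    rw [htake]
    have : ringL s ++ [ringPt s 0] =
        (List.range ((8 * s).toNat + 1)).map (fun k : ℕ => ringPt s (if k = (8 * s).toNat then 0 else k)) := by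
      rw [List.range_succ, List.map_append]
      congr 1
      · unfold ringL
        apply List.map_congr_left
        intro k hk
        rw [List.mem_range] at hk
        rw [if_neg (by omega)]
      · simp
    rw [this, List.isChain_iff_getElem]
    intro i hi
    simp only [List.length_map, List.length_range] at hi
    simp only [List.getElem_map, List.getElem_range]
    rw [adj_iff]
    simp only [ringPt]
    clear this htake
    split_ifs <;> simp only [Prod.mk.injEq, and_true, true_and] <;> push_cast <;> omega
  · intro z
    obtain ⟨x, y⟩ := z
    rw [linf_eq]
    simp only [ringL, List.mem_map, List.mem_range]
    constructor
    · rintro ⟨k, hk, h⟩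
      simp only [ringPt] at h
      split_ifs at h <;> simp only [Prod.mk.injEq] at h <;> omega
    · intro h
      have : ∃ k : ℤ, 0 ≤ k ∧ k < 8 * s ∧ ringPt s k = (x, y) := by
        by_cases h1 : x = s ∧ y < s
        · refine ⟨y + s, by omega, by omega, ?_⟩
          simp only [ringPt]
          rw [if_pos (by omega)]
          simp only [Prod.mk.injEq]; omega
        by_cases h2 : y = s ∧ -s < x
        · refine ⟨3 * s - x, by omega, by omega, ?_⟩
          simp only [ringPt]
          rw [if_neg (by omega), if_pos (by omega)]
          simp only [Prod.mk.injEq]; omega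
        by_cases h3 : x = -s ∧ -s < y
        · refine ⟨5 * s - y, by omega, by omega, ?_⟩
          simp only [ringPt]
          rw [if_neg (by omega), if_neg (by omega), if_pos (by omega)]
          simp only [Prod.mk.injEq]; omega
        · refine ⟨x + 7 * s, by omega, by omega, ?_⟩
          simp only [ringPt]
          rw [if_neg (by omega), if_neg (by omega), if_neg (by omega)]
          simp only [Prod.mk.injEq]; omega
      obtain ⟨k, h1, h2, h3⟩ := this
      exact ⟨k.toNat, by omega, by rw [Int.toNat_of_nonneg h1]; exact h3⟩

/-! ### Part F: potential theory on the lattice -/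

/-- Average over the neighbours. -/
def avg (w : Lat → ℝ) (x : Lat) : ℝ :=
  (w (x.1 + 1, x.2) + w (x.1 - 1, x.2) + w (x.1, x.2 + 1) + w (x.1, x.2 - 1)) / 4

lemma avg_le {v w : Lat → ℝ} {x : Lat} (h : ∀ y, Adj x y → v y ≤ w y) : avg v x ≤ avg w x := by
  have h1 := h (x.1 + 1, x.2) ((adj_iff _ _).2 (by simp))
  have h2 := h (x.1 - 1, x.2) ((adj_iff _ _).2 (by simp))
  have h3 := h (x.1, x.2 + 1) ((adj_iff _ _).2 (by simp))
  have h4 := h (x.1, x.2 - 1) ((adj_iff _ _).2 (by simp))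
  unfold avg; linarith

lemma avg_sub (v w : Lat → ℝ) (x : Lat) : avg (fun z => v z - w z) x = avg v x - avg w x := by
  unfold avg; ring

lemma avg_add (v w : Lat → ℝ) (x : Lat) : avg (fun z => v z + w z) x = avg v x + avg w x := by
  unfold avg; ring

lemma avg_mul (c : ℝ) (w : Lat → ℝ) (x : Lat) : avg (fun z => c * w z) x = c * avg w x := by
  unfold avg; ring

lemma avg_const (c : ℝ) (x : Lat) : avg (fun _ => c) x = c := by
  unfold avg; ring

/-- Maximum principle. -/
lemma mp (D : Finset Lat) (w : Lat → ℝ) (hD : ∀ x ∈ D, w x ≤ avg w x) (h0 : ∀ x ∉ D, w x ≤ 0) :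
    ∀ x, w x ≤ 0 := by
  by_contra hc
  push Not at hc
  obtain ⟨x0, hx0⟩ := hc
  have hx0D : x0 ∈ D := by by_contra h; exact absurd (h0 x0 h) (not_le.2 hx0)
  obtain ⟨m, hmD, hm⟩ := D.exists_max_image w ⟨x0, hx0D⟩
  have hmpos : 0 < w m := hx0.trans_le (hm x0 hx0D)
  have hle : ∀ x, w x ≤ w m := fun x => by
    by_cases h : x ∈ D
    · exact hm x h
    · exact (h0 x h).trans hmpos.le
  obtain ⟨p, hp, hpm⟩ := (D.filter (fun x => w x = w m)).exists_max_image (fun x => x.1)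
    ⟨m, by simp [hmD]⟩
  rw [Finset.mem_filter] at hp
  have h1 : w (p.1 + 1, p.2) < w m := by
    refine lt_of_le_of_ne (hle _) fun h => ?_
    have hin : (p.1 + 1, p.2) ∈ D := by
      by_contra hn; have := h0 _ hn; linarith
    have := hpm (p.1 + 1, p.2) (by rw [Finset.mem_filter]; exact ⟨hin, h⟩)
    simp only at this; omega
  have h2 := hD p hp.1
  unfold avg at h2
  linarith [hle (p.1 - 1, p.2), hle (p.1, p.2 + 1), hle (p.1, p.2 - 1), hp.2]

/-- Comparison. -/
lemma mp2 (D : Finset Lat) (v w b : Lat → ℝ) (hv : ∀ x ∈ D, v x ≤ b x + avg v x)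
    (hw : ∀ x ∈ D, b x + avg w x ≤ w x) (h0 : ∀ x ∉ D, v x ≤ w x) : ∀ x, v x ≤ w x := by
  intro x
  have := mp D (fun z => v z - w z) (fun x hx => by
    rw [avg_sub]; linarith [hv x hx, hw x hx]) (fun x hx => by linarith [h0 x hx]) x
  linarith

/-- Restricted comparison: only the neighbours of the domain matter. -/
lemma mp3 (D : Finset Lat) (v w b : Lat → ℝ) (hv : ∀ x ∈ D, v x ≤ b x + avg v x)
    (hw : ∀ x ∈ D, b x + avg w x ≤ w x) (h0 : ∀ x ∉ D, ∀ y ∈ D, Adj y x → v x ≤ w x) :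
    ∀ x ∈ D, v x ≤ w x := by
  intro x hx
  let v' : Lat → ℝ := fun x => if x ∈ D ∨ ∃ y ∈ D, Adj y x then v x - w x else 0
  have hv' : ∀ x ∈ D, ∀ y, (y = x ∨ Adj x y) → v' y = v y - w y := by
    intro x hx y hy
    simp only [v']
    rw [if_pos]
    rcases hy with rfl | hy
    · exact Or.inl hx
    · exact Or.inr ⟨x, hx, hy⟩
  have := mp D v' (fun x hx => by
    rw [hv' x hx x (Or.inl rfl)]
    have h1 : avg v' x = avg (fun z => v z - w z) x :=
      le_antisymm (avg_le fun y hy => (hv' x hx y (Or.inr hy)).le)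
        (avg_le fun y hy => (hv' x hx y (Or.inr hy)).ge)
    rw [h1, avg_sub]; linarith [hv x hx, hw x hx]) (fun x hx => by
      simp only [v']
      split_ifs with h
      · rcases h with h | ⟨y, hy, ha⟩
        · exact absurd h hx
        · linarith [h0 x hx y hy ha]
      · exact le_rfl) x
  rw [hv' x hx x (Or.inl rfl)] at this
  linarith

/-- Existence of solutions of the Dirichlet problem. -/
lemma dir_exists (D : Finset Lat) (b g : Lat → ℝ) :
    ∃ u : Lat → ℝ, (∀ x ∈ D, u x = b x + avg u x) ∧ ∀ x ∉ D, u x = g x := by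
  let ext : (D → ℝ) →ₗ[ℝ] (Lat → ℝ) :=
    { toFun := fun v x => if h : x ∈ D then v ⟨x, h⟩ else 0
      map_add' := by intro v w; funext x; simp only [Pi.add_apply]; split_ifs <;> simp
      map_smul' := by intro c w; funext x; simp only [Pi.smul_apply]; split_ifs <;> simp }
  have hext : ∀ v (x : D), ext v x = v x := by
    intro v x; simp only [ext, LinearMap.coe_mk, AddHom.coe_mk]; rw [dif_pos x.2]
  have hext0 : ∀ v (x : Lat), x ∉ D → ext v x = 0 := by
    intro v x hx; simp only [ext, LinearMap.coe_mk, AddHom.coe_mk]; rw [dif_neg hx]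
  let T : (D → ℝ) →ₗ[ℝ] (D → ℝ) :=
    { toFun := fun v x => v x - avg (ext v) x
      map_add' := by
        intro v w; funext x; simp only [map_add, Pi.add_apply]
        have := avg_add (ext v) (ext w) x
        simp only [avg, Pi.add_apply] at *; linarith
      map_smul' := by
        intro c w; funext x
        simp only [map_smul, Pi.smul_apply, RingHom.id_apply, smul_eq_mul, avg]; ring }
  have hinj : Function.Injective T := by
    rw [injective_iff_map_eq_zero]
    intro v hv
    have h1 : ∀ x : D, v x = avg (ext v) x := by
      intro x
      have := congrFun hv x
      simp only [T, LinearMap.coe_mk, AddHom.coe_mk, Pi.zero_apply] at this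
      linarith
    have h2 := mp D (ext v) (fun x hx => by rw [← h1 ⟨x, hx⟩, hext v ⟨x, hx⟩])
      (fun x hx => (hext0 v x hx).le)
    have h3 := mp D (ext (-v)) (fun x hx => by
      have h4 : avg (ext (-v)) x = - avg (ext v) x := by
        rw [map_neg]; unfold avg; simp only [Pi.neg_apply]; ring
      rw [h4, ← h1 ⟨x, hx⟩, hext (-v) ⟨x, hx⟩]; simp) (fun x hx => (hext0 (-v) x hx).le)
    funext x
    have h4 := h2 x
    have h5 := h3 x
    rw [hext] at h4 h5
    simp only [Pi.neg_apply, Pi.zero_apply] at *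
    linarith
  have hsurj := LinearMap.injective_iff_surjective.1 hinj
  let g' : Lat → ℝ := fun x => if x ∈ D then 0 else g x
  obtain ⟨v, hv⟩ := hsurj (fun x => b x + avg g' x)
  refine ⟨fun x => ext v x + g' x, fun x hx => ?_, fun x hx => ?_⟩
  · have := congrFun hv ⟨x, hx⟩
    simp only [T, LinearMap.coe_mk, AddHom.coe_mk] at this
    have h9 := hext v ⟨x, hx⟩
    simp only at h9
    rw [avg_add]; beta_reduce
    rw [h9]
    have h0 : g' x = 0 := by simp [g', hx]
    linarith
  · beta_reduce; rw [hext0 v x hx]; simp [g', hx]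

/-- Solution of the Dirichlet problem with boundary values `g`. -/
def dir (D : Finset Lat) (g : Lat → ℝ) : Lat → ℝ := (dir_exists D (fun _ => 0) g).choose

lemma dir_in (D : Finset Lat) (g : Lat → ℝ) {x : Lat} (hx : x ∈ D) : dir D g x = avg (dir D g) x := by
  have := (dir_exists D (fun _ => 0) g).choose_spec.1 x hx
  unfold dir; linarith

lemma dir_out (D : Finset Lat) (g : Lat → ℝ) {x : Lat} (hx : x ∉ D) : dir D g x = g x :=
  (dir_exists D (fun _ => 0) g).choose_spec.2 x hx

/-- The box as a finset. -/
def boxF (R : ℤ) : Finset Lat := Finset.Icc (-R) R ×ˢ Finset.Icc (-R) R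

lemma mem_boxF {R : ℤ} {z : Lat} : z ∈ boxF R ↔ linf z ≤ R := by
  rw [linf_le, boxF, Finset.mem_product, Finset.mem_Icc, Finset.mem_Icc]

/-- The open annulus. -/
def Dn (s R : ℤ) : Finset Lat := (boxF R).filter (fun z => s < linf z ∧ linf z < R)

lemma mem_Dn {s R : ℤ} {z : Lat} : z ∈ Dn s R ↔ s < linf z ∧ linf z < R := by
  rw [Dn, Finset.mem_filter, mem_boxF]
  constructor
  · exact fun h => h.2
  · exact fun h => ⟨h.2.le, h⟩

lemma linf_adj {x y : Lat} (h : Adj x y) : linf y ≤ linf x + 1 ∧ linf x ≤ linf y + 1 := by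
  have h1 := (linf_le (u := x)).1 (le_refl (linf x))
  have h2 := (linf_le (u := y)).1 (le_refl (linf y))
  rw [linf_le, linf_le]
  obtain ⟨a, b⟩ := x
  rcases (adj_iff _ _).1 h with rfl | rfl | rfl | rfl <;> simp only at * <;> omega

lemma linf_nonneg (x : Lat) : 0 ≤ linf x := (abs_nonneg x.1).trans (le_max_left _ _)

/-- The sup norm is discretely subharmonic. -/
lemma linf_sub (x : Lat) : (linf x : ℝ) ≤ avg (fun z => (linf z : ℝ)) x := by
  have key : 4 * linf x ≤ linf (x.1 + 1, x.2) + linf (x.1 - 1, x.2) + linf (x.1, x.2 + 1)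
      + linf (x.1, x.2 - 1) := by
    have h1 := (linf_le (u := (x.1 + 1, x.2))).1 (le_refl _)
    have h2 := (linf_le (u := (x.1 - 1, x.2))).1 (le_refl _)
    have h3 := (linf_le (u := (x.1, x.2 + 1))).1 (le_refl _)
    have h4 := (linf_le (u := (x.1, x.2 - 1))).1 (le_refl _)
    have h5 := (linf_eq (u := x)).1 rfl
    simp only at *
    omega
  unfold avg
  have : (4 * linf x : ℝ) ≤ linf (x.1 + 1, x.2) + linf (x.1 - 1, x.2) + linf (x.1, x.2 + 1)
      + linf (x.1, x.2 - 1) := by exact_mod_cast key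
  linarith

/-- Escape function near the inner ring. -/
def eS (s : ℤ) : Lat → ℝ := dir (Dn s (2 * s)) (fun z => if 2 * s ≤ linf z then 1 else 0)

/-- Escape function near the outer ring. -/
def fR (R : ℤ) : Lat → ℝ := dir (Dn (R / 2) R) (fun z => if linf z ≤ R / 2 then 1 else 0)

lemma dir_nonneg (D : Finset Lat) (g : Lat → ℝ) (hg : ∀ x, 0 ≤ g x) (x : Lat) : 0 ≤ dir D g x := by
  refine mp2 D (fun _ => 0) (dir D g) (fun _ => 0) ?_ ?_ ?_ x
  · intro x _; rw [avg_const]; simp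
  · intro x hx; rw [← dir_in D g hx]; simp
  · intro x hx; rw [dir_out D g hx]; exact hg x

/-- Strict positivity of a Dirichlet solution, provided each point has a neighbour closer to a
positive boundary value. -/
lemma dir_pos_step (D : Finset Lat) (g : Lat → ℝ) (hg : ∀ x, 0 ≤ g x) (x y : Lat) (h : Adj x y)
    (hx : x ∈ D) (hy : 0 < dir D g y) : 0 < dir D g x := by
  have hn := dir_nonneg D g hg
  rw [dir_in D g hx, avg]
  rcases (adj_iff _ _).1 h with rfl | rfl | rfl | rfl <;>
    linarith [hn (x.1 + 1, x.2), hn (x.1 - 1, x.2), hn (x.1, x.2 + 1), hn (x.1, x.2 - 1)]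

lemma exists_out (x : Lat) : ∃ y, Adj x y ∧ linf y = linf x + 1 := by
  have h5 := (linf_eq (u := x)).1 rfl
  obtain ⟨a, b⟩ := x
  set m := linf (a, b) with hm
  clear_value m
  simp only at h5
  have h0 : 0 ≤ m := by omega
  rcases h5.2 with h | h | h | h
  · exact ⟨(a + 1, b), (adj_iff _ _).2 (by simp), by rw [linf_eq]; simp only; omega⟩
  · exact ⟨(a - 1, b), (adj_iff _ _).2 (by simp), by rw [linf_eq]; simp only; omega⟩
  · exact ⟨(a, b + 1), (adj_iff _ _).2 (by simp), by rw [linf_eq]; simp only; omega⟩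
  · exact ⟨(a, b - 1), (adj_iff _ _).2 (by simp), by rw [linf_eq]; simp only; omega⟩

lemma eS_nonneg (s : ℤ) (x : Lat) : 0 ≤ eS s x :=
  dir_nonneg _ _ (fun x => by split_ifs <;> norm_num) x

lemma fR_nonneg (s : ℤ) (x : Lat) : 0 ≤ fR s x :=
  dir_nonneg _ _ (fun x => by split_ifs <;> norm_num) x

lemma eS_pos {s : ℤ} {x : Lat} (hx : s < linf x) : 0 < eS s x := by
  have key : ∀ n : ℕ, ∀ x : Lat, s < linf x → 2 * s ≤ linf x + n → 0 < eS s x := by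
    intro n
    induction n with
    | zero =>
      intro x _ h
      rw [eS, dir_out _ _ (by rw [mem_Dn]; push_cast at h; omega), if_pos (by simpa using h)]
      norm_num
    | succ n ih =>
      intro x hx h
      by_cases hD : x ∈ Dn s (2 * s)
      · obtain ⟨y, hy, hy'⟩ := exists_out x
        exact dir_pos_step _ _ (fun x => by split_ifs <;> norm_num) x y hy hD
          (ih y (by omega) (by push_cast at h; omega))
      · rw [mem_Dn] at hD
        exact ih x hx (by have := (Nat.cast_nonneg n : (0 : ℤ) ≤ n); omega)
  exact key (2 * s).toNat x hx (by have := linf_nonneg x; omega)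

lemma fR_pos {R : ℤ} (hR : 0 ≤ R) {x : Lat} (hx : linf x < R) : 0 < fR R x := by
  have key : ∀ n : ℕ, ∀ x : Lat, linf x < R → x.1.natAbs + x.2.natAbs = n → 0 < fR R x := by
    intro n
    induction n with
    | zero =>
      intro x _ h
      have : linf x ≤ 0 := by rw [linf_le]; omega
      rw [fR, dir_out _ _ (by rw [mem_Dn]; omega), if_pos (by omega)]
      norm_num
    | succ n ih =>
      intro x hx h
      by_cases hD : x ∈ Dn (R / 2) R
      · have hn : ∃ y, Adj x y ∧ linf y ≤ linf x ∧ y.1.natAbs + y.2.natAbs = n := by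
          have h5 := (linf_le (u := x)).1 le_rfl
          obtain ⟨a, b⟩ := x
          simp only at h h5
          rcases lt_trichotomy a 0 with ha | ha | ha
          · exact ⟨(a + 1, b), (adj_iff _ _).2 (by simp), by rw [linf_le]; simp only; omega,
              by simp only; omega⟩
          · rcases lt_trichotomy b 0 with hb | hb | hb
            · exact ⟨(a, b + 1), (adj_iff _ _).2 (by simp), by rw [linf_le]; simp only; omega,
                by simp only; omega⟩
            · omega
            · exact ⟨(a, b - 1), (adj_iff _ _).2 (by simp), by rw [linf_le]; simp only; omega,
                by simp only; omega⟩
          · exact ⟨(a - 1, b), (adj_iff _ _).2 (by simp), by rw [linf_le]; simp only; omega,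
              by simp only; omega⟩
        obtain ⟨y, hy, hy', hyn⟩ := hn
        exact dir_pos_step _ _ (fun x => by split_ifs <;> norm_num) x y hy hD
          (ih y (by omega) hyn)
      · rw [mem_Dn] at hD
        rw [fR, dir_out _ _ (by rw [mem_Dn]; omega), if_pos (by omega)]
        norm_num
  exact key _ x hx rfl

/-- Linear barrier inside a square. -/
lemma lin_super (R : ℤ) (c : ℝ) (hc : 0 ≤ c) (x : Lat) :
    avg (fun z => c * ((R : ℝ) - linf z)) x ≤ c * ((R : ℝ) - linf x) := by
  rw [avg_mul, avg_sub, avg_const]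
  exact mul_le_mul_of_nonneg_left (by linarith [linf_sub x]) hc

lemma fR_le {R : ℤ} (hR : 1 ≤ R) {x : Lat} (hx : linf x ≤ R) :
    fR R x ≤ 2 / R * ((R : ℝ) - linf x) := by
  have hR' : (0 : ℝ) < R := by exact_mod_cast (by omega : 0 < R)
  by_cases hD : x ∈ Dn (R / 2) R
  · refine mp3 (Dn (R / 2) R) (fR R) (fun x => 2 / R * ((R : ℝ) - linf x)) (fun _ => 0) ?_ ?_ ?_ x hD
    · intro x hx; rw [zero_add, fR, ← dir_in _ _ hx]
    · intro x hx; rw [zero_add]; exact lin_super R _ (by positivity) x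
    · intro x hx y hy hxy
      rw [fR, dir_out _ _ hx]
      have := linf_adj hxy
      rw [mem_Dn] at hx hy
      have h1 : linf x ≤ R := by omega
      have h1' : (linf x : ℝ) ≤ R := by exact_mod_cast h1
      split_ifs with h
      · rw [div_mul_eq_mul_div, le_div_iff₀ hR']
        have : 2 * linf x ≤ R := by omega
        have : (2 * linf x : ℝ) ≤ R := by exact_mod_cast this
        linarith
      · have : (0 : ℝ) ≤ R - linf x := by linarith
        positivity
  · rw [fR, dir_out _ _ hD]
    rw [mem_Dn] at hD
    have h1' : (linf x : ℝ) ≤ R := by exact_mod_cast hx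
    split_ifs with h
    · rw [div_mul_eq_mul_div, le_div_iff₀ hR']
      have : 2 * linf x ≤ R := by omega
      have : (2 * linf x : ℝ) ≤ R := by exact_mod_cast this
      linarith
    · have : (0 : ℝ) ≤ R - linf x := by linarith
      positivity

lemma fR_zero {R : ℤ} (hR : 1 ≤ R) {x : Lat} (hx : R ≤ linf x) : fR R x = 0 := by
  rw [fR, dir_out _ _ (by rw [mem_Dn]; omega), if_neg (by omega)]

lemma fR_one {R : ℤ} {x : Lat} (hx : linf x ≤ R / 2) : fR R x = 1 := by
  rw [fR, dir_out _ _ (by rw [mem_Dn]; omega), if_pos (by omega)]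

lemma fR_le_near {R : ℤ} (hR : 1 ≤ R) {x : Lat} (hx : R - 1 ≤ linf x) : fR R x ≤ 2 / R := by
  have hR' : (0 : ℝ) < R := by exact_mod_cast (by omega : 0 < R)
  by_cases h : R ≤ linf x
  · rw [fR_zero hR h]; positivity
  · have h1 : linf x = R - 1 := by omega
    have := fR_le hR (x := x) (by omega)
    rw [h1] at this
    push_cast at this
    linarith

lemma eS_zero {s : ℤ} (hs : 1 ≤ s) {x : Lat} (hx : linf x ≤ s) : eS s x = 0 := by
  rw [eS, dir_out _ _ (by rw [mem_Dn]; omega), if_neg (by omega)]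

lemma eS_one {s : ℤ} {x : Lat} (hx : 2 * s ≤ linf x) : eS s x = 1 := by
  rw [eS, dir_out _ _ (by rw [mem_Dn]; omega), if_pos hx]

lemma eS_near {s : ℤ} (hs : 1 ≤ s) {x : Lat} (hx : linf x ≤ 2 * s) :
    1 - eS s x ≤ 1 / s * (((2 * s : ℤ) : ℝ) - linf x) := by
  have hs' : (0 : ℝ) < s := by exact_mod_cast (by omega : 0 < s)
  have out : ∀ x, x ∉ Dn s (2 * s) → linf x ≤ 2 * s →
      1 - eS s x ≤ 1 / s * (((2 * s : ℤ) : ℝ) - linf x) := by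
    intro x hD hx
    rw [mem_Dn] at hD
    have h1' : (linf x : ℝ) ≤ (2 * s : ℤ) := by exact_mod_cast hx
    by_cases h : linf x ≤ s
    · rw [eS_zero hs h, div_mul_eq_mul_div, le_div_iff₀ hs']
      have : (linf x : ℝ) ≤ s := by exact_mod_cast h
      push_cast
      linarith
    · rw [eS_one (by omega), sub_self]
      have : (0 : ℝ) ≤ ((2 * s : ℤ) : ℝ) - linf x := by linarith
      positivity
  by_cases hD : x ∈ Dn s (2 * s)
  · refine mp3 (Dn s (2 * s)) (fun x => 1 - eS s x) (fun x => 1 / s * (((2 * s : ℤ) : ℝ) - linf x))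
      (fun _ => 0) ?_ ?_ ?_ x hD
    · intro x hx; rw [zero_add, avg_sub, avg_const, eS, ← dir_in _ _ hx]
    · intro x hx; rw [zero_add]; exact lin_super (2 * s) _ (by positivity) x
    · intro x hx y hy hxy
      have := linf_adj hxy
      exact out x hx (by rw [mem_Dn] at hy; omega)
  · exact out x hD hx

/-- The four neighbours. -/
def nbrs (x : Lat) : Finset Lat :=
  {(x.1 + 1, x.2), (x.1 - 1, x.2), (x.1, x.2 + 1), (x.1, x.2 - 1)}

lemma mem_nbrs {x y : Lat} : y ∈ nbrs x ↔ Adj x y := by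
  rw [adj_iff]; simp [nbrs]; tauto

lemma sum_nbrs {M : Type*} [AddCommMonoid M] (g : Lat → M) (x : Lat) :
    ∑ y ∈ nbrs x, g y = g (x.1 + 1, x.2) + (g (x.1 - 1, x.2) + (g (x.1, x.2 + 1) +
      g (x.1, x.2 - 1))) := by
  unfold nbrs
  rw [Finset.sum_insert, Finset.sum_insert, Finset.sum_insert, Finset.sum_singleton] <;>
    simp <;> omega

lemma sum_nbrs_avg (g : Lat → ℝ) (x : Lat) : ∑ y ∈ nbrs x, g y = 4 * avg g x := by
  rw [sum_nbrs, avg]; ring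

lemma sum_adj (B : Finset Lat) (g : Lat → ℝ) (x : Lat) (h : ∀ y, Adj x y → y ∉ B → g y = 0) :
    ∑ y ∈ B, (if Adj x y then g y else 0) = 4 * avg g x := by
  rw [← sum_nbrs_avg, ← Finset.sum_filter]
  refine Finset.sum_subset ?_ ?_
  · intro y hy; rw [mem_nbrs]; exact (Finset.mem_filter.1 hy).2
  · intro y hy hn
    rw [mem_nbrs] at hy
    refine h y hy fun hB => hn (Finset.mem_filter.2 ⟨hB, hy⟩)

/-- The ring as a finset. -/
def ringF (s : ℤ) : Finset Lat := (boxF s).filter (fun z => linf z = s)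

lemma mem_ringF {s : ℤ} {z : Lat} : z ∈ ringF s ↔ linf z = s := by
  rw [ringF, Finset.mem_filter, mem_boxF]
  exact ⟨fun h => h.2, fun h => ⟨h.le, h⟩⟩

lemma ringF_card {s : ℤ} (hs : 1 ≤ s) : ((ringF s).card : ℝ) = 8 * s := by
  obtain ⟨h1, -, h3⟩ := ring_spec hs
  have : ringF s = (ringL s).toFinset := by
    ext z; rw [mem_ringF, List.mem_toFinset, h3]
  rw [this, List.toFinset_card_of_nodup h1, ringL, List.length_map, List.length_range]
  have : ((8 * s).toNat : ℤ) = 8 * s := Int.toNat_of_nonneg (by omega)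
  exact_mod_cast this

/-- Flux bound. -/
lemma eS_sum {s : ℤ} (hs2 : 2 ≤ s) : ∑ a ∈ ringF s, avg (eS s) a ≤ 16 := by
  have hs : 1 ≤ s := by omega
  have hs' : (0 : ℝ) < s := by exact_mod_cast (by omega : 0 < s)
  set D := Dn s (2 * s) with hD
  set B := D ∪ (ringF s ∪ ringF (2 * s)) with hB
  have hd1 : Disjoint D (ringF s ∪ ringF (2 * s)) := by
    rw [Finset.disjoint_left]
    intro x hx hx'
    rw [Finset.mem_union, mem_ringF, mem_ringF] at hx'
    rw [hD, mem_Dn] at hx; omega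
  have hd2 : Disjoint (ringF s) (ringF (2 * s)) := by
    rw [Finset.disjoint_left]
    intro x hx hx'
    rw [mem_ringF] at hx hx'; omega
  let a : Lat → Lat → ℝ := fun x y => if Adj x y then eS s x - eS s y else 0
  have h1 : ∀ x ∈ D, ∑ y ∈ B, a x y = 0 := by
    intro x hx
    have hx' := mem_Dn.1 hx
    rw [show ∑ y ∈ B, a x y = ∑ y ∈ B, (if Adj x y then eS s x - eS s y else 0) from rfl,
      sum_adj B (fun y => eS s x - eS s y) x, avg_sub, avg_const, eS, ← dir_in _ _ hx, sub_self,
      mul_zero]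
    intro y hy hyB
    exfalso; apply hyB
    have := linf_adj hy
    rw [hB, Finset.mem_union, Finset.mem_union, mem_ringF, mem_ringF, hD, mem_Dn]
    omega
  have h2 : ∑ x ∈ D, ∑ y ∈ D, a x y = 0 := by
    have h3 : ∑ x ∈ D, ∑ y ∈ D, a x y = ∑ x ∈ D, ∑ y ∈ D, a y x := Finset.sum_comm
    have h4 : ∀ x y, a y x = - a x y := by
      intro x y
      simp only [a]
      by_cases h : Adj x y
      · rw [if_pos h, if_pos (adj_symm h)]; ring
      · rw [if_neg h, if_neg (fun h' => h (adj_symm h'))]; ring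
    rw [show ∑ x ∈ D, ∑ y ∈ D, a y x = - ∑ x ∈ D, ∑ y ∈ D, a x y by
      rw [← Finset.sum_neg_distrib]
      refine Finset.sum_congr rfl fun x _ => ?_
      rw [← Finset.sum_neg_distrib]
      exact Finset.sum_congr rfl fun y _ => h4 x y] at h3
    linarith
  have h3 : ∑ x ∈ D, ∑ y ∈ ringF s, a x y + ∑ x ∈ D, ∑ y ∈ ringF (2 * s), a x y = 0 := by
    have : ∑ x ∈ D, ∑ y ∈ B, a x y = 0 := Finset.sum_eq_zero h1
    rw [hB] at this
    simp_rw [Finset.sum_union hd1, Finset.sum_union hd2, Finset.sum_add_distrib] at this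
    linarith
  have h4 : ∑ x ∈ D, ∑ y ∈ ringF s, a x y = ∑ y ∈ ringF s, 4 * avg (eS s) y := by
    rw [Finset.sum_comm]
    refine Finset.sum_congr rfl fun y hy => ?_
    rw [mem_ringF] at hy
    rw [← sum_adj D (eS s) y]
    · refine Finset.sum_congr rfl fun x _ => ?_
      simp only [a]
      by_cases h : Adj x y
      · rw [if_pos h, if_pos (adj_symm h), eS_zero hs hy.le, sub_zero]
      · rw [if_neg h, if_neg (fun h' => h (adj_symm h'))]
    · intro x hx hxD
      have := linf_adj hx
      refine eS_zero hs ?_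
      rw [hD, mem_Dn] at hxD
      by_contra hc
      have : ¬ linf x < 2 * s := fun h => hxD ⟨by omega, h⟩
      omega
  have h5 : - ∑ x ∈ D, ∑ y ∈ ringF (2 * s), a x y ≤ 64 := by
    rw [Finset.sum_comm, ← Finset.sum_neg_distrib]
    calc ∑ y ∈ ringF (2 * s), - ∑ x ∈ D, a x y ≤ ∑ y ∈ ringF (2 * s), 4 / (s : ℝ) := by
          refine Finset.sum_le_sum fun y hy => ?_
          rw [mem_ringF] at hy
          rw [← Finset.sum_neg_distrib]
          calc ∑ x ∈ D, - a x y ≤ ∑ x ∈ D, (if Adj y x then (if x ∈ D then 1 / (s : ℝ) else 0)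
                else 0) := by
                refine Finset.sum_le_sum fun x hx => ?_
                simp only [a]
                rw [if_pos hx]
                by_cases h : Adj x y
                · rw [if_pos h, if_pos (adj_symm h), eS_one hy.ge]
                  have h6 := linf_adj h
                  rw [hD, mem_Dn] at hx
                  have h7 := eS_near hs hx.2.le
                  rw [show linf x = 2 * s - 1 by omega] at h7
                  push_cast at h7
                  rw [sub_sub_cancel, mul_one] at h7
                  linarith
                · rw [if_neg h, if_neg (fun h' => h (adj_symm h'))]; simp
            _ = 4 * avg (fun x => if x ∈ D then 1 / (s : ℝ) else 0) y := by
                refine sum_adj D _ y ?_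
                intro x _ hx
                rw [if_neg hx]
            _ ≤ 4 * avg (fun _ => 1 / (s : ℝ)) y := by
                refine mul_le_mul_of_nonneg_left (avg_le fun x _ => ?_) (by norm_num)
                split_ifs
                · exact le_rfl
                · positivity
            _ = 4 / (s : ℝ) := by rw [avg_const]; ring
      _ = 64 := by
          rw [Finset.sum_const, nsmul_eq_mul, ringF_card (by omega)]
          push_cast
          field_simp
          norm_num
  rw [h4, ← Finset.mul_sum] at h3
  linarith

/-- Squared Euclidean norm. -/
def nsq (z : Lat) : ℝ := (z.1 : ℝ) ^ 2 + (z.2 : ℝ) ^ 2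

lemma nsq_nonneg (z : Lat) : 0 ≤ nsq z := by unfold nsq; positivity

lemma nsq_ge (z : Lat) : (linf z : ℝ) ^ 2 ≤ nsq z := by
  have h := (linf_eq (u := z)).1 rfl
  unfold nsq
  set m := linf z with hm
  clear_value m
  have : m ^ 2 ≤ z.1 ^ 2 + z.2 ^ 2 := by
    rcases h.2 with h | h | h | h
    · rw [show z.1 = m by omega]; nlinarith
    · rw [show z.1 = -m by omega]; nlinarith
    · rw [show z.2 = m by omega]; nlinarith
    · rw [show z.2 = -m by omega]; nlinarith
  exact_mod_cast this

lemma nsq_le (z : Lat) : nsq z ≤ 2 * (linf z : ℝ) ^ 2 := by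
  have h := (linf_le (u := z)).1 le_rfl
  unfold nsq
  set m := linf z with hm
  clear_value m
  have : z.1 ^ 2 + z.2 ^ 2 ≤ 2 * m ^ 2 := by nlinarith
  exact_mod_cast this

lemma avg_log {g : Lat → ℝ} {x : Lat} (h : ∀ y, Adj x y → 0 < g y) :
    avg (fun z => Real.log (g z)) x =
      Real.log (g (x.1 + 1, x.2) * g (x.1 - 1, x.2) * g (x.1, x.2 + 1) * g (x.1, x.2 - 1)) / 4 := by
  have h1 := h (x.1 + 1, x.2) ((adj_iff _ _).2 (by simp))
  have h2 := h (x.1 - 1, x.2) ((adj_iff _ _).2 (by simp))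
  have h3 := h (x.1, x.2 + 1) ((adj_iff _ _).2 (by simp))
  have h4 := h (x.1, x.2 - 1) ((adj_iff _ _).2 (by simp))
  rw [Real.log_mul (by positivity) (by positivity), Real.log_mul (by positivity) (by positivity),
    Real.log_mul (by positivity) (by positivity)]
  rfl

lemma logp_sub (x : Lat) : Real.log (nsq x + 1) ≤ avg (fun z => Real.log (nsq z + 1)) x := by
  rw [avg_log (g := fun z => nsq z + 1) (fun y _ => by have := nsq_nonneg y; positivity)]
  have h4 : Real.log ((nsq x + 1) ^ 4) = 4 * Real.log (nsq x + 1) := by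
    rw [Real.log_pow]; norm_num
  have := Real.log_le_log (x := (nsq x + 1) ^ 4)
    (y := (nsq (x.1 + 1, x.2) + 1) * (nsq (x.1 - 1, x.2) + 1) * (nsq (x.1, x.2 + 1) + 1) *
      (nsq (x.1, x.2 - 1) + 1)) (by have := nsq_nonneg x; positivity) (by
      unfold nsq; push_cast
      set a := (x.1 : ℝ); set b := (x.2 : ℝ)
      nlinarith [sq_nonneg (a * b), sq_nonneg (a ^ 2 + b ^ 2), sq_nonneg a, sq_nonneg b])
  rw [h4] at this
  linarith

lemma logm_super (x : Lat) (hx : 3 ≤ linf x) :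
    avg (fun z => Real.log (nsq z - 1)) x ≤ Real.log (nsq x - 1) := by
  have hpos : ∀ y, 2 ≤ linf y → 0 < nsq y - 1 := by
    intro y hy
    have h1 := nsq_ge y
    have h2 : (2 : ℝ) ≤ linf y := by exact_mod_cast hy
    nlinarith
  rw [avg_log (g := fun z => nsq z - 1) (fun y hy => hpos y (by have := linf_adj hy; omega))]
  have h4 : Real.log ((nsq x - 1) ^ 4) = 4 * Real.log (nsq x - 1) := by
    rw [Real.log_pow]; norm_num
  have hS : 9 ≤ nsq x := by
    have h1 := nsq_ge x
    have h2 : (3 : ℝ) ≤ linf x := by exact_mod_cast hx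
    nlinarith
  have := Real.log_le_log (y := (nsq x - 1) ^ 4)
    (x := (nsq (x.1 + 1, x.2) - 1) * (nsq (x.1 - 1, x.2) - 1) * (nsq (x.1, x.2 + 1) - 1) *
      (nsq (x.1, x.2 - 1) - 1)) (by
      have h1 := hpos (x.1 + 1, x.2) (by
        have := linf_adj (x := x) (y := (x.1 + 1, x.2)) ((adj_iff _ _).2 (by simp)); omega)
      have h2 := hpos (x.1 - 1, x.2) (by
        have := linf_adj (x := x) (y := (x.1 - 1, x.2)) ((adj_iff _ _).2 (by simp)); omega)
      have h3 := hpos (x.1, x.2 + 1) (by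
        have := linf_adj (x := x) (y := (x.1, x.2 + 1)) ((adj_iff _ _).2 (by simp)); omega)
      have h4 := hpos (x.1, x.2 - 1) (by
        have := linf_adj (x := x) (y := (x.1, x.2 - 1)) ((adj_iff _ _).2 (by simp)); omega)
      positivity) (by
      unfold nsq at hS ⊢; push_cast
      set a := (x.1 : ℝ); set b := (x.2 : ℝ)
      nlinarith [sq_nonneg (a ^ 2 - b ^ 2), sq_nonneg (a ^ 2 + b ^ 2)])
  rw [h4] at this
  linarith

/-- Inner potential: `h` is a nonnegative supersolution with source `avg (eS s)` on the ring. -/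
lemma alpha_pot {s ρ : ℤ} (hs : 2 ≤ s) (hρ : 2 * s ≤ ρ) : ∃ h : Lat → ℝ, (∀ x, 0 ≤ h x) ∧
    (∀ x, linf x < ρ → (if linf x = s then avg (eS s) x else 0) + avg h x ≤ h x) ∧
    ∀ x, h x ≤ 5 * Real.log (ρ / s) := by
  have hs' : (2 : ℝ) ≤ s := by exact_mod_cast hs
  have hρ' : (2 : ℝ) * s ≤ ρ := by exact_mod_cast hρ
  set H := dir (Dn s ρ) (fun z => if ρ ≤ linf z then 1 else 0) with hH
  have hH0 : ∀ x, 0 ≤ H x := dir_nonneg _ _ (fun x => by split_ifs <;> norm_num)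
  have hH1 : ∀ x, H x ≤ 1 := by
    refine mp2 (Dn s ρ) H (fun _ => 1) (fun _ => 0) ?_ ?_ ?_
    · intro x hx; rw [zero_add, hH, ← dir_in _ _ hx]
    · intro x hx; rw [zero_add, avg_const]
    · intro x hx; rw [hH, dir_out _ _ hx]; split_ifs <;> norm_num
  have hHs : ∀ x, linf x ≤ s → H x = 0 := by
    intro x hx
    rw [hH, dir_out _ _ (by rw [mem_Dn]; omega), if_neg (by omega)]
  have hHρ : ∀ x, ρ ≤ linf x → H x = 1 := by
    intro x hx
    rw [hH, dir_out _ _ (by rw [mem_Dn]; omega), if_pos (by omega)]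
  set LL := Real.log (ρ / s) with hLL
  have hLLpos : 0 < LL := Real.log_pos (by rw [lt_div_iff₀ (by linarith)]; linarith)
  set Q := Real.log (2 * s ^ 2 + 1) with hQ
  -- lower bound for H
  have hlow : ∀ x ∈ Dn s ρ, (Real.log (nsq x + 1) - Q) / (2 * LL) ≤ H x := by
    refine mp3 (Dn s ρ) (fun x => (Real.log (nsq x + 1) - Q) / (2 * LL)) H (fun _ => 0) ?_ ?_ ?_
    · intro x hx
      rw [zero_add]
      have : avg (fun x => (Real.log (nsq x + 1) - Q) / (2 * LL)) x =
          (avg (fun x => Real.log (nsq x + 1)) x - Q) / (2 * LL) := by unfold avg; ring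
      rw [this]
      gcongr
      exact logp_sub x
    · intro x hx; rw [zero_add, hH, ← dir_in _ _ hx]
    · intro x hx y hy hxy
      have h1 := linf_adj hxy
      rw [mem_Dn] at hx hy
      by_cases h : linf x ≤ s
      · rw [hHs x h]
        refine div_nonpos_of_nonpos_of_nonneg ?_ (by positivity)
        have h2 := nsq_le x
        have h3 : (linf x : ℝ) ≤ s := by exact_mod_cast h
        have h4 : (0 : ℝ) ≤ linf x := by exact_mod_cast linf_nonneg x
        have := Real.log_le_log (x := nsq x + 1) (y := 2 * s ^ 2 + 1)
          (by have := nsq_nonneg x; positivity) (by nlinarith)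
        linarith
      · have h5 : linf x = ρ := by omega
        rw [hHρ x h5.ge, div_le_one (by positivity), hQ, hLL]
        rw [← Real.log_div (by have := nsq_nonneg x; positivity) (by positivity),
          show (2 : ℝ) * Real.log (ρ / s) = Real.log ((ρ / s) ^ 2) by rw [Real.log_pow]; norm_num]
        refine Real.log_le_log (by have := nsq_nonneg x; positivity) ?_
        rw [div_pow, div_le_div_iff₀ (by positivity) (by positivity)]
        have h2 := nsq_le x
        rw [h5] at h2
        nlinarith [mul_le_mul_of_nonneg_right h2 (sq_nonneg (s : ℝ))]
  set m := 1 / (5 * LL) with hm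
  have hmpos : 0 < m := by positivity
  have hm2 : ∀ x, linf x = 2 * s → m ≤ H x := by
    intro x hx
    by_cases h : x ∈ Dn s ρ
    · refine le_trans ?_ (hlow x h)
      have h1 := nsq_ge x
      rw [hx] at h1
      push_cast at h1
      have h2 : (2 : ℝ) / 5 ≤ Real.log (nsq x + 1) - Q := by
        rw [hQ, ← Real.log_div (by have := nsq_nonneg x; positivity) (by positivity)]
        have h3 : (5 : ℝ) / 3 ≤ (nsq x + 1) / (2 * s ^ 2 + 1) := by
          rw [div_le_div_iff₀ (by norm_num) (by positivity)]; nlinarith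
        have h4 := Real.one_sub_inv_le_log_of_pos (x := (5 : ℝ) / 3) (by norm_num)
        have h5 := Real.log_le_log (by norm_num) h3
        norm_num at h4
        linarith
      rw [hm, div_le_div_iff₀ (by positivity) (by positivity)]
      nlinarith
    · rw [mem_Dn] at h
      rw [hHρ x (by omega), hm, div_le_one (by positivity)]
      have : Real.log 2 ≤ LL := Real.log_le_log (by norm_num) (by
        rw [le_div_iff₀ (by linarith)]; linarith)
      linarith [Real.log_two_gt_d9]
  have heH : ∀ x, linf x ≤ 2 * s → m * eS s x ≤ H x := by
    have out : ∀ x, x ∉ Dn s (2 * s) → linf x ≤ 2 * s → m * eS s x ≤ H x := by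
      intro x hx hx2
      rw [mem_Dn] at hx
      by_cases h : linf x ≤ s
      · rw [eS_zero (by omega) h, mul_zero]; exact hH0 x
      · rw [eS_one (by omega), mul_one]; exact hm2 x (by omega)
    intro x hx
    by_cases h : x ∈ Dn s (2 * s)
    · refine mp3 (Dn s (2 * s)) (fun x => m * eS s x) H (fun _ => 0) ?_ ?_ ?_ x h
      · intro x hx; rw [zero_add, avg_mul, eS, ← dir_in _ _ hx]
      · intro x hx
        rw [mem_Dn] at hx
        rw [zero_add, hH, ← dir_in _ _ (by rw [mem_Dn]; omega)]
      · intro x hx y hy hxy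
        have h1 := linf_adj hxy
        rw [mem_Dn] at hy
        exact out x hx (by omega)
    · exact out x h hx
  refine ⟨fun x => (1 - H x) / m, fun x => div_nonneg (by linarith [hH1 x]) hmpos.le, ?_, ?_⟩
  · intro x hx
    have e1 : avg (fun x => (1 - H x) / m) x = (1 - avg H x) / m := by unfold avg; ring
    rw [e1]
    beta_reduce
    split_ifs with h
    · rw [hHs x h.le]
      have h1 : m * avg (eS s) x ≤ avg H x := by
        rw [← avg_mul]
        exact avg_le fun y hy => heH y (by have := linf_adj hy; omega)
      rw [← sub_nonneg]
      have : (1 - 0) / m - (avg (eS s) x + (1 - avg H x) / m) = (avg H x - m * avg (eS s) x) / m := by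
        field_simp; ring
      rw [this]
      exact div_nonneg (by linarith) hmpos.le
    · rw [zero_add]
      gcongr
      by_cases h2 : linf x ≤ s
      · rw [hHs x h2]
        have : avg (fun _ => (0 : ℝ)) x ≤ avg H x := avg_le fun y _ => hH0 y
        rwa [avg_const] at this
      · rw [hH, ← dir_in _ _ (by rw [mem_Dn]; omega)]
  · intro x
    beta_reduce
    rw [hm, div_div_eq_mul_div, div_one]
    have := hH0 x
    nlinarith

/-- Outer potential. -/
lemma beta_pot {s ρ : ℤ} (hs : 2 ≤ s) (hρ : 2 * s ≤ ρ) : ∃ h : Lat → ℝ, (∀ x, 0 ≤ h x) ∧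
    (∀ x, s < linf x → (if linf x = ρ then avg (fR ρ) x else 0) + avg h x ≤ h x) ∧
    ∀ x, h x ≤ 3 * Real.log (2 * ρ / s) := by
  have hs' : (2 : ℝ) ≤ s := by exact_mod_cast hs
  have hρ' : (2 : ℝ) * s ≤ ρ := by exact_mod_cast hρ
  set H := dir (Dn s ρ) (fun z => if linf z ≤ s then 1 else 0) with hH
  have hH0 : ∀ x, 0 ≤ H x := dir_nonneg _ _ (fun x => by split_ifs <;> norm_num)
  have hH1 : ∀ x, H x ≤ 1 := by
    refine mp2 (Dn s ρ) H (fun _ => 1) (fun _ => 0) ?_ ?_ ?_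
    · intro x hx; rw [zero_add, hH, ← dir_in _ _ hx]
    · intro x hx; rw [zero_add, avg_const]
    · intro x hx; rw [hH, dir_out _ _ hx]; split_ifs <;> norm_num
  have hHs : ∀ x, linf x ≤ s → H x = 1 := by
    intro x hx
    rw [hH, dir_out _ _ (by rw [mem_Dn]; omega), if_pos (by omega)]
  have hHρ : ∀ x, ρ ≤ linf x → H x = 0 := by
    intro x hx
    rw [hH, dir_out _ _ (by rw [mem_Dn]; omega), if_neg (by omega)]
  set LL := Real.log (2 * ρ / s) with hLL
  have hLL1 : Real.log 4 ≤ LL := Real.log_le_log (by norm_num) (by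
        rw [le_div_iff₀ (by linarith)]; linarith)
  have hlog4 : Real.log 4 = 2 * Real.log 2 := by
    rw [show (4 : ℝ) = 2 ^ 2 by norm_num, Real.log_pow]; norm_num
  have hl2 := Real.log_two_gt_d9
  have hLLpos : 0 < LL := by linarith
  set Q := Real.log (ρ ^ 2 - 1) with hQ
  have hpos : ∀ y, s ≤ linf y → 0 < nsq y - 1 := by
    intro y hy
    have h1 := nsq_ge y
    have h2 : (2 : ℝ) ≤ linf y := by exact_mod_cast hs.trans hy
    nlinarith
  have hρp : (0 : ℝ) < ρ ^ 2 - 1 := by nlinarith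
  have hlow : ∀ x ∈ Dn s ρ, (Q - Real.log (nsq x - 1)) / (2 * LL) ≤ H x := by
    refine mp3 (Dn s ρ) (fun x => (Q - Real.log (nsq x - 1)) / (2 * LL)) H (fun _ => 0) ?_ ?_ ?_
    · intro x hx
      rw [zero_add]
      have : avg (fun x => (Q - Real.log (nsq x - 1)) / (2 * LL)) x =
          (Q - avg (fun x => Real.log (nsq x - 1)) x) / (2 * LL) := by unfold avg; ring
      rw [this]
      rw [mem_Dn] at hx
      gcongr
      exact logm_super x (by omega)
    · intro x hx; rw [zero_add, hH, ← dir_in _ _ hx]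
    · intro x hx y hy hxy
      have h1 := linf_adj hxy
      rw [mem_Dn] at hx hy
      have hx1 := hpos x (by omega)
      by_cases h : linf x ≤ s
      · have h5 : linf x = s := by omega
        rw [hHs x h, div_le_one (by positivity), hQ, hLL]
        rw [← Real.log_div hρp.ne' hx1.ne',
          show (2 : ℝ) * Real.log (2 * ρ / s) = Real.log ((2 * ρ / s) ^ 2) by
            rw [Real.log_pow]; norm_num]
        refine Real.log_le_log (by positivity) ?_
        rw [div_pow, div_le_div_iff₀ (by positivity) (by positivity)]
        have h2 := nsq_ge x
        rw [h5] at h2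
        have h6 : (s : ℝ) ^ 2 ≤ 4 * (nsq x - 1) := by nlinarith
        nlinarith [mul_le_mul_of_nonneg_left h6 (sq_nonneg (ρ : ℝ)), sq_nonneg (s : ℝ)]
      · have h5 : linf x = ρ := by omega
        rw [hHρ x h5.ge]
        refine div_nonpos_of_nonpos_of_nonneg ?_ (by positivity)
        have h2 := nsq_ge x
        rw [h5] at h2
        have := Real.log_le_log (x := (ρ : ℝ) ^ 2 - 1) (y := nsq x - 1) hρp (by linarith)
        linarith
  set m := 1 / (3 * LL) with hm
  have hmpos : 0 < m := by positivity
  have hm2 : ∀ x, linf x = ρ / 2 → m ≤ H x := by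
    intro x hx
    by_cases h : x ∈ Dn s ρ
    · refine le_trans ?_ (hlow x h)
      rw [mem_Dn] at h
      have h1 := nsq_le x
      have hxp := hpos x (by omega)
      have h0 : (0 : ℝ) ≤ linf x := by exact_mod_cast linf_nonneg x
      have h3 : 2 * (linf x : ℝ) ≤ ρ := by
        have : 2 * linf x ≤ ρ := by omega
        exact_mod_cast this
      have h2 : Real.log 2 ≤ Q - Real.log (nsq x - 1) := by
        rw [hQ, ← Real.log_div hρp.ne' hxp.ne']
        refine Real.log_le_log (by norm_num) ?_
        rw [le_div_iff₀ hxp]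
        nlinarith
      rw [hm, div_le_div_iff₀ (by positivity) (by positivity)]
      nlinarith
    · rw [mem_Dn] at h
      rw [hHs x (by omega), hm, div_le_one (by positivity)]
      linarith
  have heH : ∀ x, ρ / 2 ≤ linf x → m * fR ρ x ≤ H x := by
    have out : ∀ x, x ∉ Dn (ρ / 2) ρ → ρ / 2 ≤ linf x → m * fR ρ x ≤ H x := by
      intro x hx hx2
      rw [mem_Dn] at hx
      by_cases h : ρ ≤ linf x
      · rw [fR_zero (by omega) h, mul_zero]; exact hH0 x
      · rw [fR_one (by omega), mul_one]; exact hm2 x (by omega)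
    intro x hx
    by_cases h : x ∈ Dn (ρ / 2) ρ
    · refine mp3 (Dn (ρ / 2) ρ) (fun x => m * fR ρ x) H (fun _ => 0) ?_ ?_ ?_ x h
      · intro x hx; rw [zero_add, avg_mul, fR, ← dir_in _ _ hx]
      · intro x hx
        rw [mem_Dn] at hx
        rw [zero_add, hH, ← dir_in _ _ (by rw [mem_Dn]; omega)]
      · intro x hx y hy hxy
        have h1 := linf_adj hxy
        rw [mem_Dn] at hy
        exact out x hx (by omega)
    · exact out x h hx
  refine ⟨fun x => (1 - H x) / m, fun x => div_nonneg (by linarith [hH1 x]) hmpos.le, ?_, ?_⟩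
  · intro x hx
    have e1 : avg (fun x => (1 - H x) / m) x = (1 - avg H x) / m := by unfold avg; ring
    rw [e1]
    beta_reduce
    split_ifs with h
    · rw [hHρ x h.ge]
      have h1 : m * avg (fR ρ) x ≤ avg H x := by
        rw [← avg_mul]
        exact avg_le fun y hy => heH y (by have := linf_adj hy; omega)
      rw [← sub_nonneg]
      have : (1 - 0) / m - (avg (fR ρ) x + (1 - avg H x) / m) = (avg H x - m * avg (fR ρ) x) / m := by
        field_simp; ring
      rw [this]
      exact div_nonneg (by linarith) hmpos.le
    · rw [zero_add]
      gcongr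
      by_cases h2 : ρ ≤ linf x
      · rw [hHρ x h2]
        have : avg (fun _ => (0 : ℝ)) x ≤ avg H x := avg_le fun y _ => hH0 y
        rwa [avg_const] at this
      · rw [hH, ← dir_in _ _ (by rw [mem_Dn]; omega)]
  · intro x
    beta_reduce
    rw [hm, div_div_eq_mul_div, div_one]
    have := hH0 x
    nlinarith

lemma taylor_quarter : ∃ C δ : ℝ, 0 < C ∧ 0 < δ ∧ δ ≤ 1 / 2 ∧ ∀ w : ℂ, ‖w‖ < δ →
    ‖(1 + w) ^ (1 / 4 : ℂ) + (1 - w) ^ (1 / 4 : ℂ) + (1 + Complex.I * w) ^ (1 / 4 : ℂ)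
      + (1 - Complex.I * w) ^ (1 / 4 : ℂ) - 4‖ ≤ C * ‖w‖ ^ 4 := by
  have han : AnalyticAt ℂ (fun w : ℂ => (1 + w) ^ (1 / 4 : ℂ)) 0 := by
    refine AnalyticAt.cpow (by fun_prop) (by fun_prop) ?_
    simp
  obtain ⟨p, hp⟩ := han
  have hO := hp.isBigO_sub_partialSum_pow 4
  rw [Asymptotics.isBigO_iff] at hO
  obtain ⟨c, hc⟩ := hO
  rw [Metric.eventually_nhds_iff] at hc
  obtain ⟨δ, hδ, hc⟩ := hc
  have h0 : p.coeff 0 = 1 := by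
    have := hp.coeff_zero (fun _ => 0)
    rw [FormalMultilinearSeries.coeff]
    have h2 : p 0 1 = p 0 (fun _ => 0) := by congr 1; funext i; exact i.elim0
    rw [h2, this]; simp
  have hps : ∀ y, p.partialSum 4 y = 1 + y * p.coeff 1 + y ^ 2 * p.coeff 2 + y ^ 3 * p.coeff 3 := by
    intro y
    rw [FormalMultilinearSeries.partialSum]
    simp only [FormalMultilinearSeries.apply_eq_pow_smul_coeff, Finset.sum_range_succ,
      Finset.sum_range_zero, smul_eq_mul, h0]
    ring
  have hb : ∀ y : ℂ, ‖y‖ < δ → ‖(1 + y) ^ (1 / 4 : ℂ) - p.partialSum 4 y‖ ≤ (|c| + 1) * ‖y‖ ^ 4 := by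
    intro y hy
    have := hc (y := y) (by simpa using hy)
    rw [zero_add] at this
    refine this.trans ?_
    rw [norm_pow, norm_norm]
    gcongr
    linarith [le_abs_self c]
  refine ⟨4 * (|c| + 1), min δ (1 / 2), by positivity, by positivity, min_le_right _ _, ?_⟩
  intro w hw
  have hw' : ‖w‖ < δ := hw.trans_le (min_le_left _ _)
  have h1 := hb w hw'
  have h2 := hb (-w) (by simpa using hw')
  have h3 := hb (Complex.I * w) (by simpa using hw')
  have h4 := hb (-(Complex.I * w)) (by simpa using hw')
  rw [norm_neg] at h2 h4
  rw [norm_mul, Complex.norm_I, one_mul] at h3 h4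
  have e : (1 + w) ^ (1 / 4 : ℂ) + (1 - w) ^ (1 / 4 : ℂ) + (1 + Complex.I * w) ^ (1 / 4 : ℂ)
      + (1 - Complex.I * w) ^ (1 / 4 : ℂ) - 4 =
      ((1 + w) ^ (1 / 4 : ℂ) - p.partialSum 4 w) + ((1 + -w) ^ (1 / 4 : ℂ) - p.partialSum 4 (-w))
      + ((1 + Complex.I * w) ^ (1 / 4 : ℂ) - p.partialSum 4 (Complex.I * w))
      + ((1 + -(Complex.I * w)) ^ (1 / 4 : ℂ) - p.partialSum 4 (-(Complex.I * w))) := by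
    simp only [hps]
    have hI : Complex.I ^ 2 = -1 := Complex.I_sq
    have : (Complex.I * w) ^ 2 = - w ^ 2 := by rw [mul_pow, hI]; ring
    rw [← sub_eq_add_neg, ← sub_eq_add_neg]
    linear_combination 2 * p.coeff 2 * this
  rw [e]
  refine (norm_add₄_le).trans ?_
  linarith

lemma cpow_split {z w : ℂ} (hz : 1 ≤ z.re) (hw : ‖w‖ < 1 / 2) :
    (z * (1 + w)) ^ (1 / 4 : ℂ) = z ^ (1 / 4 : ℂ) * (1 + w) ^ (1 / 4 : ℂ) := by
  have hz0 : z ≠ 0 := by rintro rfl; norm_num at hz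
  have hre : 0 < (1 + w).re := by
    have := Complex.abs_re_le_norm w
    have := neg_abs_le w.re
    simp only [Complex.add_re, Complex.one_re]; linarith
  have hw0 : 1 + w ≠ 0 := by intro h; rw [h] at hre; simp at hre
  have hlog : Complex.log (z * (1 + w)) = Complex.log z + Complex.log (1 + w) := by
    rw [Complex.log_mul_eq_add_log_iff hz0 hw0]
    have h1 := abs_lt.1 (Complex.abs_arg_lt_pi_div_two_iff.2 (Or.inl (by linarith : 0 < z.re)))
    have h2 := abs_lt.1 (Complex.abs_arg_lt_pi_div_two_iff.2 (Or.inl hre))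
    constructor <;> linarith [h1.1, h1.2, h2.1, h2.2]
  rw [Complex.cpow_def_of_ne_zero (mul_ne_zero hz0 hw0), Complex.cpow_def_of_ne_zero hz0,
    Complex.cpow_def_of_ne_zero hw0, hlog, ← Complex.exp_add]
  ring_nf

lemma inv_sqrt_ge {ε : ℝ} (h1 : -(1 / 2) ≤ ε) (h2 : ε ≤ 1 / 2) :
    1 - ε / 2 + 3 * ε ^ 2 / 8 - 5 * ε ^ 3 / 16 ≤ 1 / Real.sqrt (1 + ε) := by
  have hp : 0 < Real.sqrt (1 + ε) := Real.sqrt_pos.2 (by linarith)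
  rw [le_div_iff₀ hp]
  set q := 1 - ε / 2 + 3 * ε ^ 2 / 8 - 5 * ε ^ 3 / 16 with hq
  refine abs_le_of_sq_le_sq' ?_ (by norm_num) |>.2
  rw [mul_pow, Real.sq_sqrt (by linarith)]
  have e : q ^ 2 * (1 + ε) = 1 - ε ^ 4 * (35 / 64 - 14 / 64 * ε + 35 / 256 * ε ^ 2
      - 25 / 256 * ε ^ 3) := by rw [hq]; ring
  rw [e]
  have h3 : 0 ≤ 35 / 64 - 14 / 64 * ε + 35 / 256 * ε ^ 2 - 25 / 256 * ε ^ 3 := by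
    nlinarith [sq_nonneg ε, mul_nonneg (sq_nonneg ε) (by linarith : 0 ≤ 1 / 2 - ε)]
  have : 0 ≤ ε ^ 4 * (35 / 64 - 14 / 64 * ε + 35 / 256 * ε ^ 2 - 25 / 256 * ε ^ 3) := by positivity
  linarith

/-- Complex coordinate. -/
def zc (z : Lat) : ℂ := ⟨z.1, z.2⟩

lemma zc_norm (z : Lat) : ‖zc z‖ = Real.sqrt (nsq z) := by
  rw [Complex.norm_def, Complex.normSq_apply, zc, nsq]; congr 1; ring

lemma invn_sub (x : Lat) (hx : 100 ≤ nsq x) :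
    1 / Real.sqrt (nsq x) * (1 + 1 / (8 * nsq x)) ≤ avg (fun z => 1 / Real.sqrt (nsq z)) x := by
  set n := nsq x with hn
  have hn0 : 0 < n := by linarith
  have hx1 : (x.1 : ℝ) ^ 2 ≤ n := by rw [hn, nsq]; nlinarith
  have hx2 : (x.2 : ℝ) ^ 2 ≤ n := by rw [hn, nsq]; nlinarith
  have key : ∀ a : ℝ, a ^ 2 ≤ 5 * n → ∀ z, nsq z = n + a → 1 / Real.sqrt n *
      (1 - (a / n) / 2 + 3 * (a / n) ^ 2 / 8 - 5 * (a / n) ^ 3 / 16) ≤ 1 / Real.sqrt (nsq z) := by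
    intro a ha z hz
    have h1 : |a / n| ≤ 1 / 2 := by
      refine abs_le_of_sq_le_sq ?_ (by norm_num)
      rw [div_pow, div_le_iff₀ (by positivity)]; nlinarith
    rw [abs_le] at h1
    have h2 := inv_sqrt_ge (ε := a / n) (by linarith [h1.1]) h1.2
    have h3 : nsq z = n * (1 + a / n) := by rw [hz]; field_simp
    rw [h3, Real.sqrt_mul hn0.le, ← one_div_mul_one_div]
    exact mul_le_mul_of_nonneg_left h2 (by positivity)
  have k1 := key (1 + 2 * x.1) (by nlinarith [sq_nonneg ((x.1 : ℝ) - 1)]) (x.1 + 1, x.2) (by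
    rw [hn, nsq, nsq]; push_cast; ring)
  have k2 := key (1 - 2 * x.1) (by nlinarith [sq_nonneg ((x.1 : ℝ) + 1)]) (x.1 - 1, x.2) (by
    rw [hn, nsq, nsq]; push_cast; ring)
  have k3 := key (1 + 2 * x.2) (by nlinarith [sq_nonneg ((x.2 : ℝ) - 1)]) (x.1, x.2 + 1) (by
    rw [hn, nsq, nsq]; push_cast; ring)
  have k4 := key (1 - 2 * x.2) (by nlinarith [sq_nonneg ((x.2 : ℝ) + 1)]) (x.1, x.2 - 1) (by
    rw [hn, nsq, nsq]; push_cast; ring)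
  have hp : 0 < 1 / Real.sqrt n := by have := Real.sqrt_pos.2 hn0; positivity
  have hsum : 1 / Real.sqrt n * (4 + 1 / n - 6 / n ^ 2 - 5 / 4 / n ^ 3) ≤
      4 * avg (fun z => 1 / Real.sqrt (nsq z)) x := by
    have e : 1 / Real.sqrt n * (4 + 1 / n - 6 / n ^ 2 - 5 / 4 / n ^ 3) =
        1 / Real.sqrt n * (4 - 4 / n / 2 + 3 * ((4 + 8 * (x.1 ^ 2 + x.2 ^ 2)) / n ^ 2) / 8
          - 5 * ((4 + 24 * (x.1 ^ 2 + x.2 ^ 2)) / n ^ 3) / 16) := by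
      rw [show (x.1 : ℝ) ^ 2 + x.2 ^ 2 = n from rfl]
      congr 1; field_simp; ring
    rw [e]
    refine le_trans (le_of_eq ?_) ((add_le_add (add_le_add (add_le_add k1 k2) k3) k4).trans
      (le_of_eq ?_))
    · ring
    · unfold avg; ring
  have h5 : 1 / Real.sqrt n * (4 * (1 + 1 / (8 * n))) ≤
      1 / Real.sqrt n * (4 + 1 / n - 6 / n ^ 2 - 5 / 4 / n ^ 3) := by
    refine mul_le_mul_of_nonneg_left ?_ hp.le
    rw [← sub_nonneg]
    have : 4 + 1 / n - 6 / n ^ 2 - 5 / 4 / n ^ 3 - 4 * (1 + 1 / (8 * n)) =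
      (n ^ 2 / 2 - 6 * n - 5 / 4) / n ^ 3 := by field_simp; ring
    rw [this]
    refine div_nonneg (by nlinarith) (by positivity)
  linarith

/-- The barrier function. -/
def Vf (z : Lat) : ℝ := ((zc z) ^ (1 / 4 : ℂ)).re + 1 - 1 / Real.sqrt (nsq z)

lemma quarter_cast : (1 / 4 : ℂ) = ((1 / 4 : ℝ) : ℂ) := by push_cast; rfl

lemma Vf_super : ∃ N : ℝ, 0 < N ∧ ∀ x : Lat, 1 ≤ x.1 → N ≤ nsq x → avg Vf x < Vf x := by
  obtain ⟨C, δ, hC, hδ, hδ2, hT⟩ := taylor_quarter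
  refine ⟨100 + (1 / δ) ^ 2 + 1 + (8 * C + 1) ^ 4, by positivity, ?_⟩
  intro x hx1 hN
  have hpa : 0 ≤ (1 / δ) ^ 2 := by positivity
  have hpb : 0 ≤ (8 * C + 1) ^ 4 := by positivity
  have hn100 : 100 ≤ nsq x := by linarith
  have hn0 : 0 < nsq x := by linarith
  set z := zc x with hz
  have hre : 1 ≤ z.re := by
    simp only [hz, zc]; exact_mod_cast hx1
  have hnz : ‖z‖ = Real.sqrt (nsq x) := zc_norm x
  set ρ := ‖z‖ with hρ
  have hρ2 : ρ ^ 2 = nsq x := by rw [hnz, Real.sq_sqrt hn0.le]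
  have hρ0 : 0 < ρ := by rw [hnz]; exact Real.sqrt_pos.2 hn0
  have hz0 : z ≠ 0 := norm_pos_iff.1 hρ0
  have hδρ : ‖z⁻¹‖ < δ := by
    rw [norm_inv, ← hρ, inv_lt_comm₀ hρ0 hδ]
    have : (1 / δ) ^ 2 < ρ ^ 2 := by rw [hρ2]; linarith
    have := lt_of_pow_lt_pow_left₀ 2 hρ0.le this
    rwa [one_div] at this
  have hT' := hT z⁻¹ hδρ
  have s1 : zc (x.1 + 1, x.2) = z * (1 + z⁻¹) := by
    rw [mul_add, mul_inv_cancel₀ hz0, mul_one]; apply Complex.ext <;> simp [zc, hz]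
  have s2 : zc (x.1 - 1, x.2) = z * (1 + -z⁻¹) := by
    rw [mul_add, mul_neg, mul_inv_cancel₀ hz0, mul_one]
    apply Complex.ext <;> simp [zc, hz, sub_eq_add_neg]
  have s3 : zc (x.1, x.2 + 1) = z * (1 + Complex.I * z⁻¹) := by
    rw [mul_add, mul_left_comm, mul_inv_cancel₀ hz0, mul_one, mul_one]
    apply Complex.ext <;> simp [zc, hz]
  have s4 : zc (x.1, x.2 - 1) = z * (1 + -(Complex.I * z⁻¹)) := by
    rw [mul_add, mul_neg, mul_left_comm, mul_inv_cancel₀ hz0, mul_one, mul_one]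
    apply Complex.ext <;> simp [zc, hz, sub_eq_add_neg]
  have hd : ‖z⁻¹‖ < 1 / 2 := hδρ.trans_le hδ2
  have hd3 : ‖Complex.I * z⁻¹‖ < 1 / 2 := by rw [norm_mul, Complex.norm_I, one_mul]; exact hd
  have hG : avg (fun z => ((zc z) ^ (1 / 4 : ℂ)).re) x ≤ (z ^ (1 / 4 : ℂ)).re +
      ‖z ^ (1 / 4 : ℂ)‖ * (C * ‖z⁻¹‖ ^ 4) := by
    unfold avg
    beta_reduce
    rw [s1, s2, s3, s4, cpow_split hre hd, cpow_split hre (by rwa [norm_neg]),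
      cpow_split hre hd3, cpow_split hre (by rwa [norm_neg])]
    set G := z ^ (1 / 4 : ℂ)
    set S := (1 + z⁻¹) ^ (1 / 4 : ℂ) + (1 - z⁻¹) ^ (1 / 4 : ℂ) +
      (1 + Complex.I * z⁻¹) ^ (1 / 4 : ℂ) + (1 - Complex.I * z⁻¹) ^ (1 / 4 : ℂ) - 4 with hS
    have e : ((G * (1 + z⁻¹) ^ (1 / 4 : ℂ)).re + (G * (1 + -z⁻¹) ^ (1 / 4 : ℂ)).re +
        (G * (1 + Complex.I * z⁻¹) ^ (1 / 4 : ℂ)).re +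
        (G * (1 + -(Complex.I * z⁻¹)) ^ (1 / 4 : ℂ)).re) / 4 = G.re + (G * S).re / 4 := by
      have : (G * S).re + 4 * G.re = (G * (1 + z⁻¹) ^ (1 / 4 : ℂ)).re +
        (G * (1 + -z⁻¹) ^ (1 / 4 : ℂ)).re + (G * (1 + Complex.I * z⁻¹) ^ (1 / 4 : ℂ)).re +
        (G * (1 + -(Complex.I * z⁻¹)) ^ (1 / 4 : ℂ)).re := by
        rw [← sub_eq_add_neg, ← sub_eq_add_neg]
        have e2 : (4 * G.re) = (G * 4).re := by simp [Complex.mul_re]; ring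
        rw [e2, ← Complex.add_re, ← Complex.add_re, ← Complex.add_re, ← Complex.add_re]
        congr 1; rw [hS]; ring
      linarith
    rw [e]
    have h1 : (G * S).re ≤ ‖G‖ * (C * ‖z⁻¹‖ ^ 4) :=
      (Complex.re_le_norm _).trans (by rw [norm_mul]; gcongr)
    have h2 : 0 ≤ ‖G‖ * (C * ‖z⁻¹‖ ^ 4) := by positivity
    linarith
  have hI := invn_sub x hn100
  have hav : avg Vf x = avg (fun z => ((zc z) ^ (1 / 4 : ℂ)).re) x + 1 -
      avg (fun z => 1 / Real.sqrt (nsq z)) x := by unfold avg Vf; ring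
  rw [hav, Vf]
  have hGn : ‖z ^ (1 / 4 : ℂ)‖ ≤ Real.sqrt ρ := by
    rw [quarter_cast, Complex.norm_cpow_real, Real.sqrt_eq_rpow]
    refine Real.rpow_le_rpow_of_exponent_le ?_ (by norm_num)
    rw [← hρ]; nlinarith
  set τ := Real.sqrt ρ with hτ
  have hτ2 : τ ^ 2 = ρ := Real.sq_sqrt hρ0.le
  have hτ0 : 0 < τ := Real.sqrt_pos.2 hρ0
  have hτC : 8 * C < τ := by
    have : (8 * C + 1) ^ 4 ≤ τ ^ 4 := by
      rw [show τ ^ 4 = (τ ^ 2) ^ 2 by ring, hτ2, hρ2]; linarith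
    have := le_of_pow_le_pow_left₀ (by norm_num) hτ0.le this
    linarith
  have h8 : ‖z ^ (1 / 4 : ℂ)‖ * (C * ‖z⁻¹‖ ^ 4) < 1 / ρ * (1 / (8 * nsq x)) := by
    calc ‖z ^ (1 / 4 : ℂ)‖ * (C * ‖z⁻¹‖ ^ 4) ≤ τ * (C * ‖z⁻¹‖ ^ 4) := by gcongr
      _ = C / τ ^ 7 := by rw [norm_inv, ← hρ, ← hτ2]; field_simp
      _ < 1 / ρ * (1 / (8 * nsq x)) := by
        rw [← hρ2, ← hτ2, div_mul_div_comm, div_lt_div_iff₀ (by positivity) (by positivity)]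
        have : 0 < τ ^ 6 := by positivity
        nlinarith
  rw [← hnz] at hI ⊢
  rw [mul_add, mul_one] at hI
  linarith

lemma Vf_form (x : Lat) : Vf x = (Real.sqrt (nsq x)) ^ (1 / 4 : ℝ) *
    Real.cos ((zc x).arg * (1 / 4)) + 1 - 1 / Real.sqrt (nsq x) := by
  rw [Vf, quarter_cast, Complex.cpow_ofReal_re, zc_norm]

lemma sqrt_nsq_ge (x : Lat) : (linf x : ℝ) ≤ Real.sqrt (nsq x) := by
  refine Real.le_sqrt_of_sq_le (nsq_ge x)

lemma sqrt_nsq_le (x : Lat) : Real.sqrt (nsq x) ≤ 2 * linf x := by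
  have : (0 : ℝ) ≤ linf x := by exact_mod_cast linf_nonneg x
  rw [Real.sqrt_le_left (by positivity)]
  nlinarith [nsq_le x]

lemma arg_bd {x : Lat} (hx : 0 ≤ x.1) : |(zc x).arg| ≤ Real.pi / 2 := by
  rw [Complex.abs_arg_le_pi_div_two_iff]
  simp only [zc]; exact_mod_cast hx

lemma cos8_ge : (9 : ℝ) / 10 ≤ Real.cos (Real.pi / 8) := by
  have h1 := Real.one_sub_sq_div_two_le_cos (x := Real.pi / 8)
  have h2 := Real.pi_lt_d2
  have h3 := Real.pi_pos
  have h4 : Real.pi ^ 2 < 3.15 ^ 2 := by nlinarith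
  norm_num at h4
  nlinarith

lemma Vf_bounds {x : Lat} (hx : 0 ≤ x.1) (h1 : 1 ≤ linf x) :
    (1 / 2) * (linf x : ℝ) ^ (1 / 4 : ℝ) ≤ Vf x ∧ Vf x ≤ 4 * (linf x : ℝ) ^ (1 / 4 : ℝ) := by
  have hl : (1 : ℝ) ≤ linf x := by exact_mod_cast h1
  have ha := sqrt_nsq_ge x
  have hb := sqrt_nsq_le x
  set m := (linf x : ℝ)
  set ρ := Real.sqrt (nsq x)
  have hρ : 1 ≤ ρ := hl.trans ha
  have hinv : 1 / ρ ≤ 1 := by rw [div_le_one (by linarith)]; exact hρ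
  have hinv0 : 0 < 1 / ρ := by positivity
  have p1 : m ^ (1 / 4 : ℝ) ≤ ρ ^ (1 / 4 : ℝ) := Real.rpow_le_rpow (by linarith) ha (by norm_num)
  have p2 : ρ ^ (1 / 4 : ℝ) ≤ 2 * m ^ (1 / 4 : ℝ) := by
    refine (Real.rpow_le_rpow (by linarith) hb (by norm_num)).trans ?_
    rw [Real.mul_rpow (by norm_num) (by linarith)]
    gcongr
    have := Real.rpow_le_rpow_of_exponent_le (x := 2) (y := 1 / 4) (z := 1) (by norm_num)
      (by norm_num)
    rwa [Real.rpow_one] at this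
  have p3 : 1 ≤ m ^ (1 / 4 : ℝ) := Real.one_le_rpow hl (by norm_num)
  have hc1 := Real.cos_le_one ((zc x).arg * (1 / 4))
  have hc2 : 9 / 10 ≤ Real.cos ((zc x).arg * (1 / 4)) := by
    refine cos8_ge.trans ?_
    rw [← Real.cos_abs ((zc x).arg * (1 / 4))]
    have := arg_bd hx
    refine Real.cos_le_cos_of_nonneg_of_le_pi (abs_nonneg _) (by linarith [Real.pi_pos]) ?_
    rw [abs_mul, abs_of_pos (by norm_num : (0 : ℝ) < 1 / 4)]; linarith
  rw [Vf_form]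
  constructor <;> nlinarith

lemma Vf_conj {x : Lat} (hx : 0 ≤ x.1) : Vf (x.1, -x.2) = Vf x := by
  have h1 : nsq (x.1, -x.2) = nsq x := by unfold nsq; push_cast; ring
  have h2 : zc (x.1, -x.2) = (starRingEnd ℂ) (zc x) := by
    apply Complex.ext <;> simp [zc]
  rw [Vf_form, Vf_form, h1, h2, Complex.arg_conj]
  have := arg_bd hx
  rw [if_neg (by intro h; rw [h, abs_of_pos Real.pi_pos] at this; linarith [Real.pi_pos])]
  rw [neg_mul, Real.cos_neg]

lemma Vf_axis {t : ℤ} (ht : 2 ≤ t) : Real.cos (Real.pi / 8) * Vf (t, 0) < Vf (0, t) := by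
  have ht' : (2 : ℝ) ≤ t := by exact_mod_cast ht
  have n1 : Real.sqrt (nsq (t, 0)) = t := by
    unfold nsq; push_cast; rw [zero_pow (by norm_num), add_zero, Real.sqrt_sq (by linarith)]
  have n2 : Real.sqrt (nsq (0, t)) = t := by
    unfold nsq; push_cast; rw [zero_pow (by norm_num), zero_add, Real.sqrt_sq (by linarith)]
  have a1 : (zc (t, 0)).arg = 0 := by
    rw [show zc (t, 0) = ((t : ℝ) : ℂ) by apply Complex.ext <;> simp [zc]]
    exact Complex.arg_ofReal_of_nonneg (by linarith)
  have a2 : (zc (0, t)).arg = Real.pi / 2 := by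
    rw [show zc (0, t) = ((t : ℝ) : ℂ) * Complex.I by apply Complex.ext <;> simp [zc]]
    rw [Complex.arg_real_mul _ (by linarith), Complex.arg_I]
  rw [Vf_form, Vf_form, n1, n2, a1, a2, zero_mul, Real.cos_zero, mul_one,
    show Real.pi / 2 * (1 / 4) = Real.pi / 8 by ring]
  have hc : Real.cos (Real.pi / 8) < 1 := by
    rw [← Real.cos_zero]
    exact Real.cos_lt_cos_of_nonneg_of_le_pi le_rfl (by linarith [Real.pi_pos])
      (by linarith [Real.pi_pos])
  have : (1 : ℝ) / t < 1 := by rw [div_lt_one (by linarith)]; linarith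
  nlinarith

/-- Complex average. -/
def cavg (w : Lat → ℂ) (x : Lat) : ℂ :=
  (w (x.1 + 1, x.2) + w (x.1 - 1, x.2) + w (x.1, x.2 + 1) + w (x.1, x.2 - 1)) / 4

lemma norm_cavg_le (w : Lat → ℂ) (x : Lat) : ‖cavg w x‖ ≤ avg (fun z => ‖w z‖) x := by
  unfold cavg avg
  rw [norm_div]
  simp only [Complex.norm_ofNat]
  gcongr
  exact norm_add₄_le

lemma linf_conj (x : Lat) : linf (x.1, -x.2) = linf x := by
  unfold linf; simp

lemma linf_x {t : ℤ} (ht : 0 ≤ t) : linf (t, 0) = t := by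
  unfold linf; simp [abs_of_nonneg ht, ht]

lemma linf_y {t : ℤ} (ht : 0 ≤ t) : linf (0, t) = t := by
  unfold linf; simp [abs_of_nonneg ht, ht]

lemma even_part {s ρ : ℤ} (hs : 2 ≤ s) (hV : ∀ x : Lat, 1 ≤ x.1 → s < linf x → avg Vf x < Vf x)
    (v : Lat → ℂ) (B κ : ℝ) (hκ : ∀ x : Lat, 0 ≤ x.1 → linf x = ρ → B ≤ κ * Vf x) (hκ0 : 0 ≤ κ)
    (hh : ∀ x : Lat, 1 ≤ x.1 → x ∈ Dn s ρ → v x = cavg v x)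
    (h0 : ∀ x : Lat, 0 ≤ x.1 → linf x ≤ s → v x = 0)
    (hB : ∀ x : Lat, 0 ≤ x.1 → linf x = ρ → ‖v x‖ ≤ B)
    (hp : ∀ t : ℤ, 0 ≤ t → ‖v (0, t)‖ ≤ Real.cos (Real.pi / 8) * ‖v (t, 0)‖)
    (hm : ∀ t : ℤ, 0 ≤ t → ‖v (0, -t)‖ ≤ Real.cos (Real.pi / 8) * ‖v (t, 0)‖) :
    ∀ x : Lat, 0 ≤ x.1 → 1 ≤ linf x → linf x ≤ ρ → ‖v x‖ ≤ κ * Vf x := by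
  have hVpos : ∀ x : Lat, 0 ≤ x.1 → 1 ≤ linf x → 0 < Vf x := by
    intro x hx h1
    refine lt_of_lt_of_le ?_ (Vf_bounds hx h1).1
    have : (0 : ℝ) < linf x := by exact_mod_cast (by omega : 0 < linf x)
    positivity
  by_contra hc
  push Not at hc
  obtain ⟨x0, hx0, h1, h2, hbad⟩ := hc
  let Ω := (Dn s ρ).filter (fun x => 0 ≤ x.1)
  have hΩ : ∀ x : Lat, x ∈ Ω ↔ (s < linf x ∧ linf x < ρ) ∧ 0 ≤ x.1 := by
    intro x; simp only [Ω, Finset.mem_filter, mem_Dn]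
  have hx0Ω : x0 ∈ Ω := by
    rw [hΩ]
    refine ⟨⟨?_, ?_⟩, hx0⟩
    · by_contra h
      rw [h0 x0 hx0 (by omega), norm_zero] at hbad
      have := mul_nonneg hκ0 (hVpos x0 hx0 h1).le
      linarith
    · by_contra h
      have h3 : linf x0 = ρ := by omega
      linarith [hκ x0 hx0 h3, hB x0 hx0 h3]
  obtain ⟨p, hpΩ, hpm⟩ := Ω.exists_max_image (fun x => ‖v x‖ / Vf x) ⟨x0, hx0Ω⟩
  set k := ‖v p‖ / Vf p with hk
  have hkκ : κ < k := by
    refine lt_of_lt_of_le ?_ (hpm x0 hx0Ω)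
    rw [lt_div_iff₀ (hVpos x0 hx0 h1)]; exact hbad
  have hk0 : 0 < k := by linarith
  have hall : ∀ y : Lat, 0 ≤ y.1 → 1 ≤ linf y → linf y ≤ ρ → ‖v y‖ ≤ k * Vf y := by
    intro y hy hy1 hy2
    have hVy := hVpos y hy hy1
    by_cases h : y ∈ Ω
    · have := hpm y h
      rwa [div_le_iff₀ hVy] at this
    · rw [hΩ] at h
      by_cases h3 : linf y ≤ s
      · rw [h0 y hy h3, norm_zero]; positivity
      · have h4 : linf y = ρ := by omega
        have h5 := hκ y hy h4
        have h6 := hB y hy h4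
        have : κ * Vf y ≤ k * Vf y := by gcongr
        linarith
  rw [hΩ] at hpΩ
  have hVp := hVpos p hpΩ.2 (by omega)
  have heq : ‖v p‖ = k * Vf p := by rw [hk]; field_simp
  by_cases hp1 : 1 ≤ p.1
  · have h3 := norm_cavg_le v p
    rw [← hh p hp1 (mem_Dn.2 hpΩ.1)] at h3
    have h4 : avg (fun z => ‖v z‖) p ≤ avg (fun z => k * Vf z) p := by
      refine avg_le fun y hy => hall y ?_ ?_ ?_
      · rcases (adj_iff _ _).1 hy with rfl | rfl | rfl | rfl <;> simp only <;> omega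
      · have := linf_adj hy; omega
      · have := linf_adj hy; omega
    rw [avg_mul] at h4
    have h5 := mul_lt_mul_of_pos_left (hV p hp1 hpΩ.1.1) hk0
    linarith
  · obtain ⟨a, b⟩ := p
    simp only at hp1 hpΩ
    obtain rfl : a = 0 := by omega
    have hl1 := (linf_eq (u := ((0 : ℤ), b))).1 rfl
    set m := linf (0, b) with hm'
    clear_value m
    simp only at hl1
    have hlm : linf (m, 0) = m := linf_x (by omega)
    have hax := Vf_axis (t := m) (by omega)
    have h5 := hall (m, 0) (by simp only; omega) (by omega) (by omega)
    have hcos : 0 < Real.cos (Real.pi / 8) := by linarith [cos8_ge]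
    have h6 := mul_le_mul_of_nonneg_left h5 hcos.le
    have h7 := mul_lt_mul_of_pos_left hax hk0
    have hb : b = m ∨ b = -m := by omega
    rcases hb with rfl | rfl
    · have := hp b (by omega); linarith
    · have h8 := hm m (by omega)
      have := Vf_conj (x := ((0 : ℤ), m)) le_rfl
      simp only at this
      rw [this] at heq
      linarith

lemma sector {s ρ : ℤ} (hs : 2 ≤ s) (hV : ∀ x : Lat, 1 ≤ x.1 → s < linf x → avg Vf x < Vf x)
    (g : Lat → ℂ) (ω : ℂ) (hω : ‖ω‖ = 1) (hωr : |ω.re| ≤ Real.cos (Real.pi / 8)) (B κ : ℝ)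
    (hκ : ∀ x : Lat, 0 ≤ x.1 → linf x = ρ → B ≤ κ * Vf x) (hκ0 : 0 ≤ κ)
    (hh : ∀ x : Lat, 1 ≤ x.1 → x ∈ Dn s ρ → g x = cavg g x)
    (h0 : ∀ x : Lat, 0 ≤ x.1 → linf x ≤ s → g x = 0)
    (hB : ∀ x : Lat, 0 ≤ x.1 → linf x = ρ → ‖g x‖ ≤ B)
    (hp : ∀ t : ℤ, 0 ≤ t → g (0, t) = ω * g (t, 0))
    (hm : ∀ t : ℤ, 0 ≤ t → g (0, -t) = (starRingEnd ℂ) ω * g (t, 0)) :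
    ∀ x : Lat, 0 ≤ x.1 → 1 ≤ linf x → linf x ≤ ρ → ‖g x‖ ≤ 3 * κ * Vf x := by
  have hVpos : ∀ x : Lat, 0 ≤ x.1 → 1 ≤ linf x → 0 < Vf x := by
    intro x hx h1
    refine lt_of_lt_of_le ?_ (Vf_bounds hx h1).1
    have : (0 : ℝ) < linf x := by exact_mod_cast (by omega : 0 < linf x)
    positivity
  have hhc : ∀ x : Lat, 1 ≤ x.1 → x ∈ Dn s ρ → g (x.1, -x.2) = cavg (fun z => g (z.1, -z.2)) x := by
    intro x hx hD
    have := hh (x.1, -x.2) hx (by rw [mem_Dn, linf_conj]; exact mem_Dn.1 hD)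
    rw [this, cavg, cavg]
    simp only
    rw [show -(x.2 + 1) = -x.2 - 1 by ring, show -(x.2 - 1) = -x.2 + 1 by ring]
    ring
  have hev : ∀ x : Lat, 0 ≤ x.1 → 1 ≤ linf x → linf x ≤ ρ →
      ‖(g x + g (x.1, -x.2)) / 2‖ ≤ κ * Vf x := by
    have e1 : ∀ t : ℤ, 0 ≤ t → ‖(ω * g (t, 0) + (starRingEnd ℂ) ω * g (t, 0)) / 2‖ ≤
        Real.cos (Real.pi / 8) * ‖g (t, 0)‖ := by
      intro t ht
      rw [← add_mul, Complex.add_conj, show ((2 * ω.re : ℝ) : ℂ) * g (t, 0) / 2 =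
        (ω.re : ℂ) * g (t, 0) by push_cast; ring, norm_mul, Complex.norm_real, Real.norm_eq_abs]
      gcongr
    refine even_part hs hV (fun x => (g x + g (x.1, -x.2)) / 2) B κ hκ hκ0 ?_ ?_ ?_ ?_ ?_
    · intro x hx hD
      beta_reduce
      rw [hhc x hx hD, hh x hx hD]; unfold cavg; ring
    · intro x hx hl
      beta_reduce
      rw [h0 x hx hl, h0 (x.1, -x.2) hx (by rw [linf_conj]; exact hl)]; simp
    · intro x hx hl
      beta_reduce
      rw [norm_div, Complex.norm_ofNat, div_le_iff₀ (by norm_num)]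
      refine (norm_add_le _ _).trans ?_
      linarith [hB x hx hl, hB (x.1, -x.2) hx (by rw [linf_conj]; exact hl)]
    · intro t ht
      have := e1 t ht
      simp only [neg_zero, hp t ht, hm t ht]
      rwa [show (g (t, 0) + g (t, 0)) / 2 = g (t, 0) by ring]
    · intro t ht
      have := e1 t ht
      simp only [neg_zero, neg_neg, hp t ht, hm t ht]
      rwa [add_comm, show (g (t, 0) + g (t, 0)) / 2 = g (t, 0) by ring]
  have haxis : ∀ t : ℤ, 1 ≤ t → t ≤ ρ → ‖g (t, 0)‖ ≤ κ * Vf (t, 0) := by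
    intro t ht ht2
    have hl : linf (t, 0) = t := linf_x (by omega)
    have := hev (t, 0) (by simp only; omega) (by omega) (by omega)
    simp only [neg_zero] at this
    rwa [show (g (t, 0) + g (t, 0)) / 2 = g (t, 0) by ring] at this
  have hodd : ∀ x : Lat, 0 ≤ x.1 → 0 ≤ x.2 → 1 ≤ linf x → linf x ≤ ρ →
      ‖(g x - g (x.1, -x.2)) / 2‖ ≤ 2 * κ * Vf x := by
    have out : ∀ x : Lat, 0 ≤ x.1 → 0 ≤ x.2 → 1 ≤ linf x → linf x ≤ ρ →
        (x.1 = 0 ∨ x.2 = 0 ∨ linf x ≤ s ∨ linf x = ρ) →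
        ‖(g x - g (x.1, -x.2)) / 2‖ ≤ 2 * κ * Vf x := by
      intro x hx hx2 hl1 hl2 hcase
      have hVx := hVpos x hx hl1
      have hkV := mul_nonneg hκ0 hVx.le
      rcases hcase with h | h | h | h
      · obtain ⟨a, b⟩ := x
        simp only at h hx hx2
        subst h
        have hl : linf (0, b) = b := linf_y (by omega)
        have hl' : linf (b, 0) = b := linf_x (by omega)
        by_cases hb1 : b ≤ s
        · rw [h0 (0, b) le_rfl (by omega), h0 _ (by simp) (by rw [linf_conj]; omega)]
          simp; linarith
        simp only [hp b hx2, hm b hx2]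
        have h3 := haxis b (by omega) (by omega)
        have h4 := Vf_axis (t := b) (by omega)
        have h5 : ‖(ω * g (b, 0) - (starRingEnd ℂ) ω * g (b, 0)) / 2‖ ≤ ‖g (b, 0)‖ := by
          rw [norm_div, Complex.norm_ofNat, div_le_iff₀ (by norm_num)]
          refine (norm_sub_le _ _).trans ?_
          rw [norm_mul, norm_mul, RCLike.norm_conj, hω]; linarith
        have h6 : 0 < Vf (b, 0) := hVpos _ hx2 (by omega)
        have h7 : Vf (b, 0) ≤ 2 * Vf (0, b) := by nlinarith [cos8_ge]
        nlinarith [mul_le_mul_of_nonneg_left h7 hκ0]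
      · obtain ⟨a, b⟩ := x
        simp only at h
        subst h
        simp only [neg_zero, sub_self, zero_div, norm_zero]
        linarith
      · rw [h0 x hx h, h0 (x.1, -x.2) hx (by rw [linf_conj]; exact h)]
        simp; linarith
      · rw [norm_div, Complex.norm_ofNat, div_le_iff₀ (by norm_num)]
        refine (norm_sub_le _ _).trans ?_
        linarith [hB x hx h, hB (x.1, -x.2) hx (by rw [linf_conj]; exact h), hκ x hx h]
    intro x hx hx2 hl1 hl2
    by_cases hcase : x.1 = 0 ∨ x.2 = 0 ∨ linf x ≤ s ∨ linf x = ρ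
    · exact out x hx hx2 hl1 hl2 hcase
    · have hmem : ∀ x : Lat, x ∈ (Dn s ρ).filter (fun x => 1 ≤ x.1 ∧ 1 ≤ x.2) ↔
        (s < linf x ∧ linf x < ρ) ∧ 1 ≤ x.1 ∧ 1 ≤ x.2 := by
        intro x; rw [Finset.mem_filter, mem_Dn]
      refine mp3 ((Dn s ρ).filter (fun x => 1 ≤ x.1 ∧ 1 ≤ x.2))
        (fun x => ‖(g x - g (x.1, -x.2)) / 2‖) (fun x => 2 * κ * Vf x) (fun _ => 0) ?_ ?_ ?_ x ?_
      · intro x hx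
        rw [hmem] at hx
        rw [zero_add]
        refine le_trans (le_of_eq ?_) (norm_cavg_le (fun x => (g x - g (x.1, -x.2)) / 2) x)
        beta_reduce
        rw [hhc x hx.2.1 (mem_Dn.2 hx.1), hh x hx.2.1 (mem_Dn.2 hx.1)]
        congr 1; unfold cavg; ring
      · intro x hx
        rw [hmem] at hx
        rw [zero_add, avg_mul]
        exact mul_le_mul_of_nonneg_left (hV x hx.2.1 hx.1.1).le (by linarith)
      · intro x hx y hy hxy
        rw [hmem] at hx hy
        have h1 := linf_adj hxy
        have hxx : 0 ≤ x.1 ∧ 0 ≤ x.2 := by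
          rcases (adj_iff _ _).1 hxy with rfl | rfl | rfl | rfl <;> simp only <;> omega
        exact out x hxx.1 hxx.2 (by omega) (by omega) (by omega)
      · rw [hmem]; omega
  intro x hx hl1 hl2
  have e1 := hev x hx hl1 hl2
  have e2 : ‖(g x - g (x.1, -x.2)) / 2‖ ≤ 2 * κ * Vf x := by
    by_cases h : 0 ≤ x.2
    · exact hodd x hx h hl1 hl2
    · have := hodd (x.1, -x.2) hx (by simp only; omega) (by rw [linf_conj]; exact hl1)
        (by rw [linf_conj]; exact hl2)
      rw [Vf_conj hx] at this
      simp only [neg_neg] at this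
      rwa [← norm_neg, ← neg_div, neg_sub] at this
  calc ‖g x‖ = ‖(g x + g (x.1, -x.2)) / 2 + (g x - g (x.1, -x.2)) / 2‖ := by congr 1; ring
    _ ≤ κ * Vf x + 2 * κ * Vf x := (norm_add_le _ _).trans (add_le_add e1 e2)
    _ = 3 * κ * Vf x := by ring

/-- Twist of an edge. -/
def tw (z w : Lat) : ℂ := Complex.I ^ (cr (0, 0) z w)

lemma tw_norm (z w : Lat) : ‖tw z w‖ = 1 := by rw [tw, norm_zpow, Complex.norm_I, one_zpow]

/-- Twisted average. -/
def tavg (u : Lat → ℂ) (x : Lat) : ℂ :=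
  (tw x (x.1 + 1, x.2) * u (x.1 + 1, x.2) + tw x (x.1 - 1, x.2) * u (x.1 - 1, x.2) +
    tw x (x.1, x.2 + 1) * u (x.1, x.2 + 1) + tw x (x.1, x.2 - 1) * u (x.1, x.2 - 1)) / 4

lemma norm_tavg_le (w : Lat → ℂ) (x : Lat) : ‖tavg w x‖ ≤ avg (fun z => ‖w z‖) x := by
  unfold tavg avg
  rw [norm_div]
  simp only [Complex.norm_ofNat]
  gcongr
  refine (norm_add₄_le).trans (le_of_eq ?_)
  simp only [norm_mul, tw_norm, one_mul]

lemma tw_h (x : Lat) (b : ℤ) (h : x.1 ≠ b) (c : ℤ) : tw x (b, c) = 1 := by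
  rw [tw, cr, if_neg (by simp only; omega), zpow_zero]

lemma tw_neg (x : Lat) (h : x.1 ≤ 0) (w : Lat) : tw x w = 1 := by
  rw [tw, cr, if_neg (by simp only; omega), zpow_zero]

lemma tw_up (x : Lat) : tw x (x.1, x.2 + 1) = if 1 ≤ x.1 ∧ x.2 = 0 then Complex.I else 1 := by
  rw [tw, cr]
  split_ifs <;> first | omega | simp | (simp only at *; omega)

lemma tw_down (x : Lat) : tw x (x.1, x.2 - 1) = if 1 ≤ x.1 ∧ x.2 = 1 then -Complex.I else 1 := by
  rw [tw, cr]
  split_ifs <;> first | omega | simp | (simp only at *; omega)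

lemma tavg_eq (u : Lat → ℂ) (x : Lat) : tavg u x = (u (x.1 + 1, x.2) + u (x.1 - 1, x.2) +
    (if 1 ≤ x.1 ∧ x.2 = 0 then Complex.I else 1) * u (x.1, x.2 + 1) +
    (if 1 ≤ x.1 ∧ x.2 = 1 then -Complex.I else 1) * u (x.1, x.2 - 1)) / 4 := by
  rw [tavg, tw_up, tw_down, tw_h _ _ (by omega), tw_h _ _ (by omega)]; ring

/-- Sector functions. -/
def us0 (u : Lat → ℂ) (x : Lat) : ℂ := if x.2 ≤ 0 then u x else Complex.I * u x

def us1 (u : Lat → ℂ) (x : Lat) : ℂ :=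
  if x.1 = 0 ∧ x.2 < 0 then u (-x.2, x.1) else Complex.I * u (-x.2, x.1)

def us2 (u : Lat → ℂ) (x : Lat) : ℂ := Complex.I * u (-x.1, -x.2)

def us3 (u : Lat → ℂ) (x : Lat) : ℂ := Complex.I * u (x.2, -x.1)

lemma us0_h (u : Lat → ℂ) (x : Lat) (hx : 1 ≤ x.1) (h : u x = tavg u x) :
    us0 u x = cavg (us0 u) x := by
  rw [tavg_eq] at h
  unfold cavg us0
  simp only
  rw [h]
  have hI := Complex.I_mul_I
  rcases lt_trichotomy x.2 0 with h1 | h1 | h1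
  · simp only [if_pos h1.le, if_pos (by omega : (x.2 + 1 ≤ 0)),
        if_pos (by omega : (x.2 - 1 ≤ 0)), if_neg (by omega : ¬ (1 ≤ x.1 ∧ x.2 = 0)),
        if_neg (by omega : ¬ (1 ≤ x.1 ∧ x.2 = 1))]
    ring
  · rw [h1]
    simp [hx]
  · by_cases h2 : x.2 = 1
    · rw [h2]
      simp [hx]
      linear_combination (-(u (x.1, 0)) / 4) * hI
    · simp only [if_neg (by omega : ¬ (x.2 ≤ 0)), if_neg (by omega : ¬ (x.2 + 1 ≤ 0)),
        if_neg (by omega : ¬ (x.2 - 1 ≤ 0)), if_neg (by omega : ¬ (1 ≤ x.1 ∧ x.2 = 0)),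
        if_neg (by omega : ¬ (1 ≤ x.1 ∧ x.2 = 1))]; ring

lemma us1_h (u : Lat → ℂ) (x : Lat) (hx : 1 ≤ x.1) (h : u (-x.2, x.1) = tavg u (-x.2, x.1)) :
    us1 u x = cavg (us1 u) x := by
  rw [tavg_eq] at h
  simp only at h
  unfold cavg us1
  simp only
  have hI := Complex.I_mul_I
  rw [h]
  simp only [if_neg (by omega : ¬ (x.1 = 0 ∧ x.2 < 0)), if_neg (by omega : ¬ (x.1 + 1 = 0 ∧ x.2 < 0)),
    if_neg (by omega : ¬ (x.1 = 0 ∧ x.2 + 1 < 0)), if_neg (by omega : ¬ (x.1 = 0 ∧ x.2 - 1 < 0)),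
    if_neg (by omega : ¬ (1 ≤ -x.2 ∧ x.1 = 0))]
  rw [show -(x.2 + 1) = -x.2 - 1 by ring, show -(x.2 - 1) = -x.2 + 1 by ring]
  by_cases h1 : 1 ≤ -x.2 ∧ x.1 = 1
  · rw [if_pos h1, if_pos (by omega : x.1 - 1 = 0 ∧ x.2 < 0)]
    linear_combination (-(u (-x.2, x.1 - 1)) / 4) * hI
  · rw [if_neg h1, if_neg (by omega : ¬ (x.1 - 1 = 0 ∧ x.2 < 0))]
    ring

lemma us2_h (u : Lat → ℂ) (x : Lat) (hx : 1 ≤ x.1) (h : u (-x.1, -x.2) = tavg u (-x.1, -x.2)) :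
    us2 u x = cavg (us2 u) x := by
  rw [tavg_eq] at h
  simp only at h
  unfold cavg us2
  simp only
  rw [h, if_neg (by omega), if_neg (by omega)]
  rw [show -(x.2 + 1) = -x.2 - 1 by ring, show -(x.2 - 1) = -x.2 + 1 by ring,
    show -(x.1 + 1) = -x.1 - 1 by ring, show -(x.1 - 1) = -x.1 + 1 by ring]
  ring

lemma us3_h (u : Lat → ℂ) (x : Lat) (hx : 1 ≤ x.1) (h : u (x.2, -x.1) = tavg u (x.2, -x.1)) :
    us3 u x = cavg (us3 u) x := by
  rw [tavg_eq] at h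
  simp only at h
  unfold cavg us3
  simp only
  rw [h, if_neg (by omega), if_neg (by omega),
    show -(x.1 + 1) = -x.1 - 1 by ring, show -(x.1 - 1) = -x.1 + 1 by ring]
  ring

lemma linf_rot1 (x : Lat) : linf (-x.2, x.1) = linf x := by unfold linf; simp [max_comm]

lemma linf_rot2 (x : Lat) : linf (-x.1, -x.2) = linf x := by unfold linf; simp

lemma linf_rot3 (x : Lat) : linf (x.2, -x.1) = linf x := by unfold linf; simp [max_comm]

/-- Rotation-symmetrised function. -/
def gs (u : Lat → ℂ) (ω : ℂ) (x : Lat) : ℂ :=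
  us0 u x + (starRingEnd ℂ) ω * us1 u x + (starRingEnd ℂ) ω ^ 2 * us2 u x +
    (starRingEnd ℂ) ω ^ 3 * us3 u x

lemma gs_bound {s ρ : ℤ} (hs : 2 ≤ s) (hsρ : s < ρ)
    (hV : ∀ x : Lat, 1 ≤ x.1 → s < linf x → avg Vf x < Vf x)
    (u : Lat → ℂ) (ω : ℂ) (hω : ‖ω‖ = 1) (hω4 : ω ^ 4 = Complex.I)
    (hωr : |ω.re| ≤ Real.cos (Real.pi / 8)) (B κ : ℝ)
    (hκ : ∀ x : Lat, 0 ≤ x.1 → linf x = ρ → 4 * B ≤ κ * Vf x) (hκ0 : 0 ≤ κ)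
    (hh : ∀ x ∈ Dn s ρ, u x = tavg u x) (h0 : ∀ x : Lat, linf x ≤ s → u x = 0)
    (hB : ∀ x : Lat, linf x = ρ → ‖u x‖ ≤ B) :
    ∀ x : Lat, 0 ≤ x.1 → 1 ≤ linf x → linf x ≤ ρ → ‖gs u ω x‖ ≤ 3 * κ * Vf x := by
  have hcc : ω * (starRingEnd ℂ) ω = 1 := by
    rw [Complex.mul_conj, Complex.normSq_eq_norm_sq, hω]; norm_num
  set c := (starRingEnd ℂ) ω with hc
  have hcn : ‖c‖ = 1 := by rw [hc, RCLike.norm_conj, hω]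
  have hc3 : c ^ 3 * Complex.I = ω := by
    rw [← hω4, show c ^ 3 * ω ^ 4 = (ω * c) ^ 3 * ω by ring, hcc]; ring
  have hc4 : c ^ 4 = -Complex.I := by
    rw [hc, ← map_pow, hω4, Complex.conj_I]
  have h00 : u (0, 0) = 0 := h0 _ (by unfold linf; simp; omega)
  refine sector hs hV (gs u ω) ω hω hωr (4 * B) κ hκ hκ0 ?_ ?_ ?_ ?_ ?_
  · intro x hx hD
    rw [mem_Dn] at hD
    have e0 := us0_h u x hx (hh x (mem_Dn.2 hD))
    have e1 := us1_h u x hx (hh _ (mem_Dn.2 (by rwa [linf_rot1])))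
    have e2 := us2_h u x hx (hh _ (mem_Dn.2 (by rwa [linf_rot2])))
    have e3 := us3_h u x hx (hh _ (mem_Dn.2 (by rwa [linf_rot3])))
    rw [gs, e0, e1, e2, e3]
    unfold cavg gs; ring
  · intro x _ hl
    have e1 := h0 (-x.2, x.1) (by rwa [linf_rot1])
    have e2 := h0 (-x.1, -x.2) (by rwa [linf_rot2])
    have e3 := h0 (x.2, -x.1) (by rwa [linf_rot3])
    simp [gs, us0, us1, us2, us3, h0 x hl, e1, e2, e3]
  · intro x _ hl
    have n0 : ‖us0 u x‖ ≤ B := by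
      rw [us0]; split_ifs
      · exact hB x hl
      · rw [norm_mul, Complex.norm_I, one_mul]; exact hB x hl
    have n1 : ‖us1 u x‖ ≤ B := by
      have := hB (-x.2, x.1) (by rwa [linf_rot1])
      rw [us1]; split_ifs
      · exact this
      · rw [norm_mul, Complex.norm_I, one_mul]; exact this
    have n2 : ‖us2 u x‖ ≤ B := by
      rw [us2, norm_mul, Complex.norm_I, one_mul]; exact hB _ (by rwa [linf_rot2])
    have n3 : ‖us3 u x‖ ≤ B := by
      rw [us3, norm_mul, Complex.norm_I, one_mul]; exact hB _ (by rwa [linf_rot3])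
    unfold gs
    refine norm_add₄_le.trans ?_
    rw [norm_mul, norm_mul, norm_mul, norm_pow, norm_pow, hcn]
    linarith
  · intro t ht
    rcases ht.eq_or_lt with rfl | ht
    · simp [gs, us0, us1, us2, us3, h00]
    · have a0 : us0 u (0, t) = us1 u (t, 0) := by
        simp [us0, us1, ht.ne', not_le.2 ht]
      have a1 : us1 u (0, t) = us2 u (t, 0) := by
        simp [us1, us2, ht.le]
      have a2 : us2 u (0, t) = us3 u (t, 0) := by
        simp only [us3, us2]; simp
      have a3 : us3 u (0, t) = Complex.I * us0 u (t, 0) := by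
        simp only [us3, us0]; simp
      rw [gs, gs, a0, a1, a2, a3]
      linear_combination us0 u (t, 0) * hc3 - (us1 u (t, 0) + c * us2 u (t, 0) +
        c ^ 2 * us3 u (t, 0)) * hcc
  · intro t ht
    rcases ht.eq_or_lt with rfl | ht
    · simp [gs, us0, us1, us2, us3, h00]
    · have a0 : us0 u (0, -t) = - Complex.I * us3 u (t, 0) := by
        simp only [us0, us3]; rw [if_pos (by omega : -t ≤ 0)]
        linear_combination (u (0, -t)) * Complex.I_mul_I
      have a1 : us1 u (0, -t) = us0 u (t, 0) := by
        simp [us1, us0, ht]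
      have a2 : us2 u (0, -t) = us1 u (t, 0) := by
        simp [us2, us1]
      have a3 : us3 u (0, -t) = us2 u (t, 0) := by
        simp [us3, us2]
      rw [gs, gs, a0, a1, a2, a3]
      linear_combination (- us3 u (t, 0)) * hc4

lemma om_spec : ∃ ω : ℂ, ω ^ 4 = Complex.I ∧ ‖ω‖ = 1 ∧ |ω.re| ≤ Real.cos (Real.pi / 8) ∧
    |ω.im| ≤ Real.cos (Real.pi / 8) := by
  refine ⟨Complex.exp ((Real.pi / 8 : ℝ) * Complex.I), ?_, Complex.norm_exp_ofReal_mul_I _, ?_, ?_⟩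
  · rw [← Complex.exp_nat_mul]
    rw [show ((4 : ℕ) : ℂ) * ((Real.pi / 8 : ℝ) * Complex.I) = (Real.pi / 2) * Complex.I by
      push_cast; ring]
    exact Complex.exp_pi_div_two_mul_I
  · rw [Complex.exp_ofReal_mul_I_re, abs_of_nonneg (by linarith [cos8_ge])]
  · rw [Complex.exp_ofReal_mul_I_im]
    have h1 := Real.sin_sq_add_cos_sq (Real.pi / 8)
    have h2 := cos8_ge
    refine abs_le_of_sq_le_sq ?_ (by linarith)
    nlinarith

lemma lemA : ∃ s0 : ℤ, 2 ≤ s0 ∧ ∀ (s ρ : ℤ) (u : Lat → ℂ) (B : ℝ), s0 ≤ s → s < ρ → 0 ≤ B →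
    (∀ x ∈ Dn s ρ, u x = tavg u x) → (∀ x : Lat, linf x ≤ s → u x = 0) →
    (∀ x : Lat, linf x = ρ → ‖u x‖ ≤ B) → ∀ x : Lat, 1 ≤ linf x → linf x ≤ ρ →
    ‖u x‖ ≤ 96 * B * ((linf x : ℝ) / ρ) ^ (1 / 4 : ℝ) := by
  obtain ⟨N, hN0, hN⟩ := Vf_super
  obtain ⟨ω, hω4, hωn, hωr, hωi⟩ := om_spec
  refine ⟨max 2 ⌈N⌉, le_max_left _ _, ?_⟩
  intro s ρ u B hs hsρ hB0 hh h0 hB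
  have hs2 : 2 ≤ s := (le_max_left _ _).trans hs
  have hV : ∀ x : Lat, 1 ≤ x.1 → s < linf x → avg Vf x < Vf x := by
    intro x hx hl
    refine hN x hx ?_
    have h1 : ⌈N⌉ ≤ linf x := ((le_max_right _ _).trans hs).trans hl.le
    have h2 : N ≤ linf x := Int.ceil_le.1 h1
    have h3 : (1 : ℝ) ≤ linf x := by exact_mod_cast (by omega : 1 ≤ linf x)
    nlinarith [nsq_ge x]
  have hρ0 : (0 : ℝ) < ρ := by exact_mod_cast (by omega : 0 < ρ)
  have hq : 0 < (ρ : ℝ) ^ (1 / 4 : ℝ) := by positivity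
  set κ := 8 * B / (ρ : ℝ) ^ (1 / 4 : ℝ) with hκd
  have hκ0 : 0 ≤ κ := by positivity
  have hκ : ∀ x : Lat, 0 ≤ x.1 → linf x = ρ → 4 * B ≤ κ * Vf x := by
    intro x hx hl
    have := (Vf_bounds hx (by omega)).1
    rw [hl] at this
    calc 4 * B = κ * (1 / 2 * (ρ : ℝ) ^ (1 / 4 : ℝ)) := by rw [hκd]; field_simp; ring
      _ ≤ κ * Vf x := by gcongr
  have hI4 : Complex.I ^ 4 = 1 := Complex.I_pow_four
  have key : ∀ x : Lat, 0 ≤ x.1 → 1 ≤ linf x → linf x ≤ ρ →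
      ‖us0 u x‖ ≤ 3 * κ * Vf x ∧ ‖us2 u x‖ ≤ 3 * κ * Vf x := by
    intro x hx h1 h2
    have b0 := gs_bound hs2 hsρ hV u ω hωn hω4 hωr B κ hκ hκ0 hh h0 hB x hx h1 h2
    have b1 := gs_bound hs2 hsρ hV u (ω * Complex.I) (by simp [hωn])
      (by rw [mul_pow, hω4, hI4, mul_one]) (by simpa using hωi) B κ hκ hκ0 hh h0 hB x hx h1 h2
    have b2 := gs_bound hs2 hsρ hV u (-ω) (by simp [hωn])
      (by rw [neg_pow, hω4]; norm_num) (by simpa using hωr) B κ hκ hκ0 hh h0 hB x hx h1 h2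
    have b3 := gs_bound hs2 hsρ hV u (-(ω * Complex.I)) (by simp [hωn])
      (by rw [neg_pow, mul_pow, hω4, hI4]; norm_num) (by simpa using hωi) B κ hκ hκ0 hh h0 hB
      x hx h1 h2
    have hI2 : Complex.I ^ 2 = -1 := Complex.I_sq
    have hcc : (starRingEnd ℂ) ω * ω = 1 := by
      rw [mul_comm, Complex.mul_conj, Complex.normSq_eq_norm_sq, hωn]; norm_num
    have hcc2 : (starRingEnd ℂ) ω ^ 2 * ω ^ 2 = 1 := by rw [← mul_pow, hcc, one_pow]
    constructor
    · have e : us0 u x = (gs u ω x + gs u (ω * Complex.I) x + gs u (-ω) x +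
          gs u (-(ω * Complex.I)) x) / 4 := by
        simp only [gs, map_neg, map_mul, Complex.conj_I]
        linear_combination (-(starRingEnd ℂ) ω ^ 2 * us2 u x / 2) * hI2
      rw [e, norm_div, Complex.norm_ofNat, div_le_iff₀ (by norm_num)]
      refine norm_add₄_le.trans ?_
      linarith
    · have e : us2 u x = ω ^ 2 * (gs u ω x - gs u (ω * Complex.I) x + gs u (-ω) x -
          gs u (-(ω * Complex.I)) x) / 4 := by
        simp only [gs, map_neg, map_mul, Complex.conj_I]
        linear_combination (-us2 u x) * hcc2 + (ω ^ 2 * (starRingEnd ℂ) ω ^ 2 * us2 u x / 2) * hI2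
      rw [e, norm_div, Complex.norm_ofNat, div_le_iff₀ (by norm_num), norm_mul, norm_pow, hωn,
        one_pow, one_mul, sub_eq_add_neg, sub_eq_add_neg]
      refine norm_add₄_le.trans ?_
      rw [norm_neg, norm_neg]
      linarith
  have fin : ∀ x : Lat, 0 ≤ x.1 → 1 ≤ linf x →
      3 * κ * Vf x ≤ 96 * B * ((linf x : ℝ) / ρ) ^ (1 / 4 : ℝ) := by
    intro x hx h1
    have := (Vf_bounds hx h1).2
    have hl : (0 : ℝ) ≤ linf x := by exact_mod_cast linf_nonneg x
    calc 3 * κ * Vf x ≤ 3 * κ * (4 * (linf x : ℝ) ^ (1 / 4 : ℝ)) := by gcongr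
      _ = 96 * B * ((linf x : ℝ) / ρ) ^ (1 / 4 : ℝ) := by
        rw [Real.div_rpow hl hρ0.le, hκd]; ring
  intro x h1 h2
  by_cases hx : 0 ≤ x.1
  · refine le_trans (le_of_eq ?_) ((key x hx h1 h2).1.trans (fin x hx h1))
    rw [us0]; split_ifs
    · rfl
    · rw [norm_mul, Complex.norm_I, one_mul]
  · have hx' : 0 ≤ ((-x.1, -x.2) : Lat).1 := by simp only; omega
    have h1' : 1 ≤ linf (-x.1, -x.2) := by rwa [linf_rot2]
    have := (key (-x.1, -x.2) hx' h1' (by rwa [linf_rot2])).2.trans (fin _ hx' h1')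
    rw [linf_rot2] at this
    refine le_trans (le_of_eq ?_) this
    rw [us2, norm_mul, Complex.norm_I, one_mul]; simp

lemma tw_symm (x y : Lat) : tw y x = (starRingEnd ℂ) (tw x y) := by
  rw [tw, tw, cr_symm, map_zpow₀, Complex.conj_I, zpow_neg, ← inv_zpow, Complex.inv_I]

lemma tsum_eq (D : Finset Lat) (u : Lat → ℂ) (hu : ∀ y ∉ D, u y = 0) (x : Lat) :
    ∑ y ∈ D, (((if Adj x y then 1 / 4 else 0 : ℝ) : ℂ) * tw x y) * u y = tavg u x := by
  have h1 : ∑ y ∈ D, (((if Adj x y then 1 / 4 else 0 : ℝ) : ℂ) * tw x y) * u y =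
      ∑ y ∈ D.filter (fun y => Adj x y), (tw x y * u y) / 4 := by
    rw [Finset.sum_filter]
    refine Finset.sum_congr rfl fun y _ => ?_
    split_ifs
    · push_cast; ring
    · simp
  have h2 : ∑ y ∈ nbrs x, (tw x y * u y) / 4 = tavg u x := by
    rw [sum_nbrs, tavg]; ring
  rw [h1, ← h2]
  refine Finset.sum_subset ?_ ?_
  · intro y hy; rw [Finset.mem_filter] at hy; exact mem_nbrs.2 hy.2
  · intro y hy hn
    rw [Finset.mem_filter, not_and'] at hn
    rw [hu y (hn (mem_nbrs.1 hy))]; simp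

lemma avg_nsq (A : ℝ) (x : Lat) : avg (fun z => A - nsq z) x = A - nsq x - 1 := by
  unfold avg nsq; push_cast; ring

lemma psi_super (D : Finset Lat) (A : ℝ) (hA : ∀ x ∈ D, ∀ y, Adj x y → nsq y ≤ A) (x : Lat) (hx : x ∈ D) :
    ∑ y ∈ D, (if Adj x y then 1 / 4 else 0 : ℝ) * (A - nsq y) ≤ A - nsq x - 1 := by
  have h1 : ∑ y ∈ D, (if Adj x y then 1 / 4 else 0 : ℝ) * (A - nsq y) =
      ∑ y ∈ D.filter (fun y => Adj x y), (A - nsq y) / 4 := by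
    rw [Finset.sum_filter]
    refine Finset.sum_congr rfl fun y _ => ?_
    split_ifs
    · ring
    · simp
  rw [h1, ← avg_nsq]
  have h2 : ∑ y ∈ nbrs x, (A - nsq y) / 4 = avg (fun z => A - nsq z) x := by
    rw [sum_nbrs, avg]; ring
  rw [← h2]
  refine Finset.sum_le_sum_of_subset_of_nonneg ?_ ?_
  · intro y hy; rw [Finset.mem_filter] at hy; exact mem_nbrs.2 hy.2
  · intro y hy _
    have := hA x hx y (mem_nbrs.1 hy)
    linarith

lemma nsq_lt_of {s R : ℤ} {x : Lat} (hx : x ∈ Dn s R) : ∀ y, Adj x y → nsq y ≤ 2 * (R : ℝ) ^ 2 := by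
  intro y hy
  rw [mem_Dn] at hx
  have h1 := (linf_adj hy).1
  have h2 : (linf y : ℝ) ≤ R := by exact_mod_cast (by omega : linf y ≤ R)
  have h3 : (0 : ℝ) ≤ linf y := by exact_mod_cast linf_nonneg y
  have := nsq_le y
  nlinarith

/-- The plain lattice net. -/
def latNet (s R : ℤ) : Net Lat where
  U := Dn s R
  p := fun x y => if Adj x y then 1 / 4 else 0
  t := tw
  psi := fun z => 2 * (R : ℝ) ^ 2 + 1 - nsq z
  p_nonneg := fun x y => by split_ifs <;> norm_num
  p_symm := fun x y => by
    by_cases h : Adj x y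
    · rw [if_pos h, if_pos (adj_symm h)]
    · rw [if_neg h, if_neg (fun h' => h (adj_symm h'))]
  p_self := fun x => if_neg (fun h => adj_ne h rfl)
  t_norm := tw_norm
  t_symm := tw_symm
  psi_pos := fun x hx => by
    rw [mem_Dn] at hx
    have h2 : (linf x : ℝ) ≤ R := by exact_mod_cast hx.2.le
    have h3 : (0 : ℝ) ≤ linf x := by exact_mod_cast linf_nonneg x
    have := nsq_le x
    nlinarith
  super := fun x hx => by
    have := psi_super (Dn s R) (2 * (R : ℝ) ^ 2 + 1)
      (fun x hx y hy => by linarith [nsq_lt_of hx y hy]) x hx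
    linarith

/-- Twisted lattice solution. -/
def LSol (s R : ℤ) (b u : Lat → ℂ) : Prop :=
  (∀ x ∈ Dn s R, u x = b x + tavg u x) ∧ ∀ x ∉ Dn s R, u x = 0

lemma lsol_iff (s R : ℤ) (b u : Lat → ℂ) : LSol s R b u ↔ (latNet s R).IsSol (Dn s R) b u := by
  constructor
  · rintro ⟨h1, h2⟩
    refine ⟨fun x hx => ?_, h2⟩
    rw [h1 x hx, ← tsum_eq (Dn s R) u h2]; rfl
  · rintro ⟨h1, h2⟩
    refine ⟨fun x hx => ?_, h2⟩
    rw [h1 x hx, ← tsum_eq (Dn s R) u h2]; rfl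

/-- Twisted Green function. -/
def TG (s R : ℤ) (y : Lat) : Lat → ℂ := (latNet s R).sol (Dn s R) (fun z => if z = y then 1 else 0)

lemma TG_spec (s R : ℤ) (y : Lat) : LSol s R (fun z => if z = y then 1 else 0) (TG s R y) :=
  (lsol_iff _ _ _ _).2 ((latNet s R).sol_spec (Finset.Subset.refl _) _)

lemma TG_symm {s R : ℤ} {x y : Lat} (hx : x ∈ Dn s R) (hy : y ∈ Dn s R) :
    ‖TG s R y x‖ = ‖TG s R x y‖ := by
  have h := (latNet s R).sol_pairing (Finset.Subset.refl (Dn s R))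
    (fun z => if z = x then 1 else 0) (fun z => if z = y then 1 else 0)
  simp only [ite_mul, one_mul, zero_mul, Finset.sum_ite_eq', hx, hy, if_true, apply_ite (starRingEnd ℂ),
    map_one, map_zero, mul_ite, mul_one, mul_zero] at h
  have h' := congrArg norm h
  rw [RCLike.norm_conj] at h'
  exact h'

lemma TG_sub {s R : ℤ} {y x : Lat} (hx : x ∈ Dn s R) :
    ‖TG s R y x‖ ≤ (if x = y then 1 else 0) + avg (fun z => ‖TG s R y z‖) x := by
  rw [(TG_spec s R y).1 x hx]
  refine (norm_add_le _ _).trans ?_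
  refine add_le_add ?_ (norm_tavg_le _ _)
  split_ifs with h <;> simp [h]

lemma logF_super (y z : Lat) (A : ℝ) : (if z = y then 1 else 0) +
    avg (fun z => (A - Real.log (nsq (z - y) + 1)) / Real.log 2) z ≤
      (A - Real.log (nsq (z - y) + 1)) / Real.log 2 := by
  have hl : 0 < Real.log 2 := Real.log_pos (by norm_num)
  have e : avg (fun z => (A - Real.log (nsq (z - y) + 1)) / Real.log 2) z =
      (A - avg (fun z => Real.log (nsq z + 1)) (z - y)) / Real.log 2 := by
    unfold avg
    simp only [Prod.fst_sub, Prod.snd_sub]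
    rw [show ((z.1 + 1, z.2) : Lat) - y = (z.1 - y.1 + 1, z.2 - y.2) by ext <;> simp <;> ring,
      show ((z.1 - 1, z.2) : Lat) - y = (z.1 - y.1 - 1, z.2 - y.2) by ext <;> simp <;> ring,
      show ((z.1, z.2 + 1) : Lat) - y = (z.1 - y.1, z.2 - y.2 + 1) by ext <;> simp <;> ring,
      show ((z.1, z.2 - 1) : Lat) - y = (z.1 - y.1, z.2 - y.2 - 1) by ext <;> simp <;> ring]
    field_simp
    ring
  rw [e]
  split_ifs with h
  · subst h
    rw [sub_self]
    have : avg (fun z => Real.log (nsq z + 1)) 0 = Real.log 2 := by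
      unfold avg nsq; norm_num; ring
    rw [this]
    have : Real.log (nsq 0 + 1) = 0 := by unfold nsq; norm_num
    rw [this]
    apply le_of_eq
    field_simp; ring
  · rw [zero_add]
    gcongr
    exact logp_sub _

lemma TG_bound {s R : ℤ} (hs : 1 ≤ s) (hR : 8 ≤ R) {y : Lat} (hy : linf y = R / 2) {x : Lat}
    (hx : linf x ≤ R / 4) : ‖TG s R y x‖ ≤ 10 := by
  have hl : 0 < Real.log 2 := Real.log_pos (by norm_num)
  have hRr : (8 : ℝ) ≤ R := by exact_mod_cast hR
  by_cases hxD : x ∈ Dn s R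
  swap
  · rw [(TG_spec s R y).2 x hxD]; simp
  have key := mp3 (Dn s R) (fun z => ‖TG s R y z‖)
    (fun z => (Real.log (16 * (R : ℝ) ^ 2) - Real.log (nsq (z - y) + 1)) / Real.log 2)
    (fun z => if z = y then 1 else 0)
    (fun x hx => TG_sub hx) (fun x _ => logF_super y x _) ?_ x hxD
  · refine key.trans ?_
    beta_reduce
    rw [div_le_iff₀ hl]
    have h1 : linf y - linf x ≤ linf (x - y) := by
      unfold linf; simp only [Prod.fst_sub, Prod.snd_sub]; grind
    have h2 : (R : ℝ) / 8 ≤ linf (x - y) := by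
      have : R ≤ 8 * linf (x - y) := by omega
      have : (R : ℝ) ≤ 8 * linf (x - y) := by exact_mod_cast this
      linarith
    have h3 : (R : ℝ) ^ 2 / 64 ≤ nsq (x - y) := by
      refine le_trans ?_ (nsq_ge _)
      nlinarith
    have h4 : (10 : ℝ) * Real.log 2 = Real.log (2 ^ 10) := by rw [Real.log_pow]; norm_num
    rw [h4, sub_le_iff_le_add, ← Real.log_mul (by norm_num) (by have := nsq_nonneg (x - y); positivity)]
    apply Real.log_le_log (by positivity)
    nlinarith
  · intro z hz w hw hadj
    rw [(TG_spec s R y).2 z hz, norm_zero]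
    refine div_nonneg ?_ hl.le
    rw [sub_nonneg]
    have h1 : linf (z - y) ≤ linf z + linf y := by
      unfold linf; simp only [Prod.fst_sub, Prod.snd_sub]; grind
    have h2 := (linf_adj hadj).1
    rw [mem_Dn] at hw
    have h3 : (linf (z - y) : ℝ) ≤ 2 * R := by exact_mod_cast (by omega : linf (z - y) ≤ 2 * R)
    have h4 : (0 : ℝ) ≤ linf (z - y) := by exact_mod_cast linf_nonneg _
    apply Real.log_le_log (by linarith [nsq_nonneg (z - y)])
    have := nsq_le (z - y)
    nlinarith

lemma TG_est : ∃ s0 : ℤ, 2 ≤ s0 ∧ ∀ (s R : ℤ) (x y : Lat), s0 ≤ s → 16 * s ≤ R → linf x = s + 1 →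
    linf y = R - 1 → ‖TG s R y x‖ ≤ 1920 * ((s : ℝ) / R) ^ (1 / 4 : ℝ) * eS s x * fR R y := by
  obtain ⟨s0, h20, hA⟩ := lemA
  refine ⟨s0, h20, fun s R x y hs hR hx hy => ?_⟩
  have hsr : (2 : ℝ) ≤ s := by exact_mod_cast h20.trans hs
  have hRr : (16 : ℝ) * s ≤ R := by exact_mod_cast hR
  set m : ℝ := 1920 * ((s : ℝ) / R) ^ (1 / 4 : ℝ) with hm
  have hm0 : 0 ≤ m := by
    rw [hm]
    exact mul_nonneg (by norm_num) (Real.rpow_nonneg (div_nonneg (by linarith) (by linarith)) _)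
  -- step iii
  have st3 : ∀ y' x' : Lat, linf y' = R / 2 → linf x' = 2 * s → ‖TG s R y' x'‖ ≤ m := by
    intro y' x' hy' hx'
    have := hA s (R / 4) (TG s R y') 10 hs (by omega) (by norm_num) ?_ ?_ ?_ x' (by omega) (by omega)
    · refine this.trans ?_
      rw [hx', hm]
      have h1 : (((2 * s : ℤ) : ℝ) / ((R / 4 : ℤ) : ℝ)) ≤ 16 * ((s : ℝ) / R) := by
        have h2 : (R : ℝ) ≤ 8 * ((R / 4 : ℤ) : ℝ) := by exact_mod_cast (by omega : R ≤ 8 * (R / 4))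
        have h3 : (0 : ℝ) < ((R / 4 : ℤ) : ℝ) := by exact_mod_cast (by omega : 0 < R / 4)
        rw [div_le_iff₀ h3, ← mul_div_assoc, div_mul_eq_mul_div, le_div_iff₀ (by linarith)]
        push_cast
        nlinarith
      have h4 : (((2 * s : ℤ) : ℝ) / ((R / 4 : ℤ) : ℝ)) ^ (1 / 4 : ℝ) ≤
          2 * ((s : ℝ) / R) ^ (1 / 4 : ℝ) := by
        refine (Real.rpow_le_rpow ?_ h1 (by norm_num)).trans ?_
        · have h3 : (0 : ℝ) < ((R / 4 : ℤ) : ℝ) := by exact_mod_cast (by omega : 0 < R / 4)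
          push_cast; positivity
        · rw [Real.mul_rpow (by norm_num) (div_nonneg (by linarith) (by linarith))]
          rw [show (16 : ℝ) = 2 ^ (4 : ℝ) by norm_num, ← Real.rpow_mul (by norm_num)]
          norm_num
      nlinarith
    · intro z hz
      rw [mem_Dn] at hz
      rw [(TG_spec s R y').1 z (mem_Dn.2 ⟨hz.1, by omega⟩)]
      beta_reduce
      rw [if_neg (by rintro rfl; omega), zero_add]
    · intro z hz
      exact (TG_spec s R y').2 z (by rw [mem_Dn]; omega)
    · intro z hz
      exact TG_bound (by omega) (by omega) hy' (by omega)
  have st2 : ∀ x' y : Lat, linf x' = 2 * s → linf y = R - 1 → ‖TG s R x' y‖ ≤ m * fR R y := by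
    intro x' y hx' hy
    refine mp3 (Dn (R / 2) R) (fun z => ‖TG s R x' z‖) (fun z => m * fR R z) (fun _ => 0)
      ?_ ?_ ?_ y (mem_Dn.2 ⟨by omega, by omega⟩)
    · intro z hz
      rw [mem_Dn] at hz
      have := TG_sub (y := x') (mem_Dn.2 ⟨by omega, hz.2⟩ : z ∈ Dn s R)
      rwa [if_neg (by rintro rfl; omega)] at this
    · intro z hz
      rw [zero_add, avg_mul, fR, ← dir_in _ _ hz]
    · intro z hz w hw hadj
      rw [mem_Dn] at hz hw
      have := linf_adj hadj
      by_cases hzR : R ≤ linf z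
      · rw [(TG_spec s R x').2 z (by rw [mem_Dn]; omega), norm_zero]
        exact mul_nonneg hm0 (fR_nonneg _ _)
      · rw [fR_one (by omega), mul_one, ← TG_symm (mem_Dn.2 (by omega)) (mem_Dn.2 (by omega))]
        exact st3 z x' (by omega) hx'
  have := mp3 (Dn s (2 * s)) (fun z => ‖TG s R y z‖) (fun z => m * fR R y * eS s z) (fun _ => 0)
      ?_ ?_ ?_ x (mem_Dn.2 ⟨by omega, by omega⟩)
  · refine this.trans (le_of_eq ?_); ring
  · intro z hz
    rw [mem_Dn] at hz
    have := TG_sub (y := y) (mem_Dn.2 ⟨by omega, by omega⟩ : z ∈ Dn s R)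
    rwa [if_neg (by rintro rfl; omega)] at this
  · intro z hz
    rw [zero_add, avg_mul, eS, ← dir_in _ _ hz]
  · intro z hz w hw hadj
    rw [mem_Dn] at hz hw
    have := linf_adj hadj
    by_cases hzR : linf z ≤ s
    · rw [(TG_spec s R y).2 z (by rw [mem_Dn]; omega), norm_zero]
      exact mul_nonneg (mul_nonneg hm0 (fR_nonneg _ _)) (eS_nonneg _ _)
    · rw [eS_one (by omega), mul_one, TG_symm (mem_Dn.2 (by omega)) (mem_Dn.2 (by omega))]
      exact st2 z y (by omega) hy

lemma lemF : ∃ s0 : ℤ, 2 ≤ s0 ∧ ∀ (s R : ℤ) (x : Lat) (b u : Lat → ℂ), s0 ≤ s → 16 * s ≤ R →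
    linf x = s + 1 → LSol s R b u → (∀ y ∈ Dn s R, b y ≠ 0 → linf y = R - 1) →
    ‖u x‖ ≤ 1920 * ((s : ℝ) / R) ^ (1 / 4 : ℝ) * eS s x * ∑ y ∈ Dn s R, ‖b y‖ * fR R y := by
  obtain ⟨s0, h20, hT⟩ := TG_est
  refine ⟨s0, h20, fun s R x b u hs hR hx hu hb => ?_⟩
  have e : u = fun z => ∑ y ∈ Dn s R, b y * TG s R y z := by
    refine (latNet s R).sol_unique (D := Dn s R) (Finset.Subset.refl (Dn s R)) ((lsol_iff _ _ _ _).1 hu) ((lsol_iff _ _ _ _).1 ?_)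
    refine ⟨fun z hz => ?_, fun z hz => ?_⟩
    · have h1 : tavg (fun z => ∑ y ∈ Dn s R, b y * TG s R y z) z =
          ∑ y ∈ Dn s R, b y * tavg (TG s R y) z := by
        unfold tavg
        simp only [Finset.mul_sum, ← Finset.sum_add_distrib, Finset.sum_div]
        exact Finset.sum_congr rfl fun y _ => by ring
      rw [h1]
      have h2 : ∀ y ∈ Dn s R, b y * TG s R y z =
          b y * (if z = y then 1 else 0) + b y * tavg (TG s R y) z := fun y _ => by
        rw [(TG_spec s R y).1 z hz, mul_add]
      beta_reduce
      rw [Finset.sum_congr rfl h2, Finset.sum_add_distrib]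
      congr 1
      simp [hz]
    · refine Finset.sum_eq_zero fun y _ => ?_
      rw [(TG_spec s R y).2 z hz, mul_zero]
  rw [e, Finset.mul_sum]
  refine (norm_sum_le _ _).trans (Finset.sum_le_sum fun y hy => ?_)
  rw [norm_mul]
  by_cases h0 : b y = 0
  · simp [h0]
  · have := mul_le_mul_of_nonneg_left (hT s R x y hs hR hx (hb y hy h0)) (norm_nonneg (b y))
    linarith

/-- Expansion of a walk along corridors (without the first vertex). -/
def xt (ex : Lat → Lat → List Lat) : Lat → List Lat → List Lat
  | _, [] => []
  | a, b :: l => ex a b ++ b :: xt ex b l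

section
variable (ex : Lat → Lat → List Lat)

lemma xt_mem (l : List Lat) : ∀ (a x : Lat), x ∈ xt ex a l →
    x ∈ l ∨ ∃ c ∈ a :: l, ∃ d ∈ a :: l, x ∈ ex c d := by
  induction l with
  | nil => intro a x h; simp [xt] at h
  | cons b l ih =>
    intro a x h
    rw [xt, List.mem_append, List.mem_cons] at h
    rcases h with h | rfl | h
    · exact Or.inr ⟨a, by simp, b, by simp, h⟩
    · simp
    · rcases ih b x h with h | ⟨c, hc, d, hd, h⟩
      · simp [h]
      · exact Or.inr ⟨c, List.mem_cons_of_mem _ hc, d, List.mem_cons_of_mem _ hd, h⟩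

lemma xt_len (l : List Lat) : ∀ a, l.length ≤ (xt ex a l).length := by
  induction l with
  | nil => simp
  | cons b l ih => intro a; have := ih b; simp [xt]; omega

lemma xt_append (l m : List Lat) (c : Lat) : ∀ a,
    xt ex a (l ++ c :: m) = xt ex a (l ++ [c]) ++ xt ex c m := by
  induction l with
  | nil => intro a; simp [xt]
  | cons b l ih => intro a; simp [xt, ih b]

lemma xt_chain (Q : Lat → Lat → Prop) (hch : ∀ a b, Q a b → (a :: ex a b ++ [b]).IsChain Adj)
    (l : List Lat) : ∀ a, (a :: l).IsChain Q → (a :: xt ex a l).IsChain Adj := by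
  induction l with
  | nil => intro a _; simp [xt]
  | cons b l ih =>
    intro a h
    rw [List.isChain_cons_cons] at h
    rw [xt, ← List.cons_append, List.isChain_split]
    exact ⟨hch a b h.1, ih b h.2⟩

lemma xt_nodup (U : Lat → Prop) (hdis : ∀ a b x, x ∈ ex a b → ¬ U x)
    (huniq : ∀ a b c d x, x ∈ ex a b → x ∈ ex c d → (a = c ∧ b = d) ∨ (a = d ∧ b = c))
    (hnd : ∀ a b, (ex a b).Nodup) (l : List Lat) : ∀ a, (a :: l).Nodup → (∀ x ∈ a :: l, U x) →
    (a :: xt ex a l).Nodup := by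
  induction l with
  | nil => intro a _ _; simp [xt]
  | cons b l ih =>
    intro a h hU
    have hal := (List.nodup_cons.1 h).1
    have h2 := ih b (List.nodup_cons.1 h).2 (fun x hx => hU x (List.mem_cons_of_mem _ hx))
    have key : ∀ x ∈ b :: xt ex b l, x ∈ b :: l ∨ ∃ c ∈ b :: l, ∃ d ∈ b :: l, x ∈ ex c d := by
      intro x hx
      rcases List.mem_cons.1 hx with rfl | hx
      · simp
      · rcases xt_mem ex l b x hx with h | h
        · exact Or.inl (List.mem_cons_of_mem _ h)
        · exact Or.inr h
    rw [xt, List.nodup_cons, List.nodup_append]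
    refine ⟨?_, hnd a b, h2, ?_⟩
    · intro hm
      rcases List.mem_append.1 hm with hm | hm
      · exact hdis _ _ _ hm (hU a (by simp))
      · rcases key a hm with hm | ⟨c, _, d, _, hm⟩
        · exact hal hm
        · exact hdis _ _ _ hm (hU a (by simp))
    · rintro x hx y hy rfl
      rcases key x hy with hm | ⟨c, hc, d, hd, hm⟩
      · exact hdis _ _ _ hx (hU x (List.mem_cons_of_mem _ hm))
      · rcases huniq _ _ _ _ _ hx hm with ⟨rfl, _⟩ | ⟨rfl, _⟩
        · exact hal hc
        · exact hal hd

lemma cyc_nodup (U : Lat → Prop) (hdis : ∀ a b x, x ∈ ex a b → ¬ U x)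
    (huniq : ∀ a b c d x, x ∈ ex a b → x ∈ ex c d → (a = c ∧ b = d) ∨ (a = d ∧ b = c))
    (hnd : ∀ a b, (ex a b).Nodup) (a m c : Lat) (l : List Lat) (h : (a :: m :: (l ++ [c])).Nodup)
    (hU : ∀ x ∈ a :: m :: (l ++ [c]), U x) :
    (a :: (xt ex a (m :: (l ++ [c])) ++ ex c a)).Nodup := by
  have h1 := xt_nodup ex U hdis huniq hnd _ _ h hU
  rw [← List.cons_append, List.nodup_append]
  refine ⟨h1, hnd _ _, ?_⟩
  rintro x hx y hy rfl
  have hnU := hdis _ _ _ hy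
  have ha := (List.nodup_cons.1 h).1
  have hm := (List.nodup_cons.1 (List.nodup_cons.1 h).2).1
  rcases List.mem_cons.1 hx with rfl | hx
  · exact hnU (hU _ (by simp))
  rw [xt, List.mem_append, List.mem_cons] at hx
  rcases hx with hx | rfl | hx
  · rcases huniq _ _ _ _ _ hy hx with ⟨rfl, _⟩ | ⟨rfl, _⟩
    · exact ha (by simp)
    · exact hm (by simp)
  · exact hnU (hU _ (by simp))
  · rcases xt_mem ex _ _ _ hx with hx | ⟨p, hp, q, hq, hx⟩
    · exact hnU (hU _ (List.mem_cons_of_mem _ (List.mem_cons_of_mem _ hx)))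
    · rcases huniq _ _ _ _ _ hy hx with ⟨_, rfl⟩ | ⟨_, rfl⟩
      · exact ha hq
      · exact ha hp

lemma I_zpow_re (n : ℤ) (h : |n| ≤ 1) : 0 ≤ (Complex.I ^ n).re := by
  rw [abs_le] at h
  obtain rfl | rfl | rfl : n = -1 ∨ n = 0 ∨ n = 1 := by omega
  · simp
  · simp
  · simp

lemma conj_I_zpow (n : ℤ) : (starRingEnd ℂ) (Complex.I ^ n) = Complex.I ^ (-n) := by
  rw [map_zpow₀, Complex.conj_I, zpow_neg, ← inv_zpow, Complex.inv_I]

/-- Phase of an expanded walk. -/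
lemma crL_xt (a b : Lat) (l : List Lat) : crL (0, 0) (a :: xt ex a (b :: l)) =
    crL (0, 0) (a :: ex a b ++ [b]) + crL (0, 0) (b :: xt ex b l) := by
  rw [xt, ← List.cons_append, crL_append]

lemma ph_xt (N : Net Lat) (ht : ∀ a b, N.t a b = Complex.I ^ crL (0, 0) (a :: ex a b ++ [b]))
    (w : Lat) (l2 : List Lat) (l1 : List Lat) : ∀ z, (z :: (l1 ++ w :: l2)).Nodup →
    N.ph (z :: (l1 ++ w :: l2)) w =
      (starRingEnd ℂ) (Complex.I ^ crL (0, 0) (z :: xt ex z (l1 ++ [w]))) := by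
  induction l1 with
  | nil =>
    intro z h
    have hzw : z ≠ w := by rintro rfl; simp at h
    rw [List.nil_append, N.ph_cons _ _ _ _ hzw, N.ph_self, one_mul, N.t_symm, ht, List.nil_append,
      crL_xt]
    simp [xt, crL]
  | cons b l1 ih =>
    intro z h
    have hzw : z ≠ w := by rintro rfl; simp at h
    rw [List.cons_append, N.ph_cons _ _ _ _ hzw, ih b (List.nodup_cons.1 h).2, N.t_symm, ht,
      show b :: l1 ++ [w] = b :: (l1 ++ [w]) from rfl, crL_xt, zpow_add₀ Complex.I_ne_zero, map_mul,
      mul_comm]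

lemma cyc_of (N : Net Lat) (ht : ∀ a b, N.t a b = Complex.I ^ crL (0, 0) (a :: ex a b ++ [b]))
    (hdis : ∀ a b x, x ∈ ex a b → x ∉ N.U)
    (huniq : ∀ a b c d x, x ∈ ex a b → x ∈ ex c d → (a = c ∧ b = d) ∨ (a = d ∧ b = c))
    (hnd : ∀ a b, (ex a b).Nodup)
    (hch : ∀ a b, 0 < N.p a b → (a :: ex a b ++ [b]).IsChain Adj) : N.Cyc := by
  intro z l hst w hw hp
  obtain ⟨l1, l2, rfl⟩ := List.append_of_mem hw
  obtain ⟨h1, h2, h3⟩ := hst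
  rw [ph_xt ex N ht w l2 l1 z h1, N.t_symm w z, ← map_mul, Complex.conj_re, ht w z,
    ← zpow_add₀ Complex.I_ne_zero]
  cases l1 with
  | nil =>
    have : Complex.I ^ (crL (0, 0) (z :: xt ex z ([] ++ [w])) + crL (0, 0) (w :: ex w z ++ [z])) = 1 := by
      rw [zpow_add₀ Complex.I_ne_zero, ← ht w z, List.nil_append, crL_xt, zpow_add₀ Complex.I_ne_zero,
        ← ht z w, N.t_symm w z]
      simp only [xt, crL, zpow_zero, mul_one]
      rw [mul_comm, Complex.mul_conj, Complex.normSq_eq_norm_sq, N.t_norm]; norm_num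
    rw [this]; simp
  | cons m l =>
    have e : crL (0, 0) (z :: xt ex z (m :: l ++ [w])) + crL (0, 0) (w :: ex w z ++ [z]) =
        crL (0, 0) (z :: (xt ex z (m :: (l ++ [w])) ++ ex w z) ++ [z]) := by
      have e1 : xt ex z (m :: (l ++ [w])) = xt ex z (m :: l) ++ ex ((m :: l).getLast (by simp)) w ++ [w] := by
        have h0 : m :: l = (m :: l).dropLast ++ [(m :: l).getLast (by simp)] :=
          (List.dropLast_append_getLast (by simp)).symm
        have : m :: (l ++ [w]) = (m :: l).dropLast ++ (m :: l).getLast (by simp) :: [w] := by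
          calc m :: (l ++ [w]) = (m :: l) ++ [w] := by simp
            _ = ((m :: l).dropLast ++ [(m :: l).getLast (by simp)]) ++ [w] := by rw [← h0]
            _ = _ := by simp
        rw [this, xt_append, ← h0]
        simp [xt]
      rw [List.cons_append, e1]
      have := crL_append (0, 0) (z :: (xt ex z (m :: l) ++ ex ((m :: l).getLast (by simp)) w))
        (ex w z ++ [z]) w
      simp only [List.cons_append, List.append_assoc, List.nil_append] at this ⊢
      rw [this]
    rw [e]
    have hnd' : (z :: m :: (l ++ [w])).Nodup := by
      refine List.Nodup.sublist ?_ h1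
      simp
    have hsub : ∀ x ∈ z :: m :: (l ++ [w]), x ∈ N.U := by
      intro x hx; apply h3
      simp at hx ⊢; tauto
    refine I_zpow_re _ (crL_simple z _ ?_ ?_ ?_)
    · exact cyc_nodup ex (fun x => x ∈ N.U) hdis huniq hnd z m w l hnd' hsub
    · have hc : (z :: ((m :: l) ++ w :: [z])).IsChain (fun a b => 0 < N.p a b) := by
        have h4 : (z :: (m :: l ++ [w])).IsChain (fun a b => 0 < N.p a b) := by
          have : z :: (m :: l ++ w :: l2) = (z :: (m :: l)) ++ w :: l2 := by simp
          rw [this, List.isChain_split] at h2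
          simpa using h2.1
        have : z :: ((m :: l) ++ w :: [z]) = (z :: m :: l) ++ w :: [z] := by simp
        rw [this, List.isChain_split]
        refine ⟨by simpa using h4, ?_⟩
        rw [List.isChain_cons_cons]
        exact ⟨by rw [N.p_symm]; exact hp, by simp⟩
      have := xt_chain ex _ hch _ _ hc
      rw [xt_append] at this
      simpa [xt] using this
    · have := xt_len ex (m :: (l ++ [w])) z
      simp at this ⊢; omega

end

lemma crL_reverse (f : Lat) (l : List Lat) : crL f l.reverse = - crL f l := by
  induction l with
  | nil => simp [crL]
  | cons a l ih =>
    cases l with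
    | nil => simp [crL]
    | cons b l =>
      rw [List.reverse_cons, List.reverse_cons, List.append_assoc, List.singleton_append, crL_append]
      rw [List.reverse_cons] at ih
      rw [ih]
      simp only [crL]
      rw [cr_symm f a b]; ring

/-- Data for the two-hub network. -/
structure Hub (s R : ℤ) where
  a : Lat
  b : Lat
  x1 : Lat
  x2 : Lat
  y1 : Lat
  y2 : Lat
  L1 : List Lat
  L2 : List Lat
  hs : 2 ≤ s
  hR : 16 * s ≤ R
  la : linf a = s
  lb : linf b = R
  lx1 : linf x1 = s + 1
  lx2 : linf x2 = s + 1
  ly1 : linf y1 = R - 1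
  ly2 : linf y2 = R - 1
  ax : Adj a x1
  byy : Adj b y1
  c1 : (a :: L1 ++ [x2]).IsChain Adj
  c2 : (b :: L2 ++ [y2]).IsChain Adj
  n1 : L1.Nodup
  n2 : L2.Nodup
  m1 : ∀ z ∈ L1, linf z = s ∧ z ≠ a
  m2 : ∀ z ∈ L2, linf z = R ∧ z ≠ b
  d1 : x1 = x2 → L1 = []
  d2 : y1 = y2 → L2 = []

namespace Hub

variable {s R : ℤ} (H : Hub s R)

/-- Corridors. -/
def ex (u v : Lat) : List Lat :=
  if u = H.a ∧ v = H.x2 then H.L1 else if u = H.x2 ∧ v = H.a then H.L1.reverse else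
  if u = H.b ∧ v = H.y2 then H.L2 else if u = H.y2 ∧ v = H.b then H.L2.reverse else []

lemma ne_all : H.a ≠ H.b ∧ H.a ≠ H.x1 ∧ H.a ≠ H.x2 ∧ H.a ≠ H.y1 ∧ H.a ≠ H.y2 ∧ H.b ≠ H.x1 ∧
    H.b ≠ H.x2 ∧ H.b ≠ H.y1 ∧ H.b ≠ H.y2 ∧ H.x2 ≠ H.y2 ∧ H.x1 ≠ H.y2 ∧ H.x2 ≠ H.y1 := by
  have h1 := H.la; have h2 := H.lb; have h3 := H.lx1; have h4 := H.lx2; have h5 := H.ly1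
  have h6 := H.ly2; have h7 := H.hs; have h8 := H.hR
  refine ⟨?_, ?_, ?_, ?_, ?_, ?_, ?_, ?_, ?_, ?_, ?_, ?_⟩ <;> intro h <;>
    have h9 := congrArg linf h <;> omega

lemma ex_symm (u v : Lat) : H.ex v u = (H.ex u v).reverse := by
  have h := H.ne_all
  unfold ex
  split_ifs <;> first | (simp; done) | (exfalso; grind)

lemma ex_mem {u v x : Lat} (h : x ∈ H.ex u v) :
    (((u = H.a ∧ v = H.x2) ∨ (u = H.x2 ∧ v = H.a)) ∧ x ∈ H.L1) ∨
    (((u = H.b ∧ v = H.y2) ∨ (u = H.y2 ∧ v = H.b)) ∧ x ∈ H.L2) := by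
  unfold ex at h
  split_ifs at h with h1 h2 h3 h4
  · exact Or.inl ⟨Or.inl h1, h⟩
  · exact Or.inl ⟨Or.inr h2, List.mem_reverse.1 h⟩
  · exact Or.inr ⟨Or.inl h3, h⟩
  · exact Or.inr ⟨Or.inr h4, List.mem_reverse.1 h⟩
  · simp at h

lemma aD : H.a ∉ Dn s R := by rw [mem_Dn, H.la]; omega
lemma bD : H.b ∉ Dn s R := by rw [mem_Dn, H.lb]; omega
lemma x1D : H.x1 ∈ Dn s R := by rw [mem_Dn, H.lx1]; have := H.hs; have := H.hR; omega
lemma x2D : H.x2 ∈ Dn s R := by rw [mem_Dn, H.lx2]; have := H.hs; have := H.hR; omega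
lemma y1D : H.y1 ∈ Dn s R := by rw [mem_Dn, H.ly1]; have := H.hs; have := H.hR; omega
lemma y2D : H.y2 ∈ Dn s R := by rw [mem_Dn, H.ly2]; have := H.hs; have := H.hR; omega

lemma ex_D {u v : Lat} (hu : u ∈ Dn s R) (hv : v ∈ Dn s R) : H.ex u v = [] := by
  have h1 := H.aD; have h2 := H.bD
  unfold ex
  rw [if_neg (by rintro ⟨rfl, _⟩; exact h1 hu), if_neg (by rintro ⟨_, rfl⟩; exact h1 hv),
    if_neg (by rintro ⟨rfl, _⟩; exact h2 hu), if_neg (by rintro ⟨_, rfl⟩; exact h2 hv)]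

lemma ex_a2 : H.ex H.a H.x2 = H.L1 := by simp [ex]
lemma ex_b2 : H.ex H.b H.y2 = H.L2 := by
  have h := H.ne_all
  unfold ex
  rw [if_neg (by grind), if_neg (by grind), if_pos ⟨rfl, rfl⟩]
lemma ex_a1 : H.ex H.a H.x1 = [] := by
  have h := H.ne_all
  by_cases e : H.x1 = H.x2
  · rw [e, ex_a2, H.d1 e]
  · unfold ex
    rw [if_neg (by grind), if_neg (by grind), if_neg (by grind), if_neg (by grind)]
lemma ex_b1 : H.ex H.b H.y1 = [] := by
  have h := H.ne_all
  by_cases e : H.y1 = H.y2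
  · rw [e, ex_b2, H.d2 e]
  · unfold ex
    rw [if_neg (by grind), if_neg (by grind), if_neg (by grind), if_neg (by grind)]

/-- Constant in the supersolution. -/
def A (_ : Hub s R) : ℝ := 2 * (R : ℝ) ^ 2 + 1

/-- Hub weight scale. -/
def eps : ℝ := min (min (eS s H.x1) (eS s H.x2)) (min (fR R H.y1) (fR R H.y2)) / (4 * H.A)

lemma A_pos : 1 ≤ H.A := by unfold A; nlinarith [sq_nonneg (R : ℝ)]

lemma ex1_pos : 0 < eS s H.x1 := eS_pos (by rw [H.lx1]; omega)
lemma ex2_pos : 0 < eS s H.x2 := eS_pos (by rw [H.lx2]; omega)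
lemma fy1_pos : 0 < fR R H.y1 := fR_pos (by have := H.hs; have := H.hR; omega) (by rw [H.ly1]; omega)
lemma fy2_pos : 0 < fR R H.y2 := fR_pos (by have := H.hs; have := H.hR; omega) (by rw [H.ly2]; omega)

lemma eps_pos : 0 < H.eps := by
  have := H.A_pos
  exact div_pos (lt_min (lt_min H.ex1_pos H.ex2_pos) (lt_min H.fy1_pos H.fy2_pos)) (by linarith)

lemma eps_div {g : ℝ} (h0 : 0 < g)
    (h : min (min (eS s H.x1) (eS s H.x2)) (min (fR R H.y1) (fR R H.y2)) ≤ g) :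
    H.eps / g ≤ 1 / (4 * H.A) := by
  have := H.A_pos
  rw [eps, div_div, div_le_div_iff₀ (by positivity) (by positivity)]
  nlinarith

/-- One-sided hub weights. -/
def hw (u v : Lat) : ℝ :=
  if u = H.a ∧ (v = H.x1 ∨ v = H.x2) then H.eps / eS s v else
  if u = H.b ∧ (v = H.y1 ∨ v = H.y2) then H.eps / fR R v else 0

lemma hw_nonneg (u v : Lat) : 0 ≤ H.hw u v := by
  unfold hw
  split_ifs
  · exact div_nonneg H.eps_pos.le (eS_nonneg _ _)
  · exact div_nonneg H.eps_pos.le (fR_nonneg _ _)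
  · rfl

lemma hw_le (u v : Lat) : H.hw u v ≤ 1 / (4 * H.A) := by
  have hA := H.A_pos
  unfold hw
  split_ifs with h1 h2
  · rcases h1.2 with rfl | rfl
    · exact H.eps_div H.ex1_pos (by simp)
    · exact H.eps_div H.ex2_pos (by simp)
  · rcases h2.2 with rfl | rfl
    · exact H.eps_div H.fy1_pos (by simp)
    · exact H.eps_div H.fy2_pos (by simp)
  · positivity

lemma hw_D {u : Lat} (hu : u ∈ Dn s R) (v : Lat) : H.hw u v = 0 := by
  unfold hw
  rw [if_neg (by rintro ⟨rfl, _⟩; exact H.aD hu), if_neg (by rintro ⟨rfl, _⟩; exact H.bD hu)]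

lemma hw_pos {u v : Lat} (h : 0 < H.hw u v) : (u = H.a ∧ (v = H.x1 ∨ v = H.x2)) ∨
    (u = H.b ∧ (v = H.y1 ∨ v = H.y2)) := by
  unfold hw at h
  split_ifs at h with h1 h2
  · exact Or.inl h1
  · exact Or.inr h2
  · exact absurd h (lt_irrefl _)

lemma hw_out (u : Lat) {v : Lat} (hv : v ∉ Dn s R) : H.hw u v = 0 := by
  by_contra h
  rcases H.hw_pos (lt_of_le_of_ne (H.hw_nonneg u v) (Ne.symm h)) with ⟨_, rfl | rfl⟩ | ⟨_, rfl | rfl⟩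
  · exact hv H.x1D
  · exact hv H.x2D
  · exact hv H.y1D
  · exact hv H.y2D

/-- Edge weights. -/
def pw (u v : Lat) : ℝ :=
  (if u ∈ Dn s R ∧ v ∈ Dn s R ∧ Adj u v then 1 / 4 else 0) + H.hw u v + H.hw v u

lemma pw_D {u v : Lat} (hu : u ∈ Dn s R) (hv : v ∈ Dn s R) :
    H.pw u v = if Adj u v then 1 / 4 else 0 := by
  rw [pw, H.hw_D hu, H.hw_D hv]; simp [hu, hv]

lemma pw_hub {u v : Lat} (hu : u ∉ Dn s R) (hv : v ∈ Dn s R) : H.pw u v = H.hw u v := by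
  rw [pw, H.hw_D hv, if_neg (by tauto)]; ring

lemma pw_hub2 {u v : Lat} (hu : u ∉ Dn s R) (hv : v ∉ Dn s R) : H.pw u v = 0 := by
  rw [pw, H.hw_out _ hv, H.hw_out _ hu, if_neg (by tauto)]; ring

lemma pw_symm (u v : Lat) : H.pw u v = H.pw v u := by
  unfold pw
  have : (u ∈ Dn s R ∧ v ∈ Dn s R ∧ Adj u v) ↔ (v ∈ Dn s R ∧ u ∈ Dn s R ∧ Adj v u) :=
    ⟨fun h => ⟨h.2.1, h.1, adj_symm h.2.2⟩, fun h => ⟨h.2.1, h.1, adj_symm h.2.2⟩⟩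
  simp only [this]; ring

/-- Vertex set. -/
def UU : Finset Lat := insert H.a (insert H.b (Dn s R))

lemma sum_UU (g : Lat → ℝ) : ∑ y ∈ H.UU, g y = g H.a + (g H.b + ∑ y ∈ Dn s R, g y) := by
  have h := H.ne_all
  rw [UU, Finset.sum_insert, Finset.sum_insert H.bD]
  rw [Finset.mem_insert]; push Not; exact ⟨h.1, H.aD⟩

/-- Supersolution. -/
def psi (z : Lat) : ℝ := if z ∈ Dn s R then H.A - nsq z else 1

lemma psi_D {z : Lat} (hz : z ∈ Dn s R) : 1 ≤ H.psi z ∧ H.psi z ≤ H.A := by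
  rw [psi, if_pos hz, A]
  rw [mem_Dn] at hz
  have h2 : (linf z : ℝ) ≤ R := by exact_mod_cast hz.2.le
  have h3 : (0 : ℝ) ≤ linf z := by exact_mod_cast linf_nonneg z
  have := nsq_le z
  have := nsq_nonneg z
  constructor <;> nlinarith

lemma hw_sum (u : Lat) (g : Lat → ℝ) (hg : ∀ y ∈ Dn s R, 0 ≤ g y) (K : ℝ)
    (hK : ∀ y ∈ Dn s R, H.hw u y * g y ≤ K) (hK0 : 0 ≤ K) : ∑ y ∈ Dn s R, H.hw u y * g y ≤ 2 * K := by
  have key : ∀ p q : Lat, (∀ y, 0 < H.hw u y → y = p ∨ y = q) →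
      ∑ y ∈ Dn s R, H.hw u y * g y ≤ 2 * K := by
    intro p q hpq
    have : ∑ y ∈ Dn s R, H.hw u y * g y = ∑ y ∈ (Dn s R).filter (fun y => y ∈ ({p, q} : Finset Lat)),
        H.hw u y * g y := by
      rw [Finset.sum_filter]
      refine Finset.sum_congr rfl fun y _ => ?_
      split_ifs with h
      · rfl
      · rcases (H.hw_nonneg u y).eq_or_lt with h0 | h0
        · rw [← h0, zero_mul]
        · exact absurd (by simpa using hpq y h0) h
    rw [this]
    refine (Finset.sum_le_card_nsmul _ _ K fun y hy => hK y (Finset.mem_filter.1 hy).1).trans ?_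
    rw [nsmul_eq_mul]
    gcongr
    have h1 : ((Dn s R).filter (fun y => y ∈ ({p, q} : Finset Lat))).card ≤ ({p, q} : Finset Lat).card :=
      Finset.card_le_card fun y hy => (Finset.mem_filter.1 hy).2
    have h2 := h1.trans Finset.card_le_two
    exact_mod_cast h2
  by_cases hu : u = H.a
  · refine key H.x1 H.x2 fun y hy => ?_
    rcases H.hw_pos hy with h | h
    · exact h.2
    · exact absurd (hu.symm.trans h.1) H.ne_all.1
  · refine key H.y1 H.y2 fun y hy => ?_
    rcases H.hw_pos hy with h | h
    · exact absurd h.1 hu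
    · exact h.2

lemma hub_half {u : Lat} (hu : u ∉ Dn s R) : ∑ y ∈ H.UU, H.pw u y * H.psi y ≤ 1 / 2 := by
  have hA := H.A_pos
  rw [H.sum_UU, H.pw_hub2 hu H.aD, H.pw_hub2 hu H.bD]
  have e : ∑ y ∈ Dn s R, H.pw u y * H.psi y = ∑ y ∈ Dn s R, H.hw u y * H.psi y :=
    Finset.sum_congr rfl fun y hy => by rw [H.pw_hub hu hy]
  rw [e]
  have := H.hw_sum u H.psi (fun y hy => by linarith [H.psi_D hy]) (1 / 4) (fun y hy => ?_) (by norm_num)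
  · linarith
  · refine (mul_le_mul (H.hw_le u y) (H.psi_D hy).2 (by linarith [H.psi_D hy]) (by positivity)).trans
      (le_of_eq ?_)
    field_simp

/-- The two-hub network. -/
def net : Net Lat where
  U := H.UU
  p := H.pw
  t := fun u v => Complex.I ^ crL (0, 0) (u :: H.ex u v ++ [v])
  psi := H.psi
  p_nonneg := fun x y => by
    have := H.hw_nonneg x y; have := H.hw_nonneg y x
    unfold pw; split_ifs <;> linarith
  p_symm := H.pw_symm
  p_self := fun x => by
    by_cases hx : x ∈ Dn s R
    · rw [H.pw_D hx hx, if_neg (fun h => adj_ne h rfl)]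
    · exact H.pw_hub2 hx hx
  t_norm := fun x y => by rw [norm_zpow, Complex.norm_I, one_zpow]
  t_symm := fun x y => by
    rw [conj_I_zpow, ← crL_reverse, H.ex_symm x y]; simp
  psi_pos := fun x _ => by
    by_cases h : x ∈ Dn s R
    · linarith [H.psi_D h]
    · rw [psi, if_neg h]; norm_num
  super := fun x hx => by
    have hA := H.A_pos
    by_cases h : x ∈ Dn s R
    · rw [H.sum_UU]
      have e : ∑ y ∈ Dn s R, H.pw x y * H.psi y =
          ∑ y ∈ Dn s R, (if Adj x y then 1 / 4 else 0 : ℝ) * (H.A - nsq y) :=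
        Finset.sum_congr rfl fun y hy => by rw [H.pw_D h hy, psi, if_pos hy]
      rw [e]
      have h1 := psi_super (Dn s R) H.A
        (fun x hx y hy => by unfold A; linarith [nsq_lt_of hx y hy]) x h
      have h2 : H.pw x H.a * H.psi H.a ≤ 1 / 4 := by
        rw [H.pw_symm, H.pw_hub H.aD h, psi, if_neg H.aD, mul_one]
        refine (H.hw_le _ _).trans ?_
        rw [div_le_div_iff₀ (by positivity) (by norm_num)]; linarith
      have h3 : H.pw x H.b * H.psi H.b ≤ 1 / 4 := by
        rw [H.pw_symm, H.pw_hub H.bD h, psi, if_neg H.bD, mul_one]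
        refine (H.hw_le _ _).trans ?_
        rw [div_le_div_iff₀ (by positivity) (by norm_num)]; linarith
      rw [show H.psi x = H.A - nsq x by rw [psi, if_pos h]]
      linarith
    · have := H.hub_half h
      rw [show H.psi x = 1 by rw [psi, if_neg h]]
      linarith

lemma net_cyc : H.net.Cyc := by
  have hne := H.ne_all
  refine cyc_of H.ex H.net (fun _ _ => rfl) ?_ ?_ ?_ ?_
  · intro u v x hx hU
    have hU' : x = H.a ∨ x = H.b ∨ x ∈ Dn s R := by
      have : x ∈ H.UU := hU
      simpa [UU] using this
    have h1 := H.hs; have h2 := H.hR; have h3 := H.la; have h4 := H.lb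
    rcases H.ex_mem hx with ⟨_, h⟩ | ⟨_, h⟩
    · obtain ⟨h5, h6⟩ := H.m1 x h
      rcases hU' with h | rfl | h
      · exact h6 h
      · omega
      · rw [mem_Dn] at h; omega
    · obtain ⟨h5, h6⟩ := H.m2 x h
      rcases hU' with rfl | h | h
      · omega
      · exact h6 h
      · rw [mem_Dn] at h; omega
  · intro u v c d x h1 h2
    have h5 := H.hs; have h6 := H.hR
    rcases H.ex_mem h1 with ⟨h3, h⟩ | ⟨h3, h⟩ <;> rcases H.ex_mem h2 with ⟨h4, h'⟩ | ⟨h4, h'⟩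
    · grind
    · have := (H.m1 x h).1; have := (H.m2 x h').1; omega
    · have := (H.m2 x h).1; have := (H.m1 x h').1; omega
    · grind
  · intro u v
    unfold ex
    split_ifs
    · exact H.n1
    · exact List.nodup_reverse.2 H.n1
    · exact H.n2
    · exact List.nodup_reverse.2 H.n2
    · simp
  · have rev : ∀ u v, (u :: H.ex u v ++ [v]).IsChain Adj → (v :: H.ex v u ++ [u]).IsChain Adj := by
      intro u v h
      rw [← List.isChain_reverse] at h
      rw [H.ex_symm u v]
      simp only [List.reverse_append, List.reverse_cons, List.reverse_nil, List.nil_append,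
        List.append_assoc, List.singleton_append, List.cons_append] at h ⊢
      exact h.imp fun a b h => adj_symm h
    have hub : ∀ u v, 0 < H.hw u v → (u :: H.ex u v ++ [v]).IsChain Adj := by
      intro u v h
      rcases H.hw_pos h with ⟨rfl, rfl | rfl⟩ | ⟨rfl, rfl | rfl⟩
      · rw [H.ex_a1]; simpa using H.ax
      · rw [H.ex_a2]; exact H.c1
      · rw [H.ex_b1]; simpa using H.byy
      · rw [H.ex_b2]; exact H.c2
    intro u v h
    have h : 0 < H.pw u v := h
    by_cases hu : u ∈ Dn s R <;> by_cases hv : v ∈ Dn s R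
    · rw [H.pw_D hu hv] at h
      rw [H.ex_D hu hv]
      split_ifs at h with h'
      · simpa using h'
      · exact absurd h (lt_irrefl _)
    · rw [H.pw_symm, H.pw_hub hv hu] at h
      exact rev _ _ (hub _ _ h)
    · rw [H.pw_hub hu hv] at h
      exact hub _ _ h
    · rw [H.pw_hub2 hu hv] at h; exact absurd h (lt_irrefl _)

end Hub

/-- The winding form agrees with the gradient of a potential. -/
def GG (Φ : Lat → ℤ) (u v : Lat) : Prop := cr (0, 0) u v = Φ v - Φ u

lemma crL_GG (Φ : Lat → ℤ) (l : List Lat) : ∀ u v, (u :: l ++ [v]).IsChain (GG Φ) →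
    crL (0, 0) (u :: l ++ [v]) = Φ v - Φ u := by
  induction l with
  | nil => intro u v h; have : GG Φ u v := by simpa using h
           simpa [crL, GG] using this
  | cons a l ih =>
    intro u v h
    simp only [List.cons_append, List.isChain_cons_cons] at h
    have h1 := ih a v (by simpa using h.2)
    have h2 : cr (0, 0) u a = Φ a - Φ u := h.1
    simp only [List.cons_append, crL] at h1 ⊢
    rw [h1, h2]; ring

lemma chain_glue {T : Lat → Lat → Prop} {l : List Lat} {u v p q : Lat} (hl : l.IsChain T)
    (hp : l.head? = some p) (hq : l.getLast? = some q) (h1 : T u p) (h2 : T q v) :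
    (u :: l ++ [v]).IsChain T := by
  rw [List.isChain_append]
  refine ⟨?_, by simp, ?_⟩
  · rw [List.isChain_cons]
    refine ⟨fun y hy => ?_, hl⟩
    rw [hp] at hy; simp at hy; exact hy ▸ h1
  · intro x hx y hy
    rw [List.getLast?_cons, hq] at hx
    simp at hx hy
    rw [← hx, ← hy]; exact h2

namespace Hub

variable {s R : ℤ} (H : Hub s R)

/-- Admissible pairs of crossings. -/
def Good (X Y : List Lat) : Prop :=
  (X.head? = some H.x1 ∧ X.getLast? = some H.y1 ∧ X.IsChain Adj ∧ ∀ z ∈ X, z ∈ Dn s R) ∧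
  (Y.head? = some H.y2 ∧ Y.getLast? = some H.x2 ∧ Y.IsChain Adj ∧ ∀ z ∈ Y, z ∈ Dn s R) ∧
  ∃ Φ : Lat → ℤ, GG Φ H.a H.x1 ∧ X.IsChain (GG Φ) ∧ GG Φ H.y1 H.b ∧ Y.IsChain (GG Φ) ∧
    (H.a :: H.L1 ++ [H.x2]).IsChain (GG Φ) ∧ (H.b :: H.L2 ++ [H.y2]).IsChain (GG Φ)

/-- Twisted compatibility. -/
def TT (Φ : Lat → ℤ) (u v : Lat) : Prop := crL (0, 0) (u :: H.ex u v ++ [v]) = Φ v - Φ u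

lemma TT_symm {Φ : Lat → ℤ} {u v : Lat} (h : H.TT Φ u v) : H.TT Φ v u := by
  unfold TT at *
  rw [H.ex_symm u v]
  have : v :: (H.ex u v).reverse ++ [u] = (u :: H.ex u v ++ [v]).reverse := by simp
  rw [this, crL_reverse, h]; ring

lemma TT_D {Φ : Lat → ℤ} (l : List Lat) (hl : l.IsChain (GG Φ)) (hD : ∀ z ∈ l, z ∈ Dn s R) :
    l.IsChain (H.TT Φ) := by
  induction l with
  | nil => simp
  | cons a l ih =>
    cases l with
    | nil => simp
    | cons b l =>
      rw [List.isChain_cons_cons] at hl ⊢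
      refine ⟨?_, ih hl.2 fun z hz => hD z (List.mem_cons_of_mem _ hz)⟩
      have h := hl.1
      unfold TT
      rw [H.ex_D (hD a (by simp)) (hD b (by simp))]
      unfold GG at h
      simp [crL, h]

lemma good_TT {X Y : List Lat} (h : H.Good X Y) : ∃ Φ : Lat → ℤ,
    (H.a :: (X ++ H.b :: (Y ++ [H.a]))).IsChain (H.TT Φ) := by
  obtain ⟨⟨x1, x2, x3, x4⟩, ⟨y1, y2, y3, y4⟩, Φ, g1, g2, g3, g4, g5, g6⟩ := h
  refine ⟨Φ, ?_⟩
  have e1 : H.TT Φ H.a H.x1 := by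
    unfold TT; rw [H.ex_a1]; exact crL_GG Φ [] _ _ (by simpa using g1)
  have e2 : H.TT Φ H.a H.x2 := by
    unfold TT; rw [H.ex_a2]; exact crL_GG Φ _ _ _ g5
  have e3 : H.TT Φ H.b H.y1 := by
    unfold TT; rw [H.ex_b1]
    refine crL_GG Φ [] _ _ ?_
    have : GG Φ H.b H.y1 := by unfold GG at *; rw [cr_symm, g3]; ring
    simpa using this
  have e4 : H.TT Φ H.b H.y2 := by
    unfold TT; rw [H.ex_b2]; exact crL_GG Φ _ _ _ g6
  have h1 := chain_glue (H.TT_D X g2 x4) x1 x2 e1 (H.TT_symm e3)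
  have h2 := chain_glue (H.TT_D Y g4 y4) y1 y2 e4 (H.TT_symm e2)
  have := h1.append_overlap (l₃ := Y ++ [H.a]) (by simpa using h2) (by simp)
  simpa using this

lemma wt_D (m : List Lat) (l : List Lat) : ∀ x y, (x :: l).IsChain Adj → (∀ z ∈ x :: l, z ∈ Dn s R) →
    (x :: l).getLast? = some y →
    H.net.wt x (l ++ H.b :: m) = (1 / 4) ^ l.length * H.pw y H.b * H.net.wt H.b m := by
  induction l with
  | nil => intro x y h1 h2 h3
           have : x = y := by simpa using h3
           subst this
           simp only [List.nil_append, List.length_nil, pow_zero, one_mul, Net.wt]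
           rfl
  | cons a l ih =>
    intro x y h1 h2 h3
    rw [List.isChain_cons_cons] at h1
    have := ih a y h1.2 (fun z hz => h2 z (List.mem_cons_of_mem _ hz)) (by simpa using h3)
    simp only [List.cons_append, Net.wt, this]
    have e : H.net.p x a = 1 / 4 := by
      have : H.net.p x a = H.pw x a := rfl
      rw [this, H.pw_D (h2 x (by simp)) (h2 a (by simp)), if_pos h1.1]
    rw [e, List.length_cons]; ring

lemma wt_D2 (l : List Lat) : ∀ x y, (x :: l).IsChain Adj → (∀ z ∈ x :: l, z ∈ Dn s R) →
    (x :: l).getLast? = some y →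
    H.net.wt x (l ++ [H.a]) = (1 / 4) ^ l.length * H.pw y H.a := by
  induction l with
  | nil => intro x y h1 h2 h3
           have : x = y := by simpa using h3
           subst this
           simp only [List.nil_append, List.length_nil, pow_zero, one_mul, Net.wt, mul_one]
           rfl
  | cons a l ih =>
    intro x y h1 h2 h3
    rw [List.isChain_cons_cons] at h1
    have := ih a y h1.2 (fun z hz => h2 z (List.mem_cons_of_mem _ hz)) (by simpa using h3)
    simp only [List.cons_append, Net.wt, this]
    have e : H.net.p x a = 1 / 4 := by
      have : H.net.p x a = H.pw x a := rfl
      rw [this, H.pw_D (h2 x (by simp)) (h2 a (by simp)), if_pos h1.1]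
    rw [e, List.length_cons]; ring

lemma hw_a {v : Lat} (h : v = H.x1 ∨ v = H.x2) : H.hw H.a v = H.eps / eS s v := by
  rw [hw, if_pos ⟨rfl, h⟩]
lemma hw_b {v : Lat} (h : v = H.y1 ∨ v = H.y2) : H.hw H.b v = H.eps / fR R v := by
  rw [hw, if_neg (fun h => H.ne_all.1 h.1.symm), if_pos ⟨rfl, h⟩]

lemma good_wt {X Y : List Lat} (h : H.Good X Y) :
    (1 / 4 : ℝ) ^ (X.length + Y.length) * (16 * H.eps ^ 4) =
    H.net.wt H.a (X ++ H.b :: (Y ++ [H.a])) * (eS s H.x1 * fR R H.y1 * fR R H.y2 * eS s H.x2) := by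
  obtain ⟨⟨x1, x2, x3, x4⟩, ⟨y1, y2, y3, y4⟩, _⟩ := h
  obtain ⟨X', rfl⟩ : ∃ X', X = H.x1 :: X' := by
    cases X with
    | nil => simp at x1
    | cons a l => simp at x1; exact ⟨l, by rw [x1]⟩
  obtain ⟨Y', rfl⟩ : ∃ Y', Y = H.y2 :: Y' := by
    cases Y with
    | nil => simp at y1
    | cons a l => simp at y1; exact ⟨l, by rw [y1]⟩
  simp only [List.cons_append, Net.wt]
  rw [H.wt_D _ X' H.x1 H.y1 x3 x4 x2]
  simp only [Net.wt]
  rw [H.wt_D2 Y' H.y2 H.x2 y3 y4 y2]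
  have q1 : H.net.p H.a H.x1 = H.eps / eS s H.x1 := by
    have : H.net.p H.a H.x1 = H.pw H.a H.x1 := rfl
    rw [this, H.pw_hub H.aD H.x1D, H.hw_a (Or.inl rfl)]
  have q2 : H.net.p H.b H.y2 = H.eps / fR R H.y2 := by
    have : H.net.p H.b H.y2 = H.pw H.b H.y2 := rfl
    rw [this, H.pw_hub H.bD H.y2D, H.hw_b (Or.inr rfl)]
  rw [q1, q2, H.pw_symm H.y1, H.pw_hub H.bD H.y1D, H.hw_b (Or.inl rfl), H.pw_symm H.x2,
    H.pw_hub H.aD H.x2D, H.hw_a (Or.inr rfl)]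
  have := H.ex1_pos; have := H.ex2_pos; have := H.fy1_pos; have := H.fy2_pos
  rw [List.length_cons, List.length_cons, show X'.length + 1 + (Y'.length + 1) = X'.length + Y'.length + 2 by ring,
    pow_add, pow_add]
  field_simp
  norm_num

lemma off_ab : H.net.off [H.a, H.b] = Dn s R := by
  ext x
  rw [Net.mem_off]
  have : x ∈ H.net.U ↔ (x = H.a ∨ x = H.b ∨ x ∈ Dn s R) := by
    have e : H.net.U = H.UU := rfl
    rw [e, UU]; simp
  rw [this]
  have h1 := H.aD; have h2 := H.bD
  simp only [List.mem_cons, List.not_mem_nil, or_false, not_or]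
  constructor
  · tauto
  · intro h
    refine ⟨Or.inr (Or.inr h), ?_, ?_⟩ <;> rintro rfl <;> contradiction

lemma K_LSol : LSol s R (fun x => H.net.P x H.b) (fun z => H.net.K (Dn s R) z H.b) := by
  have hsub : Dn s R ⊆ H.net.U := by
    intro z hz; rw [← H.off_ab, Net.mem_off] at hz; exact hz.1
  obtain ⟨h1, h2⟩ := H.net.sol_spec hsub (fun x => H.net.P x H.b)
  refine ⟨fun x hx => ?_, h2⟩
  have := h1 x hx
  change H.net.sol (Dn s R) (fun x => H.net.P x H.b) x = _
  rw [this, ← tsum_eq (Dn s R) (fun z => H.net.K (Dn s R) z H.b) h2]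
  congr 1
  refine Finset.sum_congr rfl fun y hy => ?_
  have e : H.net.P x y = ((H.pw x y : ℝ) : ℂ) * Complex.I ^ crL (0, 0) (x :: H.ex x y ++ [y]) := rfl
  rw [e, H.pw_D hx hy, H.ex_D hx hy]
  simp only [Net.K, crL, tw, List.cons_append, List.nil_append, add_zero]

end Hub

/-- Threshold scale. -/
def s0 : ℤ := Classical.choose lemF

lemma s0_two : 2 ≤ s0 := (Classical.choose_spec lemF).1

lemma s0_spec : ∀ (s R : ℤ) (x : Lat) (b u : Lat → ℂ), s0 ≤ s → 16 * s ≤ R →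
    linf x = s + 1 → LSol s R b u → (∀ y ∈ Dn s R, b y ≠ 0 → linf y = R - 1) →
    ‖u x‖ ≤ 1920 * ((s : ℝ) / R) ^ (1 / 4 : ℝ) * eS s x * ∑ y ∈ Dn s R, ‖b y‖ * fR R y :=
  (Classical.choose_spec lemF).2

namespace Hub

variable {s R : ℤ} (H : Hub s R)

lemma norm_hub (hs0 : s0 ≤ s) : ‖∑ y ∈ Dn s R, H.net.P H.a y * H.net.K (Dn s R) y H.b‖ ≤
    7680 * ((s : ℝ) / R) ^ (1 / 4 : ℝ) * H.eps ^ 2 := by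
  have heps := H.eps_pos
  have hsp : (0 : ℝ) < s := by exact_mod_cast lt_of_lt_of_le (by norm_num) H.hs
  have hRp : (0 : ℝ) < R := by exact_mod_cast (by have := H.hs; have := H.hR; omega : (0 : ℤ) < R)
  have hq : 0 ≤ ((s : ℝ) / R) ^ (1 / 4 : ℝ) := by positivity
  set q := ((s : ℝ) / R) ^ (1 / 4 : ℝ) with hqd
  have hPn : ∀ x y, ‖H.net.P x y‖ = H.pw x y := fun x y => H.net.P_norm x y
  have hb : ∑ y ∈ Dn s R, ‖H.net.P y H.b‖ * fR R y ≤ 2 * H.eps := by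
    have e : ∑ y ∈ Dn s R, ‖H.net.P y H.b‖ * fR R y = ∑ y ∈ Dn s R, H.hw H.b y * fR R y :=
      Finset.sum_congr rfl fun y hy => by rw [hPn, H.pw_symm, H.pw_hub H.bD hy]
    rw [e]
    refine H.hw_sum H.b (fR R) (fun y _ => fR_nonneg _ _) _ (fun y hy => ?_) heps.le
    rcases (H.hw_nonneg H.b y).eq_or_lt with h | h
    · rw [← h, zero_mul]; exact heps.le
    · rcases H.hw_pos h with h | h
      · exact absurd h.1.symm H.ne_all.1
      · rw [H.hw_b h.2]
        have : 0 < fR R y := by rcases h.2 with h | h <;> rw [h]; exacts [H.fy1_pos, H.fy2_pos]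
        rw [div_mul_cancel₀ _ this.ne']
  have hK : ∀ y, linf y = s + 1 → ‖H.net.K (Dn s R) y H.b‖ ≤ 3840 * q * H.eps * eS s y := by
    intro y hy
    have := s0_spec s R y _ _ hs0 H.hR hy H.K_LSol (fun z hz hne => by
      have h1 : H.pw z H.b ≠ 0 := by rw [← hPn]; simpa using hne
      rw [H.pw_symm, H.pw_hub H.bD hz] at h1
      rcases H.hw_pos (lt_of_le_of_ne (H.hw_nonneg _ _) (Ne.symm h1)) with h | h
      · exact absurd h.1.symm H.ne_all.1
      · rcases h.2 with h | h <;> rw [h]; exacts [H.ly1, H.ly2])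
    refine this.trans ?_
    have h0 := eS_nonneg s y
    calc _ ≤ 1920 * q * eS s y * (2 * H.eps) := mul_le_mul_of_nonneg_left hb (by positivity)
      _ = _ := by ring
  refine (norm_sum_le _ _).trans ?_
  have e : ∑ y ∈ Dn s R, ‖H.net.P H.a y * H.net.K (Dn s R) y H.b‖ =
      ∑ y ∈ Dn s R, H.hw H.a y * ‖H.net.K (Dn s R) y H.b‖ :=
    Finset.sum_congr rfl fun y hy => by rw [norm_mul, hPn, H.pw_hub H.aD hy]
  rw [e]
  have := H.hw_sum H.a (fun y => ‖H.net.K (Dn s R) y H.b‖) (fun y _ => norm_nonneg _)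
    (3840 * q * H.eps * H.eps) (fun y hy => ?_) (by positivity)
  · refine this.trans (le_of_eq ?_); ring
  · rcases (H.hw_nonneg H.a y).eq_or_lt with h | h
    · rw [← h, zero_mul]; positivity
    · rcases H.hw_pos h with h | h
      · have h1 : 0 < eS s y := by rcases h.2 with h | h <;> rw [h]; exacts [H.ex1_pos, H.ex2_pos]
        have h2 : linf y = s + 1 := by rcases h.2 with h | h <;> rw [h]; exacts [H.lx1, H.lx2]
        rw [H.hw_a h.2]
        calc H.eps / eS s y * ‖H.net.K (Dn s R) y H.b‖ ≤ H.eps / eS s y * (3840 * q * H.eps * eS s y) :=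
              mul_le_mul_of_nonneg_left (hK y h2) (by positivity)
          _ = _ := by field_simp
      · exact absurd h.1 H.ne_all.1

theorem pair1 (hs0 : s0 ≤ s) (A : Finset (List Lat × List Lat)) (hA : ∀ p ∈ A, H.Good p.1 p.2) :
    ∑ p ∈ A, (1 / 4 : ℝ) ^ (p.1.length + p.2.length) ≤
    29491200 * Real.sqrt ((s : ℝ) / R) * (eS s H.x1 * fR R H.y1 * fR R H.y2 * eS s H.x2) := by
  have heps := H.eps_pos
  have hsp : (0 : ℝ) < s := by exact_mod_cast lt_of_lt_of_le (by norm_num) H.hs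
  have hRp : (0 : ℝ) < R := by exact_mod_cast (by have := H.hs; have := H.hR; omega : (0 : ℤ) < R)
  have p1 := H.ex1_pos; have p2 := H.ex2_pos; have p3 := H.fy1_pos; have p4 := H.fy2_pos
  set E := eS s H.x1 * fR R H.y1 * fR R H.y2 * eS s H.x2 with hE
  have hE0 : 0 < E := by positivity
  let f : List Lat × List Lat → List Lat := fun p => p.1 ++ H.b :: (p.2 ++ [H.a])
  have hnb : ∀ l : List Lat, (∀ z ∈ l, z ∈ Dn s R) → H.b ∉ l := fun l hl h => H.bD (hl _ h)
  have finj : Set.InjOn f (A : Set (List Lat × List Lat)) := by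
    intro p hp q hq h
    have h1 := hA p hp; have h2 := hA q hq
    have h3 : p.1 ++ H.b :: (p.2 ++ [H.a]) = q.1 ++ H.b :: (q.2 ++ [H.a]) := h
    have h4 := (List.append_cons_inj_of_notMem (hnb _ h1.1.2.2.2) (by
      rw [List.mem_append, not_or]
      exact ⟨hnb _ h1.2.1.2.2.2, by simpa using H.ne_all.1.symm⟩)).1 h3
    ext1
    · exact h4.1
    · exact List.append_cancel_right h4.2.2
  have hb : H.net.psi H.b = 1 := by
    have : H.net.psi H.b = H.psi H.b := rfl
    rw [this, psi, if_neg H.bD]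
  have ha : H.net.psi H.a = 1 := by
    have : H.net.psi H.a = H.psi H.a := rfl
    rw [this, psi, if_neg H.aD]
  have hDU : ∀ z ∈ Dn s R, z ∈ H.net.U := fun z hz => by
    have e : H.net.U = H.UU := rfl
    rw [e, UU]; simp [hz]
  have haU : H.a ∈ H.net.U := by have e : H.net.U = H.UU := rfl
                                 rw [e, UU]; simp
  have hbU : H.b ∈ H.net.U := by have e : H.net.U = H.UU := rfl
                                 rw [e, UU]; simp
  have key := H.net.key_single H.net_cyc H.a H.b haU hbU H.ne_all.1 (H.pw_hub2 H.aD H.bD)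
    (by rw [ha]; exact H.hub_half H.aD) (by rw [hb]; exact H.hub_half H.bD) (A.image f) (by
      intro c hc
      obtain ⟨p, hp, rfl⟩ := Finset.mem_image.1 hc
      have hg := hA p hp
      refine ⟨?_, ?_, ?_, ?_⟩
      · obtain ⟨Φ, h⟩ := H.good_TT hg
        refine ⟨fun v => Complex.I ^ Φ v, fun v => zpow_ne_zero _ Complex.I_ne_zero, h.imp ?_⟩
        intro u v huv
        have e : H.net.t u v = Complex.I ^ crL (0, 0) (u :: H.ex u v ++ [v]) := rfl
        rw [e, huv, ← zpow_add₀ Complex.I_ne_zero]; congr 1; ring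
      · intro y hy
        simp only [f, List.mem_append, List.mem_cons, List.not_mem_nil, or_false] at hy
        rcases hy with h | rfl | h | rfl
        · exact hDU y (hg.1.2.2.2 y h)
        · exact hbU
        · exact hDU y (hg.2.1.2.2.2 y h)
        · exact haU
      · have : H.a :: f p = (H.a :: p.1 ++ H.b :: p.2) ++ [H.a] := by simp [f]
        rw [this, List.getLast?_append]; simp
      · simp [f])
  rw [Finset.sum_image finj, H.off_ab] at key
  have h2 : (∑ p ∈ A, (1 / 4 : ℝ) ^ (p.1.length + p.2.length)) * (16 * H.eps ^ 4) =
      (∑ p ∈ A, H.net.wt H.a (f p)) * E := by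
    rw [Finset.sum_mul, Finset.sum_mul]
    exact Finset.sum_congr rfl fun p hp => H.good_wt (hA p hp)
  have h3 := H.norm_hub hs0
  set q := ((s : ℝ) / R) ^ (1 / 4 : ℝ) with hqd
  have hq : 0 ≤ q := by positivity
  have hq2 : q ^ 2 = Real.sqrt ((s : ℝ) / R) := by
    rw [hqd, ← Real.rpow_natCast, ← Real.rpow_mul (by positivity), Real.sqrt_eq_rpow]; norm_num
  have h4 : ∑ p ∈ A, H.net.wt H.a (f p) ≤ 8 * (7680 * q * H.eps ^ 2) ^ 2 :=
    key.trans (by gcongr)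
  have h5 : (∑ p ∈ A, (1 / 4 : ℝ) ^ (p.1.length + p.2.length)) * (16 * H.eps ^ 4) ≤
      (29491200 * Real.sqrt ((s : ℝ) / R) * E) * (16 * H.eps ^ 4) := by
    rw [h2, ← hq2]
    refine (mul_le_mul_of_nonneg_right h4 hE0.le).trans (le_of_eq ?_)
    ring
  exact le_of_mul_le_mul_right h5 (by positivity)

end Hub

/-- Oriented edges of a list. -/
def Ed (l : List Lat) (u v : Lat) : Prop := ∃ l₁ l₂, l = l₁ ++ u :: v :: l₂

lemma chain_iff_Ed {T : Lat → Lat → Prop} {l : List Lat} :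
    l.IsChain T ↔ ∀ u v, Ed l u v → T u v := by
  rw [List.isChain_iff_forall_rel_of_append_cons_cons]
  constructor
  · rintro h u v ⟨l₁, l₂, h'⟩; exact h h'
  · intro h u v l₁ l₂ h'; exact h u v ⟨l₁, l₂, h'⟩

lemma Ed.mem {l : List Lat} {u v : Lat} (h : Ed l u v) : u ∈ l ∧ v ∈ l := by
  obtain ⟨l₁, l₂, rfl⟩ := h; simp

lemma Ed_two {u v a b : Lat} (h : Ed [a, b] u v) : u = a ∧ v = b := by
  obtain ⟨l₁, l₂, h⟩ := h
  cases l₁ with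
  | nil => simp at h; exact ⟨h.1.symm, h.2.1.symm⟩
  | cons c l => cases l with
    | nil => simp at h
    | cons d l => simp at h

lemma Ed_snoc {l : List Lat} {c d u v : Lat} (h : Ed (l ++ [c] ++ [d]) u v) :
    Ed (l ++ [c]) u v ∨ (u = c ∧ v = d) := by
  obtain ⟨l₁, l₂, h⟩ := h
  rcases List.eq_nil_or_concat l₂ with rfl | ⟨l₃, e, rfl⟩
  · right
    have : l ++ [c] ++ [d] = (l₁ ++ [u]) ++ [v] := by rw [h]; simp
    have h1 := List.append_inj' this rfl
    have h2 := List.append_inj' h1.1 rfl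
    exact ⟨by simpa using h2.2.symm, by simpa using h1.2.symm⟩
  · left
    have : l ++ [c] ++ [d] = (l₁ ++ u :: v :: l₃) ++ [e] := by rw [h]; simp
    have h1 := List.append_inj' this rfl
    exact ⟨l₁, l₃, h1.1⟩

lemma Ed_ends {p q u v : Lat} {l : List Lat} (hn : (p :: l ++ [q]).Nodup)
    (h : Ed (p :: l ++ [q]) u v) (hu : u = p ∨ u = q) (hv : v = p ∨ v = q) : l = [] := by
  obtain ⟨l₁, l₂, h⟩ := h
  cases l₁ with
  | nil =>
    cases l with
    | nil => rfl
    | cons c l =>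
      simp at h hn
      obtain ⟨rfl, rfl, h⟩ := h
      grind
  | cons d l₁ =>
    simp at h hn
    obtain ⟨rfl, h⟩ := h
    exfalso
    have h1 : u ∈ l ++ [q] := by rw [h]; simp
    have h2 : v ∈ l ++ [q] := by rw [h]; simp
    have h3 : (l ++ [q]).Nodup := by rw [List.nodup_append]; simp; grind
    have hu' : u = q := by grind
    have hv' : v = q := by grind
    rw [h, hu', hv'] at h3
    simp [List.nodup_append] at h3

lemma ring_rot {s : ℤ} (hs : 1 ≤ s) {p : Lat} (hp : linf p = s) : ∃ l : List Lat,
    (p :: l).Nodup ∧ (p :: l ++ [p]).IsChain Adj ∧ ∀ z, z ∈ p :: l ↔ linf z = s := by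
  obtain ⟨h1, h2, h3⟩ := ring_spec hs
  obtain ⟨la, lb, h⟩ := List.append_of_mem ((h3 p).2 hp)
  rw [h] at h1 h2 h3
  refine ⟨lb ++ la, ?_, ?_, ?_⟩
  · have : (p :: (lb ++ la)).Perm (la ++ p :: lb) := by
      rw [← List.cons_append]; exact List.perm_append_comm
    exact this.nodup_iff.2 h1
  · cases la with
    | nil => simpa using h2
    | cons c la =>
      have e : c :: la ++ p :: lb ++ (c :: la ++ p :: lb).take 1 = (c :: la ++ [p]) ++ (lb ++ [c]) := by simp
      rw [e] at h2
      have e1 : (c :: la ++ [p]).IsChain Adj := List.IsChain.left_of_append h2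
      have e' : (c :: la ++ [p]) ++ (lb ++ [c]) = (c :: la) ++ (p :: lb ++ [c]) := by simp
      rw [e'] at h2
      have e2 : (p :: lb ++ [c]).IsChain Adj := List.IsChain.right_of_append h2
      have := e2.append_overlap (l₃ := la ++ [p]) (by simpa using e1) (by simp)
      simpa using this
  · intro z; rw [← h3 z]; simp; tauto

lemma arcs {s : ℤ} (hs : 1 ≤ s) {p q : Lat} (hp : linf p = s) (hq : linf q = s) (hpq : p ≠ q) :
    ∃ l l' : List Lat, ((p :: l ++ [q]).IsChain Adj ∧ (p :: l ++ [q]).Nodup ∧ ∀ z ∈ p :: l ++ [q], linf z = s) ∧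
    ((p :: l' ++ [q]).IsChain Adj ∧ (p :: l' ++ [q]).Nodup ∧ ∀ z ∈ p :: l' ++ [q], linf z = s) ∧
    ∀ a b : Lat, (∀ u v, Ed (p :: l ++ [q]) u v → (u, v) ≠ (a, b) ∧ (u, v) ≠ (b, a)) ∨
      (∀ u v, Ed (p :: l' ++ [q]) u v → (u, v) ≠ (a, b) ∧ (u, v) ≠ (b, a)) := by
  obtain ⟨m, h1, h2, h3⟩ := ring_rot hs hp
  have hqm : q ∈ m := by
    have := (h3 q).2 hq
    rcases List.mem_cons.1 this with h | h
    · exact absurd h.symm hpq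
    · exact h
  obtain ⟨l, l', rfl⟩ := List.append_of_mem hqm
  have n1 : (p :: l ++ [q]).Nodup := by
    refine h1.sublist ?_
    simp
  have n2 : (p :: l'.reverse ++ [q]).Nodup := by
    have : (p :: l'.reverse ++ [q]).Perm (p :: (q :: l')) := by
      rw [List.cons_append, List.perm_cons]
      refine List.perm_append_comm.trans ?_
      simp
    rw [this.nodup_iff]
    refine h1.sublist ?_
    simp
  have c1 : (p :: l ++ [q]).IsChain Adj := by
    have : p :: (l ++ q :: l') ++ [p] = (p :: l ++ [q]) ++ (l' ++ [p]) := by simp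
    rw [this] at h2
    exact List.IsChain.left_of_append h2
  have c2 : (p :: l'.reverse ++ [q]).IsChain Adj := by
    have : p :: (l ++ q :: l') ++ [p] = (p :: l) ++ (q :: l' ++ [p]) := by simp
    rw [this] at h2
    have h4 := List.IsChain.right_of_append h2
    rw [← List.isChain_reverse] at h4
    simp at h4
    simp
    exact h4.imp fun a b h => adj_symm h
  refine ⟨l, l'.reverse, ⟨c1, n1, fun z hz => (h3 z).1 (by simp at hz ⊢; tauto)⟩,
    ⟨c2, n2, fun z hz => (h3 z).1 (by simp at hz ⊢; tauto)⟩, fun a b => ?_⟩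
  by_contra hcon
  push Not at hcon
  obtain ⟨⟨u, v, e1, f1⟩, ⟨u', v', e2, f2⟩⟩ := hcon
  have huv : (u = a ∧ v = b) ∨ (u = b ∧ v = a) := by
    by_cases h : (u, v) = (a, b)
    · left; simpa using h
    · right; simpa using f1 h
  have huv' : (u' = a ∧ v' = b) ∨ (u' = b ∧ v' = a) := by
    by_cases h : (u', v') = (a, b)
    · left; simpa using h
    · right; simpa using f2 h
  have disj : ∀ z, z ∈ p :: l ++ [q] → z ∈ p :: l'.reverse ++ [q] → z = p ∨ z = q := by
    intro z hz hz'
    have h5 : ∀ x ∈ l, x ∉ l' := by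
      simp only [List.nodup_cons, List.nodup_append] at h1
      intro x hx hx'
      exact h1.2.2.2 x hx x (by simp [hx']) rfl
    simp at hz hz'
    by_contra hc
    push Not at hc
    exact h5 z (by tauto) (by tauto)
  have m1 := e1.mem; have m2 := e2.mem
  have ha : a = p ∨ a = q := by
    apply disj <;> rcases huv with ⟨rfl, rfl⟩ | ⟨rfl, rfl⟩ <;> rcases huv' with ⟨rfl, rfl⟩ | ⟨rfl, rfl⟩ <;> tauto
  have hb : b = p ∨ b = q := by
    apply disj <;> rcases huv with ⟨rfl, rfl⟩ | ⟨rfl, rfl⟩ <;> rcases huv' with ⟨rfl, rfl⟩ | ⟨rfl, rfl⟩ <;> tauto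
  have l1 : l = [] := Ed_ends n1 e1 (by rcases huv with ⟨rfl, rfl⟩ | ⟨rfl, rfl⟩ <;> assumption)
    (by rcases huv with ⟨rfl, rfl⟩ | ⟨rfl, rfl⟩ <;> assumption)
  have l2 : l'.reverse = [] := Ed_ends n2 e2 (by rcases huv' with ⟨rfl, rfl⟩ | ⟨rfl, rfl⟩ <;> assumption)
    (by rcases huv' with ⟨rfl, rfl⟩ | ⟨rfl, rfl⟩ <;> assumption)
  rw [List.reverse_eq_nil_iff] at l2
  subst l1 l2
  have r1 := (h3 (s, 0)).2 (by simp [linf]; omega)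
  have r2 := (h3 (-s, 0)).2 (by simp [linf]; omega)
  have r3 := (h3 (0, s)).2 (by simp [linf]; omega)
  simp only [List.nil_append, List.mem_cons, List.not_mem_nil, or_false] at r1 r2 r3
  have k1 : ((s, 0) : Lat) ≠ (-s, 0) := by simp; omega
  have k2 : ((s, 0) : Lat) ≠ (0, s) := by simp; omega
  have k3 : ((-s, 0) : Lat) ≠ (0, s) := by simp; omega
  rcases r1 with r1 | r1 <;> rcases r2 with r2 | r2 <;> rcases r3 with r3 | r3 <;>
    first
    | exact k1 (r1.trans r2.symm)
    | exact k2 (r1.trans r3.symm)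
    | exact k3 (r2.trans r3.symm)

lemma corridor {s : ℤ} (hs : 1 ≤ s) {a1 a2 x1 x2 : Lat} (h1 : linf a1 = s) (h2 : linf a2 = s)
    (h3 : Adj a1 x1) (h4 : Adj a2 x2) : ∃ L : Bool → List Lat,
    (∀ i, (a1 :: L i ++ [x2]).IsChain Adj ∧ (L i).Nodup ∧ (∀ z ∈ L i, linf z = s ∧ z ≠ a1) ∧ (x1 = x2 → L i = [])) ∧
    ∀ a b : Lat, ∃ i, ∀ u v, Ed (a1 :: L i ++ [x2]) u v → (u = a1 ∧ v = x1) ∨ (u = a2 ∧ v = x2) ∨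
      (linf u = s ∧ linf v = s ∧ (u, v) ≠ (a, b) ∧ (u, v) ≠ (b, a)) := by
  by_cases e1 : x1 = x2
  · subst e1
    refine ⟨fun _ => [], fun _ => ⟨by simpa using h3, by simp, by simp, by simp⟩, fun a b => ⟨true, fun u v h => ?_⟩⟩
    exact Or.inl (Ed_two h)
  by_cases e2 : a1 = a2
  · subst e2
    refine ⟨fun _ => [], fun _ => ⟨by simpa using h4, by simp, by simp, by simp⟩, fun a b => ⟨true, fun u v h => ?_⟩⟩
    exact Or.inr (Or.inl (Ed_two h))
  obtain ⟨l, l', c1, c2, hc⟩ := arcs hs h1 h2 e2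
  refine ⟨fun i => cond i (l ++ [a2]) (l' ++ [a2]), fun i => ?_, fun a b => ?_⟩
  · have key : ∀ m : List Lat, ((a1 :: m ++ [a2]).IsChain Adj ∧ (a1 :: m ++ [a2]).Nodup ∧
        ∀ z ∈ a1 :: m ++ [a2], linf z = s) → (a1 :: (m ++ [a2]) ++ [x2]).IsChain Adj ∧ (m ++ [a2]).Nodup ∧
        (∀ z ∈ m ++ [a2], linf z = s ∧ z ≠ a1) ∧ (x1 = x2 → m ++ [a2] = []) := by
      rintro m ⟨k1, k2, k3⟩
      refine ⟨?_, ?_, ?_, fun h => absurd h e1⟩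
      · have := k1.append_overlap (l₃ := [x2]) (l₂ := [a2]) (by simpa using h4) (by simp)
        simpa using this
      · rw [List.cons_append, List.nodup_cons] at k2; exact k2.2
      · intro z hz
        refine ⟨k3 z (by rw [List.cons_append]; exact List.mem_cons_of_mem _ hz), ?_⟩
        rw [List.cons_append, List.nodup_cons] at k2
        rintro rfl; exact k2.1 hz
    cases i
    · exact key l' c2
    · exact key l c1
  · have key : ∀ m : List Lat, (∀ z ∈ a1 :: m ++ [a2], linf z = s) →
        (∀ u v, Ed (a1 :: m ++ [a2]) u v → (u, v) ≠ (a, b) ∧ (u, v) ≠ (b, a)) →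
        ∀ u v, Ed (a1 :: (m ++ [a2]) ++ [x2]) u v → (u = a1 ∧ v = x1) ∨ (u = a2 ∧ v = x2) ∨
      (linf u = s ∧ linf v = s ∧ (u, v) ≠ (a, b) ∧ (u, v) ≠ (b, a)) := by
      intro m k1 k2 u v h
      rcases Ed_snoc (l := a1 :: m) (by simpa using h) with h | h
      · exact Or.inr (Or.inr ⟨k1 _ h.mem.1, k1 _ h.mem.2, k2 u v h⟩)
      · exact Or.inr (Or.inl h)
    rcases hc a b with h | h
    · exact ⟨true, key l c1.2.2 h⟩
    · exact ⟨false, key l' c2.2.2 h⟩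

/-- Crossing pieces. -/
def CX (s R : ℤ) (x y : Lat) (X : List Lat) : Prop :=
  X.head? = some x ∧ X.getLast? = some y ∧ X.IsChain Adj ∧ ∀ z ∈ X, z ∈ Dn s R

lemma GG_symm {Φ : Lat → ℤ} {u v : Lat} (h : GG Φ u v) : GG Φ v u := by
  unfold GG at *; rw [cr_symm, h]; ring

theorem pairL {s R : ℤ} (hs0 : s0 ≤ s) (hR : 16 * s ≤ R) {a1 a2 x1 x2 b1 b2 y1 y2 : Lat}
    (la1 : linf a1 = s) (la2 : linf a2 = s) (lb1 : linf b1 = R) (lb2 : linf b2 = R)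
    (lx1 : linf x1 = s + 1) (lx2 : linf x2 = s + 1) (ly1 : linf y1 = R - 1) (ly2 : linf y2 = R - 1)
    (hx1 : Adj a1 x1) (hx2 : Adj a2 x2) (hy1 : Adj b1 y1) (hy2 : Adj b2 y2)
    (A : Finset (List Lat × List Lat))
    (hA : ∀ p ∈ A, CX s R x1 y1 p.1 ∧ CX s R y2 x2 p.2 ∧
      NN s R (fun u v => Ed (a1 :: p.1 ++ [b1]) u v ∨ Ed (b2 :: p.2 ++ [a2]) u v)) :
    ∑ p ∈ A, (1 / 4 : ℝ) ^ (p.1.length + p.2.length) ≤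
    117964800 * Real.sqrt ((s : ℝ) / R) * (eS s x1 * fR R y1 * fR R y2 * eS s x2) := by
  have hs2 : 2 ≤ s := s0_two.trans hs0
  obtain ⟨L, hL, hL'⟩ := corridor (by omega : 1 ≤ s) la1 la2 hx1 hx2
  obtain ⟨M, hM, hM'⟩ := corridor (by omega : 1 ≤ R) lb1 lb2 hy1 hy2
  let H : Bool × Bool → Hub s R := fun ij =>
    { a := a1, b := b1, x1 := x1, x2 := x2, y1 := y1, y2 := y2, L1 := L ij.1, L2 := M ij.2
      hs := hs2, hR := hR, la := la1, lb := lb1, lx1 := lx1, lx2 := lx2, ly1 := ly1, ly2 := ly2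
      ax := hx1, byy := hy1, c1 := (hL ij.1).1, c2 := (hM ij.2).1, n1 := (hL ij.1).2.1, n2 := (hM ij.2).2.1
      m1 := (hL ij.1).2.2.1, m2 := (hM ij.2).2.2.1, d1 := (hL ij.1).2.2.2, d2 := (hM ij.2).2.2.2 }
  have hgood : ∀ p ∈ A, ∃ ij, (H ij).Good p.1 p.2 := by
    intro p hp
    obtain ⟨hX, hY, hN⟩ := hA p hp
    obtain ⟨a, b, a', b', hseg⟩ := hN.seg (by omega)
    obtain ⟨i, hi⟩ := hL' a b
    obtain ⟨j, hj⟩ := hM' a' b'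
    let Q : Lat → Lat → Prop := fun u v =>
      (linf u = s ∧ linf v = s ∧ (u, v) ≠ (a, b) ∧ (u, v) ≠ (b, a)) ∨
        (linf u = R ∧ linf v = R ∧ (u, v) ≠ (a', b') ∧ (u, v) ≠ (b', a'))
    have hbd : ∀ (c d x y : Lat) (l : List Lat), CX s R x y l → (linf c = s ∨ linf c = R) →
        (linf d = s ∨ linf d = R) → ∀ z ∈ c :: l ++ [d], s ≤ linf z ∧ linf z ≤ R := by
      intro c d x y l hl hc hd z hz
      simp only [List.cons_append, List.mem_cons, List.mem_append, List.not_mem_nil, or_false] at hz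
      rcases hz with rfl | hz | rfl
      · omega
      · have := hl.2.2.2 z hz
        rw [mem_Dn] at this; omega
      · omega
    obtain ⟨Φ, hΦ⟩ := (hseg Q fun u v h => h).pot (by omega) (by
      rintro u v ((h | h) | h | h)
      · exact ⟨hbd _ _ _ _ _ hX (Or.inl la1) (Or.inr lb1) _ h.mem.1, hbd _ _ _ _ _ hX (Or.inl la1) (Or.inr lb1) _ h.mem.2⟩
      · exact ⟨hbd _ _ _ _ _ hY (Or.inr lb2) (Or.inl la2) _ h.mem.1, hbd _ _ _ _ _ hY (Or.inr lb2) (Or.inl la2) _ h.mem.2⟩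
      · omega
      · omega)
    have c1 := chain_glue hX.2.2.1 hX.1 hX.2.1 hx1 (adj_symm hy1)
    have c2 := chain_glue hY.2.2.1 hY.1 hY.2.1 hy2 (adj_symm hx2)
    have g1 : (a1 :: p.1 ++ [b1]).IsChain (GG Φ) := chain_iff_Ed.2 fun u v h =>
      hΦ u v (chain_iff_Ed.1 c1 u v h) (Or.inl (Or.inl h))
    have g2 : (b2 :: p.2 ++ [a2]).IsChain (GG Φ) := chain_iff_Ed.2 fun u v h =>
      hΦ u v (chain_iff_Ed.1 c2 u v h) (Or.inl (Or.inr h))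
    have split : ∀ (c d x y : Lat) (l : List Lat), (c :: l ++ [d]).IsChain (GG Φ) → l.head? = some x →
        l.getLast? = some y → GG Φ c x ∧ l.IsChain (GG Φ) ∧ GG Φ y d := by
      intro c d x y l hl hx hy
      rw [List.isChain_append] at hl
      obtain ⟨k1, -, k2⟩ := hl
      rw [List.isChain_cons] at k1
      refine ⟨k1.1 x hx, k1.2, k2 y ?_ d (by simp)⟩
      rw [List.getLast?_cons, hy]; simp
    obtain ⟨u1, u2, u3⟩ := split _ _ _ _ _ g1 hX.1 hX.2.1
    obtain ⟨w1, w2, w3⟩ := split _ _ _ _ _ g2 hY.1 hY.2.1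
    refine ⟨(i, j), hX, hY, Φ, u1, u2, u3, w2, chain_iff_Ed.2 fun u v h => ?_, chain_iff_Ed.2 fun u v h => ?_⟩
    · rcases hi u v h with ⟨rfl, rfl⟩ | ⟨rfl, rfl⟩ | h'
      · exact u1
      · exact GG_symm w3
      · exact hΦ u v (chain_iff_Ed.1 (hL i).1 u v h) (Or.inr (Or.inl h'))
    · rcases hj u v h with ⟨rfl, rfl⟩ | ⟨rfl, rfl⟩ | h'
      · exact GG_symm u3
      · exact w1
      · exact hΦ u v (chain_iff_Ed.1 (hM j).1 u v h) (Or.inr (Or.inr h'))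
  have hnn : ∀ p : List Lat × List Lat, 0 ≤ (1 / 4 : ℝ) ^ (p.1.length + p.2.length) := fun p => by positivity
  calc _ ≤ ∑ p ∈ A, ∑ ij : Bool × Bool, (if (H ij).Good p.1 p.2 then
          (1 / 4 : ℝ) ^ (p.1.length + p.2.length) else 0) := by
        refine Finset.sum_le_sum fun p hp => ?_
        obtain ⟨ij, h⟩ := hgood p hp
        refine le_trans (le_of_eq ?_) (Finset.single_le_sum (f := fun ij => if (H ij).Good p.1 p.2 then
          (1 / 4 : ℝ) ^ (p.1.length + p.2.length) else 0) (fun ij _ => ?_) (Finset.mem_univ ij))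
        · beta_reduce; rw [if_pos h]
        · beta_reduce; split_ifs
          · exact hnn p
          · exact le_rfl
    _ = ∑ ij : Bool × Bool, ∑ p ∈ A.filter (fun p => (H ij).Good p.1 p.2),
          (1 / 4 : ℝ) ^ (p.1.length + p.2.length) := by
        rw [Finset.sum_comm]
        refine Finset.sum_congr rfl fun ij _ => ?_
        rw [Finset.sum_filter]
    _ ≤ ∑ ij : Bool × Bool, 29491200 * Real.sqrt ((s : ℝ) / R) * (eS s x1 * fR R y1 * fR R y2 * eS s x2) :=
        Finset.sum_le_sum fun ij _ => (H ij).pair1 hs0 _ fun p hp => (Finset.mem_filter.1 hp).2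
    _ = _ := by simp; ring

lemma emb0 (z : Lat) : emb z 0 = (z.1 : ℝ) := rfl
lemma emb1 (z : Lat) : emb z 1 = (z.2 : ℝ) := rfl

lemma mem_zip_tail {l : List Lat} {u v : Lat} : (u, v) ∈ l.zip l.tail ↔ Ed l u v := by
  induction l with
  | nil => simp [Ed]
  | cons a l ih =>
    cases l with
    | nil =>
      simp only [List.tail_cons, List.zip_nil_right, List.not_mem_nil, false_iff]
      rintro ⟨l₁, l₂, h⟩
      cases l₁ <;> simp at h
    | cons b l =>
      simp only [List.tail_cons, List.zip_cons_cons, List.mem_cons] at ih ⊢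
      rw [ih]
      constructor
      · rintro (h | ⟨l₁, l₂, h⟩)
        · rw [Prod.mk.injEq] at h; obtain ⟨rfl, rfl⟩ := h
          exact ⟨[], l, rfl⟩
        · exact ⟨a :: l₁, l₂, by rw [h]; rfl⟩
      · rintro ⟨l₁, l₂, h⟩
        cases l₁ with
        | nil => left; simp at h; rw [h.1, h.2.1]
        | cons c l₁ => right; simp at h; exact ⟨l₁, l₂, h.2⟩

lemma seg_trace {l : List Lat} {u v : Lat} (h : Ed l u v) : segment ℝ (emb u) (emb v) ⊆ traceL l := by
  intro p hp
  refine Or.inr ?_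
  simp only [mem_iUnion]
  exact ⟨(u, v), mem_zip_tail.2 h, hp⟩

lemma seg_coord {u v : Lat} {p : Plane} : p ∈ segment ℝ (emb u) (emb v) ↔ ∃ t : ℝ, 0 ≤ t ∧ t ≤ 1 ∧
    p 0 = u.1 + t * (v.1 - u.1) ∧ p 1 = u.2 + t * (v.2 - u.2) := by
  rw [segment_eq_image']
  constructor
  · rintro ⟨t, ⟨h0, h1⟩, rfl⟩
    exact ⟨t, h0, h1, by simp [emb0], by simp [emb1]⟩
  · rintro ⟨t, h0, h1, h2, h3⟩
    refine ⟨t, ⟨h0, h1⟩, ?_⟩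
    ext i
    fin_cases i
    · simp [emb0, h2]
    · simp [emb1, h3]

lemma emb_mem_trace {l : List Lat} (hl : l.IsChain Adj) {z : Lat} (h : emb z ∈ traceL l) : z ∈ l := by
  rcases h with h | h
  · simp only [mem_iUnion, mem_singleton_iff] at h
    obtain ⟨w, hw, he⟩ := h
    have h0 := congrArg (fun p : Plane => p 0) he
    have h1 := congrArg (fun p : Plane => p 1) he
    simp only [emb0, emb1] at h0 h1
    have : z = w := Prod.ext (by exact_mod_cast h0) (by exact_mod_cast h1)
    rwa [this]
  · simp only [mem_iUnion] at h
    obtain ⟨⟨u, v⟩, huv, hs⟩ := h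
    rw [mem_zip_tail] at huv
    have ha := chain_iff_Ed.1 hl u v huv
    obtain ⟨t, t0, t1, e0, e1⟩ := seg_coord.1 hs
    simp only [emb0, emb1] at e0 e1
    have key : z = u ∨ z = v := by
      obtain ⟨u1, u2⟩ := u
      obtain ⟨z1, z2⟩ := z
      have tt : ∀ k m : ℤ, (k : ℝ) = m + t → k = m ∧ t = 0 ∨ k = m + 1 ∧ t = 1 := by
        intro k m h
        have h1 : m ≤ k := by have : (m : ℝ) ≤ k := by linarith
                              exact_mod_cast this
        have h2 : k ≤ m + 1 := by have : (k : ℝ) ≤ m + 1 := by linarith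
                                  exact_mod_cast this
        rcases (by omega : k = m ∨ k = m + 1) with rfl | rfl
        · left; exact ⟨rfl, by linarith⟩
        · right; refine ⟨rfl, ?_⟩; push_cast at h; linarith
      have tt' : ∀ k m : ℤ, (k : ℝ) = m - t → k = m ∧ t = 0 ∨ k = m - 1 ∧ t = 1 := by
        intro k m h
        have h1 : k ≤ m := by have : (k : ℝ) ≤ m := by linarith
                              exact_mod_cast this
        have h2 : m ≤ k + 1 := by have : (m : ℝ) ≤ k + 1 := by linarith
                                  exact_mod_cast this
        rcases (by omega : k = m ∨ k = m - 1) with rfl | rfl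
        · left; exact ⟨rfl, by linarith⟩
        · right; refine ⟨rfl, ?_⟩; push_cast at h; linarith
      rcases (adj_iff _ _).1 ha with rfl | rfl | rfl | rfl <;> push_cast at e0 e1 <;> simp only [Prod.mk.injEq]
      · have e2 : z2 = u2 := by have : (z2 : ℝ) = u2 := by linarith
                                exact_mod_cast this
        have := tt z1 u1 (by linarith); omega
      · have e2 : z1 = u1 := by have : (z1 : ℝ) = u1 := by linarith
                                exact_mod_cast this
        have := tt z2 u2 (by linarith); omega
      · have e2 : z2 = u2 := by have : (z2 : ℝ) = u2 := by linarith
                                exact_mod_cast this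
        have := tt' z1 u1 (by linarith); omega
      · have e2 : z1 = u1 := by have : (z1 : ℝ) = u1 := by linarith
                                exact_mod_cast this
        have := tt' z2 u2 (by linarith); omega
    rcases key with rfl | rfl
    · exact huv.mem.1
    · exact huv.mem.2

lemma bdry_linf {R : ℤ} {z : Lat} (h : z ∈ bdry (box 0 R)) : linf z = R := by
  obtain ⟨h1, w, h2, h3⟩ := h
  simp only [box, mem_setOf_eq, sub_zero] at h1 h2
  have : ¬ linf w ≤ R := h2
  rw [linf_le] at this h1
  have h4 : linf (z - w) ≤ 1 := h3.le
  rw [linf_le] at h4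
  simp only [Prod.fst_sub, Prod.snd_sub] at h4
  have : R ≤ linf z := by
    by_contra hc
    have : linf z ≤ R - 1 := by omega
    rw [linf_le] at this
    omega
  have := (linf_le (u := z) (R := R)).2 h1
  omega

/-- Closed unit cells. -/
def cell (f : Lat) : Set Plane := {p | (f.1 : ℝ) ≤ p 0 ∧ p 0 ≤ f.1 + 1 ∧ (f.2 : ℝ) ≤ p 1 ∧ p 1 ≤ f.2 + 1}

lemma cell_conn1 {l : List Lat} {p : Plane} (hp : p ∉ traceL l) {i k j : ℤ}
    (h1 : p ∈ cell (i, j)) (h2 : p ∈ cell (k, j)) :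
    Relation.ReflTransGen (FStep (Ed l)) (i, j) (k, j) := by
  have step : ∀ i : ℤ, p ∈ cell (i, j) → p ∈ cell (i + 1, j) → FStep (Ed l) (i, j) (i + 1, j) := by
    intro i h1 h2
    obtain ⟨a1, a2, a3, a4⟩ := h1
    obtain ⟨b1, b2, b3, b4⟩ := h2
    push_cast at a1 a2 a3 a4 b1 b2 b3 b4
    refine ⟨(i + 1, j), (i + 1, j + 1), Or.inl ⟨by simp, rfl, rfl⟩, fun h => hp (seg_trace h ?_), fun h => hp (seg_trace h ?_)⟩
    · exact seg_coord.2 ⟨p 1 - j, by linarith, by linarith, by push_cast; linarith, by push_cast; ring⟩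
    · exact seg_coord.2 ⟨1 - (p 1 - j), by linarith, by linarith, by push_cast; linarith, by push_cast; ring⟩
  have q1 : i ≤ k + 1 := by have : (i : ℝ) ≤ k + 1 := h1.1.trans h2.2.1
                            exact_mod_cast this
  have q2 : k ≤ i + 1 := by have : (k : ℝ) ≤ i + 1 := h2.1.trans h1.2.1
                            exact_mod_cast this
  rcases (by omega : i = k + 1 ∨ i = k ∨ k = i + 1) with rfl | rfl | rfl
  · exact Relation.ReflTransGen.single (step k h2 h1).symm
  · exact Relation.ReflTransGen.refl
  · exact Relation.ReflTransGen.single (step i h1 h2)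

lemma cell_conn2 {l : List Lat} {p : Plane} (hp : p ∉ traceL l) {i k j : ℤ}
    (h1 : p ∈ cell (j, i)) (h2 : p ∈ cell (j, k)) :
    Relation.ReflTransGen (FStep (Ed l)) (j, i) (j, k) := by
  have step : ∀ i : ℤ, p ∈ cell (j, i) → p ∈ cell (j, i + 1) → FStep (Ed l) (j, i) (j, i + 1) := by
    intro i h1 h2
    obtain ⟨a1, a2, a3, a4⟩ := h1
    obtain ⟨b1, b2, b3, b4⟩ := h2
    push_cast at a1 a2 a3 a4 b1 b2 b3 b4
    refine ⟨(j, i + 1), (j + 1, i + 1), Or.inr (Or.inr (Or.inl ⟨by simp, rfl, rfl⟩)), fun h => hp (seg_trace h ?_), fun h => hp (seg_trace h ?_)⟩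
    · exact seg_coord.2 ⟨p 0 - j, by linarith, by linarith, by push_cast; ring, by push_cast; linarith⟩
    · exact seg_coord.2 ⟨1 - (p 0 - j), by linarith, by linarith, by push_cast; ring, by push_cast; linarith⟩
  have q1 : i ≤ k + 1 := by have : (i : ℝ) ≤ k + 1 := h1.2.2.1.trans h2.2.2.2
                            exact_mod_cast this
  have q2 : k ≤ i + 1 := by have : (k : ℝ) ≤ i + 1 := h2.2.2.1.trans h1.2.2.2
                            exact_mod_cast this
  rcases (by omega : i = k + 1 ∨ i = k ∨ k = i + 1) with rfl | rfl | rfl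
  · exact Relation.ReflTransGen.single (step k h2 h1).symm
  · exact Relation.ReflTransGen.refl
  · exact Relation.ReflTransGen.single (step i h1 h2)

lemma cell_conn {l : List Lat} {p : Plane} (hp : p ∉ traceL l) {f g : Lat}
    (h1 : p ∈ cell f) (h2 : p ∈ cell g) : Relation.ReflTransGen (FStep (Ed l)) f g := by
  obtain ⟨i, j⟩ := f
  obtain ⟨k, m⟩ := g
  have h3 : p ∈ cell (k, j) := ⟨h2.1, h2.2.1, h1.2.2.1, h1.2.2.2⟩
  exact (cell_conn1 hp h1 h3).trans (cell_conn2 hp h3 h2)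

lemma near_int (p : ℝ) : ∃ δ > 0, ∀ x, |x - p| < δ → ∀ i : ℤ, (i : ℝ) ≤ x → x ≤ i + 1 →
    (i : ℝ) ≤ p ∧ p ≤ i + 1 := by
  have h1 := Int.ceil_lt_add_one p
  have h2 := Int.lt_floor_add_one p
  refine ⟨min (p - (⌈p⌉ - 1)) (⌊p⌋ + 1 - p), lt_min (by linarith) (by linarith), fun x hx i h3 h4 => ?_⟩
  rw [lt_min_iff, abs_lt, abs_lt] at hx
  constructor
  · have : (i : ℝ) < ⌊p⌋ + 1 := by linarith [hx.2.2]
    have : i < ⌊p⌋ + 1 := by exact_mod_cast this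
    have : i ≤ ⌊p⌋ := by omega
    exact Int.le_floor.1 this
  · have : (⌈p⌉ : ℝ) - 1 < i + 1 := by linarith [hx.1.1]
    have : ⌈p⌉ - 1 < i + 1 := by exact_mod_cast this
    have : ⌈p⌉ ≤ i + 1 := by omega
    have := Int.ceil_le.1 this
    push_cast at this; exact this

lemma near_cell (p : Plane) : ∀ᶠ q in nhds p, ∀ f : Lat, q ∈ cell f → p ∈ cell f := by
  obtain ⟨d0, hd0, h0⟩ := near_int (p 0)
  obtain ⟨d1, hd1, h1⟩ := near_int (p 1)
  have c0 : Continuous fun q : Plane => q 0 := by fun_prop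
  have c1 : Continuous fun q : Plane => q 1 := by fun_prop
  filter_upwards [c0.continuousAt (Metric.ball_mem_nhds (p 0) hd0), c1.continuousAt (Metric.ball_mem_nhds (p 1) hd1)]
    with q hq0 hq1 f hf
  have a := h0 (q 0) (by simpa [Real.dist_eq] using hq0) f.1 hf.1 hf.2.1
  have b := h1 (q 1) (by simpa [Real.dist_eq] using hq1) f.2 hf.2.2.1 hf.2.2.2
  exact ⟨a.1, a.2, b.1, b.2⟩

theorem nn_of_not_disc {l : List Lat} {r R : ℤ}
    (h : ¬ Disconnects (traceL l) (embS (box 0 r)) (bdryE 0 R)) : NN (r + 1) R (Ed l) := by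
  unfold Disconnects at h
  push Not at h
  obtain ⟨γ, hc, ⟨z0, hz0, e0⟩, ⟨z1, hz1, e1⟩, hT⟩ := h
  have hz1 := bdry_linf hz1
  have hz0 : linf z0 ≤ r := by simpa [box] using hz0
  let S : Lat → Prop := fun f => Relation.ReflTransGen (FStep (Ed l)) z0 f
  let Q : Icc (0 : ℝ) 1 → Prop := fun t => ∃ f, S f ∧ γ t ∈ cell f
  have hcell : ∀ p : Plane, ∃ f, p ∈ cell f := fun p =>
    ⟨(⌊p 0⌋, ⌊p 1⌋), Int.floor_le _, (Int.lt_floor_add_one _).le, Int.floor_le _, (Int.lt_floor_add_one _).le⟩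
  have hQ : IsLocallyConstant Q := by
    rw [IsLocallyConstant.iff_eventually_eq]
    intro t
    have hcont : ContinuousAt (fun t : Icc (0 : ℝ) 1 => γ t) t := hc.restrict.continuousAt
    filter_upwards [hcont.eventually (near_cell (γ t))] with u hu
    refine propext ⟨?_, ?_⟩
    · rintro ⟨f, hf, hm⟩
      exact ⟨f, hf, hu f hm⟩
    · rintro ⟨f, hf, hm⟩
      obtain ⟨g, hg⟩ := hcell (γ u)
      exact ⟨g, hf.trans (cell_conn (hT t t.2) hm (hu g hg)), hg⟩
  have h01 := hQ.apply_eq_of_preconnectedSpace ⟨0, by simp⟩ ⟨1, by simp⟩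
  have q0 : Q ⟨0, by simp⟩ := ⟨z0, Relation.ReflTransGen.refl, by
    simp only [← e0, cell, mem_setOf_eq, emb0, emb1]; constructorm* _ ∧ _ <;> linarith⟩
  rw [h01] at q0
  obtain ⟨f, hf, hm⟩ := q0
  simp only at hm
  have fin : ∀ g : Lat, emb z1 ∈ cell g → ¬ inF R g → NN (r + 1) R (Ed l) := by
    intro g hg hn
    refine ⟨z0, g, ?_, hn, hf.trans (cell_conn (hT 1 (by simp)) hm (by rw [← e1]; exact hg))⟩
    rw [linf_le] at hz0
    unfold inF; omega
  rw [linf_eq] at hz1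
  have hcc : ∀ g : Lat, emb z1 ∈ cell g ↔ g.1 ≤ z1.1 ∧ z1.1 ≤ g.1 + 1 ∧ g.2 ≤ z1.2 ∧ z1.2 ≤ g.2 + 1 := by
    intro g
    simp only [cell, mem_setOf_eq, emb0, emb1]
    norm_cast
  by_cases c1 : z1.1 = R
  · exact fin (R, z1.2) ((hcc _).2 (by dsimp; omega)) (by unfold inF; dsimp; omega)
  by_cases c2 : z1.1 = -R
  · exact fin (-R - 1, z1.2) ((hcc _).2 (by dsimp; omega)) (by unfold inF; dsimp; omega)
  by_cases c3 : z1.2 = R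
  · exact fin (z1.1, R) ((hcc _).2 (by dsimp; omega)) (by unfold inF; dsimp; omega)
  by_cases c4 : z1.2 = -R
  · exact fin (z1.1, -R - 1) ((hcc _).2 (by dsimp; omega)) (by unfold inF; dsimp; omega)
  · omega

/-- Weight of a list. -/
def wl (l : List Lat) : ℝ≥0∞ := (4 : ℝ≥0∞)⁻¹ ^ l.length

/-- First vertex. -/
def hd (l : List Lat) : Lat := l.head?.getD 0

/-- Last vertex. -/
def lt (l : List Lat) : Lat := l.getLast?.getD 0

lemma wl_append (l m : List Lat) : wl (l ++ m) = wl l * wl m := by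
  rw [wl, List.length_append, pow_add]; rfl

lemma wl_cons (a : Lat) (m : List Lat) : wl (a :: m) = 4⁻¹ * wl m := by
  rw [wl, List.length_cons, pow_succ, mul_comm]; rfl

lemma hd_cons (a : Lat) (m : List Lat) : hd (a :: m) = a := rfl

lemma lt_cons_cons (a b : Lat) (m : List Lat) : lt (a :: b :: m) = lt (b :: m) := by
  simp [lt]

lemma tsum_list (F : List Lat → ℝ≥0∞) : ∑' l, F l = F [] + ∑' a, ∑' l, F (a :: l) := by
  let e : Unit ⊕ (Lat × List Lat) ≃ List Lat :=
    { toFun := fun o => match o with | Sum.inl _ => [] | Sum.inr p => p.1 :: p.2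
      invFun := fun l => match l with | [] => Sum.inl () | a :: l => Sum.inr (a, l)
      left_inv := by rintro (_ | ⟨a, l⟩) <;> rfl
      right_inv := by rintro (_ | ⟨a, l⟩) <;> rfl }
  rw [← e.tsum_eq, Summable.tsum_sum ENNReal.summable ENNReal.summable]
  congr 1
  · simp [e]
  exact ENNReal.tsum_prod (f := fun a l => F (a :: l))

/-- Walk restricted to a domain. -/
def WD (D : Lat → Prop) (l : List Lat) : Prop := l ≠ [] ∧ l.IsChain Adj ∧ ∀ z ∈ l, D z

lemma walk_sum_aux (D : Lat → Prop) (μ h : Lat → ℝ) (hμ : ∀ x, 0 ≤ μ x) (hh : ∀ x, 0 ≤ h x)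
    (H : ∀ x, D x → μ x + avg h x ≤ h x) (n : ℕ) : ∀ x,
    ∑' l : List Lat, (if WD D (x :: l) ∧ l.length ≤ n then wl (x :: l) * ENNReal.ofReal (4 * μ (lt (x :: l))) else 0)
      ≤ ENNReal.ofReal (h x) := by
  induction n with
  | zero =>
    intro x
    by_cases hx : D x
    · rw [tsum_eq_single []]
      · refine (ite_le_sup _ _ _).trans (sup_le ?_ (by simp))
        have : wl [x] * ENNReal.ofReal (4 * μ (lt [x])) = ENNReal.ofReal (μ x) := by
          have e : lt [x] = x := rfl
          rw [e, wl, List.length_singleton, pow_one, ENNReal.ofReal_mul (by norm_num), ← mul_assoc]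
          rw [show ENNReal.ofReal 4 = 4 by simp, ENNReal.inv_mul_cancel (by simp) (by simp), one_mul]
        rw [this]
        refine ENNReal.ofReal_le_ofReal ?_
        have := H x hx
        have h0 : 0 ≤ avg h x := by
          have := hh (x.1 + 1, x.2); have := hh (x.1 - 1, x.2); have := hh (x.1, x.2 + 1); have := hh (x.1, x.2 - 1)
          unfold avg; linarith
        linarith
      · intro l hl
        rw [if_neg]
        rintro ⟨_, h⟩
        exact hl (List.length_eq_zero_iff.1 (by omega))
    · rw [ENNReal.tsum_eq_zero.2]
      · simp
      · intro l; rw [if_neg]; rintro ⟨h, _⟩; exact hx (h.2.2 x (by simp))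
  | succ n ih =>
    intro x
    by_cases hx : D x
    swap
    · rw [ENNReal.tsum_eq_zero.2]
      · simp
      · intro l; rw [if_neg]; rintro ⟨h, _⟩; exact hx (h.2.2 x (by simp))
    rw [tsum_list]
    have e1 : (if WD D [x] ∧ ([] : List Lat).length ≤ n + 1 then wl [x] * ENNReal.ofReal (4 * μ (lt [x])) else 0)
        ≤ ENNReal.ofReal (μ x) := by
      refine (ite_le_sup _ _ _).trans (sup_le ?_ (by simp))
      have e : lt [x] = x := rfl
      rw [e, wl, List.length_singleton, pow_one, ENNReal.ofReal_mul (by norm_num), ← mul_assoc]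
      rw [show ENNReal.ofReal 4 = 4 by simp, ENNReal.inv_mul_cancel (by simp) (by simp), one_mul]
    have e2 : ∀ a, ∑' l : List Lat, (if WD D (x :: a :: l) ∧ (a :: l).length ≤ n + 1 then
        wl (x :: a :: l) * ENNReal.ofReal (4 * μ (lt (x :: a :: l))) else 0) ≤
        if a ∈ nbrs x then 4⁻¹ * ENNReal.ofReal (h a) else 0 := by
      intro a
      split_ifs with ha
      · refine le_trans ?_ (mul_le_mul_right (ih a) _)
        rw [← ENNReal.tsum_mul_left]
        refine ENNReal.tsum_le_tsum fun l => ?_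
        by_cases hc : WD D (x :: a :: l) ∧ (a :: l).length ≤ n + 1
        · have hc' : WD D (a :: l) ∧ l.length ≤ n := by
            refine ⟨⟨by simp, (List.isChain_cons_cons.1 hc.1.2.1).2, fun z hz => hc.1.2.2 z (List.mem_cons_of_mem _ hz)⟩, ?_⟩
            have := hc.2; rw [List.length_cons] at this; omega
          rw [if_pos hc, if_pos hc', wl_cons x, lt_cons_cons, mul_assoc]
        · rw [if_neg hc]; exact zero_le
      · rw [ENNReal.tsum_eq_zero.2]
        intro l
        rw [if_neg]
        rintro ⟨h, _⟩
        exact ha ((mem_nbrs).2 (List.isChain_cons_cons.1 h.2.1).1)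
    refine (add_le_add e1 (ENNReal.tsum_le_tsum e2)).trans ?_
    rw [tsum_eq_sum (s := nbrs x) (fun a ha => if_neg ha)]
    have e3 : ∑ a ∈ nbrs x, (if a ∈ nbrs x then 4⁻¹ * ENNReal.ofReal (h a) else 0) = ENNReal.ofReal (avg h x) := by
      have : avg h x = ∑ a ∈ nbrs x, (1 / 4) * h a := by
        rw [← Finset.mul_sum, sum_nbrs_avg]; ring
      rw [this, ENNReal.ofReal_sum_of_nonneg (fun a _ => by have := hh a; positivity)]
      refine Finset.sum_congr rfl fun a ha => ?_
      rw [if_pos ha, ENNReal.ofReal_mul (by norm_num)]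
      congr 1
      rw [one_div, ENNReal.ofReal_inv_of_pos (by norm_num)]; simp
    rw [e3, ← ENNReal.ofReal_add (hμ x)]
    · exact ENNReal.ofReal_le_ofReal (H x hx)
    · have := hh (x.1 + 1, x.2); have := hh (x.1 - 1, x.2); have := hh (x.1, x.2 + 1); have := hh (x.1, x.2 - 1)
      unfold avg; linarith

lemma walk_sum (D : Lat → Prop) (μ h : Lat → ℝ) (hμ : ∀ x, 0 ≤ μ x) (hh : ∀ x, 0 ≤ h x)
    (H : ∀ x, D x → μ x + avg h x ≤ h x) (x : Lat) :
    ∑' l : List Lat, (if WD D (x :: l) then wl (x :: l) * ENNReal.ofReal (4 * μ (lt (x :: l))) else 0)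
      ≤ ENNReal.ofReal (h x) := by
  rw [ENNReal.tsum_eq_iSup_sum]
  refine iSup_le fun S => ?_
  refine le_trans ?_ (walk_sum_aux D μ h hμ hh H (S.sup List.length) x)
  refine le_trans (Finset.sum_le_sum fun l hl => ?_) (ENNReal.sum_le_tsum S)
  by_cases hc : WD D (x :: l)
  · rw [if_pos hc, if_pos ⟨hc, Finset.le_sup (f := List.length) hl⟩]
  · rw [if_neg hc]; exact zero_le

/-- Weighted mass of a family of lists. -/
def Wk (P : List Lat → Prop) (u : Lat → ℝ≥0∞) : ℝ≥0∞ :=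
  ∑' l, if P l then u (hd l) * wl l * u (lt l) else 0

/-- Inner pieces. -/
def PI (s ρ : ℤ) (l : List Lat) : Prop :=
  WD (fun z => linf z < ρ) l ∧ linf (hd l) = s ∧ linf (lt l) = s

/-- Outer pieces. -/
def PO (s ρ : ℤ) (l : List Lat) : Prop :=
  WD (fun z => s < linf z) l ∧ linf (hd l) = ρ ∧ linf (lt l) = ρ

/-- Inner flux. -/
def eb (s : ℤ) (a : Lat) : ℝ≥0∞ := ENNReal.ofReal (4 * avg (eS s) a)

/-- Outer flux. -/
def fb (R : ℤ) (b : Lat) : ℝ≥0∞ := ENNReal.ofReal (4 * avg (fR R) b)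

lemma Wk_bound (D : Lat → Prop) (g h : Lat → ℝ) (hg : ∀ x, 0 ≤ g x) (hh : ∀ x, 0 ≤ h x) (s : ℤ)
    (H : ∀ x, D x → (if linf x = s then g x else 0) + avg h x ≤ h x) (C : ℝ) (hC : ∀ x, h x ≤ C)
    (hs : ∑ a ∈ ringF s, g a ≤ 16) (hring : ∀ x, linf x = s → x ∈ ringF s) (hC0 : 0 ≤ C) :
    Wk (fun l => WD D l ∧ linf (hd l) = s ∧ linf (lt l) = s) (fun a => ENNReal.ofReal (4 * g a)) ≤
      ENNReal.ofReal (64 * C) := by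
  have h1 : Wk (fun l => WD D l ∧ linf (hd l) = s ∧ linf (lt l) = s) (fun a => ENNReal.ofReal (4 * g a)) ≤
      ∑ a ∈ ringF s, ENNReal.ofReal (4 * g a) * ENNReal.ofReal (h a) := by
    unfold Wk
    rw [tsum_list]
    beta_reduce
    rw [if_neg (fun h : WD D [] ∧ linf (hd []) = s ∧ linf (lt []) = s => h.1.1 rfl), zero_add]
    have : ∀ a, ∑' l : List Lat, (if WD D (a :: l) ∧ linf (hd (a :: l)) = s ∧ linf (lt (a :: l)) = s then
        ENNReal.ofReal (4 * g (hd (a :: l))) * wl (a :: l) * ENNReal.ofReal (4 * g (lt (a :: l))) else 0) ≤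
        if a ∈ ringF s then ENNReal.ofReal (4 * g a) * ENNReal.ofReal (h a) else 0 := by
      intro a
      split_ifs with ha
      · refine le_trans ?_ (mul_le_mul_right (walk_sum D (fun x => if linf x = s then g x else 0) h
          (fun x => by beta_reduce; split_ifs; exacts [hg x, le_rfl]) hh H a) _)
        rw [← ENNReal.tsum_mul_left]
        refine ENNReal.tsum_le_tsum fun l => ?_
        by_cases hc : WD D (a :: l) ∧ linf (hd (a :: l)) = s ∧ linf (lt (a :: l)) = s
        · rw [if_pos hc, if_pos hc.1, hd_cons]
          beta_reduce
          rw [if_pos hc.2.2, mul_assoc]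
        · rw [if_neg hc]; exact zero_le
      · rw [ENNReal.tsum_eq_zero.2]
        intro l
        rw [if_neg]
        rintro ⟨_, h, _⟩
        exact ha (hring a h)
    refine le_trans (le_of_eq ?_) ((ENNReal.tsum_le_tsum this).trans ?_)
    · refine tsum_congr fun a => tsum_congr fun l => ?_
      congr
    rw [tsum_eq_sum (s := ringF s) (fun a ha => if_neg ha)]
    exact Finset.sum_le_sum fun a ha => by rw [if_pos ha]
  refine h1.trans ?_
  have h2 : ∀ a ∈ ringF s, ENNReal.ofReal (4 * g a) * ENNReal.ofReal (h a) ≤ ENNReal.ofReal (4 * C * g a) := by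
    intro a _
    rw [← ENNReal.ofReal_mul (by have := hg a; positivity)]
    refine ENNReal.ofReal_le_ofReal ?_
    nlinarith [mul_le_mul_of_nonneg_left (hC a) (hg a)]
  refine (Finset.sum_le_sum h2).trans ?_
  rw [← ENNReal.ofReal_sum_of_nonneg (fun a _ => by have := hg a; positivity), ← Finset.mul_sum]
  refine ENNReal.ofReal_le_ofReal ?_
  nlinarith

lemma alpha0 {s ρ : ℤ} (hs : 2 ≤ s) (hρ : 2 * s ≤ ρ) :
    Wk (PI s ρ) (eb s) ≤ ENNReal.ofReal (320 * Real.log ((ρ : ℝ) / s)) := by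
  obtain ⟨h, h0, h1, h2⟩ := alpha_pot hs hρ
  have hs' : (0 : ℝ) < s := by exact_mod_cast (by omega : 0 < s)
  have hρ' : (s : ℝ) ≤ ρ := by exact_mod_cast (by omega : s ≤ ρ)
  have hl : 0 ≤ Real.log ((ρ : ℝ) / s) := Real.log_nonneg (by rw [le_div_iff₀ hs']; linarith)
  have := Wk_bound (fun z => linf z < ρ) (avg (eS s)) h (fun x => ?_) h0 s h1 _ h2 (eS_sum hs)
    (fun x hx => mem_ringF.2 hx) (by positivity)
  · refine le_trans this (ENNReal.ofReal_le_ofReal ?_); linarith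
  · unfold avg
    linarith [eS_nonneg s (x.1 + 1, x.2), eS_nonneg s (x.1 - 1, x.2), eS_nonneg s (x.1, x.2 + 1), eS_nonneg s (x.1, x.2 - 1)]

lemma beta0 {s ρ : ℤ} (hs : 2 ≤ s) (hρ : 2 * s ≤ ρ) :
    Wk (PO s ρ) (fb ρ) ≤ ENNReal.ofReal (192 * Real.log (2 * (ρ : ℝ) / s)) := by
  obtain ⟨h, h0, h1, h2⟩ := beta_pot hs hρ
  have hs' : (0 : ℝ) < s := by exact_mod_cast (by omega : 0 < s)
  have hρ' : (s : ℝ) ≤ ρ := by exact_mod_cast (by omega : s ≤ ρ)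
  have hρ0 : (0 : ℝ) < ρ := by linarith
  have hl : 0 ≤ Real.log (2 * (ρ : ℝ) / s) := Real.log_nonneg (by rw [le_div_iff₀ hs']; linarith)
  have hsum : ∑ a ∈ ringF ρ, avg (fR ρ) a ≤ 16 := by
    have : ∀ a ∈ ringF ρ, avg (fR ρ) a ≤ 2 / ρ := by
      intro a ha
      rw [mem_ringF] at ha
      have hn : ∀ y, Adj a y → fR ρ y ≤ 2 / ρ := fun y hy => fR_le_near (by omega) (by
        have := linf_adj hy; omega)
      have k1 := hn (a.1 + 1, a.2) ((adj_iff _ _).2 (by simp))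
      have k2 := hn (a.1 - 1, a.2) ((adj_iff _ _).2 (by simp))
      have k3 := hn (a.1, a.2 + 1) ((adj_iff _ _).2 (by simp))
      have k4 := hn (a.1, a.2 - 1) ((adj_iff _ _).2 (by simp))
      unfold avg; linarith
    refine (Finset.sum_le_card_nsmul _ _ _ this).trans ?_
    have hc : ((ringF ρ).card : ℝ) = 8 * ρ := ringF_card (by omega)
    rw [nsmul_eq_mul, hc]
    refine le_of_eq ?_
    field_simp; norm_num
  have := Wk_bound (fun z => s < linf z) (avg (fR ρ)) h (fun x => ?_) h0 ρ h1 _ h2 hsum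
    (fun x hx => mem_ringF.2 hx) (by positivity)
  · refine le_trans this (ENNReal.ofReal_le_ofReal ?_); linarith
  · unfold avg
    linarith [fR_nonneg ρ (x.1 + 1, x.2), fR_nonneg ρ (x.1 - 1, x.2), fR_nonneg ρ (x.1, x.2 + 1), fR_nonneg ρ (x.1, x.2 - 1)]

/-- Two corridors crossing the annulus. -/
def PairE (s R : ℤ) (a1 b1 b2 a2 : Lat) (X Y : List Lat) : Prop :=
  linf a1 = s ∧ linf b1 = R ∧ linf b2 = R ∧ linf a2 = s ∧ X ≠ [] ∧ Y ≠ [] ∧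
  (a1 :: X ++ [b1]).IsChain Adj ∧ (b2 :: Y ++ [a2]).IsChain Adj ∧
  (∀ z ∈ X, z ∈ Dn s R) ∧ (∀ z ∈ Y, z ∈ Dn s R)

/-- Two corridors with a dual path between them. -/
def PairOK (s R : ℤ) (a1 b1 b2 a2 : Lat) (X Y : List Lat) : Prop :=
  PairE s R a1 b1 b2 a2 X Y ∧
    NN s R (fun u v => Ed (a1 :: X ++ [b1]) u v ∨ Ed (b2 :: Y ++ [a2]) u v)

lemma corr {a b : Lat} {X : List Lat} (hX : X ≠ []) (h : (a :: X ++ [b]).IsChain Adj) :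
    Adj a (hd X) ∧ Adj (lt X) b ∧ X.head? = some (hd X) ∧ X.getLast? = some (lt X) ∧ X.IsChain Adj := by
  have h1 : X.head? = some (hd X) := by
    cases X with
    | nil => exact absurd rfl hX
    | cons x X => rfl
  have h2 : X.getLast? = some (lt X) := by
    rw [lt, List.getLast?_eq_getLast_of_ne_nil hX]; rfl
  rw [List.cons_append] at h
  have h3 := List.isChain_cons.1 h
  have h4 := List.isChain_append.1 h3.2
  refine ⟨h3.1 _ ?_, h4.2.2 _ h2 b (by simp), h1, h2, h4.1⟩
  rw [List.head?_append, h1]; rfl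

lemma wl_real (X Y : List Lat) : wl X * wl Y = ENNReal.ofReal ((1 / 4 : ℝ) ^ (X.length + Y.length)) := by
  rw [ENNReal.ofReal_pow (by norm_num), pow_add, one_div, ENNReal.ofReal_inv_of_pos (by norm_num)]
  simp [wl]

lemma pair_fin {s R : ℤ} (hs0 : s0 ≤ s) (hR : 16 * s ≤ R) (a1 b1 b2 a2 : Lat)
    (A : Finset (List Lat × List Lat)) (hA : ∀ p ∈ A, PairOK s R a1 b1 b2 a2 p.1 p.2) :
    ∑ p ∈ A, (1 / 4 : ℝ) ^ (p.1.length + p.2.length) ≤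
      117964800 * √((s : ℝ) / R) * ((4 * avg (eS s) a1) * (4 * avg (fR R) b1) *
        (4 * avg (fR R) b2) * (4 * avg (eS s) a2)) := by
  set key : List Lat × List Lat → (Lat × Lat) × (Lat × Lat) :=
    fun p => ((hd p.1, lt p.1), (hd p.2, lt p.2)) with hkey
  set N : Finset ((Lat × Lat) × (Lat × Lat)) := (nbrs a1 ×ˢ nbrs b1) ×ˢ (nbrs b2 ×ˢ nbrs a2) with hN
  have hmap : ∀ p ∈ A, key p ∈ N := by
    intro p hp
    obtain ⟨⟨_, _, _, _, hX, hY, cX, cY, _, _⟩, _⟩ := hA p hp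
    have k1 := corr hX cX
    have k2 := corr hY cY
    simp only [hN, hkey, Finset.mem_product, mem_nbrs]
    exact ⟨⟨k1.1, adj_symm k1.2.1⟩, ⟨k2.1, adj_symm k2.2.1⟩⟩
  rw [← Finset.sum_fiberwise_of_maps_to hmap]
  have hb : ∀ q ∈ N, ∑ p ∈ A with key p = q, (1 / 4 : ℝ) ^ (p.1.length + p.2.length) ≤
      117964800 * √((s : ℝ) / R) * (eS s q.1.1 * fR R q.1.2 * fR R q.2.1 * eS s q.2.2) := by
    rintro ⟨⟨x1, y1⟩, ⟨y2, x2⟩⟩ _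
    by_cases hne : (A.filter (fun p => key p = ((x1, y1), (y2, x2)))) = ∅
    · rw [hne, Finset.sum_empty]
      have := eS_nonneg s x1; have := eS_nonneg s x2; have := fR_nonneg R y1; have := fR_nonneg R y2
      positivity
    · obtain ⟨p, hp⟩ := Finset.nonempty_iff_ne_empty.2 hne
      rw [Finset.mem_filter] at hp
      obtain ⟨hp, hk⟩ := hp
      simp only [hkey, Prod.mk.injEq] at hk
      obtain ⟨⟨l1, l2, l3, l4, hX, hY, cX, cY, dX, dY⟩, _⟩ := hA p hp
      have k1 := corr hX cX
      have k2 := corr hY cY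
      have m1 := dX _ (List.mem_of_head? k1.2.2.1)
      have m2 := dX _ (List.mem_of_getLast? k1.2.2.2.1)
      have m3 := dY _ (List.mem_of_head? k2.2.2.1)
      have m4 := dY _ (List.mem_of_getLast? k2.2.2.2.1)
      rw [hk.1.1] at k1 m1
      rw [hk.1.2] at k1 m2
      rw [hk.2.1] at k2 m3
      rw [hk.2.2] at k2 m4
      rw [mem_Dn] at m1 m2 m3 m4
      have j1 := linf_adj k1.1
      have j2 := linf_adj k1.2.1
      have j3 := linf_adj k2.1
      have j4 := linf_adj k2.2.1
      refine pairL hs0 hR l1 l4 l2 l3 (by omega) (by omega) (by omega) (by omega) k1.1 (adj_symm k2.2.1)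
        (adj_symm k1.2.1) k2.1 _ ?_
      intro p' hp'
      rw [Finset.mem_filter] at hp'
      obtain ⟨hp', hk'⟩ := hp'
      simp only [hkey, Prod.mk.injEq] at hk'
      obtain ⟨⟨_, _, _, _, hX', hY', cX', cY', dX', dY'⟩, hn⟩ := hA p' hp'
      have k1' := corr hX' cX'
      have k2' := corr hY' cY'
      rw [hk'.1.1, hk'.1.2] at k1'
      rw [hk'.2.1, hk'.2.2] at k2'
      exact ⟨⟨k1'.2.2.1, k1'.2.2.2.1, k1'.2.2.2.2, dX'⟩, ⟨k2'.2.2.1, k2'.2.2.2.1, k2'.2.2.2.2, dY'⟩, hn⟩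
  refine (Finset.sum_le_sum hb).trans (le_of_eq ?_)
  have e1 : (4 * avg (eS s) a1) * (4 * avg (fR R) b1) = ∑ p ∈ nbrs a1 ×ˢ nbrs b1, eS s p.1 * fR R p.2 := by
    rw [← sum_nbrs_avg, ← sum_nbrs_avg, Finset.sum_mul_sum, Finset.sum_product]
  have e2 : (4 * avg (fR R) b2) * (4 * avg (eS s) a2) = ∑ p ∈ nbrs b2 ×ˢ nbrs a2, fR R p.1 * eS s p.2 := by
    rw [← sum_nbrs_avg, ← sum_nbrs_avg, Finset.sum_mul_sum, Finset.sum_product]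
  rw [← Finset.mul_sum, mul_assoc (_ * _) (4 * avg (fR R) b2), e1, e2, Finset.sum_mul_sum, hN, Finset.sum_product]
  congr 1
  refine Finset.sum_congr rfl fun p _ => Finset.sum_congr rfl fun q _ => ?_
  ring

lemma pair_sum {s R : ℤ} (hs0 : s0 ≤ s) (hR : 16 * s ≤ R) (a1 b1 b2 a2 : Lat) :
    ∑' p : List Lat × List Lat, (if PairOK s R a1 b1 b2 a2 p.1 p.2 then wl p.1 * wl p.2 else 0) ≤
      ENNReal.ofReal (117964800 * √((s : ℝ) / R)) * (eb s a1 * fb R b1 * fb R b2 * eb s a2) := by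
  rw [ENNReal.tsum_eq_iSup_sum]
  refine iSup_le fun S => ?_
  have a0 : ∀ x, 0 ≤ avg (eS s) x := fun x => by
    unfold avg
    linarith [eS_nonneg s (x.1 + 1, x.2), eS_nonneg s (x.1 - 1, x.2), eS_nonneg s (x.1, x.2 + 1), eS_nonneg s (x.1, x.2 - 1)]
  have f0 : ∀ x, 0 ≤ avg (fR R) x := fun x => by
    unfold avg
    linarith [fR_nonneg R (x.1 + 1, x.2), fR_nonneg R (x.1 - 1, x.2), fR_nonneg R (x.1, x.2 + 1), fR_nonneg R (x.1, x.2 - 1)]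
  have := a0 a1; have := a0 a2; have := f0 b1; have := f0 b2
  rw [← Finset.sum_filter, eb, eb, fb, fb, ← ENNReal.ofReal_mul (by positivity), ← ENNReal.ofReal_mul (by positivity),
    ← ENNReal.ofReal_mul (by positivity), ← ENNReal.ofReal_mul (by positivity)]
  rw [Finset.sum_congr rfl (fun p _ => wl_real p.1 p.2), ← ENNReal.ofReal_sum_of_nonneg (fun p _ => by positivity)]
  exact ENNReal.ofReal_le_ofReal (pair_fin hs0 hR a1 b1 b2 a2 _ fun p hp => (Finset.mem_filter.1 hp).2)

lemma tsum_decomp {α β : Type*} (P : α → Prop) (F : α → ℝ≥0∞) (G : β → ℝ≥0∞) (cat : β → α)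
    (h : ∀ l, P l → ∃ t, cat t = l ∧ F l ≤ G t) :
    ∑' l, (if P l then F l else 0) ≤ ∑' t, G t := by
  choose φ h1 h2 using h
  have e : ∑' l, (if P l then F l else 0) = ∑' l : {l // P l}, F l.1 := by
    rw [← tsum_subtype_eq_of_support_subset (s := {l | P l})]
    · refine tsum_congr fun l => ?_
      exact if_pos l.2
    · intro l hl
      by_contra hc
      exact hl (if_neg hc)
  rw [e]
  refine le_trans (ENNReal.tsum_le_tsum fun l => h2 l.1 l.2) ?_
  refine ENNReal.tsum_comp_le_tsum_of_injective (f := fun l : {l // P l} => φ l.1 l.2) ?_ G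
  intro l l' hl
  refine Subtype.ext ?_
  rw [← h1 l.1 l.2, ← h1 l'.1 l'.2]
  exact congrArg cat hl

/-- Summability bound of a quadruple relation. -/
def RB (Rl : Lat → Lat → Lat → Lat → List Lat → List Lat → Prop) (u v : Lat → ℝ≥0∞) (K : ℝ≥0∞) : Prop :=
  ∀ a1 b1 b2 a2, ∑' p : List Lat × List Lat, (if Rl a1 b1 b2 a2 p.1 p.2 then wl p.1 * wl p.2 else 0) ≤
    K * (u a1 * v b1 * v b2 * u a2)

lemma RB_in {s R : ℤ} (hs0 : s0 ≤ s) (hR : 16 * s ≤ R) :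
    RB (PairOK s R) (eb s) (fb R) (ENNReal.ofReal (117964800 * √((s : ℝ) / R))) := fun a1 b1 b2 a2 =>
  pair_sum hs0 hR a1 b1 b2 a2

lemma RB_out {s R : ℤ} (hs0 : s0 ≤ s) (hR : 16 * s ≤ R) :
    RB (fun b2 a2 a1 b1 Y X => PairOK s R a1 b1 b2 a2 X Y) (fb R) (eb s)
      (ENNReal.ofReal (117964800 * √((s : ℝ) / R))) := by
  intro b2 a2 a1 b1
  refine le_trans (le_of_eq ?_) ((pair_sum hs0 hR a1 b1 b2 a2).trans (le_of_eq (by ring)))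
  rw [← (Equiv.prodComm _ _).tsum_eq]
  refine tsum_congr fun p => ?_
  simp only [Equiv.prodComm_apply, Prod.fst_swap, Prod.snd_swap]
  rw [mul_comm]
  congr

lemma boot {Rl : Lat → Lat → Lat → Lat → List Lat → List Lat → Prop} {u v : Lat → ℝ≥0∞} {K : ℝ≥0∞}
    (hRl : RB Rl u v K) (P P0 Q : List Lat → Prop)
    (h : ∀ l, P l → P0 l ∨ ∃ m1 X mo Y m2, m1 ++ (X ++ (mo ++ (Y ++ m2))) = l ∧ P0 m1 ∧ Q mo ∧ P m2 ∧
      hd m1 = hd l ∧ lt m2 = lt l ∧ Rl (lt m1) (hd mo) (lt mo) (hd m2) X Y) :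
    Wk P u ≤ Wk P0 u + (K * Wk P0 u * Wk Q v) * Wk P u := by
  obtain ⟨P', hP'⟩ : ∃ P' : List Lat → Prop, ∀ l, P' l ↔ (P l ∧ ¬ P0 l) := ⟨_, fun _ => Iff.rfl⟩
  have h1 : Wk P u ≤ Wk P0 u + ∑' l, (if P' l then u (hd l) * wl l * u (lt l) else 0) := by
    unfold Wk
    rw [← ENNReal.tsum_add]
    refine ENNReal.tsum_le_tsum fun l => ?_
    by_cases a : P l
    · by_cases b : P0 l
      · rw [if_pos a, if_pos b]; exact le_self_add
      · rw [if_pos a, if_neg b, if_pos ((hP' l).2 ⟨a, b⟩), zero_add]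
    · rw [if_neg a]; exact zero_le
  refine h1.trans (add_le_add le_rfl ?_)
  let G : List Lat × List Lat × List Lat → List Lat × List Lat → ℝ≥0∞ := fun t p =>
    ((if P0 t.1 then u (hd t.1) * wl t.1 else 0) * ((if Q t.2.1 then wl t.2.1 else 0) *
      (if P t.2.2 then wl t.2.2 * u (lt t.2.2) else 0))) *
      (if Rl (lt t.1) (hd t.2.1) (lt t.2.1) (hd t.2.2) p.1 p.2 then wl p.1 * wl p.2 else 0)
  have h2 : ∑' l, (if P' l then u (hd l) * wl l * u (lt l) else 0) ≤
      ∑' tp : (List Lat × List Lat × List Lat) × (List Lat × List Lat), G tp.1 tp.2 := by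
    refine tsum_decomp P' _ _ (fun tp : (List Lat × List Lat × List Lat) × (List Lat × List Lat) => tp.1.1 ++ (tp.2.1 ++ (tp.1.2.1 ++ (tp.2.2 ++ tp.1.2.2)))) ?_
    intro l hl'
    obtain ⟨hl, hl0⟩ := (hP' l).1 hl'
    rcases h l hl with h' | ⟨m1, X, mo, Y, m2, e, p1, p2, p3, e1, e2, r⟩
    · exact absurd h' hl0
    · refine ⟨((m1, mo, m2), (X, Y)), e, ?_⟩
      simp only [G]
      rw [if_pos p1, if_pos p2, if_pos p3, if_pos r, ← e1, ← e2, ← e, wl_append, wl_append, wl_append, wl_append]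
      refine le_of_eq (by ring)
  refine h2.trans ?_
  rw [ENNReal.tsum_prod (f := G)]
  have h3 : ∀ t, ∑' p, G t p ≤ K * ((if P0 t.1 then u (hd t.1) * wl t.1 * u (lt t.1) else 0) *
      ((if Q t.2.1 then v (hd t.2.1) * wl t.2.1 * v (lt t.2.1) else 0) *
      (if P t.2.2 then u (hd t.2.2) * wl t.2.2 * u (lt t.2.2) else 0))) := by
    intro t
    simp only [G]
    rw [ENNReal.tsum_mul_left]
    refine (mul_le_mul_right (hRl _ _ _ _) _).trans (le_of_eq ?_)
    split_ifs <;> ring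
  refine (ENNReal.tsum_le_tsum h3).trans (le_of_eq ?_)
  rw [ENNReal.tsum_mul_left]
  have h4 := ENNReal.tsum_prod (f := fun (a : List Lat) (b : List Lat × List Lat) =>
    (if P0 a then u (hd a) * wl a * u (lt a) else 0) *
      ((if Q b.1 then v (hd b.1) * wl b.1 * v (lt b.1) else 0) *
      (if P b.2 then u (hd b.2) * wl b.2 * u (lt b.2) else 0)))
  rw [h4]
  have h5 := ENNReal.tsum_prod (f := fun (a : List Lat) (b : List Lat) =>
      ((if Q a then v (hd a) * wl a * v (lt a) else 0) *
      (if P b then u (hd b) * wl b * u (lt b) else 0)))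
  simp only [ENNReal.tsum_mul_left, ENNReal.tsum_mul_right, h5]
  unfold Wk
  ring

lemma join {α : Type*} {Rl : Lat → Lat → Lat → Lat → List Lat → List Lat → Prop} {u v : Lat → ℝ≥0∞} {K : ℝ≥0∞}
    (hRl : RB Rl u v K) (P Q : List Lat → Prop) (C : α → Prop) (F : α → ℝ≥0∞) (cat : List Lat → α)
    (h : ∀ l, C l → ∃ X mo Y mi, cat (X ++ (mo ++ (Y ++ mi))) = l ∧ Q mo ∧ P mi ∧
      F l ≤ wl (X ++ (mo ++ (Y ++ mi))) ∧ Rl (lt mi) (hd mo) (lt mo) (hd mi) X Y) :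
    ∑' l, (if C l then F l else 0) ≤ K * Wk Q v * Wk P u := by
  let G : List Lat × List Lat → List Lat × List Lat → ℝ≥0∞ := fun t p =>
    ((if Q t.1 then wl t.1 else 0) * (if P t.2 then wl t.2 else 0)) *
      (if Rl (lt t.2) (hd t.1) (lt t.1) (hd t.2) p.1 p.2 then wl p.1 * wl p.2 else 0)
  have h2 : ∑' l, (if C l then F l else 0) ≤
      ∑' tp : (List Lat × List Lat) × (List Lat × List Lat), G tp.1 tp.2 := by
    refine tsum_decomp _ _ _ (fun tp : (List Lat × List Lat) × (List Lat × List Lat) => cat (tp.2.1 ++ (tp.1.1 ++ (tp.2.2 ++ tp.1.2)))) ?_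
    intro l hl
    obtain ⟨X, mo, Y, mi, e, p1, p2, hF, r⟩ := h l hl
    refine ⟨((mo, mi), (X, Y)), e, hF.trans ?_⟩
    simp only [G]
    rw [if_pos p1, if_pos p2, if_pos r, wl_append, wl_append, wl_append]
    refine le_of_eq (by ring)
  refine h2.trans ?_
  rw [ENNReal.tsum_prod (f := G)]
  have h3 : ∀ t, ∑' p, G t p ≤ K * ((if Q t.1 then v (hd t.1) * wl t.1 * v (lt t.1) else 0) *
      (if P t.2 then u (hd t.2) * wl t.2 * u (lt t.2) else 0)) := by
    intro t
    simp only [G]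
    rw [ENNReal.tsum_mul_left]
    refine (mul_le_mul_right (hRl _ _ _ _) _).trans (le_of_eq ?_)
    split_ifs <;> ring
  refine (ENNReal.tsum_le_tsum h3).trans (le_of_eq ?_)
  rw [ENNReal.tsum_mul_left]
  have h5 := ENNReal.tsum_prod (f := fun (a : List Lat) (b : List Lat) =>
      ((if Q a then v (hd a) * wl a * v (lt a) else 0) *
      (if P b then u (hd b) * wl b * u (lt b) else 0)))
  simp only [ENNReal.tsum_mul_left, ENNReal.tsum_mul_right, h5]
  unfold Wk
  ring

lemma absorb {x c k : ℝ≥0∞} (h : x ≤ c + k * x) (hk : k ≤ 2⁻¹) (hx : x ≠ ⊤) : x ≤ 2 * c := by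
  have h1 : x ≤ c + 2⁻¹ * x := h.trans (by gcongr)
  have h2 : 2⁻¹ * x + 2⁻¹ * x ≤ c + 2⁻¹ * x := by
    rwa [← add_mul, ENNReal.inv_two_add_inv_two, one_mul]
  have h3 := (ENNReal.add_le_add_iff_right (ENNReal.mul_ne_top (by simp) hx)).1 h2
  calc x = 2 * (2⁻¹ * x) := by rw [← mul_assoc, ENNReal.mul_inv_cancel (by simp) (by simp), one_mul]
    _ ≤ 2 * c := by gcongr

lemma split_first (Q : Lat → Prop) : ∀ l : List Lat, (∃ z ∈ l, Q z) →
    ∃ p b q, l = p ++ b :: q ∧ Q b ∧ ∀ z ∈ p, ¬ Q z := by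
  intro l
  induction l with
  | nil => rintro ⟨z, hz, _⟩; simp at hz
  | cons a l ih =>
    rintro ⟨z, hz, hQ⟩
    by_cases ha : Q a
    · exact ⟨[], a, l, rfl, ha, by simp⟩
    · obtain ⟨p, b, q, rfl, hb, hp⟩ := ih ⟨z, by
        rcases List.mem_cons.1 hz with rfl | h
        · exact absurd hQ ha
        · exact h, hQ⟩
      refine ⟨a :: p, b, q, rfl, hb, ?_⟩
      intro w hw
      rcases List.mem_cons.1 hw with rfl | h
      exacts [ha, hp w h]

lemma split_last (Q : Lat → Prop) (l : List Lat) (h : ∃ z ∈ l, Q z) :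
    ∃ p b q, l = p ++ b :: q ∧ Q b ∧ ∀ z ∈ q, ¬ Q z := by
  obtain ⟨p, b, q, e, hb, hp⟩ := split_first Q l.reverse (by simpa using h)
  refine ⟨q.reverse, b, p.reverse, ?_, hb, by simpa using hp⟩
  have := congrArg List.reverse e
  simpa using this

lemma hd_append {m : List Lat} (hm : m ≠ []) (n : List Lat) : hd (m ++ n) = hd m := by
  cases m with
  | nil => exact absurd rfl hm
  | cons a m => rfl

lemma lt_snoc (m : List Lat) (a : Lat) : lt (m ++ [a]) = a := by simp [lt]

lemma lt_append (m : List Lat) {n : List Lat} (hn : n ≠ []) : lt (m ++ n) = lt n := by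
  rcases List.eq_nil_or_concat n with rfl | ⟨n', a, rfl⟩
  · exact absurd rfl hn
  · rw [List.concat_eq_append, ← List.append_assoc, lt_snoc, lt_snoc]

lemma hd_eq {m : List Lat} (hm : m ≠ []) : ∃ t, m = hd m :: t := by
  cases m with
  | nil => exact absurd rfl hm
  | cons a m => exact ⟨m, rfl⟩

lemma lt_eq {m : List Lat} (hm : m ≠ []) : ∃ t, m = t ++ [lt m] := by
  rcases List.eq_nil_or_concat m with rfl | ⟨n', a, rfl⟩
  · exact absurd rfl hm
  · exact ⟨n', by rw [List.concat_eq_append, lt_snoc]⟩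

lemma hd_mem {m : List Lat} (hm : m ≠ []) : hd m ∈ m := by
  obtain ⟨t, e⟩ := hd_eq hm
  rw [e]; simp [hd]

lemma lt_mem {m : List Lat} (hm : m ≠ []) : lt m ∈ m := by
  obtain ⟨t, e⟩ := lt_eq hm
  have : lt m ∈ t ++ [lt m] := by simp
  rwa [← e] at this

lemma chain_part {m l : List Lat} (h : List.IsChain Adj l) (i : m <:+: l) :
    List.IsChain Adj m := by
  obtain ⟨a, b, rfl⟩ := i
  exact (List.isChain_append.1 (List.isChain_append.1 h).1).2.1

lemma Ed_sub {m l : List Lat} (h : m <:+: l) {u v : Lat} (e : Ed m u v) : Ed l u v := by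
  obtain ⟨p, q, rfl⟩ := h
  obtain ⟨l1, l2, rfl⟩ := e
  exact ⟨p ++ l1, l2 ++ q, by simp⟩

lemma Ed_join {p q : List Lat} {z u v : Lat} (h : Ed (p ++ z :: q) u v) :
    Ed (p ++ [z]) u v ∨ Ed (z :: q) u v := by
  have : (p ++ z :: q).IsChain (fun u v => Ed (p ++ [z]) u v ∨ Ed (z :: q) u v) := by
    rw [List.isChain_split]
    exact ⟨chain_iff_Ed.2 fun u v h => Or.inl h, chain_iff_Ed.2 fun u v h => Or.inr h⟩
  exact chain_iff_Ed.1 this u v h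

lemma junct {m n : List Lat} (hm : m ≠ []) (hn : n ≠ []) (h : (m ++ n).IsChain Adj) : Adj (lt m) (hd n) := by
  obtain ⟨t, e⟩ := lt_eq hm
  obtain ⟨t', e'⟩ := hd_eq hn
  rw [e, e'] at h
  exact chain_iff_Ed.1 h _ _ ⟨t, t', by simp⟩

lemma seg_sub {m X n : List Lat} (w w' : List Lat) (hm : m ≠ []) (hn : n ≠ []) :
    (lt m :: X ++ [hd n]) <:+: (w ++ (m ++ (X ++ (n ++ w')))) := by
  obtain ⟨t, e⟩ := lt_eq hm
  obtain ⟨t', e'⟩ := hd_eq hn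
  refine ⟨w ++ t, t' ++ w', ?_⟩
  conv_rhs => rw [e, e']
  simp

/-- Decomposition of a list with respect to a height function. -/
lemma dec_gen (f : Lat → ℤ) (hf : ∀ u v, Adj u v → f v ≤ f u + 1 ∧ f u ≤ f v + 1) {s ρ : ℤ} (hsρ : s + 1 < ρ)
    {l : List Lat} (hne : l ≠ []) (hc : l.IsChain Adj) (h1 : f (hd l) ≤ s) (h2 : f (lt l) ≤ s)
    (h3 : ∃ z ∈ l, ρ ≤ f z) :
    ∃ m1 X mo Y m2, m1 ++ (X ++ (mo ++ (Y ++ m2))) = l ∧ m1 ≠ [] ∧ X ≠ [] ∧ mo ≠ [] ∧ Y ≠ [] ∧ m2 ≠ [] ∧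
      (∀ z ∈ m1, f z < ρ) ∧ f (lt m1) = s ∧ (∀ z ∈ X, s < f z ∧ f z < ρ) ∧ (∀ z ∈ mo, s < f z) ∧
      f (hd mo) = ρ ∧ f (lt mo) = ρ ∧ (∀ z ∈ Y, s < f z ∧ f z < ρ) ∧ f (hd m2) = s ∧
      hd m1 = hd l ∧ lt m2 = lt l := by
  obtain ⟨p, b, q, e1, hb, hp⟩ := split_first (fun z => ρ ≤ f z) l h3
  have hpne : p ≠ [] := by
    rintro rfl
    rw [e1] at h1
    have : hd ([] ++ b :: q) = b := rfl
    rw [this] at h1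
    omega
  have hdp : hd p = hd l := by rw [e1, hd_append hpne]
  obtain ⟨p1, a, X, e2, ha, hX⟩ := split_last (fun z => f z ≤ s) p ⟨hd p, hd_mem hpne, by rw [hdp]; exact h1⟩
  have hltq : lt (b :: q) = lt l := by rw [e1, lt_append _ (by simp)]
  obtain ⟨t, a', m2, e3, ha', ht⟩ := split_first (fun z => f z ≤ s) (b :: q)
    ⟨lt (b :: q), lt_mem (by simp), by rw [hltq]; exact h2⟩
  have htne : t ≠ [] := by
    rintro rfl
    rw [List.nil_append, List.cons.injEq] at e3
    rw [← e3.1] at ha'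
    omega
  have hdt : hd t = b := by
    rw [← hd_append htne (a' :: m2), ← e3]; rfl
  obtain ⟨o, b', Y, e4, hb', hY⟩ := split_last (fun z => ρ ≤ f z) t ⟨hd t, hd_mem htne, by rw [hdt]; exact hb⟩
  have hmo : hd (o ++ [b']) = b := by
    rw [← hdt, e4]
    cases o <;> rfl
  have hl : (p1 ++ [a]) ++ (X ++ ((o ++ [b']) ++ (Y ++ (a' :: m2)))) = l := by
    rw [e1, e3, e2, e4]; simp
  rw [← hl] at hc
  have c1 := (List.isChain_append.1 hc).2.1
  have c2 := (List.isChain_append.1 c1).2.1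
  have c3 := (List.isChain_append.1 c2).2.1
  have hXs : ∀ z ∈ X, s < f z ∧ f z < ρ := fun z hz =>
    ⟨not_le.1 (hX z hz), not_le.1 (hp z (by rw [e2]; simp [hz]))⟩
  have hYs : ∀ z ∈ Y, s < f z ∧ f z < ρ := fun z hz =>
    ⟨not_le.1 (ht z (by rw [e4]; simp [hz])), not_le.1 (hY z hz)⟩
  have hXne : X ≠ [] := by
    rintro rfl
    have := hf _ _ (junct (by simp) (by simp) hc)
    rw [lt_snoc, List.nil_append, hd_append (by simp), hmo] at this
    omega
  have hYne : Y ≠ [] := by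
    rintro rfl
    have := hf _ _ (junct (by simp) (by simp) c2)
    rw [lt_snoc, List.nil_append] at this
    have e : hd (a' :: m2) = a' := rfl
    rw [e] at this
    omega
  refine ⟨p1 ++ [a], X, o ++ [b'], Y, a' :: m2, hl, by simp, hXne, by simp, hYne, by simp, ?_, ?_, hXs, ?_, ?_, ?_, hYs, ?_, ?_, ?_⟩
  · intro z hz
    exact not_le.1 (hp z (by rw [e2]; simp at hz ⊢; tauto))
  · have k := hf _ _ (junct (by simp) (by simp [hXne]) hc)
    rw [hd_append hXne, lt_snoc] at k
    have := hXs _ (hd_mem hXne)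
    rw [lt_snoc]; omega
  · intro z hz
    exact not_le.1 (ht z (by rw [e4]; simp at hz ⊢; tauto))
  · have k := hf _ _ (junct hXne (by simp) c1)
    rw [hd_append (by simp), hmo] at k
    have := hXs _ (lt_mem hXne)
    rw [hmo]; omega
  · have k := hf _ _ (junct (by simp) (by simp [hYne]) c2)
    rw [hd_append hYne, lt_snoc] at k
    have := hYs _ (hd_mem hYne)
    rw [lt_snoc]; omega
  · have k := hf _ _ (junct hYne (by simp) c3)
    have := hYs _ (lt_mem hYne)
    have e : hd (a' :: m2) = a' := rfl
    rw [e] at k ⊢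
    omega
  · rw [← hl]; exact (hd_append (by simp) _).symm
  · rw [← hl, lt_append _ (by simp), lt_append _ (by simp), lt_append _ (by simp), lt_append _ (by simp)]

/-- Inner excursions. -/
def PA (s R R' : ℤ) (l : List Lat) : Prop :=
  PI s (R' + 1) l ∧ NN s R (Ed l)

/-- Outer excursions. -/
def PBo (s R : ℤ) (l : List Lat) : Prop :=
  PO s R l ∧ NN s R (Ed l)

lemma decI {s ρ : ℤ} (hsρ : s + 1 < ρ) {l : List Lat} (hne : l ≠ []) (hc : l.IsChain Adj)
    (h1 : linf (hd l) ≤ s) (h2 : linf (lt l) ≤ s) (h3 : ∃ z ∈ l, ρ ≤ linf z) :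
    ∃ m1 X mo Y m2, m1 ++ (X ++ (mo ++ (Y ++ m2))) = l ∧ m1 ≠ [] ∧ m2 ≠ [] ∧
      (∀ z ∈ m1, linf z < ρ) ∧ linf (lt m1) = s ∧ PO s ρ mo ∧ linf (hd m2) = s ∧
      hd m1 = hd l ∧ lt m2 = lt l ∧ PairE s ρ (lt m1) (hd mo) (lt mo) (hd m2) X Y ∧
      (∀ u v, Ed (lt m1 :: X ++ [hd mo]) u v ∨ Ed (lt mo :: Y ++ [hd m2]) u v → Ed l u v) := by
  obtain ⟨m1, X, mo, Y, m2, e, n1, n2, n3, n4, n5, k1, k2, k3, k4, k5, k6, k7, k8, k9, k10⟩ :=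
    dec_gen linf (fun u v h => linf_adj h) hsρ hne hc h1 h2 h3
  have i1 : (lt m1 :: X ++ [hd mo]) <:+: l := by
    have := seg_sub (X := X) [] (Y ++ m2) n1 n3
    rwa [List.nil_append, e] at this
  have i2 : (lt mo :: Y ++ [hd m2]) <:+: l := by
    have := seg_sub (X := Y) (m1 ++ X) [] n3 n5
    rwa [List.append_assoc, List.append_nil, e] at this
  have i3 : mo <:+: l := ⟨m1 ++ X, Y ++ m2, by rw [← e]; simp⟩
  refine ⟨m1, X, mo, Y, m2, e, n1, n5, k1, k2, ⟨⟨n3, chain_part hc i3, k4⟩, k5, k6⟩, k8, k9, k10,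
    ⟨k2, k5, k6, k8, n2, n4, chain_part hc i1, chain_part hc i2, fun z hz => (mem_Dn).2 (k3 z hz),
      fun z hz => (mem_Dn).2 (k7 z hz)⟩, ?_⟩
  rintro u v (h | h)
  exacts [Ed_sub i1 h, Ed_sub i2 h]

lemma decO {s ρ : ℤ} (hsρ : s + 1 < ρ) {l : List Lat} (hne : l ≠ []) (hc : l.IsChain Adj)
    (h1 : ρ ≤ linf (hd l)) (h2 : ρ ≤ linf (lt l)) (h3 : ∃ z ∈ l, linf z ≤ s) :
    ∃ m1 X mo Y m2, m1 ++ (X ++ (mo ++ (Y ++ m2))) = l ∧ m1 ≠ [] ∧ m2 ≠ [] ∧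
      (∀ z ∈ m1, s < linf z) ∧ linf (lt m1) = ρ ∧ PI s ρ mo ∧ linf (hd m2) = ρ ∧
      hd m1 = hd l ∧ lt m2 = lt l ∧ PairE s ρ (lt mo) (hd m2) (lt m1) (hd mo) Y X ∧
      (∀ u v, Ed (lt mo :: Y ++ [hd m2]) u v ∨ Ed (lt m1 :: X ++ [hd mo]) u v → Ed l u v) := by
  obtain ⟨z, hz, hzs⟩ := h3
  obtain ⟨m1, X, mo, Y, m2, e, n1, n2, n3, n4, n5, k1, k2, k3, k4, k5, k6, k7, k8, k9, k10⟩ :=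
    dec_gen (fun z => - linf z) (fun u v h => by have := linf_adj h; beta_reduce; omega) (s := -ρ) (ρ := -s)
      (by omega) hne hc (by beta_reduce; omega) (by beta_reduce; omega) ⟨z, hz, by beta_reduce; omega⟩
  beta_reduce at k1 k2 k3 k4 k5 k6 k7 k8
  have i1 : (lt m1 :: X ++ [hd mo]) <:+: l := by
    have := seg_sub (X := X) [] (Y ++ m2) n1 n3
    rwa [List.nil_append, e] at this
  have i2 : (lt mo :: Y ++ [hd m2]) <:+: l := by
    have := seg_sub (X := Y) (m1 ++ X) [] n3 n5
    rwa [List.append_assoc, List.append_nil, e] at this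
  have i3 : mo <:+: l := ⟨m1 ++ X, Y ++ m2, by rw [← e]; simp⟩
  refine ⟨m1, X, mo, Y, m2, e, n1, n5, fun z hz => by have := k1 z hz; omega, by omega,
    ⟨⟨n3, chain_part hc i3, fun z hz => by have := k4 z hz; omega⟩, by omega, by omega⟩, by omega, k9, k10,
    ⟨by omega, by omega, by omega, by omega, n4, n2, chain_part hc i2, chain_part hc i1,
      fun z hz => (mem_Dn).2 (by have := k7 z hz; omega),
      fun z hz => (mem_Dn).2 (by have := k3 z hz; omega)⟩, ?_⟩
  rintro u v (h | h)
  exacts [Ed_sub i2 h, Ed_sub i1 h]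

lemma alpha_boot {s ρ R R' : ℤ} (hs0 : s0 ≤ s) (hρ : 16 * s ≤ ρ) (hR : ρ ≤ R) :
    Wk (PA s R R') (eb s) ≤ Wk (PI s ρ) (eb s) +
      (ENNReal.ofReal (117964800 * √((s : ℝ) / ρ)) * Wk (PI s ρ) (eb s) * Wk (PO s ρ) (fb ρ)) *
        Wk (PA s R R') (eb s) := by
  have := s0_two
  refine boot (RB_in hs0 hρ) _ _ _ ?_
  rintro l ⟨⟨⟨w1, w2, w3⟩, w4, w5⟩, w6⟩
  by_cases h3 : ∃ z ∈ l, ρ ≤ linf z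
  · right
    obtain ⟨m1, X, mo, Y, m2, e, n1, n5, k1, k2, k3, k4, k5, k6, k7, k8⟩ :=
      decI (by omega) w1 w2 w4.le w5.le h3
    have i1 : m1 <:+: l := ⟨[], X ++ (mo ++ (Y ++ m2)), by rw [← e]; simp⟩
    have i2 : m2 <:+: l := ⟨m1 ++ (X ++ (mo ++ Y)), [], by rw [← e]; simp⟩
    refine ⟨m1, X, mo, Y, m2, e, ⟨⟨n1, chain_part w2 i1, k1⟩, by rw [k5, w4], k2⟩, k3,
      ⟨⟨⟨n5, chain_part w2 i2, fun z hz => w3 z (i2.subset hz)⟩, k4, by rw [k6, w5]⟩,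
        w6.mono (fun u v h => Ed_sub i2 h) le_rfl le_rfl⟩, k5, k6, k7, w6.mono k8 le_rfl hR⟩
  · left
    push Not at h3
    exact ⟨⟨w1, w2, h3⟩, w4, w5⟩

lemma beta_boot {s s' R : ℤ} (hs0 : s0 ≤ s) (hs : s ≤ s') (hR : 16 * s' ≤ R) :
    Wk (PBo s R) (fb R) ≤ Wk (PO s' R) (fb R) +
      (ENNReal.ofReal (117964800 * √((s' : ℝ) / R)) * Wk (PO s' R) (fb R) * Wk (PI s' R) (eb s')) *
        Wk (PBo s R) (fb R) := by
  have := s0_two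
  refine boot (RB_out (hs0.trans hs) hR) _ _ _ ?_
  rintro l ⟨⟨⟨w1, w2, w3⟩, w4, w5⟩, w6⟩
  by_cases h3 : ∃ z ∈ l, linf z ≤ s'
  · right
    obtain ⟨m1, X, mo, Y, m2, e, n1, n5, k1, k2, k3, k4, k5, k6, k7, k8⟩ :=
      decO (by omega) w1 w2 w4.ge w5.ge h3
    have i1 : m1 <:+: l := ⟨[], X ++ (mo ++ (Y ++ m2)), by rw [← e]; simp⟩
    have i2 : m2 <:+: l := ⟨m1 ++ (X ++ (mo ++ Y)), [], by rw [← e]; simp⟩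
    refine ⟨m1, X, mo, Y, m2, e, ⟨⟨n1, chain_part w2 i1, k1⟩, by rw [k5, w4], k2⟩, k3,
      ⟨⟨⟨n5, chain_part w2 i2, fun z hz => w3 z (i2.subset hz)⟩, k4, by rw [k6, w5]⟩,
        w6.mono (fun u v h => Ed_sub i2 h) le_rfl le_rfl⟩, k5, k6, k7, w6.mono k8 hs le_rfl⟩
  · left
    push Not at h3
    exact ⟨⟨w1, w2, h3⟩, w4, w5⟩

lemma Wk_mono {P Q : List Lat → Prop} (h : ∀ l, P l → Q l) (u : Lat → ℝ≥0∞) : Wk P u ≤ Wk Q u := by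
  refine ENNReal.tsum_le_tsum fun l => ?_
  by_cases hp : P l
  · rw [if_pos hp, if_pos (h l hp)]
  · rw [if_neg hp]; exact zero_le

lemma exists_M : ∃ M : ℤ, 16 ≤ M ∧
    117964800 * (√((M : ℝ)))⁻¹ * (320 * Real.log (2 * M)) * (192 * Real.log (4 * M)) ≤ 1 / 2 := by
  have h1 : Filter.Tendsto (fun x : ℝ => Real.log x ^ 2 / (1 * x ^ (1 / 2 : ℝ) + 0)) Filter.atTop (nhds 0) := by
    have := (isLittleO_log_rpow_rpow_atTop 2 (show (0 : ℝ) < 1 / 2 by norm_num)).tendsto_div_nhds_zero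
    refine this.congr fun x => ?_
    simp
  have h2 : Filter.Tendsto (fun n : ℕ => (4 : ℝ) * n) Filter.atTop Filter.atTop :=
    Filter.Tendsto.const_mul_atTop (by norm_num) tendsto_natCast_atTop_atTop
  have h3 := (h1.comp h2).eventually (gt_mem_nhds (show (0 : ℝ) < 1 / (2 * 117964800 * 320 * 192 * 2) by norm_num))
  obtain ⟨n, hn, hn16⟩ := (h3.and (Filter.eventually_ge_atTop 16)).exists
  refine ⟨n, by exact_mod_cast hn16, ?_⟩
  have hn' : (16 : ℝ) ≤ n := by exact_mod_cast hn16
  simp only [Function.comp, add_zero, one_mul] at hn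
  rw [← Real.sqrt_eq_rpow, Real.sqrt_mul (by norm_num), show √(4 : ℝ) = 2 by
    rw [show (4 : ℝ) = 2 ^ 2 by norm_num]; exact Real.sqrt_sq (by norm_num)] at hn
  push_cast
  have hL : Real.log (2 * n) ≤ Real.log (4 * n) := Real.log_le_log (by linarith) (by linarith)
  have hL0 : 0 ≤ Real.log (4 * n) := Real.log_nonneg (by linarith)
  have hq : 0 < √(n : ℝ) := Real.sqrt_pos.2 (by linarith)
  rw [div_lt_iff₀ (by positivity)] at hn
  have : 117964800 * (√((n : ℝ)))⁻¹ * (320 * Real.log (2 * n)) * (192 * Real.log (4 * n)) ≤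
      117964800 * (√((n : ℝ)))⁻¹ * (320 * Real.log (4 * n)) * (192 * Real.log (4 * n)) := by
    gcongr
  refine this.trans ?_
  have e : 117964800 * (√((n : ℝ)))⁻¹ * (320 * Real.log (4 * n)) * (192 * Real.log (4 * n)) =
    117964800 * 320 * 192 * Real.log (4 * n) ^ 2 / √(n : ℝ) := by ring
  rw [e, div_le_iff₀ hq]
  nlinarith

lemma nonempty_ULoop : Nonempty ULoop :=
  ⟨Quot.mk _ ⟨[(0, 0), (1, 0)], by simp, by
    show List.IsChain Adj _
    simp [Adj]⟩⟩

/-- The unrooted loop with a given word. -/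
def catL (W : List Lat) : ULoop := @Classical.epsilon ULoop nonempty_ULoop (fun γ => γ.out.word.IsRotated W)

lemma catL_eq {γ : ULoop} {W : List Lat} (h : γ.out.word.IsRotated W) : catL W = γ := by
  have h1 : (catL W).out.word.IsRotated W :=
    @Classical.epsilon_spec ULoop (fun γ => γ.out.word.IsRotated W) ⟨γ, h⟩
  obtain ⟨k, hk⟩ := h1.trans h.symm
  have h2 : loopRot (catL W).out γ.out := ⟨k, hk.symm⟩
  have h3 := Quot.sound h2
  have e1 : Quot.mk loopRot (catL W).out = catL W := Quot.out_eq _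
  have e2 : Quot.mk loopRot γ.out = γ := Quot.out_eq _
  rwa [e1, e2] at h3

instance countable_ULoop : Countable ULoop := by
  have : Function.Injective (fun γ : ULoop => γ.out.word) := by
    intro γ γ' h
    rw [← catL_eq (List.IsRotated.refl γ.out.word), ← catL_eq (List.IsRotated.refl γ'.out.word)]
    exact congrArg catL h
  exact this.countable

lemma loopWeight_le (γ : ULoop) : (loopWeight γ : ℝ≥0∞) ≤ wl γ.out.word := by
  have h : loopWeight γ ≤ (4 : ℝ≥0)⁻¹ ^ γ.steps := by
    unfold loopWeight
    rcases Nat.eq_zero_or_pos γ.mult with h | h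
    · rw [h, Nat.cast_zero, div_zero]; exact zero_le
    · exact div_le_self (zero_le) (by exact_mod_cast h)
  refine (ENNReal.coe_le_coe.2 h).trans (le_of_eq ?_)
  rw [ENNReal.coe_pow, ENNReal.coe_inv (by norm_num)]
  rfl

lemma loop_dec {r s R R' : ℤ} (hr : r + 1 ≤ s) (hsR : s + 1 < R) {γ : ULoop}
    (hv : ULoop.verts γ ⊆ box 0 R') (hcr : CrossesAnn (ULoop.trace γ) 0 r R)
    (hd' : ¬ Disconnects (ULoop.trace γ) (embS (box 0 r)) (bdryE 0 R)) :
    ∃ X mo Y mi, catL (X ++ (mo ++ (Y ++ mi))) = γ ∧ PBo s R mo ∧ PA s R R' mi ∧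
      (loopWeight γ : ℝ≥0∞) ≤ wl (X ++ (mo ++ (Y ++ mi))) ∧ PairOK s R (lt mi) (hd mo) (lt mo) (hd mi) X Y := by
  have hnn := nn_of_not_disc hd'
  have hch : (γ.out.word ++ γ.out.word.take 1).IsChain Adj := γ.out.adj
  have hmem : ∀ z, emb z ∈ ULoop.trace γ → z ∈ γ.out.word := by
    intro z hz
    have := emb_mem_trace hch hz
    rcases List.mem_append.1 this with h | h
    exacts [h, List.mem_of_mem_take h]
  obtain ⟨⟨_, h1, z0, hz0, rfl⟩, ⟨_, h2, z1, hz1, rfl⟩⟩ := hcr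
  have m0 := hmem _ h1
  have m1' := hmem _ h2
  have l0 := bdry_linf hz0
  have l1 := bdry_linf hz1
  have hw := loopWeight_le γ
  have hcat := @catL_eq γ
  have hbox : ∀ z ∈ γ.out.word, linf z ≤ R' := by
    intro z hz
    have : z ∈ box 0 R' := hv hz
    simpa [box] using this
  generalize γ.out.word = w at *
  obtain ⟨p, q, rfl⟩ := List.append_of_mem m0
  set l : List Lat := (z0 :: q ++ p) ++ [z0] with hl
  have hEd : ∀ u v, Ed l u v → Ed (p ++ z0 :: q ++ (p ++ z0 :: q).take 1) u v := by
    intro u v h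
    cases p with
    | nil => simpa [hl] using h
    | cons c p =>
      have h' : Ed ((z0 :: q) ++ c :: (p ++ [z0])) u v := by simpa [hl] using h
      rcases Ed_join h' with h' | h'
      · exact Ed_sub ⟨c :: p, [], by simp⟩ h'
      · exact Ed_sub ⟨[], q ++ [c], by simp⟩ h'
  have hchl : l.IsChain Adj := chain_iff_Ed.2 fun u v h => chain_iff_Ed.1 hch u v (hEd u v h)
  have hnnl : NN s R (Ed l) := hnn.mono hEd hr le_rfl
  have hhl : hd l = z0 := rfl
  have hll : lt l = z0 := lt_snoc _ _
  have hml : ∀ z ∈ l, linf z ≤ R' := by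
    intro z hz
    refine hbox z ?_
    simp [hl] at hz ⊢
    tauto
  obtain ⟨n1, X, mo, Y, n2, e, ne1, ne2, k1, k2, k3, k4, k5, k6, k7, k8⟩ :=
    decI (ρ := R) hsR (by simp [hl]) hchl (by rw [hhl]; omega) (by rw [hll]; omega)
      ⟨z1, by simp [hl] at m1' ⊢; tauto, l1.ge⟩
  obtain ⟨t, ht⟩ := lt_eq ne2
  obtain ⟨t1, ht1⟩ := hd_eq ne1
  rw [k6, hll] at ht
  rw [k5, hhl] at ht1
  have e' : n1 ++ (X ++ (mo ++ (Y ++ t))) = z0 :: q ++ p := by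
    refine List.append_cancel_right (bs := [z0]) ?_
    rw [← hl, ← e, ht]; simp
  have hi1 : n1 <:+: l := ⟨[], X ++ (mo ++ (Y ++ n2)), by rw [← e]; simp⟩
  have hi2 : n2 <:+: l := ⟨n1 ++ (X ++ (mo ++ Y)), [], by rw [← e]; simp⟩
  have himo : mo <:+: l := ⟨n1 ++ X, Y ++ n2, by rw [← e]; simp⟩
  have hmiE : ∀ u v, Ed (t ++ n1) u v → Ed l u v := by
    intro u v h
    rw [ht1] at h
    rcases Ed_join h with h | h
    · rw [← ht] at h; exact Ed_sub hi2 h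
    · rw [← ht1] at h; exact Ed_sub hi1 h
  have hhm : hd (t ++ n1) = hd n2 := by
    rw [ht, ht1]
    cases t <;> rfl
  have hlm : lt (t ++ n1) = lt n1 := lt_append _ ne1
  have hrot : (p ++ z0 :: q).IsRotated (X ++ (mo ++ (Y ++ (t ++ n1)))) := by
    have a := List.isRotated_append (l := p) (l' := z0 :: q)
    rw [← e'] at a
    have b := List.isRotated_append (l := n1) (l' := X ++ (mo ++ (Y ++ t)))
    have e2 : X ++ (mo ++ (Y ++ t)) ++ n1 = X ++ (mo ++ (Y ++ (t ++ n1))) := by simp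
    rw [e2] at b
    exact a.trans b
  refine ⟨X, mo, Y, t ++ n1, hcat hrot, ⟨k3, hnnl.mono (fun u v h => Ed_sub himo h) le_rfl le_rfl⟩,
    ⟨⟨⟨by simp [ne1], chain_iff_Ed.2 fun u v h => chain_iff_Ed.1 hchl u v (hmiE u v h), ?_⟩, ?_, ?_⟩,
      hnnl.mono hmiE le_rfl le_rfl⟩, ?_, ?_⟩
  · intro z hz
    have : z ∈ l := by
      rcases List.mem_append.1 hz with h | h
      · exact hi2.subset (by rw [ht]; simp [h])
      · exact hi1.subset h
    have := hml z this
    omega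
  · rw [hhm, k4]
  · rw [hlm, k2]
  · refine hw.trans (le_of_eq ?_)
    unfold wl
    rw [hrot.perm.length_eq]
  · rw [hhm, hlm]
    exact ⟨k7, hnnl.mono k8 le_rfl le_rfl⟩

lemma prod_bound {M : ℤ} (hM : 16 ≤ M)
    (hM2 : 117964800 * (√((M : ℝ)))⁻¹ * (320 * Real.log (2 * M)) * (192 * Real.log (4 * M)) ≤ 1 / 2)
    {s ρ : ℤ} (hs : 2 ≤ s) (h1 : M * s ≤ ρ) (h2 : ρ ≤ 2 * M * s) :
    Wk (PI s ρ) (eb s) ≤ ENNReal.ofReal (320 * Real.log (2 * M)) ∧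
    Wk (PO s ρ) (fb ρ) ≤ ENNReal.ofReal (192 * Real.log (4 * M)) ∧
    ENNReal.ofReal (117964800 * √((s : ℝ) / ρ)) * Wk (PI s ρ) (eb s) * Wk (PO s ρ) (fb ρ) ≤ 2⁻¹ := by
  have hs' : (0 : ℝ) < s := by exact_mod_cast (by omega : 0 < s)
  have hM' : (16 : ℝ) ≤ M := by exact_mod_cast hM
  have h1' : (M : ℝ) * s ≤ ρ := by exact_mod_cast h1
  have h2' : (ρ : ℝ) ≤ 2 * M * s := by exact_mod_cast h2
  have hρ : 2 * s ≤ ρ := by nlinarith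
  have hρ' : (0 : ℝ) < ρ := by nlinarith
  have a1 : Wk (PI s ρ) (eb s) ≤ ENNReal.ofReal (320 * Real.log (2 * M)) := by
    refine (alpha0 hs hρ).trans (ENNReal.ofReal_le_ofReal ?_)
    have : Real.log ((ρ : ℝ) / s) ≤ Real.log (2 * M) :=
      Real.log_le_log (by positivity) (by rw [div_le_iff₀ hs']; exact h2')
    linarith
  have a2 : Wk (PO s ρ) (fb ρ) ≤ ENNReal.ofReal (192 * Real.log (4 * M)) := by
    refine (beta0 hs hρ).trans (ENNReal.ofReal_le_ofReal ?_)
    have : Real.log (2 * (ρ : ℝ) / s) ≤ Real.log (4 * M) :=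
      Real.log_le_log (by positivity) (by rw [div_le_iff₀ hs']; linarith)
    linarith
  refine ⟨a1, a2, ?_⟩
  have hL1 : 0 ≤ Real.log (2 * M) := Real.log_nonneg (by linarith)
  have hL2 : 0 ≤ Real.log (4 * M) := Real.log_nonneg (by linarith)
  have hq : √((s : ℝ) / ρ) ≤ (√((M : ℝ)))⁻¹ := by
    rw [← Real.sqrt_inv]
    refine Real.sqrt_le_sqrt ?_
    rw [div_le_iff₀ hρ', inv_mul_eq_div, le_div_iff₀ (by linarith)]
    linarith
  calc _ ≤ ENNReal.ofReal (117964800 * (√((M : ℝ)))⁻¹) * ENNReal.ofReal (320 * Real.log (2 * M)) *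
        ENNReal.ofReal (192 * Real.log (4 * M)) := by
        gcongr
    _ = ENNReal.ofReal (117964800 * (√((M : ℝ)))⁻¹ * (320 * Real.log (2 * M)) * (192 * Real.log (4 * M))) := by
        rw [← ENNReal.ofReal_mul (by positivity), ← ENNReal.ofReal_mul (by positivity)]
    _ ≤ ENNReal.ofReal (1 / 2) := ENNReal.ofReal_le_ofReal hM2
    _ = 2⁻¹ := by rw [one_div, ENNReal.ofReal_inv_of_pos (by norm_num)]; simp

lemma mass_bound : ∃ (M : ℤ) (C : ℝ), 16 ≤ M ∧ 0 ≤ C ∧ ∀ r s R R' : ℤ, 0 ≤ r → r + 1 ≤ s → s0 ≤ s → M * s ≤ R → R < R' →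
    ∑' γ : ULoop, (if ULoop.verts γ ⊆ box 0 R' ∧ CrossesAnn (ULoop.trace γ) 0 r R ∧
      ¬ Disconnects (ULoop.trace γ) (embS (box 0 r)) (bdryE 0 R) then (loopWeight γ : ℝ≥0∞) else 0) ≤
      ENNReal.ofReal (C * √((s : ℝ) / R)) := by
  obtain ⟨M, hM, hM2⟩ := exists_M
  have hM' : (16 : ℝ) ≤ M := by exact_mod_cast hM
  have hL1 : 0 ≤ Real.log (2 * M) := Real.log_nonneg (by linarith)
  have hL2 : 0 ≤ Real.log (4 * M) := Real.log_nonneg (by linarith)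
  refine ⟨M, 117964800 * (2 * (192 * Real.log (4 * M))) * (2 * (320 * Real.log (2 * M))), hM, by positivity, ?_⟩
  intro r s R R' hr hrs hs hR hRR
  have hs2 : 2 ≤ s := s0_two.trans hs
  have hMs : 16 * s ≤ M * s := by nlinarith
  have hα : Wk (PA s R R') (eb s) ≤ ENNReal.ofReal (2 * (320 * Real.log (2 * M))) := by
    obtain ⟨b1, b2, b3⟩ := prod_bound hM hM2 hs2 (le_refl (M * s)) (by nlinarith)
    have hfin : Wk (PA s R R') (eb s) ≠ ⊤ := by
      refine ne_top_of_le_ne_top ?_ ((Wk_mono (fun l h => h.1) _).trans (alpha0 (ρ := R' + 1) hs2 (by omega)))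
      exact ENNReal.ofReal_ne_top
    refine (absorb (alpha_boot hs hMs hR) b3 hfin).trans ?_
    rw [ENNReal.ofReal_mul (by norm_num)]
    refine mul_le_mul' (by simp) b1
  have hβ : Wk (PBo s R) (fb R) ≤ ENNReal.ofReal (2 * (192 * Real.log (4 * M))) := by
    have hss : s ≤ R / M := by rw [Int.le_ediv_iff_mul_le (by omega)]; linarith
    have hm1 : M * (R / M) ≤ R := Int.mul_ediv_self_le (by omega)
    have hm2 : R < M * (R / M) + M := by
      have := Int.emod_lt_of_pos R (show 0 < M by omega)
      have := Int.mul_ediv_add_emod R M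
      omega
    generalize R / M = s' at *
    obtain ⟨b1, b2, b3⟩ := prod_bound hM hM2 (hs2.trans hss) hm1 (by nlinarith)
    have hfin : Wk (PBo s R) (fb R) ≠ ⊤ := by
      refine ne_top_of_le_ne_top ?_ ((Wk_mono (fun l h => h.1) _).trans (beta0 hs2 (by omega)))
      exact ENNReal.ofReal_ne_top
    refine (absorb (beta_boot hs hss (by nlinarith)) ?_ hfin).trans ?_
    · rw [mul_right_comm]; exact b3
    rw [ENNReal.ofReal_mul (by norm_num)]
    refine mul_le_mul' (by simp) b2
  refine (le_trans (le_of_eq (tsum_congr fun γ => by congr)) (join (RB_in hs (hMs.trans hR)) (PA s R R') (PBo s R)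
    (fun γ : ULoop => ULoop.verts γ ⊆ box 0 R' ∧ CrossesAnn (ULoop.trace γ) 0 r R ∧
      ¬ Disconnects (ULoop.trace γ) (embS (box 0 r)) (bdryE 0 R)) (fun γ => (loopWeight γ : ℝ≥0∞)) catL ?_)).trans ?_
  · rintro γ ⟨h1, h2, h3⟩
    exact loop_dec hrs (by omega) h1 h2 h3
  · refine (mul_le_mul' (mul_le_mul' le_rfl hβ) hα).trans (le_of_eq ?_)
    rw [← ENNReal.ofReal_mul (by positivity), ← ENNReal.ofReal_mul (by positivity)]
    congr 1
    ring

lemma prob_loop {D : Set Lat} {P : Measure Config} (h : IsLoopSoup D 1 P) (γ : ULoop) :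
    P {ω | ω γ ≠ 0} ≤ (nuD D γ : ℝ≥0∞) := by
  obtain ⟨hP, h⟩ := h
  have h0 := h {γ} (fun _ => 0)
  have e : {ω : Config | ∀ γ' ∈ ({γ} : Finset ULoop), ω γ' = 0} = {ω | ω γ = 0} := by
    ext ω; simp
  rw [e, Finset.prod_singleton] at h0
  have hm : MeasurableSet {ω : Config | ω γ = 0} := measurable_pi_apply γ (measurableSet_singleton 0)
  have hc : {ω : Config | ω γ ≠ 0} = {ω | ω γ = 0}ᶜ := rfl
  rw [hc, prob_compl_eq_one_sub hm, h0]
  rw [Real.toNNReal_one, one_mul, poissonProb]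
  generalize nuD D γ = x
  rw [tsub_le_iff_right, ← ENNReal.ofReal_coe_nnreal, ← ENNReal.ofReal_add x.coe_nonneg (by positivity)]
  rw [← ENNReal.ofReal_one]
  refine ENNReal.ofReal_le_ofReal ?_
  have := Real.add_one_le_exp (-(x : ℝ))
  simp
  linarith

/-- There is a universal constant `c > 0` such that for all
`1 ≤ r < R < R'`, in the random walk loop soup in `B_{R'}` with intensity `1`, the
probability that some loop crosses `A_{r,R}` without disconnecting `B_r` from `∂B_R`
is at most `c·(r/R)^{1/2}`. -/
theorem crossing_loop_probability :
    ∃ c : ℝ, 0 < c ∧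
      ∀ (r R R' : ℤ) (P : Measure Config),
        1 ≤ r → r < R → R < R' → IsLoopSoup (box 0 R') 1 P →
        P {ω | ∃ γ ∈ Config.loops ω, CrossesAnn (ULoop.trace γ) 0 r R ∧
            ¬ Disconnects (ULoop.trace γ) (embS (box 0 r)) (bdryE 0 R)} ≤
          ENNReal.ofReal (c * Real.sqrt ((r : ℝ) / (R : ℝ))) := by
  obtain ⟨M, C, hM, hC, hmass⟩ := mass_bound
  have hs0 := s0_two
  have hs0' : (2 : ℝ) ≤ s0 := by exact_mod_cast hs0
  have hM' : (16 : ℝ) ≤ M := by exact_mod_cast hM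
  refine ⟨C * √(2 * s0) + √(2 * s0 * M), ?_, ?_⟩
  · have : 0 < √(2 * (s0 : ℝ) * M) := Real.sqrt_pos.2 (by positivity)
    positivity
  intro r R R' P hr hrR hRR' hP
  have hr' : (1 : ℝ) ≤ r := by exact_mod_cast hr
  have hR' : (0 : ℝ) < R := by exact_mod_cast (by omega : 0 < R)
  have hq : 0 ≤ √((r : ℝ) / R) := Real.sqrt_nonneg _
  by_cases hcase : M * (s0 * (r + 1)) ≤ R
  · have hb := hmass r (s0 * (r + 1)) R R' (by omega) (by nlinarith) (by nlinarith) hcase hRR'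
    have hsub : {ω : Config | ∃ γ ∈ Config.loops ω, CrossesAnn (ULoop.trace γ) 0 r R ∧
            ¬ Disconnects (ULoop.trace γ) (embS (box 0 r)) (bdryE 0 R)} ⊆
        ⋃ γ : ULoop, {ω : Config | ω γ ≠ 0 ∧ CrossesAnn (ULoop.trace γ) 0 r R ∧
            ¬ Disconnects (ULoop.trace γ) (embS (box 0 r)) (bdryE 0 R)} := by
      rintro ω ⟨γ, h1, h2⟩
      exact mem_iUnion.2 ⟨γ, h1, h2⟩
    refine (measure_mono hsub).trans ((measure_iUnion_le _).trans ?_)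
    refine (ENNReal.tsum_le_tsum fun γ => ?_).trans (hb.trans ?_)
    · by_cases hγ : CrossesAnn (ULoop.trace γ) 0 r R ∧
            ¬ Disconnects (ULoop.trace γ) (embS (box 0 r)) (bdryE 0 R)
      · refine (measure_mono (t := {ω : Config | ω γ ≠ 0}) (fun ω h => h.1)).trans ((prob_loop hP γ).trans ?_)
        unfold nuD
        by_cases hv : ULoop.verts γ ⊆ box 0 R'
        · rw [if_pos hv, if_pos ⟨hv, hγ⟩]
        · rw [if_neg hv]; simp
      · have : {ω : Config | ω γ ≠ 0 ∧ CrossesAnn (ULoop.trace γ) 0 r R ∧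
            ¬ Disconnects (ULoop.trace γ) (embS (box 0 r)) (bdryE 0 R)} = ∅ := by
          ext ω
          simp only [mem_setOf_eq, mem_empty_iff_false, iff_false]
          exact fun h => hγ h.2
        rw [this, measure_empty]; exact zero_le
    · refine ENNReal.ofReal_le_ofReal ?_
      have e : √(((s0 * (r + 1) : ℤ) : ℝ) / R) ≤ √(2 * s0) * √((r : ℝ) / R) := by
        rw [← Real.sqrt_mul (by positivity)]
        refine Real.sqrt_le_sqrt ?_
        rw [← mul_div_assoc]
        refine div_le_div_of_nonneg_right ?_ hR'.le
        push_cast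
        nlinarith
      have h1 := mul_le_mul_of_nonneg_left e hC
      have h2 : 0 ≤ √(2 * s0 * (M : ℝ)) * √((r : ℝ) / R) := by positivity
      nlinarith
  · have hP1 := hP.1
    refine prob_le_one.trans ?_
    rw [← ENNReal.ofReal_one]
    refine ENNReal.ofReal_le_ofReal ?_
    have e : 1 ≤ √(2 * s0 * (M : ℝ)) * √((r : ℝ) / R) := by
      rw [← Real.sqrt_mul (by positivity)]
      rw [Real.one_le_sqrt, ← mul_div_assoc, le_div_iff₀ hR', one_mul]
      push Not at hcase
      have : (R : ℝ) < M * (s0 * (r + 1)) := by exact_mod_cast hcase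
      have h2 : (M : ℝ) * (s0 * (r + 1)) ≤ M * (s0 * (2 * r)) := by
        gcongr; linarith
      nlinarith
    have h2 : 0 ≤ C * √(2 * (s0 : ℝ)) * √((r : ℝ) / R) := by positivity
    linarith

end RWLSPaper
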